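/- For every integer m ≥ 2 there are infinitely many natural numbers r such that the run of consecutive prime gaps δ_j = p_{r+j+1} − p_{r+j} (1 ≤ j ≤ m) is strictly increasing: δ_1 < δ_2 < ⋯ < δ_m. -/

import Mathlib

/-- `nthPrime n` is the `n`-th smallest prime, so `nthPrime 1 = 2`. -/
noncomputable def nthPrime (n : ℕ) : ℕ := Nat.nth Nat.Prime (n - 1)

/-- The `j`-th prime gap in the run starting at `r`:
`primeGap r j = p_{r+j+1} - p_{r+j}`. -/
noncomputable def primeGap (r j : ℕ) : ℕ := nthPrime (r + j + 1) - nthPrime (r + j)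

namespace PrimeGapRuns

open Finset

/-- All sums of `ψ` over intervals of integers are bounded by `K`. -/
def BoundedSums (ψ : ℕ → ℂ) (K : ℝ) : Prop := ∀ a b : ℕ, ‖∑ n ∈ Ico a b, ψ n‖ ≤ K

lemma sum_range_mod_of_periodic {ψ : ℕ → ℂ} {N : ℕ} (hN : 0 < N) (hper : ∀ n, ψ (n + N) = ψ n)
    (hsum : ∑ n ∈ range N, ψ n = 0) (M : ℕ) :
    ∑ n ∈ range M, ψ n = ∑ n ∈ range (M % N), ψ n := by
  induction M using Nat.strong_induction_on with
  | _ M ih =>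
    rcases lt_or_ge M N with h | h
    · rw [Nat.mod_eq_of_lt h]
    · obtain ⟨t, rfl⟩ := Nat.exists_eq_add_of_le h
      rw [Finset.sum_range_add, hsum, zero_add, Nat.add_mod_left, ← ih t (by omega)]
      exact Finset.sum_congr rfl fun n _ => by rw [add_comm, hper]

lemma boundedSums_of_periodic {ψ : ℕ → ℂ} {N : ℕ} (hN : 0 < N) (hper : ∀ n, ψ (n + N) = ψ n)
    (hsum : ∑ n ∈ range N, ψ n = 0) (hle : ∀ n, ‖ψ n‖ ≤ 1) : BoundedSums ψ N := by
  have aux : ∀ r s : ℕ, r ≤ s → s ≤ N →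
      ‖∑ n ∈ range s, ψ n - ∑ n ∈ range r, ψ n‖ ≤ N := by
    intro r s hrs hs
    rw [← Finset.sum_Ico_eq_sub _ hrs]
    calc ‖∑ n ∈ Ico r s, ψ n‖ ≤ ∑ n ∈ Ico r s, ‖ψ n‖ := norm_sum_le _ _
      _ ≤ ∑ n ∈ Ico r s, (1 : ℝ) := Finset.sum_le_sum fun n _ => hle n
      _ = ((s - r : ℕ) : ℝ) := by simp
      _ ≤ N := by exact_mod_cast (Nat.sub_le _ _).trans hs
  intro a b
  rcases le_or_gt a b with hab | hab
  · rw [Finset.sum_Ico_eq_sub _ hab, sum_range_mod_of_periodic hN hper hsum b,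
      sum_range_mod_of_periodic hN hper hsum a]
    have hb := (Nat.mod_lt b hN).le
    have ha := (Nat.mod_lt a hN).le
    rcases le_total (a % N) (b % N) with h | h
    · exact aux _ _ h hb
    · rw [norm_sub_rev]; exact aux _ _ h ha
  · simp [Finset.Ico_eq_empty_of_le hab.le]

lemma boundedSums_of_ne_one {N : ℕ} [NeZero N] {χ : DirichletCharacter ℂ N} (hχ : χ ≠ 1) :
    BoundedSums (fun n => χ (n : ZMod N)) N := by
  refine boundedSums_of_periodic (Nat.pos_of_ne_zero (NeZero.ne N)) (by simp) ?_
    (fun n => χ.norm_le_one _)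
  have h := MulChar.sum_eq_zero_of_ne_one hχ
  rw [← h]
  obtain ⟨M, rfl⟩ : ∃ M, N = M + 1 := ⟨N - 1, by have := NeZero.ne N; omega⟩
  rw [Finset.sum_range]
  refine Finset.sum_congr rfl fun i _ => ?_
  congr 1
  exact Fin.cast_val_eq_self i

/-- Two distinct primitive characters have a twisted product with bounded interval sums. -/
lemma boundedSums_mul_conj {q q' : ℕ} [NeZero q] [NeZero q'] {χ : DirichletCharacter ℂ q}
    {χ' : DirichletCharacter ℂ q'} (hχ : χ.IsPrimitive) (hχ' : χ'.IsPrimitive)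
    (hne : (⟨q, χ⟩ : Σ q : ℕ, DirichletCharacter ℂ q) ≠ ⟨q', χ'⟩) :
    BoundedSums (fun n => χ (n : ZMod q) * starRingEnd ℂ (χ' (n : ZMod q'))) ((q * q' : ℕ) : ℝ) := by
  set ψ : DirichletCharacter ℂ (q * q') :=
    DirichletCharacter.changeLevel (Nat.dvd_mul_right q q') χ *
      (DirichletCharacter.changeLevel (Nat.dvd_mul_left q' q) χ')⁻¹ with hψ
  have hψ1 : ψ ≠ 1 := by
    intro h
    have heq := mul_inv_eq_one.mp h
    have hc := congrArg DirichletCharacter.conductor heq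
    rw [DirichletCharacter.conductor_changeLevel, DirichletCharacter.conductor_changeLevel,
      hχ, hχ'] at hc
    subst hc
    exact hne (by rw [DirichletCharacter.changeLevel_injective (Nat.dvd_mul_right q q) heq])
  have key : (fun n : ℕ => χ (n : ZMod q) * starRingEnd ℂ (χ' (n : ZMod q'))) =
      fun n : ℕ => ψ (n : ZMod (q * q')) := by
    funext n
    by_cases hn : IsUnit (n : ZMod (q * q'))
    · have hcop := (ZMod.isUnit_iff_coprime n (q * q')).mp hn
      have hi : IsCoprime (n : ℤ) ((q * q' : ℕ) : ℤ) := Nat.isCoprime_iff_coprime.mpr hcop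
      have h1 := DirichletCharacter.changeLevel_eq_cast_of_dvd' χ (Nat.dvd_mul_right q q') hi
      have h2 := DirichletCharacter.changeLevel_eq_cast_of_dvd' χ' (Nat.dvd_mul_left q' q) hi
      simp only [Int.cast_natCast] at h1 h2
      rw [hψ, MulChar.mul_apply, h1, MulChar.inv_apply_eq_inv', h2]
      congr 1
      have hu : IsUnit (n : ZMod q') :=
        (ZMod.isUnit_iff_coprime n q').mpr (hcop.coprime_dvd_right (Nat.dvd_mul_left q' q))
      have h3 : ‖χ' (n : ZMod q')‖ = 1 := by
        obtain ⟨u, hu⟩ := hu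
        rw [← hu]; exact χ'.unit_norm_eq_one u
      rw [Complex.inv_def, Complex.normSq_eq_norm_sq, h3]; simp
    · rw [MulChar.map_nonunit ψ hn]
      have : ¬ (IsUnit (n : ZMod q) ∧ IsUnit (n : ZMod q')) := by
        rintro ⟨h1, h2⟩
        rw [ZMod.isUnit_iff_coprime] at h1 h2 hn
        exact hn (Nat.Coprime.mul_right h1 h2)
      by_cases h1 : IsUnit (n : ZMod q)
      · rw [MulChar.map_nonunit χ' (fun h2 => this ⟨h1, h2⟩)]; simp
      · rw [MulChar.map_nonunit χ h1]; simp
  rw [key]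
  exact boundedSums_of_ne_one hψ1

lemma norm_sum_mul_le_variation {ψ : ℕ → ℂ} {K : ℝ} (hψ : BoundedSums ψ K) (F : ℕ → ℝ)
    {a b : ℕ} (hab : a ≤ b) :
    ‖∑ n ∈ Ico a b, ψ n * F n‖ ≤ K * (|F b| + ∑ n ∈ Ico a b, |F (n + 1) - F n|) := by
  have key : ∑ n ∈ Ico a b, ψ n * F n = (∑ n ∈ Ico a b, ψ n) * F b -
      ∑ n ∈ Ico a b, (∑ i ∈ Ico a (n + 1), ψ i) * ((F (n + 1) - F n : ℝ) : ℂ) := by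
    induction b, hab using Nat.le_induction with
    | base => simp
    | succ b hab ih =>
      rw [Finset.sum_Ico_succ_top hab, Finset.sum_Ico_succ_top hab (fun n => _ * _), ih,
        Finset.sum_Ico_succ_top hab ψ]
      push_cast
      ring
  rw [key, mul_add]
  refine (norm_sub_le _ _).trans (add_le_add ?_ ?_)
  · rw [norm_mul, Complex.norm_real, Real.norm_eq_abs]
    exact mul_le_mul_of_nonneg_right (hψ a b) (abs_nonneg _)
  · rw [Finset.mul_sum]
    refine (norm_sum_le _ _).trans (Finset.sum_le_sum fun n _ => ?_)
    rw [norm_mul, Complex.norm_real, Real.norm_eq_abs]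
    exact mul_le_mul_of_nonneg_right (hψ a (n + 1)) (abs_nonneg _)

lemma BoundedSums.nonneg {ψ : ℕ → ℂ} {K : ℝ} (hψ : BoundedSums ψ K) : 0 ≤ K := by
  simpa using hψ 0 0

lemma sum_Ico_inv_sq_le {a : ℕ} (ha : 1 ≤ a) (b : ℕ) :
    ∑ n ∈ Ico a b, 1 / (n : ℝ) ^ 2 ≤ 2 / (a : ℝ) := by
  obtain ⟨c, rfl⟩ : ∃ c, a = c + 1 := ⟨a - 1, by omega⟩
  have h := sum_Ioo_inv_sq_le (α := ℝ) c b
  have hI : Ioo c b = Ico (c + 1) b := by ext; simp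
  rw [hI] at h
  simpa using h

/-- Smooth character sums with weight `1/n`. -/
lemma norm_sum_smooth_le {ψ : ℕ → ℂ} {K B : ℝ} (hψ : BoundedSums ψ K) {G : ℝ → ℝ}
    (hG : Differentiable ℝ G) (hB : ∀ t, |G t| ≤ B) (hB' : ∀ t, |deriv G t| ≤ B)
    {a b : ℕ} (ha : 1 ≤ a) :
    ‖∑ n ∈ Ico a b, ψ n * ((G (Real.log n) / n : ℝ) : ℂ)‖ ≤ K * (5 * B / (a : ℝ)) := by
  have hK := hψ.nonneg
  have hB0 : 0 ≤ B := (abs_nonneg _).trans (hB 0)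
  have ha' : (0 : ℝ) < a := by exact_mod_cast ha
  rcases le_or_gt b a with h | hab
  · rw [Finset.Ico_eq_empty_of_le h, Finset.sum_empty, norm_zero]; positivity
  refine (norm_sum_mul_le_variation hψ _ hab.le).trans (mul_le_mul_of_nonneg_left ?_ hK)
  have hb : |G (Real.log b) / b| ≤ B / (a : ℝ) := by
    rw [abs_div, Nat.abs_cast]
    exact div_le_div₀ hB0 (hB _) ha' (by exact_mod_cast hab.le)
  have hv : ∑ n ∈ Ico a b, |G (Real.log ((n + 1 : ℕ) : ℝ)) / ((n + 1 : ℕ) : ℝ) - G (Real.log n) / n|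
      ≤ ∑ n ∈ Ico a b, 2 * B * (1 / (n : ℝ) ^ 2) := by
    refine Finset.sum_le_sum fun n hn => ?_
    have hn0 : (0 : ℝ) < n := by exact_mod_cast ha.trans (Finset.mem_Ico.mp hn).1
    have hd : ∀ t ∈ Set.Icc (n : ℝ) (n + 1), HasDerivWithinAt (fun t => G (Real.log t) / t)
        ((deriv G (Real.log t) * t⁻¹ * t - G (Real.log t) * 1) / t ^ 2) (Set.Icc (n : ℝ) (n + 1)) t := by
      intro t ht
      have ht0 : 0 < t := hn0.trans_le ht.1
      have h1 : HasDerivAt (fun t => G (Real.log t)) (deriv G (Real.log t) * t⁻¹) t :=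
        (hG _).hasDerivAt.comp t (Real.hasDerivAt_log ht0.ne')
      exact (h1.div (hasDerivAt_id t) ht0.ne').hasDerivWithinAt
    have hbd : ∀ t ∈ Set.Icc (n : ℝ) (n + 1),
        ‖(deriv G (Real.log t) * t⁻¹ * t - G (Real.log t) * 1) / t ^ 2‖ ≤ 2 * B * (1 / (n : ℝ) ^ 2) := by
      intro t ht
      have ht0 : 0 < t := hn0.trans_le ht.1
      rw [Real.norm_eq_abs, abs_div, abs_of_pos (pow_pos ht0 2), mul_one_div]
      refine div_le_div₀ (by positivity) ?_ (by positivity) (by gcongr; exact ht.1)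
      rw [mul_assoc, inv_mul_cancel₀ ht0.ne', mul_one, mul_one]
      have := abs_sub (deriv G (Real.log t)) (G (Real.log t))
      linarith [hB (Real.log t), hB' (Real.log t)]
    have := Convex.norm_image_sub_le_of_norm_hasDerivWithin_le hd hbd (convex_Icc _ _)
      (Set.left_mem_Icc.mpr (by linarith)) (Set.right_mem_Icc.mpr (by linarith))
    rw [Real.norm_eq_abs, Real.norm_eq_abs] at this
    push_cast
    simpa using this
  rw [← Finset.mul_sum] at hv
  have h2 := mul_le_mul_of_nonneg_left (sum_Ico_inv_sq_le ha b) (by positivity : 0 ≤ 2 * B)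
  have h3 : 5 * B / (a : ℝ) = B / a + 2 * B * (2 / (a : ℝ)) := by ring
  rw [h3]
  exact add_le_add hb (hv.trans h2)

end PrimeGapRuns

namespace PrimeGapRuns

open Finset

/-- Dirichlet characters of arbitrary moduli. -/
abbrev Chars := Σ q : ℕ, DirichletCharacter ℂ q

/-- The value of a character at a natural number. -/
noncomputable def ev (z : Chars) (n : ℕ) : ℂ := z.2 (n : ZMod z.1)

lemma norm_ev_le (z : Chars) (n : ℕ) : ‖ev z n‖ ≤ 1 := z.2.norm_le_one _

lemma ev_mul (z : Chars) (m n : ℕ) : ev z (m * n) = ev z m * ev z n := by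
  simp [ev]

/-- Finite families of primitive characters of modulus in `[1, Q]`. -/
def IsFamily (Q : ℕ) (F : Finset Chars) : Prop :=
  ∀ z ∈ F, z.2.IsPrimitive ∧ 0 < z.1 ∧ z.1 ≤ Q

lemma IsFamily.card_le {Q : ℕ} {F : Finset Chars} (hF : IsFamily Q F) : F.card ≤ Q ^ 2 := by
  classical
  have h1 : ∀ z ∈ F, z.1 ∈ Finset.Icc 1 Q := fun z hz =>
    Finset.mem_Icc.mpr ⟨(hF z hz).2.1, (hF z hz).2.2⟩
  have h2 := Finset.card_le_mul_card_image_of_maps_to (f := fun z : Chars => z.1) h1 Q ?_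
  · simpa [sq] using h2
  intro q hq
  have hq' := Finset.mem_Icc.mp hq
  have : NeZero q := ⟨by omega⟩
  have h3 : ({z ∈ F | z.1 = q} : Finset Chars) ⊆
      (Finset.univ : Finset (DirichletCharacter ℂ q)).map
        ⟨fun χ => (⟨q, χ⟩ : Chars), fun a b h => by simpa using h⟩ := by
    rintro ⟨q', χ⟩ hz
    obtain rfl : q' = q := (Finset.mem_filter.mp hz).2
    exact Finset.mem_map.mpr ⟨χ, Finset.mem_univ _, rfl⟩
  refine (Finset.card_le_card h3).trans ?_
  rw [Finset.card_map, Finset.card_univ, ← Nat.card_eq_fintype_card,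
    DirichletCharacter.card_eq_totient_of_hasEnoughRootsOfUnity]
  exact (Nat.totient_le q).trans hq'.2

lemma norm_sum_ev_mul_conj_le {Q : ℕ} {F : Finset Chars} (hF : IsFamily Q F) {z w : Chars}
    (hz : z ∈ F) (hw : w ∈ F) (hne : z ≠ w) {U : ℕ} (hU : 1 ≤ U) (N : ℕ) :
    ‖∑ n ∈ Ico U N, (1 / (n : ℂ)) * (ev z n * starRingEnd ℂ (ev w n))‖ ≤ 5 * (Q : ℝ) ^ 2 / U := by
  have : NeZero z.1 := ⟨(hF z hz).2.1.ne'⟩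
  have : NeZero w.1 := ⟨(hF w hw).2.1.ne'⟩
  have hb := boundedSums_mul_conj (hF z hz).1 (hF w hw).1 hne
  have h := norm_sum_smooth_le hb (G := fun _ => 1) (B := 1) (differentiable_const _)
    (by simp) (by simp) hU (b := N)
  have e : ∑ n ∈ Ico U N, (1 / (n : ℂ)) * (ev z n * starRingEnd ℂ (ev w n)) =
      ∑ n ∈ Ico U N, z.2 (n : ZMod z.1) * starRingEnd ℂ (w.2 (n : ZMod w.1)) *
        ((1 / (n : ℝ) : ℝ) : ℂ) := by
    refine Finset.sum_congr rfl fun n _ => ?_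
    simp only [ev]; push_cast; ring
  rw [e]
  refine h.trans ?_
  have h1 : ((z.1 * w.1 : ℕ) : ℝ) ≤ (Q : ℝ) ^ 2 := by
    rw [sq]; exact_mod_cast Nat.mul_le_mul (hF z hz).2.2 (hF w hw).2.2
  calc ((z.1 * w.1 : ℕ) : ℝ) * (5 * 1 / (U : ℝ)) ≤ (Q : ℝ) ^ 2 * (5 * 1 / (U : ℝ)) := by gcongr
    _ = _ := by ring

lemma dual_large_sieve {Q : ℕ} {F : Finset Chars} (hF : IsFamily Q F) (b : Chars → ℂ)
    {U N : ℕ} (hU : 1 ≤ U) (hUQ : Q ^ 4 ≤ U) :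
    ∑ n ∈ Ico U N, (1 / (n : ℝ)) * ‖∑ z ∈ F, b z * ev z n‖ ^ 2 ≤
      (∑ n ∈ Ico U N, 1 / (n : ℝ) + 5) * ∑ z ∈ F, ‖b z‖ ^ 2 := by
  classical
  have hU' : (0 : ℝ) < U := by exact_mod_cast hU
  set H := ∑ n ∈ Ico U N, 1 / (n : ℝ)
  set c : Chars → Chars → ℂ := fun z w =>
    ∑ n ∈ Ico U N, (1 / (n : ℂ)) * (ev z n * starRingEnd ℂ (ev w n))
  have hexp : ((∑ n ∈ Ico U N, (1 / (n : ℝ)) * ‖∑ z ∈ F, b z * ev z n‖ ^ 2 : ℝ) : ℂ) =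
      ∑ z ∈ F, ∑ w ∈ F, b z * starRingEnd ℂ (b w) * c z w := by
    push_cast
    have : ∀ n ∈ Ico U N, (1 / (n : ℂ)) * (‖∑ z ∈ F, b z * ev z n‖ : ℂ) ^ 2 =
        ∑ z ∈ F, ∑ w ∈ F, b z * starRingEnd ℂ (b w) *
          ((1 / (n : ℂ)) * (ev z n * starRingEnd ℂ (ev w n))) := by
      intro n _
      rw [← Complex.mul_conj', map_sum, Finset.sum_mul_sum, Finset.mul_sum]
      refine Finset.sum_congr rfl fun z _ => ?_
      rw [Finset.mul_sum]
      refine Finset.sum_congr rfl fun w _ => ?_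
      rw [map_mul]; ring
    rw [Finset.sum_congr rfl this, Finset.sum_comm]
    refine Finset.sum_congr rfl fun z _ => ?_
    rw [Finset.sum_comm]
    refine Finset.sum_congr rfl fun w _ => ?_
    rw [Finset.mul_sum]
  have hc : ∀ z ∈ F, ∀ w ∈ F, ‖c z w‖ ≤ (if z = w then H else 0) + 5 * (Q : ℝ) ^ 2 / U := by
    intro z hz w hw
    by_cases h : z = w
    · rw [if_pos h]
      have : ‖c z w‖ ≤ H := by
        refine (norm_sum_le _ _).trans (Finset.sum_le_sum fun n _ => ?_)
        rw [norm_mul, norm_mul, RCLike.norm_conj, norm_div, norm_one, Complex.norm_natCast]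
        have := mul_le_one₀ (norm_ev_le z n) (norm_nonneg _) (norm_ev_le w n)
        calc _ ≤ 1 / (n : ℝ) * 1 := by gcongr
          _ = _ := mul_one _
      have h5 : 0 ≤ 5 * (Q : ℝ) ^ 2 / U := by positivity
      linarith
    · rw [if_neg h, zero_add]; exact norm_sum_ev_mul_conj_le hF hz hw h hU N
  have hS0 : 0 ≤ ∑ n ∈ Ico U N, (1 / (n : ℝ)) * ‖∑ z ∈ F, b z * ev z n‖ ^ 2 :=
    Finset.sum_nonneg fun n _ => by positivity
  have hnorm : ∑ n ∈ Ico U N, (1 / (n : ℝ)) * ‖∑ z ∈ F, b z * ev z n‖ ^ 2 ≤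
      ∑ z ∈ F, ∑ w ∈ F, ‖b z‖ * ‖b w‖ * ((if z = w then H else 0) + 5 * (Q : ℝ) ^ 2 / U) := by
    rw [← abs_of_nonneg hS0, ← Real.norm_eq_abs, ← Complex.norm_real, hexp]
    refine (norm_sum_le _ _).trans (Finset.sum_le_sum fun z hz => ?_)
    refine (norm_sum_le _ _).trans (Finset.sum_le_sum fun w hw => ?_)
    rw [norm_mul, norm_mul, RCLike.norm_conj]
    exact mul_le_mul_of_nonneg_left (hc z hz w hw) (by positivity)
  refine hnorm.trans ?_
  have e1 : ∑ z ∈ F, ∑ w ∈ F, ‖b z‖ * ‖b w‖ * ((if z = w then H else 0) + 5 * (Q : ℝ) ^ 2 / U) =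
      H * ∑ z ∈ F, ‖b z‖ ^ 2 + 5 * (Q : ℝ) ^ 2 / U * (∑ z ∈ F, ‖b z‖) ^ 2 := by
    simp only [mul_add, Finset.sum_add_distrib, mul_ite, mul_zero]
    congr 1
    · rw [Finset.mul_sum]
      refine Finset.sum_congr rfl fun z hz => ?_
      rw [Finset.sum_ite_eq, if_pos hz]; ring
    · rw [sq (∑ z ∈ F, ‖b z‖), Finset.sum_mul_sum, Finset.mul_sum]
      refine Finset.sum_congr rfl fun z _ => ?_
      rw [Finset.mul_sum]
      exact Finset.sum_congr rfl fun w _ => by ring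
  rw [e1, add_mul]
  refine add_le_add le_rfl ?_
  have h1 : (∑ z ∈ F, ‖b z‖) ^ 2 ≤ F.card * ∑ z ∈ F, ‖b z‖ ^ 2 := sq_sum_le_card_mul_sum_sq
  have h2 : (F.card : ℝ) ≤ (Q : ℝ) ^ 2 := by exact_mod_cast hF.card_le
  have h3 : (Q : ℝ) ^ 4 ≤ U := by exact_mod_cast hUQ
  have hs : 0 ≤ ∑ z ∈ F, ‖b z‖ ^ 2 := Finset.sum_nonneg fun z _ => by positivity
  calc 5 * (Q : ℝ) ^ 2 / U * (∑ z ∈ F, ‖b z‖) ^ 2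
      ≤ 5 * (Q : ℝ) ^ 2 / U * ((Q : ℝ) ^ 2 * ∑ z ∈ F, ‖b z‖ ^ 2) := by
        gcongr; exact h1.trans (by gcongr)
    _ = 5 * ((Q : ℝ) ^ 4 / U) * ∑ z ∈ F, ‖b z‖ ^ 2 := by ring
    _ ≤ 5 * 1 * ∑ z ∈ F, ‖b z‖ ^ 2 := by
        gcongr; exact (div_le_one hU').mpr h3
    _ = _ := by ring

/-- The large sieve inequality with weights `1/n`, in the easy range `U ≥ Q ^ 4`. -/
theorem large_sieve {Q : ℕ} {F : Finset Chars} (hF : IsFamily Q F) (a : ℕ → ℂ)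
    {U N : ℕ} (hU : 1 ≤ U) (hUQ : Q ^ 4 ≤ U) :
    ∑ z ∈ F, ‖∑ n ∈ Ico U N, a n / n * ev z n‖ ^ 2 ≤
      (∑ n ∈ Ico U N, 1 / (n : ℝ) + 5) * ∑ n ∈ Ico U N, ‖a n‖ ^ 2 / n := by
  set T : Chars → ℂ := fun z => ∑ n ∈ Ico U N, a n / n * ev z n
  set S := ∑ z ∈ F, ‖T z‖ ^ 2 with hS
  set H := ∑ n ∈ Ico U N, 1 / (n : ℝ) + 5
  set A := ∑ n ∈ Ico U N, ‖a n‖ ^ 2 / (n : ℝ)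
  have hS0 : 0 ≤ S := Finset.sum_nonneg fun z _ => by positivity
  have hA0 : 0 ≤ A := Finset.sum_nonneg fun z _ => by positivity
  have hH0 : 0 ≤ H := add_nonneg (Finset.sum_nonneg fun z _ => by positivity) (by norm_num)
  have hd := dual_large_sieve hF (fun z => starRingEnd ℂ (T z)) (N := N) hU hUQ
  simp only [RCLike.norm_conj] at hd
  have hexp : (S : ℂ) = ∑ n ∈ Ico U N, a n / n * ∑ z ∈ F, starRingEnd ℂ (T z) * ev z n := by
    rw [hS]; push_cast
    have : ∀ z ∈ F, (‖T z‖ : ℂ) ^ 2 = ∑ n ∈ Ico U N, a n / n * (starRingEnd ℂ (T z) * ev z n) := by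
      intro z _
      rw [← Complex.mul_conj', Finset.sum_mul]
      exact Finset.sum_congr rfl fun n _ => by ring
    rw [Finset.sum_congr rfl this, Finset.sum_comm]
    exact Finset.sum_congr rfl fun n _ => by rw [Finset.mul_sum]
  have hle : S ≤ ∑ n ∈ Ico U N, (‖a n‖ / √n) * (‖∑ z ∈ F, starRingEnd ℂ (T z) * ev z n‖ / √n) := by
    rw [← abs_of_nonneg hS0, ← Real.norm_eq_abs, ← Complex.norm_real, hexp]
    refine (norm_sum_le _ _).trans (Finset.sum_le_sum fun n _ => le_of_eq ?_)
    rw [norm_mul, norm_div, Complex.norm_natCast, div_mul_div_comm,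
      Real.mul_self_sqrt (Nat.cast_nonneg n)]
    ring
  have hcs := Finset.sum_mul_sq_le_sq_mul_sq (Ico U N) (fun n : ℕ => ‖a n‖ / √(n : ℝ))
    (fun n => ‖∑ z ∈ F, starRingEnd ℂ (T z) * ev z n‖ / √(n : ℝ))
  simp only [div_pow, Real.sq_sqrt (Nat.cast_nonneg _)] at hcs
  have h1 : S ^ 2 ≤ A * (H * S) := by
    refine (pow_le_pow_left₀ hS0 hle 2).trans (hcs.trans ?_)
    refine mul_le_mul_of_nonneg_left ?_ hA0
    refine le_trans (le_of_eq (Finset.sum_congr rfl fun n _ => ?_)) hd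
    ring
  rcases hS0.eq_or_lt with h | h
  · rw [← h]; positivity
  · have : S * S ≤ H * A * S := by nlinarith
    exact le_of_mul_le_mul_right this h

end PrimeGapRuns

namespace PrimeGapRuns

open Finset ArithmeticFunction

lemma sum_Ioc_sum_antidiagonal {E : Type*} [AddCommMonoid E] (f : ℕ → ℕ → E) (N : ℕ) :
    ∑ n ∈ Ioc 0 N, ∑ x ∈ n.divisorsAntidiagonal, f x.1 x.2 =
      ∑ d ∈ Ioc 0 N, ∑ m ∈ Ioc 0 (N / d), f d m := by
  rw [Finset.sum_sigma', Finset.sum_sigma']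
  refine Finset.sum_bij' (fun x _ => ⟨x.2.1, x.2.2⟩) (fun y _ => ⟨y.1 * y.2, (y.1, y.2)⟩) ?_ ?_ ?_ ?_ ?_
  · rintro ⟨n, d, m⟩ h
    simp only [mem_sigma, mem_Ioc, Nat.mem_divisorsAntidiagonal] at h ⊢
    obtain ⟨⟨h1, h2⟩, rfl, h3⟩ := h
    have hd : 0 < d := Nat.pos_of_ne_zero fun h => by simp [h] at h3
    have hm : 0 < m := Nat.pos_of_ne_zero fun h => by simp [h] at h3
    exact ⟨⟨hd, (Nat.le_mul_of_pos_right d hm).trans h2⟩, hm,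
      (Nat.le_div_iff_mul_le hd).mpr (by rwa [mul_comm])⟩
  · rintro ⟨d, m⟩ h
    simp only [mem_sigma, mem_Ioc, Nat.mem_divisorsAntidiagonal] at h ⊢
    obtain ⟨⟨h1, h2⟩, h3, h4⟩ := h
    have := (Nat.le_div_iff_mul_le h1).mp h4
    exact ⟨⟨Nat.mul_pos h1 h3, by rwa [mul_comm]⟩, trivial, (Nat.mul_pos h1 h3).ne'⟩
  · rintro ⟨n, d, m⟩ h
    simp only [mem_sigma, mem_Ioc, Nat.mem_divisorsAntidiagonal] at h
    obtain ⟨⟨h1, h2⟩, rfl, h3⟩ := h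
    rfl
  · rintro ⟨d, m⟩ h; rfl
  · rintro ⟨n, d, m⟩ h; rfl

lemma sum_Ioc_one_div_le (N : ℕ) : ∑ n ∈ Ioc 0 N, 1 / (n : ℝ) ≤ 1 + Real.log N := by
  have h := harmonic_le_one_add_log N
  rw [harmonic_eq_sum_Icc] at h
  push_cast at h
  have e : Ioc 0 N = Icc 1 N := by ext; simp [Nat.succ_le_iff]
  rw [e]
  simpa using h

lemma sum_Ioc_log (N : ℕ) : ∑ n ∈ Ioc 0 N, Real.log n = Real.log (N.factorial : ℝ) := by
  induction N with
  | zero => simp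
  | succ N ih =>
    rw [Finset.sum_Ioc_succ_top (Nat.zero_le _), ih, Nat.factorial_succ, Nat.cast_mul,
      Real.log_mul (by positivity) (by positivity), add_comm]

lemma log_factorial_eq (N : ℕ) :
    Real.log (N.factorial : ℝ) = ∑ d ∈ Ioc 0 N, Λ d * ((N / d : ℕ) : ℝ) := by
  rw [← sum_Ioc_log]
  have h := sum_Ioc_mul_zeta_eq_sum (R := ℝ) Λ N
  rw [← h]
  have := vonMangoldt_mul_zeta
  exact Finset.sum_congr rfl fun n _ => by
    rw [← log_apply, ← this]

/-- Mertens' first theorem, for the von Mangoldt function. -/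
lemma abs_sum_vonMangoldt_div_sub_log_le {N : ℕ} (hN : 1 ≤ N) :
    |∑ d ∈ Ioc 0 N, Λ d / (d : ℝ) - Real.log N| ≤ 6 := by
  have hN' : (0 : ℝ) < N := by exact_mod_cast hN
  have hf := log_factorial_eq N
  have hu : Real.log (N.factorial : ℝ) ≤ N * Real.log N := by
    rw [← Real.log_pow]
    exact Real.log_le_log (by positivity) (by exact_mod_cast Nat.factorial_le_pow N)
  have hl : N * Real.log N - N ≤ Real.log (N.factorial : ℝ) := by
    have h := Stirling.le_log_factorial_stirling (n := N) (by omega)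
    have h1 : 0 ≤ Real.log N := Real.log_natCast_nonneg N
    have h2 : 0 ≤ Real.log (2 * Real.pi) := Real.log_nonneg (by linarith [Real.pi_gt_three])
    linarith
  have hpsi := Chebyshev.psi_le_const_mul_self hN'.le
  have hlog4 : Real.log 4 ≤ 2 := by
    have : (4 : ℝ) = 2 ^ 2 := by norm_num
    rw [this, Real.log_pow]
    have := Real.log_two_lt_d9
    push_cast; linarith
  have h1 : (N : ℝ) * ∑ d ∈ Ioc 0 N, Λ d / (d : ℝ) ≤ Real.log (N.factorial : ℝ) +
      Chebyshev.psi N := by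
    rw [hf, Chebyshev.psi, Nat.floor_natCast, ← Finset.sum_add_distrib, Finset.mul_sum]
    refine Finset.sum_le_sum fun d _ => ?_
    have h3 : (N : ℝ) / d ≤ ((N / d : ℕ) : ℝ) + 1 := by
      rw [← Nat.floor_div_eq_div (K := ℝ)]; exact (Nat.lt_floor_add_one _).le
    have := mul_le_mul_of_nonneg_left h3 (vonMangoldt_nonneg (n := d))
    calc (N : ℝ) * (Λ d / d) = Λ d * (N / d) := by ring
      _ ≤ _ := by linarith
  have h2 : Real.log (N.factorial : ℝ) ≤ (N : ℝ) * ∑ d ∈ Ioc 0 N, Λ d / (d : ℝ) := by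
    rw [hf, Finset.mul_sum]
    refine Finset.sum_le_sum fun d _ => ?_
    have := mul_le_mul_of_nonneg_left (Nat.cast_div_le (α := ℝ) (m := N) (n := d))
      (vonMangoldt_nonneg (n := d))
    calc Λ d * ((N / d : ℕ) : ℝ) ≤ Λ d * (N / d) := this
      _ = _ := by ring
  rw [abs_le]
  constructor
  · have : (N : ℝ) * (-6) ≤ N * (∑ d ∈ Ioc 0 N, Λ d / (d : ℝ) - Real.log N) := by
      rw [mul_sub]; linarith
    exact le_of_mul_le_mul_left this hN'
  · have : N * (∑ d ∈ Ioc 0 N, Λ d / (d : ℝ) - Real.log N) ≤ (N : ℝ) * 6 := by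
      rw [mul_sub]; nlinarith
    exact le_of_mul_le_mul_left this hN'

/-- Partial summation: a set with counting function `O(√t)` has small reciprocal tails. -/
lemma sum_Ioc_div_le_of_sqrt_bound {a : ℕ → ℝ} {C : ℝ} (ha : ∀ n, 0 ≤ a n)
    (hA : ∀ n : ℕ, ∑ i ∈ Ioc 0 n, a i ≤ C * √n) {Y N : ℕ} (hY : 1 ≤ Y) :
    ∑ n ∈ Ioc Y N, a n / n ≤ 3 * C / √Y := by
  have hC : 0 ≤ C := by
    have := hA 1; simp at this; exact (ha 1).trans this
  rcases le_or_gt N Y with h | h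
  · rw [Finset.Ioc_eq_empty_of_le h, Finset.sum_empty]; positivity
  have key : ∑ n ∈ Ioc Y N, a n / n ≤ (∑ i ∈ Ioc 0 N, a i) / N + (2 * C / √Y - 2 * C / √N) := by
    induction N, h.le using Nat.le_induction with
    | base => simp only [Ioc_self, sum_empty, sub_self, add_zero]; exact div_nonneg (Finset.sum_nonneg fun i _ => ha i) (by positivity)
    | succ N hN ih =>
      rcases hN.eq_or_lt with rfl | hlt
      · simp only [Nat.Ioc_succ_singleton, sum_singleton]
        rw [Finset.sum_Ioc_succ_top (Nat.zero_le _)]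
        have h1 : 0 ≤ ∑ i ∈ Ioc 0 Y, a i := Finset.sum_nonneg fun i _ => ha i
        have h2 : 2 * C / √((Y + 1 : ℕ) : ℝ) ≤ 2 * C / √Y := by
          have : (0 : ℝ) < √Y := Real.sqrt_pos.mpr (by exact_mod_cast hY)
          gcongr
        have h3 : 0 ≤ (∑ i ∈ Ioc 0 Y, a i) / ((Y + 1 : ℕ) : ℝ) := by positivity
        rw [add_div]; linarith
      have hih := ih hlt
      rw [Finset.sum_Ioc_succ_top hN, Finset.sum_Ioc_succ_top (Nat.zero_le _), add_div]
      set A := ∑ i ∈ Ioc 0 N, a i with hAdef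
      have hAN := hA N
      have hN0 : (0 : ℝ) < N := by exact_mod_cast (by omega : 0 < N)
      suffices A / N - A / ((N + 1 : ℕ) : ℝ) ≤ 2 * C / √N - 2 * C / √((N + 1 : ℕ) : ℝ) by linarith
      push_cast
      set s := √(N : ℝ)
      set t := √((N : ℝ) + 1)
      have hs : 0 < s := Real.sqrt_pos.mpr hN0
      have hst : s ≤ t := Real.sqrt_le_sqrt (by linarith)
      have ht : 0 < t := hs.trans_le hst
      have hs2 : (N : ℝ) = s ^ 2 := (Real.sq_sqrt hN0.le).symm
      have ht2 : (N : ℝ) + 1 = t ^ 2 := (Real.sq_sqrt (by linarith)).symm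
      have e1 : A / N - A / (N + 1) = A / (s ^ 2 * t ^ 2) := by
        rw [div_sub_div _ _ hN0.ne' (by linarith), ← hs2, ← ht2]; ring
      have e2 : 2 * C / s - 2 * C / t = 2 * C * (t - s) / (s * t) := by
        field_simp
      have hts : t - s = 1 / (t + s) := by
        rw [eq_div_iff (by positivity)]; nlinarith
      rw [e1, e2, hts]
      calc A / (s ^ 2 * t ^ 2) ≤ C * s / (s ^ 2 * t ^ 2) := by gcongr
        _ = 2 * C * (1 / (t + t)) / (s * t) := by field_simp; ring
        _ ≤ 2 * C * (1 / (t + s)) / (s * t) := by gcongr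
  have hN0 : (0 : ℝ) < N := by exact_mod_cast (by omega : 0 < N)
  have hY0 : (0 : ℝ) < √Y := Real.sqrt_pos.mpr (by exact_mod_cast hY)
  have h1 : (∑ i ∈ Ioc 0 N, a i) / N ≤ C / √N := by
    rw [div_le_div_iff₀ hN0 (Real.sqrt_pos.mpr hN0)]
    calc _ ≤ C * √N * √N := by gcongr; exact hA N
      _ = _ := by rw [mul_assoc, Real.mul_self_sqrt hN0.le]
  have h2 : C / √N ≤ C / √Y := by gcongr
  have h3 : 0 ≤ C / √(N : ℝ) := by positivity
  have h4 : 3 * C / √Y = C / √Y + 2 * C / √Y := by ring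
  have h5 : 2 * C / √(N : ℝ) = C / √N + C / √N := by ring
  linarith

/-- The contribution of proper prime powers beyond `Y` is negligible. -/
lemma exists_sum_not_prime_vonMangoldt_le : ∃ C : ℝ, 0 < C ∧ ∀ Y N : ℕ, 1 ≤ Y →
    ∑ n ∈ Ioc Y N with ¬ n.Prime, Λ n / (n : ℝ) ≤ C / √Y := by
  obtain ⟨C, hC⟩ := Chebyshev.psi_sub_theta_le_mul_sqrt
  refine ⟨3 * max C 1, by positivity, fun Y N hY => ?_⟩
  rw [Finset.sum_filter]
  have h := sum_Ioc_div_le_of_sqrt_bound (a := fun n => if ¬ n.Prime then Λ n else 0) (C := max C 1)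
    (fun n => by split_ifs <;> simp [vonMangoldt_nonneg]) (fun n => ?_) hY (N := N)
  · refine le_trans (le_of_eq (Finset.sum_congr rfl fun n _ => ?_)) h
    split_ifs <;> simp only [zero_div]
  · have := hC n
    rw [Chebyshev.psi_sub_theta_eq_sum_not_prime, Nat.floor_natCast, Finset.sum_filter] at this
    exact this.trans (by gcongr; exact le_max_left _ _)

lemma card_divisors_mul_le (m n : ℕ) :
    (m * n).divisors.card ≤ m.divisors.card * n.divisors.card := by
  rw [Nat.divisors_mul]; exact Finset.card_mul_le

lemma sum_Ioc_div_le_mul {f g h : ℕ → ℝ} (hf : ∀ n, 0 ≤ f n) (hg : ∀ n, 0 ≤ g n)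
    (hle : ∀ n, n ≠ 0 → h n ≤ ∑ x ∈ n.divisorsAntidiagonal, f x.1 * g x.2) (N : ℕ) :
    ∑ n ∈ Ioc 0 N, h n / n ≤ (∑ n ∈ Ioc 0 N, f n / n) * ∑ n ∈ Ioc 0 N, g n / n := by
  calc ∑ n ∈ Ioc 0 N, h n / n ≤ ∑ n ∈ Ioc 0 N, ∑ x ∈ n.divisorsAntidiagonal,
        (f x.1 / x.1) * (g x.2 / x.2) := by
        refine Finset.sum_le_sum fun n hn => ?_
        have hn0 : n ≠ 0 := (Finset.mem_Ioc.mp hn).1.ne'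
        have := div_le_div_of_nonneg_right (hle n hn0) (Nat.cast_nonneg (α := ℝ) n)
        refine this.trans (le_of_eq ?_)
        rw [Finset.sum_div]
        refine Finset.sum_congr rfl fun x hx => ?_
        rw [div_mul_div_comm, ← Nat.cast_mul, (Nat.mem_divisorsAntidiagonal.mp hx).1]
    _ = ∑ d ∈ Ioc 0 N, ∑ m ∈ Ioc 0 (N / d), (f d / d) * (g m / m) :=
        sum_Ioc_sum_antidiagonal (fun d m => (f d / d) * (g m / (m : ℝ))) N
    _ ≤ ∑ d ∈ Ioc 0 N, ∑ m ∈ Ioc 0 N, (f d / d) * (g m / m) := by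
        refine Finset.sum_le_sum fun d _ => Finset.sum_le_sum_of_subset_of_nonneg
          (Finset.Ioc_subset_Ioc_right (Nat.div_le_self _ _)) fun m _ _ => ?_
        have := hf d; have := hg m; positivity
    _ = _ := by rw [Finset.sum_mul_sum]

lemma sum_card_divisors_div_le (N : ℕ) :
    ∑ n ∈ Ioc 0 N, (n.divisors.card : ℝ) / n ≤ (1 + Real.log N) ^ 2 := by
  have h := sum_Ioc_div_le_mul (f := fun _ => 1) (g := fun _ => 1)
    (h := fun n => (n.divisors.card : ℝ)) (fun _ => zero_le_one) (fun _ => zero_le_one)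
    (fun n _ => by
      simp only [mul_one, sum_const, nsmul_eq_mul]
      rw [← Nat.map_div_right_divisors, Finset.card_map]) N
  refine h.trans ?_
  rw [sq]
  have h0 : 0 ≤ ∑ n ∈ Ioc 0 N, 1 / (n : ℝ) := Finset.sum_nonneg fun _ _ => by positivity
  have := sum_Ioc_one_div_le N
  gcongr

lemma sum_card_divisors_sq_div_le (N : ℕ) :
    ∑ n ∈ Ioc 0 N, (n.divisors.card : ℝ) ^ 2 / n ≤ (1 + Real.log N) ^ 4 := by
  have h := sum_Ioc_div_le_mul (f := fun n => (n.divisors.card : ℝ))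
    (g := fun n => (n.divisors.card : ℝ))
    (h := fun n => (n.divisors.card : ℝ) ^ 2) (fun _ => Nat.cast_nonneg _) (fun _ => Nat.cast_nonneg _)
    (fun n _ => by
      calc ((n.divisors.card : ℝ)) ^ 2 = ∑ x ∈ n.divisorsAntidiagonal, (n.divisors.card : ℝ) := by
            simp only [sum_const, nsmul_eq_mul]
            rw [← Nat.map_div_right_divisors, Finset.card_map, sq]
        _ ≤ _ := by
            refine Finset.sum_le_sum fun x hx => ?_
            rw [← (Nat.mem_divisorsAntidiagonal.mp hx).1]
            exact_mod_cast card_divisors_mul_le _ _) N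
  refine h.trans ?_
  have h0 : 0 ≤ ∑ n ∈ Ioc 0 N, (n.divisors.card : ℝ) / n := Finset.sum_nonneg fun _ _ => by positivity
  have h1 := sum_card_divisors_div_le N
  calc _ ≤ (1 + Real.log N) ^ 2 * (1 + Real.log N) ^ 2 := by gcongr
    _ = _ := by ring

end PrimeGapRuns

namespace PrimeGapRuns

open Finset ArithmeticFunction

/-- A differentiable function supported in `[1/2, 1]`, bounded by `C` with its derivative. -/
structure IsTest (g : ℝ → ℝ) (C : ℝ) : Prop where
  diff : Differentiable ℝ g
  bound : ∀ t, |g t| ≤ C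
  bound_deriv : ∀ t, |deriv g t| ≤ C
  zero_of_le : ∀ t, t ≤ 1 / 2 → g t = 0
  zero_of_ge : ∀ t, 1 ≤ t → g t = 0

lemma IsTest.nonneg {g : ℝ → ℝ} {C : ℝ} (hg : IsTest g C) : 0 ≤ C :=
  (abs_nonneg _).trans (hg.bound 0)

lemma IsTest.deriv_eq_zero {g : ℝ → ℝ} {C : ℝ} (hg : IsTest g C) {t : ℝ} (ht : t < 0 ∨ 1 < t) :
    deriv g t = 0 := by
  have : g =ᶠ[nhds t] fun _ => 0 := by
    rcases ht with h | h
    · filter_upwards [Iio_mem_nhds h] with s hs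
      exact hg.zero_of_le s (by have : s < 0 := hs; linarith)
    · filter_upwards [Ioi_mem_nhds h] with s hs
      exact hg.zero_of_ge s (le_of_lt hs)
  rw [this.deriv_eq]; simp

/-- The inner sums of type I. -/
lemma norm_typeI_inner_le {g : ℝ → ℝ} {C : ℝ} (hg : IsTest g C) {ψ : ℕ → ℂ} {K : ℝ}
    (hψ : BoundedSums ψ K) {L : ℝ} (hL : 1 ≤ L) {M D d : ℕ} (hM : L = 2 * Real.log M)
    (hM1 : 1 ≤ M) (hd : 1 ≤ d) (hdD : d ≤ D) (hdL : Real.log d ≤ L) {P : ℝ → ℝ}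
    (hP : P = id ∨ P = fun _ => 1) (b : ℕ) :
    ‖∑ m ∈ Ioc 0 b, ψ m *
      ((P (Real.log m) * g ((Real.log d + Real.log m) / L) / m : ℝ) : ℂ)‖ ≤
      10 * C * L * K * D / M := by
  have hC := hg.nonneg
  have hL0 : 0 < L := by linarith
  have hd0 : 0 ≤ Real.log d := Real.log_natCast_nonneg d
  have hPd : Differentiable ℝ P := by
    rcases hP with rfl | rfl
    · exact differentiable_id
    · exact differentiable_const _
  have hPb : ∀ t, |t| ≤ L → |P t| ≤ L := by
    rcases hP with rfl | rfl
    · exact fun t ht => ht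
    · intro t _; simpa using hL
  have hPb' : ∀ t, |deriv P t| ≤ 1 := by
    rcases hP with rfl | rfl <;> intro t <;> simp
  set G : ℝ → ℝ := fun t => P t * g ((Real.log d + t) / L) with hG
  have hGd : ∀ t, HasDerivAt G (deriv P t * g ((Real.log d + t) / L) +
      P t * (deriv g ((Real.log d + t) / L) * (1 / L))) t := by
    intro t
    have h1 : HasDerivAt (fun t => (Real.log d + t) / L) (1 / L) t :=
      ((hasDerivAt_id t).const_add _).div_const L
    exact (hPd t).hasDerivAt.mul ((hg.diff _).hasDerivAt.comp t h1)
  have hsupp : ∀ t, ¬ |t| ≤ L → (Real.log d + t) / L < 0 ∨ 1 < (Real.log d + t) / L := by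
    intro t ht
    rcases lt_abs.mp (not_le.mp ht) with h | h
    · right; rw [lt_div_iff₀ hL0]; linarith
    · left; rw [div_lt_iff₀ hL0]; linarith
  have hb1 : ∀ t, |G t| ≤ 2 * C * L := by
    intro t
    by_cases ht : |t| ≤ L
    · rw [hG, abs_mul]
      calc _ ≤ L * C := mul_le_mul (hPb t ht) (hg.bound _) (abs_nonneg _) hL0.le
        _ ≤ _ := by nlinarith
    · have : g ((Real.log d + t) / L) = 0 := by
        rcases hsupp t ht with h | h
        · exact hg.zero_of_le _ (by linarith)
        · exact hg.zero_of_ge _ h.le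
      simp only [hG, this, mul_zero, abs_zero]; positivity
  have hb2 : ∀ t, |deriv G t| ≤ 2 * C * L := by
    intro t
    rw [(hGd t).deriv]
    have h1 : |deriv P t * g ((Real.log d + t) / L)| ≤ C := by
      rw [abs_mul]
      calc _ ≤ 1 * C := mul_le_mul (hPb' t) (hg.bound _) (abs_nonneg _) zero_le_one
        _ = C := one_mul C
    have h2 : |P t * (deriv g ((Real.log d + t) / L) * (1 / L))| ≤ C := by
      by_cases ht : |t| ≤ L
      · rw [abs_mul, abs_mul, abs_of_pos (by positivity : 0 < 1 / L)]
        calc _ ≤ L * (C * (1 / L)) := by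
              gcongr
              · exact hPb t ht
              · exact hg.bound_deriv _
          _ = C := by field_simp
      · rw [hg.deriv_eq_zero (hsupp t ht)]; simpa using hC
    calc _ ≤ C + C := (abs_add_le _ _).trans (add_le_add h1 h2)
      _ ≤ _ := by nlinarith
  have hD : 0 < D := hd.trans hdD
  set a := M / D + 1 with ha
  have hstart : ∑ m ∈ Ioc 0 b, ψ m *
      ((P (Real.log m) * g ((Real.log d + Real.log m) / L) / m : ℝ) : ℂ) =
      ∑ m ∈ Ico a (b + 1), ψ m * ((G (Real.log m) / m : ℝ) : ℂ) := by
    symm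
    refine Finset.sum_subset ?_ ?_
    · intro m hm; rw [Finset.mem_Ico] at hm; rw [Finset.mem_Ioc]; have := Nat.zero_le (M / D); omega
    · intro m hm hm'
      rw [Finset.mem_Ioc] at hm; rw [Finset.mem_Ico, not_and_or] at hm'
      have hm2 : m ≤ M / D := by omega
      have hm3 : d * m ≤ M := by
        calc d * m ≤ D * (M / D) := Nat.mul_le_mul hdD hm2
          _ ≤ M := Nat.mul_div_le M D
      have : (Real.log d + Real.log m) / L ≤ 1 / 2 := by
        rw [← Real.log_mul (by exact_mod_cast (by omega : d ≠ 0)) (by exact_mod_cast hm.1.ne'),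
          div_le_iff₀ hL0, hM]
        have : Real.log ((d : ℝ) * m) ≤ Real.log M := by
          apply Real.log_le_log
          · exact_mod_cast Nat.mul_pos hd hm.1
          · exact_mod_cast hm3
        linarith
      simp [hG, hg.zero_of_le _ this]
  rw [hstart]
  refine (norm_sum_smooth_le hψ (fun t => (hGd t).differentiableAt) hb1 hb2 (Nat.le_add_left 1 _)).trans ?_
  have hM0 : (0 : ℝ) < M := by exact_mod_cast hM1
  have hD0 : (0 : ℝ) < D := by exact_mod_cast hD
  have ha' : (M : ℝ) / D ≤ (a : ℝ) := by
    rw [ha, ← Nat.floor_div_eq_div (K := ℝ)]; push_cast; exact (Nat.lt_floor_add_one _).le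
  have hK := hψ.nonneg
  calc K * (5 * (2 * C * L) / (a : ℝ)) ≤ K * (5 * (2 * C * L) / (M / D : ℝ)) := by
        gcongr
    _ = _ := by field_simp; ring

/-- The basic smoothly weighted sum over a convolution. -/
noncomputable def wsum (f : ℕ → ℝ) (g : ℝ → ℝ) (N : ℕ) (z : Chars) : ℂ :=
  ∑ n ∈ Ioc 0 N, ((f n * g (Real.log n / Real.log N) / n : ℝ) : ℂ) * ev z n

lemma wsum_mul (α β : ArithmeticFunction ℝ) (g : ℝ → ℝ) (N : ℕ) (z : Chars) :
    wsum (⇑(α * β)) g N z = ∑ d ∈ Ioc 0 N, ∑ m ∈ Ioc 0 (N / d), ((α d / d : ℝ) : ℂ) * ev z d *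
      (ev z m * ((β m * g ((Real.log d + Real.log m) / Real.log N) / m : ℝ) : ℂ)) := by
  rw [← sum_Ioc_sum_antidiagonal (fun d m => ((α d / d : ℝ) : ℂ) * ev z d *
      (ev z m * ((β m * g ((Real.log d + Real.log m) / Real.log N) / m : ℝ) : ℂ))), wsum]
  refine Finset.sum_congr rfl fun n hn => ?_
  rw [ArithmeticFunction.mul_apply, Finset.sum_mul, Finset.sum_div, Complex.ofReal_sum,
    Finset.sum_mul]
  refine Finset.sum_congr rfl fun x hx => ?_
  obtain ⟨h1, h2⟩ := Nat.mem_divisorsAntidiagonal.mp hx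
  subst h1
  have h3 : (x.1 : ℝ) ≠ 0 := Nat.cast_ne_zero.mpr fun h => h2 (by simp [h])
  have h4 : (x.2 : ℝ) ≠ 0 := Nat.cast_ne_zero.mpr fun h => h2 (by simp [h])
  rw [ev_mul, Nat.cast_mul, Real.log_mul h3 h4]
  push_cast
  have h3' : (x.1 : ℂ) ≠ 0 := by exact_mod_cast h3
  have h4' : (x.2 : ℂ) ≠ 0 := by exact_mod_cast h4
  field_simp

lemma norm_typeI_le {g : ℝ → ℝ} {C : ℝ} (hg : IsTest g C) {z : Chars} {K : ℝ}
    (hψ : BoundedSums (ev z) K) {N M D : ℕ} (hN : N = M ^ 2) (hL : 1 ≤ Real.log N)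
    {α β : ArithmeticFunction ℝ} {A : ℝ} (hα : ∀ d ≤ N, |α d| ≤ A) (hα0 : ∀ d, D < d → α d = 0)
    (hβ : β = log ∨ β = ((zeta : ArithmeticFunction ℕ) : ArithmeticFunction ℝ)) :
    ‖wsum (⇑(α * β)) g N z‖ ≤ 10 * A * C * Real.log N * K * D ^ 2 / M := by
  have hC := hg.nonneg
  have hK := hψ.nonneg
  have hA : 0 ≤ A := (abs_nonneg _).trans (hα 0 (Nat.zero_le _))
  have hM1 : 1 ≤ M := by
    rcases Nat.eq_zero_or_pos M with rfl | h
    · simp [hN] at hL; norm_num at hL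
    · exact h
  have hM : Real.log N = 2 * Real.log M := by rw [hN]; push_cast; rw [Real.log_pow]; norm_num
  set B := 10 * C * Real.log N * K * D / M with hB
  have hB0 : 0 ≤ B := by positivity
  obtain ⟨P, hP, hPβ⟩ : ∃ P : ℝ → ℝ, (P = id ∨ P = fun _ => 1) ∧
      ∀ m : ℕ, 0 < m → β m = P (Real.log m) := by
    rcases hβ with rfl | rfl
    · exact ⟨id, Or.inl rfl, fun m _ => rfl⟩
    · refine ⟨fun _ => 1, Or.inr rfl, fun m hm => ?_⟩
      simp [natCoe_apply, zeta_apply, hm.ne']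
  rw [wsum_mul]
  have hterm : ∀ d ∈ Ioc 0 N, ‖∑ m ∈ Ioc 0 (N / d), ((α d / d : ℝ) : ℂ) * ev z d *
      (ev z m * ((β m * g ((Real.log d + Real.log m) / Real.log N) / m : ℝ) : ℂ))‖ ≤
      if d ≤ D then A * B else 0 := by
    intro d hd
    obtain ⟨hd1, hd2⟩ := Finset.mem_Ioc.mp hd
    split_ifs with hdD
    · rw [← Finset.mul_sum, norm_mul, norm_mul, Complex.norm_real, Real.norm_eq_abs]
      have hdl : Real.log d ≤ Real.log N :=
        Real.log_le_log (by exact_mod_cast hd1) (by exact_mod_cast hd2)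
      have h1 := norm_typeI_inner_le hg hψ hL hM hM1 hd1 hdD hdl hP (N / d)
      have h2 : ∑ m ∈ Ioc 0 (N / d), ev z m *
          ((β m * g ((Real.log d + Real.log m) / Real.log N) / m : ℝ) : ℂ) =
          ∑ m ∈ Ioc 0 (N / d), ev z m *
          ((P (Real.log m) * g ((Real.log d + Real.log m) / Real.log N) / m : ℝ) : ℂ) :=
        Finset.sum_congr rfl fun m hm => by rw [hPβ m (Finset.mem_Ioc.mp hm).1]
      rw [h2]
      have h3 : |α d / (d : ℝ)| ≤ A := by
        rw [abs_div, Nat.abs_cast]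
        exact div_le_of_le_mul₀ (Nat.cast_nonneg _) hA ((hα d hd2).trans
          (le_mul_of_one_le_right hA (by exact_mod_cast hd1)))
      calc |α d / (d : ℝ)| * ‖ev z d‖ * _ ≤ A * 1 * B := by
            gcongr
            exact norm_ev_le z d
        _ = A * B := by ring
    · rw [hα0 d (by omega)]; simp
  refine (norm_sum_le _ _).trans ((Finset.sum_le_sum hterm).trans ?_)
  rw [← Finset.sum_filter, Finset.sum_const, nsmul_eq_mul]
  have hcard : (((Ioc 0 N).filter (fun d => d ≤ D)).card : ℝ) ≤ D := by
    have : (Ioc 0 N).filter (fun d => d ≤ D) ⊆ Ioc 0 D := by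
      intro d hd; simp only [mem_filter, mem_Ioc] at hd ⊢; exact ⟨hd.1.1, hd.2⟩
    exact_mod_cast (Finset.card_le_card this).trans (by simp)
  calc _ ≤ (D : ℝ) * (A * B) := by gcongr
    _ = _ := by rw [hB]; ring

end PrimeGapRuns

namespace PrimeGapRuns

open Finset ArithmeticFunction

lemma IsTest.abs_sub_le {g : ℝ → ℝ} {C : ℝ} (hg : IsTest g C) (s t : ℝ) :
    |g t - g s| ≤ C * |t - s| := by
  have := Convex.norm_image_sub_le_of_norm_deriv_le (f := g) (s := Set.univ) (C := C)
    (fun x _ => hg.diff x) (fun x _ => hg.bound_deriv x) convex_univ (Set.mem_univ s)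
    (Set.mem_univ t)
  simpa using this

/-- Bilinear (type II) sums on average over a family of primitive characters. -/
lemma sum_norm_typeII_le {g : ℝ → ℝ} {C : ℝ} (hg : IsTest g C) {Q : ℕ} {F : Finset Chars}
    (hF : IsFamily Q F) {U N : ℕ} (hU : 1 ≤ U) (hUQ : Q ^ 4 ≤ U) (hL : 1 ≤ Real.log N)
    {α β : ArithmeticFunction ℝ} (hα : ∀ d, 0 < d → d ≤ N → |α d| ≤ Real.log N)
    (hα0 : ∀ d, d < U → α d = 0) (hβ : ∀ m, |β m| ≤ m.divisors.card) (hβ0 : ∀ m, m < U → β m = 0) :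
    ∑ z ∈ F, ‖wsum (⇑(α * β)) g N z‖ ≤ C * (Real.log N + 6) ^ 5 := by
  set L := Real.log N with hLdef
  have hC := hg.nonneg
  have hL0 : 0 < L := by linarith
  set Δ : ℕ → ℕ → ℝ := fun j d => g ((Real.log d + Real.log ((j + 1 : ℕ) : ℝ)) / L) -
    g ((Real.log d + Real.log j) / L) with hΔ
  have hΔb : ∀ j d, 0 < j → |Δ j d| ≤ C / (j * L) := by
    intro j d hj
    have hj' : (0 : ℝ) < j := by exact_mod_cast hj
    refine (hg.abs_sub_le _ _).trans ?_
    rw [← sub_div, add_sub_add_left_eq_sub, abs_div, abs_of_pos hL0]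
    have h1 : |Real.log ((j + 1 : ℕ) : ℝ) - Real.log j| ≤ 1 / j := by
      rw [abs_of_nonneg (sub_nonneg.mpr (Real.log_le_log hj' (by push_cast; linarith))),
        ← Real.log_div (by positivity) hj'.ne']
      have := Real.log_le_sub_one_of_pos (x := ((j + 1 : ℕ) : ℝ) / j) (by positivity)
      refine this.trans (le_of_eq ?_)
      push_cast; field_simp; ring
    calc C * (_ / L) ≤ C * (1 / j / L) := by gcongr
      _ = _ := by field_simp
  set A : ℕ → Chars → ℂ := fun j z => ∑ d ∈ Ico U (N + 1), ((α d * Δ j d : ℝ) : ℂ) / d * ev z d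
  set B : ℕ → Chars → ℂ := fun j z => ∑ m ∈ Ico U (j + 1), ((β m : ℝ) : ℂ) / m * ev z m
  set H := 1 + L with hH
  have hharm : ∀ j ≤ N, ∑ n ∈ Ico U (j + 1), 1 / (n : ℝ) ≤ H := by
    intro j hj
    refine le_trans (Finset.sum_le_sum_of_subset_of_nonneg ?_ fun _ _ _ => by positivity)
      (sum_Ioc_one_div_le N)
    intro n hn; rw [Finset.mem_Ico] at hn; rw [Finset.mem_Ioc]; omega
  have hA : ∀ j, 0 < j → ∑ z ∈ F, ‖A j z‖ ^ 2 ≤ (H + 5) * (H * (C / j) ^ 2) := by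
    intro j hj
    have hj' : (0 : ℝ) < j := by exact_mod_cast hj
    refine (large_sieve hF (fun d => ((α d * Δ j d : ℝ) : ℂ)) hU hUQ).trans ?_
    have h1 : ∑ d ∈ Ico U (N + 1), ‖((α d * Δ j d : ℝ) : ℂ)‖ ^ 2 / (d : ℝ) ≤ H * (C / j) ^ 2 := by
      calc _ ≤ ∑ d ∈ Ico U (N + 1), 1 / (d : ℝ) * (C / j) ^ 2 := by
            refine Finset.sum_le_sum fun d hd => ?_
            rw [Finset.mem_Ico] at hd
            rw [Complex.norm_real, Real.norm_eq_abs, abs_mul, div_eq_mul_one_div, mul_comm]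
            have h2 : |α d| * |Δ j d| ≤ C / j := by
              calc _ ≤ L * (C / (j * L)) := by
                    gcongr
                    · exact hα d (by omega) (by omega)
                    · exact hΔb j d hj
                _ = _ := by field_simp
            gcongr
        _ ≤ _ := by rw [← Finset.sum_mul]; gcongr; exact hharm N le_rfl
    gcongr
    exact hharm N le_rfl
  have hB : ∀ j ≤ N, ∑ z ∈ F, ‖B j z‖ ^ 2 ≤ (H + 5) * H ^ 4 := by
    intro j hj
    refine (large_sieve hF (fun m => ((β m : ℝ) : ℂ)) hU hUQ).trans ?_
    have h1 : ∑ m ∈ Ico U (j + 1), ‖((β m : ℝ) : ℂ)‖ ^ 2 / (m : ℝ) ≤ H ^ 4 := by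
      refine le_trans ?_ (sum_card_divisors_sq_div_le N)
      calc _ ≤ ∑ m ∈ Ico U (j + 1), (m.divisors.card : ℝ) ^ 2 / m := by
            refine Finset.sum_le_sum fun m _ => ?_
            rw [Complex.norm_real, Real.norm_eq_abs]
            gcongr
            exact hβ m
        _ ≤ _ := by
            refine Finset.sum_le_sum_of_subset_of_nonneg ?_ fun _ _ _ => by positivity
            intro n hn; rw [Finset.mem_Ico] at hn; rw [Finset.mem_Ioc]; omega
    gcongr
    exact hharm j hj
  have hAB : ∀ j ∈ Ioc 0 N, ∑ z ∈ F, ‖A j z‖ * ‖B j z‖ ≤ C * (L + 6) ^ 4 * (1 / j) := by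
    intro j hj
    obtain ⟨hj1, hj2⟩ := Finset.mem_Ioc.mp hj
    have hj' : (0 : ℝ) < j := by exact_mod_cast hj1
    have h := Finset.sum_mul_sq_le_sq_mul_sq F (fun z => ‖A j z‖) (fun z => ‖B j z‖)
    have h0 : 0 ≤ ∑ z ∈ F, ‖A j z‖ * ‖B j z‖ := Finset.sum_nonneg fun _ _ => by positivity
    refine abs_le_of_sq_le_sq' ?_ (by positivity) |>.2
    calc _ ≤ (∑ z ∈ F, ‖A j z‖ ^ 2) * ∑ z ∈ F, ‖B j z‖ ^ 2 := h
      _ ≤ ((H + 5) * (H * (C / j) ^ 2)) * ((H + 5) * H ^ 4) := by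
          have h1 := hA j hj1
          have h2 := hB j hj2
          have : 0 ≤ ∑ z ∈ F, ‖B j z‖ ^ 2 := Finset.sum_nonneg fun _ _ => by positivity
          gcongr
      _ = (H + 5) ^ 2 * H ^ 5 * (C / j) ^ 2 := by ring
      _ ≤ (L + 6) ^ 2 * (L + 6) ^ 6 * (C / j) ^ 2 := by
          have h5 : H ^ 5 ≤ (L + 6) ^ 6 := by
            calc H ^ 5 ≤ (L + 6) ^ 5 := by gcongr; linarith
              _ ≤ _ := pow_le_pow_right₀ (by linarith) (by norm_num)
          have h6 : (H + 5) ^ 2 ≤ (L + 6) ^ 2 := le_of_eq (by rw [hH]; ring)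
          exact mul_le_mul_of_nonneg_right (mul_le_mul h6 h5 (by positivity) (by positivity))
            (by positivity)
      _ = _ := by ring
  have hdecomp : ∀ z, wsum (⇑(α * β)) g N z = - ∑ j ∈ Ioc 0 N, A j z * B j z := by
    intro z
    rw [wsum_mul]
    have h1 : ∀ d ∈ Ioc 0 N, ∑ m ∈ Ioc 0 (N / d), ((α d / d : ℝ) : ℂ) * ev z d *
        (ev z m * ((β m * g ((Real.log d + Real.log m) / Real.log N) / m : ℝ) : ℂ)) =
        - ∑ j ∈ Ioc 0 N, ((α d * Δ j d : ℝ) : ℂ) / d * ev z d * B j z := by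
      intro d hd
      obtain ⟨hd1, hd2⟩ := Finset.mem_Ioc.mp hd
      have hd' : (0 : ℝ) < d := by exact_mod_cast hd1
      have hbig : ∀ m : ℕ, 0 < m → N ≤ d * m → g ((Real.log d + Real.log m) / L) = 0 := by
        intro m hm hNm
        apply hg.zero_of_ge
        have hm' : (0 : ℝ) < m := by exact_mod_cast hm
        rw [le_div_iff₀ hL0, one_mul, ← Real.log_mul hd'.ne' hm'.ne']
        have hN0 : 0 < N := hd1.trans_le hd2
        exact Real.log_le_log (by exact_mod_cast hN0) (by exact_mod_cast hNm)
      have hext : ∑ m ∈ Ioc 0 (N / d), ((α d / d : ℝ) : ℂ) * ev z d *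
          (ev z m * ((β m * g ((Real.log d + Real.log m) / L) / m : ℝ) : ℂ)) =
          ∑ m ∈ Ioc 0 N, ((α d / d : ℝ) : ℂ) * ev z d *
          (ev z m * ((β m * g ((Real.log d + Real.log m) / L) / m : ℝ) : ℂ)) := by
        refine Finset.sum_subset (Finset.Ioc_subset_Ioc_right (Nat.div_le_self _ _)) ?_
        intro m hm hm'
        rw [Finset.mem_Ioc] at hm hm'
        have : N < d * m := by
          rw [mul_comm, ← Nat.div_lt_iff_lt_mul hd1]; omega
        rw [hbig m hm.1 this.le]; simp
      rw [hext]
      have htel : ∀ m ∈ Ioc 0 N, g ((Real.log d + Real.log m) / L) =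
          - ∑ j ∈ Ioc 0 N, if m ≤ j then Δ j d else 0 := by
        intro m hm
        obtain ⟨hm1, hm2⟩ := Finset.mem_Ioc.mp hm
        have e : ∑ j ∈ Ioc 0 N, (if m ≤ j then Δ j d else 0) = ∑ j ∈ Ico m (N + 1), Δ j d := by
          rw [← Finset.sum_filter]
          congr 1
          ext j; simp only [mem_filter, mem_Ioc, mem_Ico]; omega
        rw [e, hΔ, Finset.sum_Ico_sub (fun j : ℕ => g ((Real.log d + Real.log (j : ℝ)) / L))
          (by omega), hbig (N + 1) (by omega) (by nlinarith)]
        ring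
      have h2 : ∀ m ∈ Ioc 0 N, ((α d / d : ℝ) : ℂ) * ev z d *
          (ev z m * ((β m * g ((Real.log d + Real.log m) / L) / m : ℝ) : ℂ)) =
          - ∑ j ∈ Ioc 0 N, if m ≤ j then ((α d * Δ j d : ℝ) : ℂ) / d * ev z d *
            (((β m : ℝ) : ℂ) / m * ev z m) else 0 := by
        intro m hm
        rw [htel m hm, mul_neg, neg_div, Complex.ofReal_neg, mul_neg, mul_neg, Finset.mul_sum,
          Finset.sum_div, Complex.ofReal_sum, Finset.mul_sum, Finset.mul_sum]
        congr 1
        refine Finset.sum_congr rfl fun j _ => ?_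
        split_ifs
        · push_cast; ring
        · simp
      rw [Finset.sum_congr rfl h2, Finset.sum_neg_distrib, Finset.sum_comm]
      congr 1
      refine Finset.sum_congr rfl fun j hj => ?_
      obtain ⟨hj1, hj2⟩ := Finset.mem_Ioc.mp hj
      rw [Finset.mul_sum, ← Finset.sum_filter]
      symm
      refine Finset.sum_subset ?_ ?_
      · intro m hm; simp only [mem_filter, mem_Ioc, mem_Ico] at hm ⊢; omega
      · intro m hm hm'
        simp only [mem_filter, mem_Ioc, mem_Ico] at hm hm'
        rw [hβ0 m (by omega)]; simp
    rw [Finset.sum_congr rfl h1, Finset.sum_neg_distrib, Finset.sum_comm]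
    congr 1
    refine Finset.sum_congr rfl fun j _ => ?_
    rw [← Finset.sum_mul]
    congr 1
    symm
    refine Finset.sum_subset ?_ ?_
    · intro d hd; rw [Finset.mem_Ico] at hd; rw [Finset.mem_Ioc]; omega
    · intro d hd hd'
      rw [Finset.mem_Ioc] at hd; rw [Finset.mem_Ico] at hd'
      rw [hα0 d (by omega)]; simp
  calc ∑ z ∈ F, ‖wsum (⇑(α * β)) g N z‖ ≤ ∑ z ∈ F, ∑ j ∈ Ioc 0 N, ‖A j z‖ * ‖B j z‖ := by
        refine Finset.sum_le_sum fun z _ => ?_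
        rw [hdecomp, norm_neg]
        refine (norm_sum_le _ _).trans (Finset.sum_le_sum fun j _ => ?_)
        rw [norm_mul]
    _ = ∑ j ∈ Ioc 0 N, ∑ z ∈ F, ‖A j z‖ * ‖B j z‖ := Finset.sum_comm
    _ ≤ ∑ j ∈ Ioc 0 N, C * (L + 6) ^ 4 * (1 / j) := Finset.sum_le_sum hAB
    _ = C * (L + 6) ^ 4 * ∑ j ∈ Ioc 0 N, 1 / (j : ℝ) := by rw [Finset.mul_sum]
    _ ≤ C * (L + 6) ^ 4 * (L + 6) := by
        gcongr
        exact (sum_Ioc_one_div_le N).trans (by linarith)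
    _ = _ := by ring

end PrimeGapRuns

namespace PrimeGapRuns

open Finset ArithmeticFunction
open scoped ArithmeticFunction.Moebius

/-- Truncation of an arithmetic function to `[1, U]`. -/
def trunc (f : ArithmeticFunction ℝ) (U : ℕ) : ArithmeticFunction ℝ :=
  ⟨fun n => if n ≤ U then f n else 0, by simp⟩

lemma trunc_apply (f : ArithmeticFunction ℝ) (U n : ℕ) :
    trunc f U n = if n ≤ U then f n else 0 := rfl

lemma wsum_add (f₁ f₂ : ℕ → ℝ) (g : ℝ → ℝ) (N : ℕ) (z : Chars) :
    wsum (f₁ + f₂) g N z = wsum f₁ g N z + wsum f₂ g N z := by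
  rw [wsum, wsum, wsum, ← Finset.sum_add_distrib]
  refine Finset.sum_congr rfl fun n _ => ?_
  rw [Pi.add_apply]; push_cast; ring

lemma wsum_sub (f₁ f₂ : ℕ → ℝ) (g : ℝ → ℝ) (N : ℕ) (z : Chars) :
    wsum (f₁ - f₂) g N z = wsum f₁ g N z - wsum f₂ g N z := by
  rw [wsum, wsum, wsum, ← Finset.sum_sub_distrib]
  refine Finset.sum_congr rfl fun n _ => ?_
  rw [Pi.sub_apply]; push_cast; ring

lemma wsum_trunc_eq_zero {g : ℝ → ℝ} {C : ℝ} (hg : IsTest g C) (f : ArithmeticFunction ℝ)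
    {N M U : ℕ} (hN : N = M ^ 2) (hL : 1 ≤ Real.log N) (hU : U ≤ M) (z : Chars) :
    wsum (⇑(trunc f U)) g N z = 0 := by
  refine Finset.sum_eq_zero fun n hn => ?_
  rw [trunc_apply]
  split_ifs with h
  · have hM : Real.log N = 2 * Real.log M := by rw [hN]; push_cast; rw [Real.log_pow]; norm_num
    rw [hg.zero_of_le]
    · simp
    · rw [div_le_iff₀ (by linarith)]
      have hn0 : 0 < n := (Finset.mem_Ioc.mp hn).1
      have := Real.log_le_log (by exact_mod_cast hn0)
        (show (n : ℝ) ≤ M by exact_mod_cast h.trans hU)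
      linarith
  · simp

lemma vaughan_identity (U : ℕ) :
    (Λ : ArithmeticFunction ℝ) = trunc Λ U + trunc (μ : ArithmeticFunction ℝ) U * log -
      (trunc (μ : ArithmeticFunction ℝ) U * trunc Λ U) * ((zeta : ArithmeticFunction ℕ) :
        ArithmeticFunction ℝ) + (Λ - trunc Λ U) * (((μ : ArithmeticFunction ℝ) -
        trunc (μ : ArithmeticFunction ℝ) U) * ((zeta : ArithmeticFunction ℕ) :
        ArithmeticFunction ℝ)) := by
  have h1 : ((μ : ArithmeticFunction ℤ) : ArithmeticFunction ℝ) *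
    ((zeta : ArithmeticFunction ℕ) : ArithmeticFunction ℝ) = 1 := coe_moebius_mul_coe_zeta
  have h2 : (log : ArithmeticFunction ℝ) = Λ * ((zeta : ArithmeticFunction ℕ) :
    ArithmeticFunction ℝ) := vonMangoldt_mul_zeta.symm
  rw [h2]
  linear_combination (trunc Λ U - Λ) * h1

lemma abs_sum_le_log (U n : ℕ) :
    |(trunc (μ : ArithmeticFunction ℝ) U * trunc Λ U) n| ≤ Real.log n := by
  rw [ArithmeticFunction.mul_apply]
  refine (Finset.abs_sum_le_sum_abs _ _).trans ?_
  rw [← log_apply, ← vonMangoldt_mul_zeta, mul_comm, ArithmeticFunction.mul_apply]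
  refine Finset.sum_le_sum fun x hx => ?_
  have hx1 : x.1 ≠ 0 := left_ne_zero_of_mul (by
    rw [(Nat.mem_divisorsAntidiagonal.mp hx).1]; exact (Nat.mem_divisorsAntidiagonal.mp hx).2)
  rw [abs_mul]
  refine mul_le_mul ?_ ?_ (abs_nonneg _) ?_
  · rw [trunc_apply, natCoe_apply, zeta_apply_ne hx1, Nat.cast_one]
    split_ifs
    · rw [intCoe_apply]; exact_mod_cast abs_moebius_le_one
    · simp
  · rw [trunc_apply]
    split_ifs
    · rw [abs_of_nonneg vonMangoldt_nonneg]
    · simp [vonMangoldt_nonneg]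
  · rw [natCoe_apply]; positivity

/-- Large sieve estimate for primes twisted by primitive characters. -/
theorem sum_norm_wsum_vonMangoldt_le {g : ℝ → ℝ} {C : ℝ} (hg : IsTest g C) {Q : ℕ}
    {F : Finset Chars} (hF : IsFamily Q F) (hF1 : ∀ z ∈ F, 1 < z.1) {U N M : ℕ} (hU : 1 ≤ U)
    (hUQ : Q ^ 4 ≤ U) (hUM : U ≤ M) (hN : N = M ^ 2) (hL : 1 ≤ Real.log N) :
    ∑ z ∈ F, ‖wsum (⇑(Λ : ArithmeticFunction ℝ)) g N z‖ ≤
      Q ^ 2 * (20 * C * Real.log N ^ 2 * Q * U ^ 4 / M) + C * (Real.log N + 6) ^ 5 := by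
  have hC := hg.nonneg
  set L := Real.log N
  have hU' : (1 : ℝ) ≤ U := by exact_mod_cast hU
  set M1 := trunc (μ : ArithmeticFunction ℝ) U
  set L1 := trunc Λ U
  set Z := ((zeta : ArithmeticFunction ℕ) : ArithmeticFunction ℝ)
  have hM1 : ∀ d, |M1 d| ≤ 1 := by
    intro d
    change |trunc _ U d| ≤ 1
    rw [trunc_apply]
    split_ifs
    · rw [intCoe_apply]; exact_mod_cast abs_moebius_le_one
    · simp
  have hII : ∑ z ∈ F, ‖wsum (⇑((Λ - L1) * (((μ : ArithmeticFunction ℝ) - M1) * Z))) g N z‖ ≤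
      C * (L + 6) ^ 5 := by
    refine sum_norm_typeII_le hg hF hU hUQ hL ?_ ?_ ?_ ?_
    · intro d hd hdN
      change |Λ d - trunc Λ U d| ≤ _
      have h1 : Λ d ≤ L := vonMangoldt_le_log.trans
        (Real.log_le_log (by exact_mod_cast hd) (by exact_mod_cast hdN))
      rw [trunc_apply]
      split_ifs
      · simp; linarith
      · rwa [sub_zero, abs_of_nonneg vonMangoldt_nonneg]
    · intro d hd
      change Λ d - trunc Λ U d = 0
      rw [trunc_apply, if_pos hd.le, sub_self]
    · intro m
      rw [mul_comm, coe_zeta_mul_apply]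
      refine (Finset.abs_sum_le_sum_abs _ _).trans ?_
      rw [Finset.card_eq_sum_ones]
      push_cast
      refine Finset.sum_le_sum fun d _ => ?_
      change |(μ : ArithmeticFunction ℝ) d - trunc _ U d| ≤ _
      rw [trunc_apply]
      split_ifs
      · simp
      · rw [sub_zero, intCoe_apply]; exact_mod_cast abs_moebius_le_one
    · intro m hm
      rw [mul_comm, coe_zeta_mul_apply]
      refine Finset.sum_eq_zero fun d hd => ?_
      change (μ : ArithmeticFunction ℝ) d - trunc _ U d = 0
      rw [trunc_apply, if_pos ((Nat.divisor_le hd).trans hm.le), sub_self]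
  have hI : ∀ z ∈ F, ‖wsum (⇑(M1 * log)) g N z‖ + ‖wsum (⇑(M1 * L1 * Z)) g N z‖ ≤
      20 * C * L ^ 2 * Q * U ^ 4 / M := by
    intro z hz
    obtain ⟨hp, h0, hQ⟩ := hF z hz
    have hQ' : (z.1 : ℝ) ≤ Q := by exact_mod_cast hQ
    have : NeZero z.1 := ⟨by omega⟩
    have hne : z.2 ≠ 1 := by
      intro h
      have := DirichletCharacter.eq_one_iff_conductor_eq_one (χ := z.2) |>.mp h
      have h2 : z.2.conductor = z.1 := hp
      have := hF1 z hz
      omega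
    have hψ : BoundedSums (ev z) z.1 := boundedSums_of_ne_one hne
    have hd : ∀ d ≤ N, 0 < d → Real.log d ≤ L := fun d hdN hd =>
      Real.log_le_log (by exact_mod_cast hd) (by exact_mod_cast hdN)
    have h1 := norm_typeI_le hg hψ hN hL (α := M1) (β := log) (A := 1) (D := U)
      (fun d _ => hM1 d) (fun d hd => by
        change trunc _ U d = 0
        rw [trunc_apply, if_neg (by omega)]) (Or.inl rfl)
    have h2 := norm_typeI_le hg hψ hN hL (α := M1 * L1) (β := Z) (A := L) (D := U ^ 2)
      (fun d hdN => by
        refine (abs_sum_le_log U d).trans ?_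
        rcases Nat.eq_zero_or_pos d with rfl | h
        · simp; linarith
        · exact hd d hdN h)
      (fun d hd => by
        rw [ArithmeticFunction.mul_apply]
        refine Finset.sum_eq_zero fun x hx => ?_
        change trunc _ U x.1 * trunc _ U x.2 = 0
        rw [trunc_apply, trunc_apply]
        have h3 := (Nat.mem_divisorsAntidiagonal.mp hx).1
        split_ifs with h4 h5
        · exfalso
          have := Nat.mul_le_mul h4 h5
          rw [h3] at this; nlinarith
        all_goals simp) (Or.inr rfl)
    have hU2 : (U : ℝ) ^ 2 ≤ U ^ 4 := pow_le_pow_right₀ hU' (by norm_num)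
    have hLL : 1 * L ≤ L * L := by nlinarith
    calc _ ≤ 10 * 1 * C * L * z.1 * U ^ 2 / M + 10 * L * C * L * z.1 * ((U ^ 2 : ℕ) : ℝ) ^ 2 / M :=
          add_le_add h1 h2
      _ = 10 * C * (1 * L) * z.1 * U ^ 2 / M + 10 * C * (L * L) * z.1 * U ^ 4 / M := by
          push_cast; ring
      _ ≤ 10 * C * (L * L) * Q * U ^ 4 / M + 10 * C * (L * L) * Q * U ^ 4 / M := by
          gcongr
      _ = _ := by ring
  have hdec : ∀ z, wsum (⇑(Λ : ArithmeticFunction ℝ)) g N z = wsum (⇑(M1 * log)) g N z -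
      wsum (⇑(M1 * L1 * Z)) g N z +
      wsum (⇑((Λ - L1) * (((μ : ArithmeticFunction ℝ) - M1) * Z))) g N z := by
    intro z
    rw [← wsum_sub, ← wsum_add, ← zero_add (wsum (_ + _) g N z),
      ← wsum_trunc_eq_zero hg Λ hN hL hUM z, ← wsum_add]
    congr 1
    conv_lhs => rw [vaughan_identity U]
    ext n
    change (trunc Λ U n + (M1 * log) n - (M1 * L1 * Z) n) + _ =
      trunc Λ U n + ((M1 * log) n - (M1 * L1 * Z) n + _)
    rw [← add_assoc, add_sub_assoc]
  have hcard : (F.card : ℝ) ≤ Q ^ 2 := by exact_mod_cast hF.card_le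
  have hM0 : (0 : ℝ) ≤ 20 * C * L ^ 2 * Q * U ^ 4 / M := by positivity
  calc _ ≤ ∑ z ∈ F, (20 * C * L ^ 2 * Q * U ^ 4 / M +
        ‖wsum (⇑((Λ - L1) * (((μ : ArithmeticFunction ℝ) - M1) * Z))) g N z‖) := by
        refine Finset.sum_le_sum fun z hz => ?_
        rw [hdec z]
        refine (norm_add_le _ _).trans ?_
        gcongr
        exact (norm_sub_le _ _).trans (hI z hz)
    _ ≤ _ := by
        rw [Finset.sum_add_distrib, Finset.sum_const, nsmul_eq_mul]
        gcongr

end PrimeGapRuns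

namespace PrimeGapRuns

open Finset ArithmeticFunction

/-- Smooth functions supported in `[α, 1]` with prescribed bounds for all derivatives. -/
structure IsSmooth (g : ℝ → ℝ) (α : ℝ) (b : ℕ → ℝ) : Prop where
  contDiff : ∀ n : ℕ, ContDiff ℝ n g
  bound : ∀ i t, |iteratedDeriv i g t| ≤ b i
  zero_of_le : ∀ t, t ≤ α → g t = 0
  zero_of_ge : ∀ t, 1 ≤ t → g t = 0

variable {g : ℝ → ℝ} {α : ℝ} {b : ℕ → ℝ}

lemma IsSmooth.nonneg (hg : IsSmooth g α b) (i : ℕ) : 0 ≤ b i :=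
  (abs_nonneg _).trans (hg.bound i 0)

lemma IsSmooth.differentiable (hg : IsSmooth g α b) : Differentiable ℝ g :=
  (hg.contDiff 1).differentiable (by norm_num)

lemma IsSmooth.abs_le (hg : IsSmooth g α b) (t : ℝ) : |g t| ≤ b 0 := by
  simpa using hg.bound 0 t

lemma IsSmooth.abs_deriv_le (hg : IsSmooth g α b) (t : ℝ) : |deriv g t| ≤ b 1 := by
  simpa [iteratedDeriv_one] using hg.bound 1 t

/-- The difference quotient of a smooth function, with all derivative bounds shifted. -/
lemma IsSmooth.slope (hg : IsSmooth g α b) {s : ℝ} (hs : 0 < s) (hsα : s ≤ α / 2) :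
    IsSmooth (fun t => s⁻¹ * (g (t + s) - g t)) (α / 2) fun i => b (i + 1) where
  contDiff n := contDiff_const.mul
    (((hg.contDiff n).comp (contDiff_id.add contDiff_const)).sub (hg.contDiff n))
  bound i t := by
    have h1 : ContDiff ℝ i (fun t => g (t + s)) :=
      (hg.contDiff i).comp (contDiff_id.add contDiff_const)
    rw [iteratedDeriv_const_mul s⁻¹ (h1.sub (hg.contDiff i)).contDiffAt,
      iteratedDeriv_fun_sub h1.contDiffAt (hg.contDiff i).contDiffAt,
      iteratedDeriv_comp_add_const]
    have hd : Differentiable ℝ (iteratedDeriv i g) :=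
      (hg.contDiff (i + 1)).differentiable_iteratedDeriv i (by norm_cast; omega)
    have := Convex.norm_image_sub_le_of_norm_deriv_le (f := iteratedDeriv i g) (s := Set.univ)
      (C := b (i + 1)) (fun x _ => hd x)
      (fun x _ => by rw [← iteratedDeriv_succ]; exact hg.bound (i + 1) x) convex_univ
      (Set.mem_univ t) (Set.mem_univ (t + s))
    rw [add_sub_cancel_left, Real.norm_eq_abs, Real.norm_eq_abs, abs_of_pos hs] at this
    rw [abs_mul, abs_of_pos (inv_pos.mpr hs), inv_mul_le_iff₀ hs, mul_comm]
    exact this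
  zero_of_le t ht := by
    rw [hg.zero_of_le _ (by linarith), hg.zero_of_le _ (by linarith)]; simp
  zero_of_ge t ht := by
    rw [hg.zero_of_ge _ (by linarith), hg.zero_of_ge _ (by linarith)]; simp

lemma norm_wsum_vonMangoldt_le {B : ℝ} (hB : ∀ t, |g t| ≤ B) {N : ℕ} (hN : 1 ≤ N) (z : Chars) :
    ‖wsum (⇑(Λ : ArithmeticFunction ℝ)) g N z‖ ≤ B * (Real.log N + 6) := by
  have hB0 : 0 ≤ B := (abs_nonneg _).trans (hB 0)
  calc _ ≤ ∑ n ∈ Ioc 0 N, B * (Λ n / n) := by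
        refine norm_sum_le_of_le _ fun n hn => ?_
        rw [norm_mul, Complex.norm_real, Real.norm_eq_abs, abs_div, abs_mul,
          abs_of_nonneg vonMangoldt_nonneg, Nat.abs_cast]
        have := norm_ev_le z n
        have h2 := hB (Real.log n / Real.log N)
        have h3 : 0 ≤ Λ n := vonMangoldt_nonneg
        calc _ ≤ Λ n * B / n * 1 := by gcongr
          _ = _ := by ring
    _ ≤ _ := by
        rw [← Finset.mul_sum]
        have := (abs_le.mp (abs_sum_vonMangoldt_div_sub_log_le hN)).2
        gcongr; linarith

lemma wsum_test_add (f : ℕ → ℝ) (g₁ g₂ : ℝ → ℝ) (c : ℝ) (N : ℕ) (z : Chars) :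
    wsum f (fun t => g₁ t + c * g₂ t) N z = wsum f g₁ N z + c * wsum f g₂ N z := by
  rw [wsum, wsum, wsum, Finset.mul_sum, ← Finset.sum_add_distrib]
  refine Finset.sum_congr rfl fun n _ => ?_
  push_cast; ring

/-- Truncated value at `1` of the `L`-function of a character. -/
noncomputable def partialL (z : Chars) (M : ℕ) : ℂ := ∑ m ∈ Ioc 0 M, ev z m / m

lemma norm_wsum_log_le (hg : IsSmooth g α b) (hα : 0 ≤ α) {z : Chars} {K : ℝ} (hψ : BoundedSums (ev z) K)
    {N M : ℕ} (hM : 1 ≤ M) (hL : 1 ≤ Real.log N) (hMα : Real.log M ≤ α * Real.log N) :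
    ‖wsum (⇑(log : ArithmeticFunction ℝ)) g N z‖ ≤
      K * (5 * ((b 0 + b 1) * Real.log N) / M) := by
  set L := Real.log N
  have hb0 := hg.nonneg 0
  have hb1 := hg.nonneg 1
  have hL0 : 0 < L := by linarith
  set G : ℝ → ℝ := fun u => u * g (u / L)
  have hGd : ∀ u, HasDerivAt G (1 * g (u / L) + u * (deriv g (u / L) * (1 / L))) u := by
    intro u
    have h1 : HasDerivAt (fun u : ℝ => g (u / L)) (deriv g (u / L) * (1 / L)) u :=
      HasDerivAt.comp u (hg.differentiable (u / L)).hasDerivAt ((hasDerivAt_id u).div_const L)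
    exact (hasDerivAt_id u).mul h1
  have hout : ∀ u, ¬ (0 ≤ u ∧ u ≤ L) → g (u / L) = 0 ∧ deriv g (u / L) = 0 := by
    intro u hu
    by_cases h : 0 ≤ u
    · have hu1 : 1 < u / L := by rw [lt_div_iff₀ hL0]; by_contra h'; exact hu ⟨h, by linarith⟩
      refine ⟨hg.zero_of_ge _ hu1.le, ?_⟩
      have : g =ᶠ[nhds (u / L)] fun _ => 0 := by
        filter_upwards [Ioi_mem_nhds hu1] with s hs
        exact hg.zero_of_ge s (le_of_lt hs)
      rw [this.deriv_eq]; simp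
    · have hu1 : u / L < α := lt_of_lt_of_le (div_neg_of_neg_of_pos (not_le.mp h) hL0) hα
      refine ⟨hg.zero_of_le _ hu1.le, ?_⟩
      have : g =ᶠ[nhds (u / L)] fun _ => 0 := by
        filter_upwards [Iio_mem_nhds hu1] with s hs
        exact hg.zero_of_le s (le_of_lt hs)
      rw [this.deriv_eq]; simp
  have hB : ∀ u, |G u| ≤ (b 0 + b 1) * L := by
    intro u
    by_cases hu : 0 ≤ u ∧ u ≤ L
    · rw [abs_mul, abs_of_nonneg hu.1]
      nlinarith [hg.abs_le (u / L), hu.1, hu.2, abs_nonneg (g (u / L)), mul_nonneg hb1 hL0.le]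
    · simp only [G, (hout u hu).1, mul_zero, abs_zero]; positivity
  have hB' : ∀ u, |deriv G u| ≤ (b 0 + b 1) * L := by
    intro u
    rw [(hGd u).deriv]
    by_cases hu : 0 ≤ u ∧ u ≤ L
    · have h1 : |u * (deriv g (u / L) * (1 / L))| ≤ b 1 := by
        rw [abs_mul, abs_mul, abs_of_nonneg hu.1, abs_of_pos (by positivity : 0 < 1 / L)]
        have h2 := hg.abs_deriv_le (u / L)
        calc u * (|deriv g (u / L)| * (1 / L)) ≤ L * (b 1 * (1 / L)) := by
              gcongr; exact hu.2
          _ = b 1 := by field_simp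
      have h2 := hg.abs_le (u / L)
      refine (abs_add_le _ _).trans ?_
      rw [one_mul]
      nlinarith
    · rw [(hout u hu).1, (hout u hu).2]; simp; positivity
  have key := norm_sum_smooth_le hψ (fun u => (hGd u).differentiableAt) hB hB' (a := M)
    (b := N + 1) hM
  refine le_of_eq_of_le ?_ key
  congr 1
  have hsub : Ico M (N + 1) ⊆ Ioc 0 N := by
    intro n hn; rw [Finset.mem_Ico] at hn; rw [Finset.mem_Ioc]; omega
  rw [wsum, ← Finset.sum_subset hsub]
  · refine Finset.sum_congr rfl fun n _ => ?_
    rw [log_apply, mul_comm]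
  · intro n hn hn'
    rw [Finset.mem_Ico] at hn'; rw [Finset.mem_Ioc] at hn
    rw [hg.zero_of_le]
    · simp
    · rw [div_le_iff₀ hL0]
      refine le_trans (Real.log_le_log (by exact_mod_cast hn.1) ?_) hMα
      have : n ≤ M := by omega
      exact_mod_cast this

/-- One step of the bootstrap. -/
lemma norm_partialL_mul_wsum_le (hg : IsSmooth g α b) (hα : 0 ≤ α) {z : Chars} {K : ℝ}
    (hψ : BoundedSums (ev z) K) {N M : ℕ} (hM : 1 ≤ M) (hMN : M ≤ N) (hL : 1 ≤ Real.log N)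
    (hMα : Real.log M ≤ α / 2 * Real.log N) {S : ℝ}
    (hS : ∀ g', IsSmooth g' (α / 2) (fun i => b (i + 1)) →
      ‖wsum (⇑(Λ : ArithmeticFunction ℝ)) g' N z‖ ≤ S) (hS0 : 0 ≤ S) :
    ‖partialL z M * wsum (⇑(Λ : ArithmeticFunction ℝ)) g N z‖ ≤
      K * (5 * ((b 0 + b 1) * (2 * Real.log N + 6)) / M) +
      (1 + Real.log M) * (Real.log M / Real.log N) * S := by
  set L := Real.log N with hLdef
  have hL0 : 0 < L := by linarith
  have hb0 := hg.nonneg 0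
  have hb1 := hg.nonneg 1
  have hK := hψ.nonneg
  have hN : 1 ≤ N := hM.trans hMN
  have hM0 : (0 : ℝ) < M := by exact_mod_cast hM
  set Z := ((zeta : ArithmeticFunction ℕ) : ArithmeticFunction ℝ)
  set T : ℝ → ℂ := fun s => wsum (⇑(Λ : ArithmeticFunction ℝ)) (fun t => g (t + s)) N z with hT
  set tail : ℕ → ℂ := fun d => ∑ m ∈ Ico (M + 1) (N + 1),
    ev z m * ((g ((Real.log d + Real.log m) / L) / m : ℝ) : ℂ) with htail
  have hlog : wsum (⇑(log : ArithmeticFunction ℝ)) g N z =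
      ∑ m ∈ Ioc 0 M, ev z m / m * T (Real.log m / L) +
      ∑ d ∈ Ioc 0 N, ((Λ d / d : ℝ) : ℂ) * ev z d * tail d := by
    have e : (log : ArithmeticFunction ℝ) = Λ * Z := vonMangoldt_mul_zeta.symm
    rw [e, wsum_mul]
    have h1 : ∀ d ∈ Ioc 0 N, ∑ m ∈ Ioc 0 (N / d), ((Λ d / d : ℝ) : ℂ) * ev z d *
        (ev z m * ((Z m * g ((Real.log d + Real.log m) / L) / m : ℝ) : ℂ)) =
        ∑ m ∈ Ioc 0 M, ((Λ d / d : ℝ) : ℂ) * ev z d *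
          (ev z m * ((g ((Real.log d + Real.log m) / L) / m : ℝ) : ℂ)) +
        ((Λ d / d : ℝ) : ℂ) * ev z d * tail d := by
      intro d hd
      obtain ⟨hd1, hd2⟩ := Finset.mem_Ioc.mp hd
      have hd' : (0 : ℝ) < d := by exact_mod_cast hd1
      have hu : Ioc 0 N = Ioc 0 M ∪ Ico (M + 1) (N + 1) := by
        ext n; simp only [mem_union, mem_Ioc, mem_Ico]; omega
      have hdis : Disjoint (Ioc 0 M) (Ico (M + 1) (N + 1)) := by
        rw [Finset.disjoint_left]; intro n; simp only [mem_Ioc, mem_Ico]; omega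
      rw [htail, Finset.mul_sum, ← Finset.sum_union hdis, ← hu]
      rw [Finset.sum_subset (Finset.Ioc_subset_Ioc_right (Nat.div_le_self N d))]
      · refine Finset.sum_congr rfl fun m hm => ?_
        have : Z m = 1 := by
          change ((zeta : ArithmeticFunction ℕ) : ArithmeticFunction ℝ) m = 1
          rw [natCoe_apply, zeta_apply_ne (by rw [Finset.mem_Ioc] at hm; omega), Nat.cast_one]
        rw [this, one_mul]
      · intro m hm hm'
        rw [Finset.mem_Ioc] at hm hm'
        have hlt : N < d * m := by
          rw [mul_comm, ← Nat.div_lt_iff_lt_mul hd1]; omega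
        have hm0 : (0 : ℝ) < m := by exact_mod_cast hm.1
        rw [hg.zero_of_ge]
        · simp
        · rw [le_div_iff₀ hL0, one_mul, ← Real.log_mul hd'.ne' hm0.ne']
          exact Real.log_le_log (by exact_mod_cast hN) (by exact_mod_cast hlt.le)
    rw [Finset.sum_congr rfl h1, Finset.sum_add_distrib, Finset.sum_comm]
    congr 1
    refine Finset.sum_congr rfl fun m _ => ?_
    rw [hT]
    simp only [wsum]
    rw [Finset.mul_sum]
    refine Finset.sum_congr rfl fun d _ => ?_
    rw [add_div]
    push_cast
    ring
  have htailb : ∀ d ∈ Ioc 0 N, ‖tail d‖ ≤ K * (5 * (b 0 + b 1) / M) := by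
    intro d _
    have hd : ∀ u, HasDerivAt (fun u : ℝ => g ((Real.log d + u) / L))
        (deriv g ((Real.log d + u) / L) * (1 / L)) u := fun u =>
      HasDerivAt.comp u (hg.differentiable _).hasDerivAt
        (((hasDerivAt_id u).const_add _).div_const L)
    refine (norm_sum_smooth_le hψ (fun u => (hd u).differentiableAt) (B := b 0 + b 1) ?_ ?_
      (a := M + 1) (b := N + 1) (by omega)).trans ?_
    · intro u; linarith [hg.abs_le ((Real.log d + u) / L)]
    · intro u
      rw [(hd u).deriv, abs_mul, abs_of_pos (by positivity : 0 < 1 / L)]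
      have h1 := hg.abs_deriv_le ((Real.log d + u) / L)
      have h2 : 1 / L ≤ 1 := by rw [div_le_one hL0]; exact hL
      calc _ ≤ b 1 * 1 := by gcongr
        _ ≤ _ := by linarith
    · gcongr; linarith
  have hsl : ∀ m ∈ Ioc 0 M, ∃ E : ℂ, ‖E‖ ≤ Real.log M / L * S ∧
      T (Real.log m / L) = wsum (⇑(Λ : ArithmeticFunction ℝ)) g N z + E := by
    intro m hm
    obtain ⟨hm1, hm2⟩ := Finset.mem_Ioc.mp hm
    have hlm : Real.log m ≤ Real.log M :=
      Real.log_le_log (by exact_mod_cast hm1) (by exact_mod_cast hm2)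
    have hlm0 : 0 ≤ Real.log m := Real.log_natCast_nonneg m
    set s := Real.log m / L with hs
    have hs0 : 0 ≤ s := by positivity
    have hsM : s ≤ Real.log M / L := by rw [hs]; gcongr
    rcases hs0.eq_or_lt with h | h
    · refine ⟨0, ?_, ?_⟩
      · rw [norm_zero]; exact mul_nonneg (hs0.trans hsM) hS0
      · simp only [hT, ← h, add_zero]
    · have hsα : s ≤ α / 2 := hsM.trans (by rw [div_le_iff₀ hL0]; exact hMα)
      refine ⟨s * wsum (⇑(Λ : ArithmeticFunction ℝ)) (fun t => s⁻¹ * (g (t + s) - g t)) N z, ?_, ?_⟩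
      · rw [norm_mul, Complex.norm_real, Real.norm_eq_abs, abs_of_pos h]
        exact mul_le_mul hsM (hS _ (hg.slope h hsα)) (norm_nonneg _) (hs0.trans hsM)
      · rw [← wsum_test_add]
        simp only [hT]
        congr 1
        funext t
        field_simp
        ring
  choose! E hE1 hE2 using hsl
  have hmain : partialL z M * wsum (⇑(Λ : ArithmeticFunction ℝ)) g N z =
      wsum (⇑(log : ArithmeticFunction ℝ)) g N z -
      ∑ d ∈ Ioc 0 N, ((Λ d / d : ℝ) : ℂ) * ev z d * tail d -
      ∑ m ∈ Ioc 0 M, ev z m / m * E m := by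
    rw [hlog, Finset.sum_congr rfl fun m hm => by rw [hE2 m hm, mul_add],
      Finset.sum_add_distrib, ← Finset.sum_mul, partialL]
    ring
  have h1 := norm_wsum_log_le hg hα hψ hM hL (hMα.trans (by nlinarith))
  have h2 : ‖∑ d ∈ Ioc 0 N, ((Λ d / d : ℝ) : ℂ) * ev z d * tail d‖ ≤
      (L + 6) * (K * (5 * (b 0 + b 1) / M)) := by
    have hm := (abs_le.mp (abs_sum_vonMangoldt_div_sub_log_le hN)).2
    calc _ ≤ ∑ d ∈ Ioc 0 N, Λ d / d * (K * (5 * (b 0 + b 1) / M)) := by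
          refine norm_sum_le_of_le _ fun d hd => ?_
          have h0 : 0 ≤ Λ d / d := div_nonneg vonMangoldt_nonneg (Nat.cast_nonneg _)
          rw [norm_mul, norm_mul, Complex.norm_real, Real.norm_eq_abs, abs_of_nonneg h0]
          refine mul_le_mul ?_ (htailb d hd) (norm_nonneg _) h0
          exact mul_le_of_le_one_right h0 (norm_ev_le z d)
      _ ≤ _ := by
          rw [← Finset.sum_mul]
          gcongr
          linarith
  have h3 : ‖∑ m ∈ Ioc 0 M, ev z m / m * E m‖ ≤ (1 + Real.log M) * (Real.log M / L) * S := by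
    have hS' : 0 ≤ Real.log M / L * S :=
      mul_nonneg (div_nonneg (Real.log_natCast_nonneg _) hL0.le) hS0
    calc _ ≤ ∑ m ∈ Ioc 0 M, 1 / (m : ℝ) * (Real.log M / L * S) := by
          refine norm_sum_le_of_le _ fun m hm => ?_
          rw [norm_mul, norm_div, Complex.norm_natCast]
          have := norm_ev_le z m
          have := hE1 m hm
          gcongr
      _ ≤ _ := by
          rw [← Finset.sum_mul, mul_assoc]
          gcongr
          exact sum_Ioc_one_div_le M
  rw [hmain]
  calc _ ≤ K * (5 * ((b 0 + b 1) * L) / M) + (L + 6) * (K * (5 * (b 0 + b 1) / M)) +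
        (1 + Real.log M) * (Real.log M / L) * S :=
        (norm_sub_le _ _).trans (add_le_add ((norm_sub_le _ _).trans (add_le_add h1 h2)) h3)
    _ = _ := by ring

/-- Sums over primes twisted by a character whose `L`-function is not small at `1`. -/
theorem exists_norm_wsum_vonMangoldt_le (t : ℕ) : ∀ α > 0, ∀ b : ℕ → ℝ, ∃ C ℓ₀ : ℝ,
    ∀ (N M : ℕ) (ℓ K : ℝ) (z : Chars), ℓ₀ ≤ ℓ → Real.log N = ℓ ^ 4 → BoundedSums (ev z) K →
      1 ≤ M → (1 + Real.log M) ^ 2 ≤ ℓ → K * ℓ ^ (t + 2) ≤ M → 1 ≤ 2 * ℓ ^ 2 * ‖partialL z M‖ →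
      ∀ g, IsSmooth g α b →
        ‖wsum (⇑(Λ : ArithmeticFunction ℝ)) g N z‖ * ℓ ^ t ≤ C * ℓ ^ 4 := by
  induction t with
  | zero =>
    intro α _ b
    refine ⟨7 * |b 0|, 1, fun N M ℓ K z hℓ hN _ _ _ _ _ g hg => ?_⟩
    have hN1 : 1 ≤ N := by
      rcases Nat.eq_zero_or_pos N with rfl | h
      · simp at hN; nlinarith [pow_pos (show 0 < ℓ by linarith) 4]
      · exact h
    have h1 : 1 ≤ ℓ ^ 4 := one_le_pow₀ hℓ
    have := norm_wsum_vonMangoldt_le hg.abs_le hN1 z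
    rw [abs_of_nonneg (hg.nonneg 0), pow_zero, mul_one]
    rw [hN] at this
    nlinarith [hg.nonneg 0]
  | succ t ih =>
    intro α hα b
    obtain ⟨C, ℓ₀, h⟩ := ih (α / 2) (by positivity) (fun i => b (i + 1))
    refine ⟨80 * (|b 0| + |b 1|) + 2 * |C|, max ℓ₀ (max 1 (2 / α)),
      fun N M ℓ K z hℓ hN hψ hM hMℓ hK hc g hg => ?_⟩
    obtain ⟨hℓ0, hℓ'⟩ := max_le_iff.mp hℓ
    obtain ⟨hℓ1, hℓα⟩ := max_le_iff.mp hℓ'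
    have hb0 := hg.nonneg 0
    have hb1 := hg.nonneg 1
    have hK0 := hψ.nonneg
    have hM' : (1 : ℝ) ≤ M := by exact_mod_cast hM
    have hlM : 0 ≤ Real.log M := Real.log_nonneg hM'
    have h4 : ℓ ^ 2 ≤ ℓ ^ 4 := pow_le_pow_right₀ hℓ1 (by norm_num)
    have h1 : 1 ≤ ℓ ^ 4 := one_le_pow₀ hℓ1
    have hlMℓ : Real.log M ≤ ℓ := by nlinarith
    have hKt : K * ℓ ^ (t + 2) ≤ M := le_trans (by
      gcongr 2
      omega) hK
    have hS : ∀ g', IsSmooth g' (α / 2) (fun i => b (i + 1)) →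
        ‖wsum (⇑(Λ : ArithmeticFunction ℝ)) g' N z‖ ≤ |C| * ℓ ^ 4 / ℓ ^ t := by
      intro g' hg'
      rw [le_div_iff₀ (by positivity)]
      refine (h N M ℓ K z hℓ0 hN hψ hM hMℓ hKt hc g' hg').trans ?_
      gcongr; exact le_abs_self C
    have hMN : M ≤ N := by
      have hN0 : 0 < N := by
        rcases Nat.eq_zero_or_pos N with rfl | h
        · simp at hN; nlinarith [pow_pos (show 0 < ℓ by linarith) 4]
        · exact h
      have : Real.log M ≤ Real.log N := by rw [hN]; nlinarith
      exact_mod_cast (Real.log_le_log_iff (by linarith) (by exact_mod_cast hN0)).mp this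
    have h2 := norm_partialL_mul_wsum_le hg hα.le hψ hM hMN (by rwa [hN]) (by
      rw [hN]
      rw [div_le_iff₀ hα] at hℓα
      nlinarith [mul_pos hα (show (0:ℝ) < ℓ by linarith)]) hS (by positivity)
    set T := ‖wsum (⇑(Λ : ArithmeticFunction ℝ)) g N z‖
    have hT : T ≤ 2 * ℓ ^ 2 * ‖partialL z M * wsum (⇑(Λ : ArithmeticFunction ℝ)) g N z‖ := by
      rw [norm_mul, ← mul_assoc]
      exact le_mul_of_one_le_left (norm_nonneg _) hc
    rw [abs_of_nonneg hb0, abs_of_nonneg hb1]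
    have h3 : K * (5 * ((b 0 + b 1) * (2 * Real.log N + 6)) / M) * ℓ ^ (t + 3) ≤
        40 * (b 0 + b 1) * ℓ ^ 4 := by
      calc _ = (K * ℓ ^ (t + 3) / M) * (5 * ((b 0 + b 1) * (2 * ℓ ^ 4 + 6))) := by
            rw [hN]; ring
        _ ≤ 1 * (5 * ((b 0 + b 1) * (2 * ℓ ^ 4 + 6 * ℓ ^ 4))) := by
            gcongr
            · rw [div_le_one (by linarith)]; exact hK
            · linarith
        _ = _ := by ring
    have h5 : (1 + Real.log M) * (Real.log M / Real.log N) * (|C| * ℓ ^ 4 / ℓ ^ t) * ℓ ^ (t + 3) ≤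
        |C| * ℓ ^ 4 := by
      have : (1 + Real.log M) * Real.log M ≤ ℓ := by nlinarith
      calc _ = (1 + Real.log M) * Real.log M * |C| * ℓ ^ 3 := by
            rw [hN, pow_add]; field_simp
        _ ≤ ℓ * |C| * ℓ ^ 3 := by gcongr
        _ = _ := by ring
    calc T * ℓ ^ (t + 1) ≤ 2 * ℓ ^ 2 * (K * (5 * ((b 0 + b 1) * (2 * Real.log N + 6)) / M) +
        (1 + Real.log M) * (Real.log M / Real.log N) * (|C| * ℓ ^ 4 / ℓ ^ t)) * ℓ ^ (t + 1) := by
          gcongr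
          exact hT.trans (by gcongr)
      _ = 2 * (K * (5 * ((b 0 + b 1) * (2 * Real.log N + 6)) / M) * ℓ ^ (t + 3) +
        (1 + Real.log M) * (Real.log M / Real.log N) * (|C| * ℓ ^ 4 / ℓ ^ t) * ℓ ^ (t + 3)) := by
          ring
      _ ≤ 2 * (40 * (b 0 + b 1) * ℓ ^ 4 + |C| * ℓ ^ 4) := by gcongr
      _ = _ := by ring

end PrimeGapRuns

namespace PrimeGapRuns

open Finset Filter Topology

/-- Partial sums of `ψ (n) n⁻¹⁻ˣ`. -/
lemma hasSum_LSeries_real {ψ : ℕ → ℂ} (h1 : ∀ n, ‖ψ n‖ ≤ 1) {x : ℝ} (hx : 0 < x) :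
    Tendsto (fun N : ℕ => ∑ n ∈ Ioc 0 N, ψ n * (((n : ℝ) ^ (-(1 + x)) : ℝ) : ℂ)) atTop
      (𝓝 (LSeries ψ (1 + x))) := by
  have hs : LSeriesSummable ψ (1 + x) :=
    LSeriesSummable_of_bounded_of_one_lt_re (m := 1) (fun n _ => h1 n) (by simpa using hx)
  have h := (hs.LSeriesHasSum.tendsto_sum_nat).comp (tendsto_add_atTop_nat 1)
  refine h.congr fun N => ?_
  have e : range (N + 1) = insert 0 (Ioc 0 N) := by
    ext n; simp only [mem_range, mem_insert, mem_Ioc]; omega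
  rw [Function.comp_apply, e, Finset.sum_insert (by simp), LSeries.term_zero, zero_add]
  refine Finset.sum_congr rfl fun n hn => ?_
  have hn0 : n ≠ 0 := by rw [Finset.mem_Ioc] at hn; omega
  rw [LSeries.term_of_ne_zero hn0, div_eq_mul_inv, Complex.ofReal_cpow (Nat.cast_nonneg n)]
  push_cast
  rw [Complex.cpow_neg]

lemma sum_rpow_le {x : ℝ} (hx : 0 < x) (N : ℕ) :
    ∑ n ∈ Ioc 0 N, (n : ℝ) ^ (-(1 + x)) ≤ 1 + 1 / x := by
  suffices h : ∀ N : ℕ, ∑ n ∈ Ioc 0 (N + 1), (n : ℝ) ^ (-(1 + x)) ≤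
      1 + 1 / x - 1 / x * ((N + 1 : ℕ) : ℝ) ^ (-x) by
    rcases N with _ | N
    · simp; positivity
    · have h2 : (0 : ℝ) ≤ ((N + 1 : ℕ) : ℝ) ^ (-x) := by positivity
      refine (h N).trans (sub_le_self _ (by positivity))
  intro N
  induction N with
  | zero => simp
  | succ N ih =>
    rw [Finset.sum_Ioc_succ_top (by omega)]
    have hN1 : (0 : ℝ) < ((N + 1 : ℕ) : ℝ) := by positivity
    have hN2 : (0 : ℝ) < ((N + 1 + 1 : ℕ) : ℝ) := by positivity
    set a := ((N + 1 : ℕ) : ℝ) with ha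
    set c := ((N + 1 + 1 : ℕ) : ℝ) with hc
    have hca : c = a + 1 := by rw [hc, ha]; push_cast; ring
    have key : c ^ (-x) * (1 + x / c) ≤ a ^ (-x) := by
      have h1 : 1 + x / c ≤ (c / a) ^ x := by
        rw [Real.rpow_def_of_pos (by positivity)]
        refine le_trans ?_ (Real.add_one_le_exp _)
        have := Real.one_sub_inv_le_log_of_pos (show 0 < c / a by positivity)
        have h3 : 1 - (c / a)⁻¹ = 1 / c := by rw [hca]; field_simp; ring
        rw [h3] at this
        have : 1 / c * x ≤ Real.log (c / a) * x := by gcongr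
        have e : x / c = 1 / c * x := by ring
        linarith
      calc _ ≤ c ^ (-x) * (c / a) ^ x := by gcongr
        _ = a ^ (-x) := by
          rw [Real.div_rpow hN2.le hN1.le, Real.rpow_neg hN2.le, Real.rpow_neg hN1.le]
          have : c ^ x ≠ 0 := (Real.rpow_pos_of_pos hN2 x).ne'
          field_simp
    have h2 : c ^ (-(1 + x)) = c ^ (-x) / c := by
      rw [neg_add, add_comm, Real.rpow_add hN2, Real.rpow_neg_one]; rfl
    rw [h2]
    have h3 : 1 / x * c ^ (-x) + c ^ (-x) / c = 1 / x * (c ^ (-x) * (1 + x / c)) := by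
      field_simp
    have h4 : 1 / x * (c ^ (-x) * (1 + x / c)) ≤ 1 / x * a ^ (-x) := by gcongr
    linarith

lemma norm_LSeries_le {ψ : ℕ → ℂ} (h1 : ∀ n, ‖ψ n‖ ≤ 1) {x : ℝ} (hx : 0 < x) :
    ‖LSeries ψ (1 + x)‖ ≤ 1 + 1 / x := by
  refine le_of_tendsto (hasSum_LSeries_real h1 hx).norm (Eventually.of_forall fun N => ?_)
  refine (norm_sum_le_of_le _ fun n _ => ?_).trans (sum_rpow_le hx N)
  have h0 : (0 : ℝ) ≤ (n : ℝ) ^ (-(1 + x)) := by positivity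
  rw [norm_mul, Complex.norm_real, Real.norm_eq_abs, abs_of_nonneg h0]
  exact mul_le_of_le_one_left h0 (h1 n)

lemma norm_LSeries_sub_le {ψ : ℕ → ℂ} (h1 : ∀ n, ‖ψ n‖ ≤ 1) {K : ℝ} (hψ : BoundedSums ψ K)
    {x : ℝ} (hx : 0 < x) {M : ℕ} (hM : 1 ≤ M) :
    ‖LSeries ψ (1 + x) - ∑ m ∈ Ioc 0 M, ψ m / m‖ ≤ x * (1 + Real.log M) ^ 2 + K / M := by
  have hK := hψ.nonneg
  have hM0 : (0 : ℝ) < M := by exact_mod_cast hM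
  refine le_of_tendsto ((hasSum_LSeries_real h1 hx).sub_const _).norm
    ((eventually_ge_atTop M).mono fun N hN => ?_)
  have hu : Ioc 0 N = Ioc 0 M ∪ Ico (M + 1) (N + 1) := by
    ext n; simp only [mem_union, mem_Ioc, mem_Ico]; omega
  have hdis : Disjoint (Ioc 0 M) (Ico (M + 1) (N + 1)) := by
    rw [Finset.disjoint_left]; intro n; simp only [mem_Ioc, mem_Ico]; omega
  rw [hu, Finset.sum_union hdis, add_sub_right_comm, ← Finset.sum_sub_distrib]
  refine (norm_add_le _ _).trans (add_le_add ?_ ?_)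
  · calc _ ≤ ∑ n ∈ Ioc 0 M, 1 / (n : ℝ) * (x * Real.log M) := by
          refine norm_sum_le_of_le _ fun n hn => ?_
          obtain ⟨hn1, hn2⟩ := Finset.mem_Ioc.mp hn
          have hn0 : (0 : ℝ) < n := by exact_mod_cast hn1
          have e : ψ n * (((n : ℝ) ^ (-(1 + x)) : ℝ) : ℂ) - ψ n / n =
              ψ n * (((n : ℝ) ^ (-(1 + x)) - 1 / n : ℝ) : ℂ) := by push_cast; ring
          rw [e, norm_mul, Complex.norm_real, Real.norm_eq_abs]
          have h2 : (n : ℝ) ^ (-(1 + x)) = 1 / n * (n : ℝ) ^ (-x) := by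
            rw [neg_add, Real.rpow_add hn0, Real.rpow_neg_one, one_div]
          have h3 : (n : ℝ) ^ (-x) ≤ 1 :=
            Real.rpow_le_one_of_one_le_of_nonpos (by exact_mod_cast hn1) (by linarith)
          have h4 : 1 - x * Real.log n ≤ (n : ℝ) ^ (-x) := by
            rw [Real.rpow_def_of_pos hn0]
            have := Real.add_one_le_exp (Real.log n * -x)
            linarith
          have h5 : Real.log n ≤ Real.log M := Real.log_le_log hn0 (by exact_mod_cast hn2)
          have h6 : |(n : ℝ) ^ (-(1 + x)) - 1 / n| ≤ 1 / n * (x * Real.log M) := by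
            rw [h2, show 1 / (n : ℝ) * (n : ℝ) ^ (-x) - 1 / n = 1 / n * ((n : ℝ) ^ (-x) - 1) by ring,
              abs_mul, abs_of_pos (by positivity : (0 : ℝ) < 1 / n), abs_of_nonpos (by linarith)]
            gcongr
            nlinarith
          calc _ ≤ 1 * |(n : ℝ) ^ (-(1 + x)) - 1 / n| := by gcongr; exact h1 n
            _ ≤ _ := by rw [one_mul]; exact h6
      _ ≤ (1 + Real.log M) * (x * Real.log M) := by
          rw [← Finset.sum_mul]
          have : 0 ≤ Real.log M := Real.log_natCast_nonneg M
          gcongr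
          exact sum_Ioc_one_div_le M
      _ ≤ _ := by
          have : 0 ≤ Real.log M := Real.log_natCast_nonneg M
          nlinarith [mul_nonneg hx.le this]
  · set F : ℕ → ℝ := fun n => (n : ℝ) ^ (-(1 + x)) with hF
    have hF0 : ∀ n, 0 ≤ F n := fun n => by positivity
    have hab : M + 1 ≤ N + 1 := by omega
    have hmono : ∀ n ∈ Ico (M + 1) (N + 1), |F (n + 1) - F n| = -(F (n + 1) - F n) := by
      intro n hn
      rw [Finset.mem_Ico] at hn
      refine abs_of_nonpos (sub_nonpos.mpr ?_)
      have : (0 : ℝ) < n := by exact_mod_cast (by omega : 0 < n)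
      exact Real.rpow_le_rpow_of_nonpos this (by push_cast; linarith) (by linarith)
    refine (norm_sum_mul_le_variation hψ F hab).trans ?_
    rw [Finset.sum_congr rfl hmono, Finset.sum_neg_distrib, Finset.sum_Ico_sub F hab,
      abs_of_nonneg (hF0 _)]
    have h7 : F (M + 1) ≤ 1 / M := by
      have hM1 : (1 : ℝ) ≤ ((M + 1 : ℕ) : ℝ) := by push_cast; linarith
      calc F (M + 1) ≤ ((M + 1 : ℕ) : ℝ) ^ (-1 : ℝ) :=
            Real.rpow_le_rpow_of_exponent_le hM1 (by linarith)
        _ = 1 / ((M + 1 : ℕ) : ℝ) := by rw [Real.rpow_neg_one, one_div]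
        _ ≤ _ := by
            apply one_div_le_one_div_of_le hM0; push_cast; linarith
    calc K * (F (N + 1) + -(F (N + 1) - F (M + 1))) = K * F (M + 1) := by ring
      _ ≤ K * (1 / M) := by gcongr
      _ = _ := by ring

/-- Euler product for a bounded completely multiplicative function. -/
lemma hasProd_LSeries {ψ : ℕ → ℂ} (h1 : ψ 1 = 1)
    (hmul : ∀ m n, ψ (m * n) = ψ m * ψ n) (hb : ∀ n, ‖ψ n‖ ≤ 1) {x : ℝ} (hx : 0 < x) :
    HasProd (fun p : Nat.Primes => (1 - ψ p * (((p : ℝ) ^ (-(1 + x)) : ℝ) : ℂ))⁻¹)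
      (LSeries ψ (1 + x)) := by
  let f : ℕ →*₀ ℂ :=
    { toFun := fun n => ψ n * (((n : ℝ) ^ (-(1 + x)) : ℝ) : ℂ)
      map_zero' := by
        rw [Nat.cast_zero, Real.zero_rpow (by linarith), Complex.ofReal_zero, mul_zero]
      map_one' := by simp [h1]
      map_mul' := fun m n => by
        rw [hmul]; push_cast [Real.mul_rpow (Nat.cast_nonneg m) (Nat.cast_nonneg n)]; ring }
  have hs : LSeriesSummable ψ (1 + x) :=
    LSeriesSummable_of_bounded_of_one_lt_re (m := 1) (fun n _ => hb n) (by simpa using hx)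
  have hf : ∀ n, LSeries.term ψ (1 + x) n = f n := by
    intro n
    rcases eq_or_ne n 0 with rfl | hn
    · simp
    · rw [LSeries.term_of_ne_zero hn]
      change _ = ψ n * (((n : ℝ) ^ (-(1 + x)) : ℝ) : ℂ)
      rw [div_eq_mul_inv, Complex.ofReal_cpow (Nat.cast_nonneg n)]
      push_cast
      rw [Complex.cpow_neg]
  have hs' : Summable fun n => ‖f n‖ := by
    have := hs.norm
    simpa only [hf] using this
  have := EulerProduct.eulerProduct_completely_multiplicative_hasProd hs'
  rw [LSeries, tsum_congr hf]
  exact this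

lemma one_le_norm_LSeries_pair {ψ₁ ψ₂ : ℕ → ℂ} (h₁ : ψ₁ 1 = 1) (h₂ : ψ₂ 1 = 1)
    (hm₁ : ∀ m n, ψ₁ (m * n) = ψ₁ m * ψ₁ n) (hm₂ : ∀ m n, ψ₂ (m * n) = ψ₂ m * ψ₂ n)
    (hr₁ : ∀ n, ψ₁ n = 0 ∨ ψ₁ n = 1 ∨ ψ₁ n = -1) (hr₂ : ∀ n, ψ₂ n = 0 ∨ ψ₂ n = 1 ∨ ψ₂ n = -1)
    {x : ℝ} (hx : 0 < x) :
    1 ≤ ‖LSeries (fun _ => 1) (1 + x)‖ * ‖LSeries ψ₁ (1 + x)‖ * ‖LSeries ψ₂ (1 + x)‖ *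
      ‖LSeries (fun n => ψ₁ n * ψ₂ n) (1 + x)‖ := by
  have hb₁ : ∀ n, ‖ψ₁ n‖ ≤ 1 := fun n => by rcases hr₁ n with h | h | h <;> simp [h]
  have hb₂ : ∀ n, ‖ψ₂ n‖ ≤ 1 := fun n => by rcases hr₂ n with h | h | h <;> simp [h]
  have p0 := hasProd_LSeries (ψ := fun _ => 1) rfl (fun _ _ => (one_mul 1).symm) (by simp) hx
  have p1 := hasProd_LSeries h₁ hm₁ hb₁ hx
  have p2 := hasProd_LSeries h₂ hm₂ hb₂ hx
  have p3 := hasProd_LSeries (ψ := fun n => ψ₁ n * ψ₂ n) (by rw [h₁, h₂, one_mul])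
    (fun m n => by rw [hm₁, hm₂]; ring)
    (fun n => by rw [norm_mul]; exact mul_le_one₀ (hb₁ n) (norm_nonneg _) (hb₂ n)) hx
  have hp := (((p0.mul p1).mul p2).mul p3).norm
  rw [norm_mul, norm_mul, norm_mul] at hp
  refine ge_of_tendsto hp (Eventually.of_forall fun s => ?_)
  refine (Finset.prod_const_one (s := s)).symm.le.trans
    (Finset.prod_le_prod (fun _ _ => zero_le_one) fun p _ => ?_)
  set u : ℝ := (p : ℝ) ^ (-(1 + x)) with hu
  have hp1 : (1 : ℝ) < p := by exact_mod_cast p.2.one_lt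
  have hu0 : 0 < u := by positivity
  have hu1 : u < 1 := Real.rpow_lt_one_of_one_lt_of_neg hp1 (by linarith)
  have key : ∀ a b : ℝ, (a = 0 ∨ a = 1 ∨ a = -1) → (b = 0 ∨ b = 1 ∨ b = -1) →
      1 ≤ ‖(1 - 1 * (u : ℂ))⁻¹ * (1 - (a : ℂ) * u)⁻¹ * (1 - (b : ℂ) * u)⁻¹ *
        (1 - (a : ℂ) * b * u)⁻¹‖ := by
    intro a b ha hb
    have e : (1 - 1 * (u : ℂ))⁻¹ * (1 - (a : ℂ) * u)⁻¹ * (1 - (b : ℂ) * u)⁻¹ *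
        (1 - (a : ℂ) * b * u)⁻¹ =
        ((((1 - u) * (1 - a * u) * (1 - b * u) * (1 - a * b * u))⁻¹ : ℝ) : ℂ) := by
      push_cast; rw [mul_inv, mul_inv, mul_inv, one_mul]
    have hpos : 0 < (1 - u) * (1 - a * u) * (1 - b * u) * (1 - a * b * u) := by
      have h1 : 0 < 1 - u := by linarith
      have h2 : 0 < 1 - a * u := by rcases ha with rfl | rfl | rfl <;> linarith
      have h3 : 0 < 1 - b * u := by rcases hb with rfl | rfl | rfl <;> linarith
      have h4 : 0 < 1 - a * b * u := by
        rcases ha with rfl | rfl | rfl <;> rcases hb with rfl | rfl | rfl <;> linarith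
      positivity
    rw [e, Complex.norm_real, Real.norm_eq_abs, abs_of_pos (inv_pos.mpr hpos)]
    refine (one_le_inv₀ hpos).mpr ?_
    have h5 : (1 - u) * (1 + u) ≤ 1 := by nlinarith
    have h6 : 0 ≤ (1 - u) * (1 + u) := by nlinarith
    have h7 : (1 - u) * (1 - u) ≤ 1 := by nlinarith
    have h8 : 0 ≤ (1 - u) * (1 - u) := by nlinarith
    rcases ha with rfl | rfl | rfl <;> rcases hb with rfl | rfl | rfl <;> nlinarith
  have lift : ∀ w : ℂ, (w = 0 ∨ w = 1 ∨ w = -1) → ∃ a : ℝ, (a = 0 ∨ a = 1 ∨ a = -1) ∧ w = a := by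
    rintro w (rfl | rfl | rfl)
    · exact ⟨0, by simp, by simp⟩
    · exact ⟨1, by simp, by simp⟩
    · exact ⟨-1, by simp, by simp⟩
  obtain ⟨a, ha, ea⟩ := lift _ (hr₁ p)
  obtain ⟨b, hb, eb⟩ := lift _ (hr₂ p)
  rw [ea, eb]
  exact key a b ha hb

section Exceptional

variable {z : Chars} {M : ℕ} {ℓ K : ℝ}

lemma norm_LSeries_le_of_bad (hψ : BoundedSums (ev z) K) (hM : 1 ≤ M) (hℓ : 1 ≤ ℓ)
    (hK : 2 * K * ℓ ^ 2 ≤ M) (hbad : 2 * ℓ ^ 2 * ‖partialL z M‖ < 1) :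
    ‖LSeries (ev z) (1 + ((ℓ ^ 2)⁻¹ : ℝ))‖ ≤ 2 * (1 + Real.log M) ^ 2 * (ℓ ^ 2)⁻¹ := by
  have hℓ2 : 0 < ℓ ^ 2 := by positivity
  have hM0 : (0 : ℝ) < M := by exact_mod_cast hM
  have hlM : 0 ≤ Real.log M := Real.log_natCast_nonneg M
  have h := norm_LSeries_sub_le (norm_ev_le z) hψ (inv_pos.mpr hℓ2) hM
  have h1 := norm_sub_norm_le (LSeries (ev z) (1 + ((ℓ ^ 2)⁻¹ : ℝ))) (∑ m ∈ Ioc 0 M, ev z m / m)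
  have h2 : ‖partialL z M‖ ≤ 1 / 2 * (ℓ ^ 2)⁻¹ := by
    rw [← div_eq_mul_inv, le_div_iff₀ hℓ2]; linarith
  have h3 : K / M ≤ 1 / 2 * (ℓ ^ 2)⁻¹ := by
    rw [← div_eq_mul_inv, div_le_div_iff₀ hM0 hℓ2]; linarith
  have h4 : 1 ≤ (1 + Real.log M) ^ 2 := one_le_pow₀ (by linarith)
  rw [partialL] at h2
  have h5 : 0 < (ℓ ^ 2)⁻¹ := by positivity
  nlinarith

lemma norm_LSeries_le_of_boundedSums {ψ : ℕ → ℂ} (hb : ∀ n, ‖ψ n‖ ≤ 1) (hψ : BoundedSums ψ K)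
    (hM : 1 ≤ M) (hℓ : 1 ≤ ℓ) (hK : K ≤ M) :
    ‖LSeries ψ (1 + ((ℓ ^ 2)⁻¹ : ℝ))‖ ≤ 3 * (1 + Real.log M) ^ 2 := by
  have hℓ2 : 1 ≤ ℓ ^ 2 := one_le_pow₀ hℓ
  have hM0 : (0 : ℝ) < M := by exact_mod_cast hM
  have hlM : 0 ≤ Real.log M := Real.log_natCast_nonneg M
  have h := norm_LSeries_sub_le hb hψ (inv_pos.mpr (by linarith : 0 < ℓ ^ 2)) hM
  have h1 := norm_sub_norm_le (LSeries ψ (1 + ((ℓ ^ 2)⁻¹ : ℝ))) (∑ m ∈ Ioc 0 M, ψ m / m)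
  have h2 : ‖∑ m ∈ Ioc 0 M, ψ m / m‖ ≤ 1 + Real.log M := by
    refine (norm_sum_le_of_le _ fun m _ => ?_).trans (sum_Ioc_one_div_le M)
    rw [norm_div, Complex.norm_natCast]
    gcongr; exact hb m
  have h3 : K / M ≤ 1 := by rwa [div_le_one hM0]
  have h4 : (ℓ ^ 2)⁻¹ ≤ 1 := inv_le_one_of_one_le₀ hℓ2
  have h5 : (ℓ ^ 2)⁻¹ * (1 + Real.log M) ^ 2 ≤ 1 * (1 + Real.log M) ^ 2 := by gcongr
  nlinarith

lemma norm_LSeries_le_inv {ψ : ℕ → ℂ} (hb : ∀ n, ‖ψ n‖ ≤ 1) (hℓ : 1 ≤ ℓ) :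
    ‖LSeries ψ (1 + ((ℓ ^ 2)⁻¹ : ℝ))‖ ≤ 2 * ℓ ^ 2 := by
  have hℓ2 : 1 ≤ ℓ ^ 2 := one_le_pow₀ hℓ
  have := norm_LSeries_le hb (inv_pos.mpr (by linarith : 0 < ℓ ^ 2))
  rw [one_div, inv_inv] at this
  linarith

lemma sq_eq_one_of_bad (hz : 1 < z.1) (hz1 : z.2 ≠ 1) (hM : 1 ≤ M) (hℓ : 1 ≤ ℓ)
    (hK : 2 * z.1 * ℓ ^ 2 ≤ M) (hMℓ : 400 * (1 + Real.log M) ^ 10 < ℓ ^ 2)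
    (hbad : 2 * ℓ ^ 2 * ‖partialL z M‖ < 1) : z.2 ^ 2 = 1 := by
  by_contra hne
  have : NeZero z.1 := ⟨by omega⟩
  have hℓ2 : 1 ≤ ℓ ^ 2 := one_le_pow₀ hℓ
  have hx : 0 < (ℓ ^ 2)⁻¹ := by positivity
  have h1 := norm_LSeries_le_of_bad (boundedSums_of_ne_one hz1) hM hℓ hK hbad
  have h2 := norm_LSeries_le_of_boundedSums (ψ := fun n => (z.2 ^ 2) (n : ZMod z.1)) (ℓ := ℓ)
    (fun n => (z.2 ^ 2).norm_le_one _) (boundedSums_of_ne_one hne) hM hℓ (by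
      have : (0 : ℝ) ≤ z.1 := by positivity
      nlinarith)
  have h3 := norm_LSeries_le_inv (ψ := fun n => (1 : DirichletCharacter ℂ z.1) (n : ZMod z.1))
    (fun n => (1 : DirichletCharacter ℂ z.1).norm_le_one _) hℓ
  have h := DirichletCharacter.norm_LSeries_product_ge_one z.2 hx 0
  simp only [Complex.ofReal_zero, mul_zero, add_zero, norm_mul, norm_pow] at h
  set lam := (1 + Real.log M) ^ 2
  have h4 : ‖LSeries (fun n => (1 : DirichletCharacter ℂ z.1) (n : ZMod z.1))
      (1 + ((ℓ ^ 2)⁻¹ : ℝ))‖ ^ 3 * ‖LSeries (fun n => z.2 (n : ZMod z.1))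
      (1 + ((ℓ ^ 2)⁻¹ : ℝ))‖ ^ 4 * ‖LSeries (fun n => (z.2 ^ 2) (n : ZMod z.1))
      (1 + ((ℓ ^ 2)⁻¹ : ℝ))‖ ≤ (2 * ℓ ^ 2) ^ 3 * (2 * lam * (ℓ ^ 2)⁻¹) ^ 4 * (3 * lam) := by
    gcongr
    exact h1
  have h5 : (2 * ℓ ^ 2) ^ 3 * (2 * lam * (ℓ ^ 2)⁻¹) ^ 4 * (3 * lam) = 384 * lam ^ 5 / ℓ ^ 2 := by
    field_simp; ring
  have h6 : 384 * lam ^ 5 / ℓ ^ 2 < 1 := by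
    rw [div_lt_one (by linarith)]
    have : lam ^ 5 = (1 + Real.log M) ^ 10 := by simp only [lam]; ring
    rw [this]
    have : 0 ≤ (1 + Real.log M) ^ 10 := by
      have := Real.log_natCast_nonneg M
      positivity
    linarith
  linarith

lemma ev_eq_of_sq_eq_one (h : z.2 ^ 2 = 1) (n : ℕ) : ev z n = 0 ∨ ev z n = 1 ∨ ev z n = -1 := by
  have e : ev z n ^ 2 = (1 : DirichletCharacter ℂ z.1) (n : ZMod z.1) := by
    rw [ev, ← h, MulChar.pow_apply' _ two_ne_zero]
  by_cases hu : IsUnit (n : ZMod z.1)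
  · rw [MulChar.one_apply hu] at e
    exact Or.inr (sq_eq_sq_iff_eq_or_eq_neg.mp (by rw [e, one_pow]))
  · left; exact MulChar.map_nonunit _ hu

/-- At most one primitive character has a very small value at `1`. -/
theorem eq_of_bad {z' : Chars} (hz : 1 < z.1) (hz' : 1 < z'.1) (hp : z.2.IsPrimitive)
    (hp' : z'.2.IsPrimitive) (hM : 1 ≤ M) (hℓ : 1 ≤ ℓ) (hzK : (z.1 : ℝ) ≤ K) (hzK' : (z'.1 : ℝ) ≤ K)
    (hK : 2 * K ^ 2 * ℓ ^ 2 ≤ M) (hMℓ : 400 * (1 + Real.log M) ^ 10 < ℓ ^ 2)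
    (hbad : 2 * ℓ ^ 2 * ‖partialL z M‖ < 1) (hbad' : 2 * ℓ ^ 2 * ‖partialL z' M‖ < 1) : z = z' := by
  by_contra hne
  have : NeZero z.1 := ⟨by omega⟩
  have : NeZero z'.1 := ⟨by omega⟩
  have hℓ2 : 1 ≤ ℓ ^ 2 := one_le_pow₀ hℓ
  have hx : 0 < (ℓ ^ 2)⁻¹ := by positivity
  have hK1 : 1 ≤ K := le_trans (by exact_mod_cast hz.le) hzK
  have hKK : K ≤ K ^ 2 := by nlinarith
  have ne_one : ∀ w : Chars, 1 < w.1 → w.2.IsPrimitive → w.2 ≠ 1 := by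
    intro w hw hwp h
    have : NeZero w.1 := ⟨by omega⟩
    have h1 := DirichletCharacter.eq_one_iff_conductor_eq_one.mp h
    have h2 : w.2.conductor = w.1 := hwp
    omega
  have hbd : ∀ w : Chars, (w.1 : ℝ) ≤ K → 2 * (w.1 : ℝ) * ℓ ^ 2 ≤ M := by
    intro w hw
    refine le_trans ?_ hK
    gcongr
    exact hw.trans hKK
  have hs := sq_eq_one_of_bad hz (ne_one z hz hp) hM hℓ (hbd z hzK) hMℓ hbad
  have hs' := sq_eq_one_of_bad hz' (ne_one z' hz' hp') hM hℓ (hbd z' hzK') hMℓ hbad'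
  have h1 := norm_LSeries_le_of_bad (boundedSums_of_ne_one (ne_one z hz hp)) hM hℓ (hbd z hzK) hbad
  have h2 := norm_LSeries_le_of_bad (boundedSums_of_ne_one (ne_one z' hz' hp')) hM hℓ
    (hbd z' hzK') hbad'
  have hprod : BoundedSums (fun n => ev z n * ev z' n) ((z.1 * z'.1 : ℕ) : ℝ) := by
    have := boundedSums_mul_conj hp hp' hne
    refine Eq.mp ?_ this
    congr 1
    funext n
    change ev z n * starRingEnd ℂ (ev z' n) = ev z n * ev z' n
    congr 1
    rcases ev_eq_of_sq_eq_one hs' n with h | h | h <;> simp [h]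
  have h3 := norm_LSeries_le_of_boundedSums (ℓ := ℓ) (fun n => by
    rw [norm_mul]; exact mul_le_one₀ (norm_ev_le z n) (norm_nonneg _) (norm_ev_le z' n))
    hprod hM hℓ (by
      push_cast
      calc (z.1 : ℝ) * z'.1 ≤ K * K := by gcongr
        _ ≤ 2 * K ^ 2 * ℓ ^ 2 := by nlinarith [sq_nonneg K]
        _ ≤ M := hK)
  have h4 := norm_LSeries_le_inv (ψ := fun _ => 1) (fun _ => by simp) hℓ
  have h := one_le_norm_LSeries_pair (ψ₁ := ev z) (ψ₂ := ev z') (by simp [ev]) (by simp [ev])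
    (ev_mul z) (ev_mul z') (ev_eq_of_sq_eq_one hs) (ev_eq_of_sq_eq_one hs') hx
  set lam := (1 + Real.log M) ^ 2 with hlam
  have hlM := Real.log_natCast_nonneg M
  have hlam1 : 1 ≤ lam := one_le_pow₀ (by linarith)
  have h5 := h.trans (mul_le_mul (mul_le_mul (mul_le_mul h4 h1 (norm_nonneg _) (by positivity)) h2
    (norm_nonneg _) (by positivity)) h3 (norm_nonneg _) (by positivity))
  have h6 : 2 * ℓ ^ 2 * (2 * lam * (ℓ ^ 2)⁻¹) * (2 * lam * (ℓ ^ 2)⁻¹) * (3 * lam) =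
      24 * lam ^ 3 / ℓ ^ 2 := by field_simp; ring
  have h7 : 24 * lam ^ 3 / ℓ ^ 2 < 1 := by
    rw [div_lt_one (by linarith)]
    have e : lam ^ 5 = (1 + Real.log M) ^ 10 := by simp only [lam]; ring
    have : lam ^ 3 ≤ lam ^ 5 := pow_le_pow_right₀ hlam1 (by norm_num)
    rw [← e] at hMℓ
    have : 0 < lam ^ 5 := by positivity
    linarith
  linarith

lemma norm_LFunction_one_sub_partialL_le (hz : 1 < z.1) (hz1 : z.2 ≠ 1) (hM : 1 ≤ M)
    [NeZero z.1] : ‖z.2.LFunction 1 - partialL z M‖ ≤ z.1 / M := by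
  have hc : Continuous z.2.LFunction := (DirichletCharacter.differentiable_LFunction hz1).continuous
  have h1 : Tendsto (fun x : ℝ => ‖z.2.LFunction (1 + x) - partialL z M‖) (𝓝[>] 0)
      (𝓝 ‖z.2.LFunction (1 + (0 : ℝ)) - partialL z M‖) :=
    Continuous.tendsto (by fun_prop) 0 |>.mono_left nhdsWithin_le_nhds
  have h2 : Tendsto (fun x : ℝ => x * (1 + Real.log M) ^ 2 + z.1 / M) (𝓝[>] 0)
      (𝓝 (0 * (1 + Real.log M) ^ 2 + z.1 / M)) :=
    Continuous.tendsto (by fun_prop) 0 |>.mono_left nhdsWithin_le_nhds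
  have := le_of_tendsto_of_tendsto h1 h2 (by
    filter_upwards [self_mem_nhdsWithin] with x hx
    rw [DirichletCharacter.LFunction_eq_LSeries _ (by simpa using hx)]
    exact norm_LSeries_sub_le (norm_ev_le z) (boundedSums_of_ne_one hz1) hx hM)
  simpa using this

/-- Characters of bounded modulus are not exceptional. -/
theorem exists_not_bad (W : ℕ) : ∃ M₀ : ℕ, ∃ ℓ₀ : ℝ, ∀ z : Chars, 1 < z.1 → z.1 ≤ W → z.2 ≠ 1 →
    ∀ (M : ℕ) (ℓ : ℝ), M₀ ≤ M → ℓ₀ ≤ ℓ → 1 ≤ 2 * ℓ ^ 2 * ‖partialL z M‖ := by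
  have key : ∀ z : Chars, ∃ M₀ : ℕ, ∃ ℓ₀ : ℝ, 1 < z.1 → z.2 ≠ 1 →
      ∀ (M : ℕ) (ℓ : ℝ), M₀ ≤ M → ℓ₀ ≤ ℓ → 1 ≤ 2 * ℓ ^ 2 * ‖partialL z M‖ := by
    intro z
    by_cases h : 1 < z.1 ∧ z.2 ≠ 1
    · obtain ⟨hz, hz1⟩ := h
      have : NeZero z.1 := ⟨by omega⟩
      set δ := ‖z.2.LFunction 1‖ with hδ
      have hδ0 : 0 < δ := norm_pos_iff.mpr (DirichletCharacter.LFunction_apply_one_ne_zero hz1)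
      obtain ⟨M₀, hM₀⟩ := exists_nat_gt (2 * z.1 / δ)
      refine ⟨max M₀ 1, max 1 (1 / δ), fun _ _ M ℓ hM hℓ => ?_⟩
      obtain ⟨hM1, hM2⟩ := max_le_iff.mp hM
      obtain ⟨hℓ1, hℓ2⟩ := max_le_iff.mp hℓ
      have hM0 : (0 : ℝ) < M := by exact_mod_cast hM2
      have h1 := norm_LFunction_one_sub_partialL_le hz hz1 hM2
      have h2 : (z.1 : ℝ) / M ≤ δ / 2 := by
        have h3 : 2 * z.1 / δ < M := hM₀.trans_le (by exact_mod_cast hM1)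
        rw [div_lt_iff₀ hδ0] at h3
        rw [div_le_div_iff₀ hM0 two_pos]; linarith
      have h3 := norm_sub_norm_le (z.2.LFunction 1) (partialL z M)
      have h4 : δ / 2 ≤ ‖partialL z M‖ := by linarith
      have h5 : 1 ≤ ℓ * δ := by rwa [div_le_iff₀ hδ0] at hℓ2
      have h6 : ℓ * δ ≤ ℓ ^ 2 * δ := by
        have : ℓ ≤ ℓ ^ 2 := by nlinarith
        gcongr
      have h7 : 2 * ℓ ^ 2 * (δ / 2) ≤ 2 * ℓ ^ 2 * ‖partialL z M‖ := by gcongr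
      nlinarith
    · exact ⟨0, 0, fun h1 h2 => absurd ⟨h1, h2⟩ h⟩
  choose M₀ ℓ₀ h using key
  have hfin : {z : Chars | 1 < z.1 ∧ z.1 ≤ W}.Finite := by
    have : {z : Chars | 1 < z.1 ∧ z.1 ≤ W} ⊆
        ⋃ q ∈ Set.Icc 1 W, Set.range (fun χ : DirichletCharacter ℂ q => (⟨q, χ⟩ : Chars)) := by
      rintro ⟨q, χ⟩ ⟨h1, h2⟩
      simp only [Set.mem_iUnion]
      exact ⟨q, ⟨by simp at h1; omega, h2⟩, χ, rfl⟩
    refine Set.Finite.subset ((Set.finite_Icc 1 W).biUnion fun q hq => ?_) this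
    have : NeZero q := ⟨by have := hq.1; omega⟩
    exact Set.finite_range _
  refine ⟨hfin.toFinset.sup M₀, ∑ z ∈ hfin.toFinset, |ℓ₀ z|, fun z hz hzW hz1 M ℓ hM hℓ => ?_⟩
  have hmem : z ∈ hfin.toFinset := by simp [hz, hzW]
  refine h z hz hz1 M ℓ ((Finset.le_sup hmem).trans hM) (le_trans ?_ hℓ)
  exact (le_abs_self _).trans (Finset.single_le_sum (f := fun z => |ℓ₀ z|)
    (fun _ _ => abs_nonneg _) hmem)

end Exceptional

end PrimeGapRuns

namespace PrimeGapRuns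

open Finset ArithmeticFunction Filter

/-- A smooth bump function supported in `[1/2, 1]` and equal to `1` on `[5/8, 7/8]`. -/
noncomputable def bumpFun : ContDiffBump (3 / 4 : ℝ) := ⟨1 / 8, 1 / 4, by norm_num, by norm_num⟩

/-- The underlying function of `bumpFun`. -/
noncomputable def bump (t : ℝ) : ℝ := bumpFun t

lemma bump_nonneg (t : ℝ) : 0 ≤ bump t := bumpFun.nonneg

lemma bump_le_one (t : ℝ) : bump t ≤ 1 := bumpFun.le_one

lemma bump_eq_one {t : ℝ} (h : 5 / 8 ≤ t) (h' : t ≤ 7 / 8) : bump t = 1 := by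
  refine bumpFun.one_of_mem_closedBall ?_
  rw [Metric.mem_closedBall, Real.dist_eq, abs_le]
  simp only [bumpFun]; constructor <;> linarith

lemma bump_eq_zero_of_le {t : ℝ} (h : t ≤ 1 / 2) : bump t = 0 := by
  refine bumpFun.zero_of_le_dist ?_
  rw [Real.dist_eq, abs_of_nonpos (by linarith)]
  simp only [bumpFun]; linarith

lemma bump_eq_zero_of_ge {t : ℝ} (h : 1 ≤ t) : bump t = 0 := by
  refine bumpFun.zero_of_le_dist ?_
  rw [Real.dist_eq, abs_of_nonneg (by linarith)]
  simp only [bumpFun]; linarith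

lemma exists_isSmooth_bump : ∃ b, IsSmooth bump (1 / 2) b := by
  have hc : ∀ n : ℕ, ContDiff ℝ n bump := fun n => bumpFun.contDiff
  have hs : HasCompactSupport bump := bumpFun.hasCompactSupport
  have h : ∀ i : ℕ, ∃ C, ∀ t, |iteratedDeriv i bump t| ≤ C := fun i => by
    obtain ⟨C, hC⟩ := (hs.iteratedFDeriv i (𝕜 := ℝ)).exists_bound_of_continuous
      ((hc i).continuous_iteratedFDeriv le_rfl)
    refine ⟨C, fun t => ?_⟩
    rw [← Real.norm_eq_abs, ← norm_iteratedFDeriv_eq_norm_iteratedDeriv]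
    exact hC t
  choose b hb using h
  exact ⟨b, hc, hb, fun t => bump_eq_zero_of_le, fun t => bump_eq_zero_of_ge⟩

lemma IsSmooth.isTest {g : ℝ → ℝ} {b : ℕ → ℝ} (hg : IsSmooth g (1 / 2) b) :
    IsTest g (max (b 0) (b 1)) :=
  ⟨hg.differentiable, fun t => (hg.abs_le t).trans (le_max_left _ _),
    fun t => (hg.abs_deriv_le t).trans (le_max_right _ _), hg.zero_of_le, hg.zero_of_ge⟩

/-- The logarithm restricted to primes. -/
noncomputable def logPrime (n : ℕ) : ℝ := if n.Prime then Real.log n else 0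

/-- Smoothed and logarithmically averaged character sums over primes. -/
noncomputable def primeSum (R : ℕ) (z : Chars) : ℂ := wsum logPrime bump (R ^ 120) z

lemma exists_norm_wsum_sub_primeSum_le : ∃ C : ℝ, ∀ R : ℕ, 1 ≤ R → ∀ z : Chars,
    ‖primeSum R z‖ ≤ ‖wsum (⇑(Λ : ArithmeticFunction ℝ)) bump (R ^ 120) z‖ + C / R ^ 30 := by
  obtain ⟨C, hC, h⟩ := exists_sum_not_prime_vonMangoldt_le
  refine ⟨C, fun R hR z => ?_⟩
  have hR' : (0 : ℝ) < R := by exact_mod_cast hR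
  have key : ‖wsum (⇑(Λ : ArithmeticFunction ℝ)) bump (R ^ 120) z - primeSum R z‖ ≤ C / R ^ 30 := by
    have h1 := h (R ^ 60) (R ^ 120) (Nat.one_le_pow _ _ hR)
    have h2 : √((R ^ 60 : ℕ) : ℝ) = R ^ 30 := by
      rw [Nat.cast_pow, show (R : ℝ) ^ 60 = (R ^ 30) ^ 2 by ring, Real.sqrt_sq (by positivity)]
    rw [h2] at h1
    refine le_trans ?_ h1
    rw [primeSum, ← wsum_sub, wsum, Finset.sum_filter]
    have hsub : Ioc (R ^ 60) (R ^ 120) ⊆ Ioc 0 (R ^ 120) := Ioc_subset_Ioc_left (Nat.zero_le _)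
    rw [← Finset.sum_subset hsub]
    · refine norm_sum_le_of_le _ fun n hn => ?_
      rw [norm_mul, Complex.norm_real, Real.norm_eq_abs, abs_div, abs_mul, Nat.abs_cast,
        abs_of_nonneg (bump_nonneg _)]
      have h3 := norm_ev_le z n
      have h4 := bump_le_one (Real.log n / Real.log ((R ^ 120 : ℕ) : ℝ))
      have h5 := bump_nonneg (Real.log n / Real.log ((R ^ 120 : ℕ) : ℝ))
      by_cases hp : n.Prime
      · simp [hp, logPrime, vonMangoldt_apply_prime]
      · simp only [hp, not_false_eq_true, if_true]
        rw [Pi.sub_apply, logPrime, if_neg hp, sub_zero, abs_of_nonneg vonMangoldt_nonneg]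
        have h6 : 0 ≤ Λ n := vonMangoldt_nonneg
        calc _ ≤ Λ n * 1 / n * 1 := by gcongr
          _ = _ := by ring
    · intro n hn hn'
      simp only [mem_Ioc, not_and, not_le] at hn hn'
      have h7 : n ≤ R ^ 60 := by
        by_contra hh
        have := hn' (by omega); omega
      have h8 : bump (Real.log n / Real.log ((R ^ 120 : ℕ) : ℝ)) = 0 := by
        apply bump_eq_zero_of_le
        have h9 : Real.log n ≤ Real.log ((R ^ 60 : ℕ) : ℝ) :=
          Real.log_le_log (by exact_mod_cast hn.1) (by exact_mod_cast h7)
        have h10 : 0 ≤ Real.log R := Real.log_nonneg (by exact_mod_cast hR)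
        rw [Nat.cast_pow, Real.log_pow] at h9 ⊢
        push_cast at h9 ⊢
        apply div_le_of_le_mul₀ (by positivity) (by norm_num); linarith
      rw [h8]; simp
  have h11 := norm_sub_norm_le (primeSum R z) (wsum (⇑(Λ : ArithmeticFunction ℝ)) bump (R ^ 120) z)
  rw [norm_sub_rev] at h11
  linarith

lemma eventually_mul_pow_le_exp (c : ℝ) (n : ℕ) : ∀ᶠ u : ℝ in atTop, c * u ^ n ≤ Real.exp u := by
  filter_upwards [(Real.tendsto_exp_div_pow_atTop n).eventually_ge_atTop c, eventually_gt_atTop 0]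
    with u hu hu0
  rwa [le_div_iff₀ (by positivity)] at hu

lemma eventually_mul_pow_le_floor_exp (c : ℝ) (n : ℕ) :
    ∀ᶠ u : ℝ in atTop, c * u ^ n ≤ ⌊Real.exp u⌋₊ := by
  filter_upwards [eventually_mul_pow_le_exp (|c| + 1) n, eventually_ge_atTop 1] with u hu hu1
  have h1 := Nat.lt_floor_add_one (Real.exp u)
  have h2 : 1 ≤ u ^ n := one_le_pow₀ hu1
  have h3 := le_abs_self c
  nlinarith

lemma IsPrimitive.ne_one {z : Chars} (hp : z.2.IsPrimitive) (hz : 1 < z.1) : z.2 ≠ 1 := by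
  have : NeZero z.1 := ⟨by omega⟩
  intro h
  rw [DirichletCharacter.isPrimitive_def, h, DirichletCharacter.conductor_one] at hp
  omega

/-- Character sums over primes are small on average, apart from one exceptional modulus. -/
theorem exists_sum_primeSum_le (B W : ℕ) : ∃ R₀ : ℕ, ∀ R ≥ R₀, ∃ qe : ℕ, (qe = 0 ∨ W < qe) ∧
    ∀ F : Finset Chars, (∀ z ∈ F, z.2.IsPrimitive ∧ 1 < z.1 ∧ z.1 ≤ R ^ 3 ∧ z.1 ≠ qe) →
      (∑ z ∈ F, ‖primeSum R z‖ / √z.1) * Real.log R ^ B ≤ 1 := by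
  obtain ⟨b, hb⟩ := exists_isSmooth_bump
  set a := 64 * B + 321 with ha
  set t := 4 * B + 5 + a with ht
  obtain ⟨C₁, ℓ₁, hsmall⟩ := exists_norm_wsum_vonMangoldt_le t (1 / 2) (by norm_num) b
  obtain ⟨M₀, ℓ₂, hnb⟩ := exists_not_bad W
  obtain ⟨C₂, hC₂⟩ := exists_norm_wsum_sub_primeSum_le
  obtain ⟨C₃, hT⟩ : ∃ C₃, IsTest bump C₃ := ⟨_, hb.isTest⟩
  have hC₃ : 0 ≤ C₃ := hT.nonneg
  clear_value a t
  have htend : Tendsto (fun R : ℕ => (120 * Real.log R) ^ (1 / 64 : ℝ)) atTop atTop :=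
    (tendsto_rpow_atTop (by norm_num)).comp
      ((Real.tendsto_log_atTop.comp tendsto_natCast_atTop_atTop).const_mul_atTop (by norm_num))
  have hev1 := htend.eventually ((eventually_ge_atTop (2 : ℝ)).and <|
    (eventually_ge_atTop ℓ₁).and <| (eventually_ge_atTop ℓ₂).and <|
    (eventually_ge_atTop (|C₁| + |C₂| + 16827 * C₃)).and <|
    (eventually_mul_pow_le_floor_exp 1 (2 * a + 16 * (t + 2))).and <|
    (eventually_mul_pow_le_floor_exp 2 (4 * a + 32)).and <|
    (eventually_mul_pow_le_floor_exp M₀ 0))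
  have hev2 := (Real.tendsto_log_atTop.comp (tendsto_natCast_atTop_atTop (R := ℝ))).eventually
    (eventually_mul_pow_le_exp (120 ^ (64 * B + 1)) (64 * B + 1))
  obtain ⟨R₀, hR₀⟩ := eventually_atTop.mp (hev1.and (hev2.and (eventually_ge_atTop 1)))
  refine ⟨R₀, fun R hR => ?_⟩
  obtain ⟨⟨hy2, hyℓ₁, hyℓ₂, hyC, hyM, hyM2, hyM0⟩, hyR, hR1⟩ := hR₀ R hR
  have hR' : (1 : ℝ) ≤ R := by exact_mod_cast hR1
  have hlog0 : 0 ≤ Real.log R := Real.log_nonneg hR'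
  set y := (120 * Real.log R) ^ (1 / 64 : ℝ) with hy
  have hy1 : 1 ≤ y := by linarith
  have hy64 : y ^ 64 = 120 * Real.log R := by
    rw [hy, ← Real.rpow_natCast, ← Real.rpow_mul (by positivity)]; norm_num
  clear_value y
  have hlogN : Real.log ((R ^ 120 : ℕ) : ℝ) = y ^ 64 := by
    rw [hy64, Nat.cast_pow, Real.log_pow]; norm_num
  simp only [Function.comp] at hyR
  rw [Real.exp_log (by linarith), ← mul_pow, ← hy64, ← pow_mul] at hyR
  have hyR' : y ^ (64 * B + 1) ≤ R := (pow_le_pow_right₀ hy1 (by omega)).trans hyR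
  set M := ⌊Real.exp y⌋₊ with hM
  have hM1 : 1 ≤ M := Nat.le_floor (by
    simp only [Nat.cast_one]; exact Real.one_le_exp (by linarith))
  have hlogM : Real.log M ≤ y := by
    rw [Real.log_le_iff_le_exp (by exact_mod_cast hM1)]
    exact Nat.floor_le (Real.exp_pos _).le
  clear_value M
  have hlogM0 : 0 ≤ Real.log M := Real.log_natCast_nonneg M
  have hy16 : y ≤ y ^ 16 := le_self_pow₀ hy1 (by norm_num)
  have hML : 400 * (1 + Real.log M) ^ 10 < (y ^ 16) ^ 2 := by
    have h1 : (1 + Real.log M) ^ 10 ≤ (2 * y) ^ 10 := by gcongr; linarith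
    have h2 : (2 : ℝ) ^ 22 ≤ y ^ 22 := by gcongr
    have h3 : 0 < y ^ 10 := by positivity
    calc 400 * (1 + Real.log M) ^ 10 ≤ 400 * (2 * y) ^ 10 := by gcongr
      _ = 409600 * y ^ 10 := by ring
      _ < 2 ^ 22 * y ^ 10 := by nlinarith
      _ ≤ y ^ 22 * y ^ 10 := by gcongr
      _ = _ := by ring
  set Bad : Chars → Prop := fun z => 2 * (y ^ 16) ^ 2 * ‖partialL z M‖ < 1 with hBad
  have hqe : ∃ qe : ℕ, (qe = 0 ∨ W < qe) ∧ ∀ z : Chars, z.2.IsPrimitive → 1 < z.1 →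
      (z.1 : ℝ) ≤ y ^ (2 * a) → z.1 ≠ qe → ¬ Bad z := by
    by_cases hex : ∃ z : Chars, z.2.IsPrimitive ∧ 1 < z.1 ∧ (z.1 : ℝ) ≤ y ^ (2 * a) ∧ Bad z
    · obtain ⟨z, hzp, hz, hzK, hzb⟩ := hex
      refine ⟨z.1, Or.inr ?_, fun w hwp hw hwK hwz hwb => hwz ?_⟩
      · by_contra hW
        have := hnb z hz (by omega) (IsPrimitive.ne_one hzp hz) M (y ^ 16)
          (by simpa using hyM0) (hyℓ₂.trans hy16)
        simp only [hBad] at hzb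
        linarith
      · rw [eq_of_bad hw hz hwp hzp hM1 (one_le_pow₀ hy1) hwK hzK
          (by convert hyM2 using 1; rw [← pow_mul, ← pow_mul, mul_assoc, ← pow_add]; congr 2; ring)
          hML hwb hzb]
    · exact ⟨0, Or.inl rfl, fun z hzp hz hzK _ hzb => hex ⟨z, hzp, hz, hzK, hzb⟩⟩
  obtain ⟨qe, hqe0, hqe⟩ := hqe
  refine ⟨qe, hqe0, fun F hF => ?_⟩
  have hFam : IsFamily (R ^ 3) F := fun z hz => ⟨(hF z hz).1, by have := (hF z hz).2.1; omega,
    (hF z hz).2.2.1⟩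
  set T : Chars → ℝ := fun z => ‖wsum (⇑(Λ : ArithmeticFunction ℝ)) bump (R ^ 120) z‖ with hTdef
  have hT0 : ∀ z, 0 ≤ T z := fun z => norm_nonneg _
  have hsq : ∀ z ∈ F, 1 ≤ √(z.1 : ℝ) := fun z hz => by
    rw [Real.one_le_sqrt]; exact_mod_cast (hF z hz).2.1.le
  set Fs := F.filter (fun z => (z.1 : ℝ) ≤ y ^ (2 * a)) with hFs
  set Fl := F.filter (fun z => ¬ (z.1 : ℝ) ≤ y ^ (2 * a)) with hFl
  have hS : (∑ z ∈ Fs, T z / √z.1) * y ^ (64 * B + 1) ≤ |C₁| := by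
    have h1 : ∀ z ∈ Fs, T z / √z.1 * y ^ (16 * t) ≤ |C₁| * y ^ 64 := fun z hz => by
      obtain ⟨hzF, hzK⟩ := mem_filter.mp hz
      obtain ⟨hzp, hz1, hzQ, hze⟩ := hF z hzF
      have : NeZero z.1 := ⟨by omega⟩
      have h2 := hsmall (R ^ 120) M (y ^ 16) (z.1 : ℝ) z (hyℓ₁.trans hy16) (by rw [hlogN]; ring)
        (boundedSums_of_ne_one (IsPrimitive.ne_one hzp hz1)) hM1
        (by
          calc (1 + Real.log M) ^ 2 ≤ (2 * y) ^ 2 := by gcongr; linarith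
            _ = 2 ^ 2 * y ^ 2 := by ring
            _ ≤ y ^ 2 * y ^ 2 := by gcongr
            _ = y ^ 4 := by ring
            _ ≤ y ^ 16 := pow_le_pow_right₀ hy1 (by norm_num))
        (by
          refine le_trans ?_ hyM
          rw [one_mul, pow_add y (2 * a), ← pow_mul y 16]
          exact mul_le_mul_of_nonneg_right hzK (by positivity))
        (not_lt.mp (hqe z hzp hz1 hzK hze)) bump hb
      rw [← pow_mul, ← pow_mul] at h2
      calc T z / √z.1 * y ^ (16 * t) ≤ T z * y ^ (16 * t) := by
            gcongr; exact div_le_self (hT0 z) (hsq z hzF)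
        _ ≤ C₁ * y ^ (16 * 4) := h2
        _ ≤ |C₁| * y ^ 64 := by gcongr; exact le_abs_self _
    have h3 : (Fs.card : ℝ) ≤ y ^ (4 * a) := by
      have h4 : IsFamily ⌊y ^ (2 * a)⌋₊ Fs := fun z hz => by
        obtain ⟨hzF, hzK⟩ := mem_filter.mp hz
        exact ⟨(hF z hzF).1, by have := (hF z hzF).2.1; omega, Nat.le_floor hzK⟩
      calc (Fs.card : ℝ) ≤ (⌊y ^ (2 * a)⌋₊ : ℝ) ^ 2 := by exact_mod_cast h4.card_le
        _ ≤ (y ^ (2 * a)) ^ 2 := by gcongr; exact Nat.floor_le (by positivity)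
        _ = _ := by rw [← pow_mul]; congr 1; ring
    have h5 : (∑ z ∈ Fs, T z / √z.1) * y ^ (16 * t) ≤ |C₁| * (y ^ (4 * a) * y ^ 64) := by
      rw [Finset.sum_mul]
      refine (Finset.sum_le_sum h1).trans ?_
      rw [Finset.sum_const, nsmul_eq_mul]
      calc _ ≤ y ^ (4 * a) * (|C₁| * y ^ 64) := by gcongr
        _ = _ := by ring
    have h6 : y ^ (64 * B + 1) * (y ^ (4 * a) * y ^ 64) ≤ y ^ (16 * t) := by
      rw [← pow_add, ← pow_add]; exact pow_le_pow_right₀ hy1 (by omega)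
    have h7 : 0 ≤ ∑ z ∈ Fs, T z / √z.1 := Finset.sum_nonneg fun z _ => by
      have := hT0 z; positivity
    have h8 : 0 < y ^ (4 * a) * y ^ 64 := by positivity
    refine le_of_mul_le_mul_right ?_ h8
    calc _ = (∑ z ∈ Fs, T z / √z.1) * (y ^ (64 * B + 1) * (y ^ (4 * a) * y ^ 64)) := by ring
      _ ≤ (∑ z ∈ Fs, T z / √z.1) * y ^ (16 * t) := by gcongr
      _ ≤ _ := h5
  have hL : (∑ z ∈ Fl, T z / √z.1) * y ^ (64 * B + 1) ≤ 16827 * C₃ := by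
    have h1 := sum_norm_wsum_vonMangoldt_le hT (F := Fl) (Q := R ^ 3) (U := R ^ 12)
      (N := R ^ 120) (M := R ^ 60) (fun z hz => hFam z (mem_filter.mp hz).1)
      (fun z hz => (hF z (mem_filter.mp hz).1).2.1) (Nat.one_le_pow _ _ hR1)
      (by rw [← pow_mul]) (Nat.pow_le_pow_right hR1 (by norm_num)) (by rw [← pow_mul])
      (by rw [hlogN]; exact one_le_pow₀ hy1)
    rw [hlogN] at h1
    have h2 : ∑ z ∈ Fl, T z ≤ 16827 * C₃ * y ^ 320 := by
      refine h1.trans ?_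
      push_cast
      have h3 : ((R : ℝ) ^ 3) ^ 2 * (20 * C₃ * (y ^ 64) ^ 2 * R ^ 3 * (R ^ 12) ^ 4 / R ^ 60) =
          20 * C₃ * y ^ 128 / R ^ 3 := by field_simp
      rw [h3]
      have h4 : 20 * C₃ * y ^ 128 / R ^ 3 ≤ 20 * C₃ * y ^ 320 :=
        (div_le_self (by positivity) (one_le_pow₀ hR')).trans
          (mul_le_mul_of_nonneg_left (pow_le_pow_right₀ hy1 (by norm_num)) (by positivity))
      have h5 : (y ^ 64 + 6) ^ 5 ≤ 16807 * y ^ 320 := by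
        have : 1 ≤ y ^ 64 := one_le_pow₀ hy1
        calc (y ^ 64 + 6) ^ 5 ≤ (7 * y ^ 64) ^ 5 := by gcongr; linarith
          _ = _ := by ring
      nlinarith [mul_le_mul_of_nonneg_left h5 hC₃]
    have h6 : (∑ z ∈ Fl, T z / √z.1) * y ^ a ≤ ∑ z ∈ Fl, T z := by
      rw [Finset.sum_mul]
      refine Finset.sum_le_sum fun z hz => ?_
      obtain ⟨hzF, hzK⟩ := mem_filter.mp hz
      have h7 : y ^ a ≤ √z.1 := by
        apply Real.le_sqrt_of_sq_le
        rw [← pow_mul, mul_comm]; exact (not_le.mp hzK).le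
      have h8 : 0 < √(z.1 : ℝ) := by have := hsq z hzF; linarith
      rw [div_mul_eq_mul_div, div_le_iff₀ h8]
      exact mul_le_mul_of_nonneg_left h7 (hT0 z)
    have h9 : y ^ a = y ^ (64 * B + 1) * y ^ 320 := by rw [← pow_add, ha]
    have h10 : 0 < y ^ 320 := by positivity
    refine le_of_mul_le_mul_right ?_ h10
    rw [mul_assoc, ← h9]; exact h6.trans h2
  have hP : ∑ z ∈ F, ‖primeSum R z‖ / √z.1 ≤ ∑ z ∈ F, T z / √z.1 + |C₂| / R := by
    have h1 : ∀ z ∈ F, ‖primeSum R z‖ / √z.1 ≤ T z / √z.1 + |C₂| / R ^ 30 := fun z hz => by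
      have h2 := hC₂ R hR1 z
      have h3 := hsq z hz
      have h4 : C₂ / R ^ 30 ≤ |C₂| / R ^ 30 := by gcongr; exact le_abs_self _
      calc ‖primeSum R z‖ / √z.1 ≤ (T z + |C₂| / R ^ 30) / √z.1 := by
              gcongr; exact h2.trans (by gcongr)
        _ = T z / √z.1 + |C₂| / R ^ 30 / √z.1 := by ring
        _ ≤ _ := add_le_add_right (div_le_self (by positivity) h3) _
    refine (Finset.sum_le_sum h1).trans ?_
    rw [Finset.sum_add_distrib, Finset.sum_const, nsmul_eq_mul]
    have h5 : (F.card : ℝ) ≤ R ^ 6 := by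
      have := hFam.card_le
      rw [← pow_mul] at this
      exact_mod_cast this
    gcongr
    calc (F.card : ℝ) * (|C₂| / R ^ 30) ≤ R ^ 6 * (|C₂| / R ^ 30) := by gcongr
      _ = |C₂| / R ^ 24 := by field_simp
      _ ≤ |C₂| / R := by gcongr; exact le_self_pow₀ hR' (by norm_num)
  have hsplit : ∑ z ∈ F, T z / √z.1 = ∑ z ∈ Fs, T z / √z.1 + ∑ z ∈ Fl, T z / √z.1 :=
    (Finset.sum_filter_add_sum_filter_not F _ _).symm
  have hN : |C₂| / R * y ^ (64 * B + 1) ≤ |C₂| := by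
    rw [div_mul_eq_mul_div, div_le_iff₀ (by linarith)]; gcongr
  have htot : (∑ z ∈ F, ‖primeSum R z‖ / √z.1) * y ^ (64 * B + 1) ≤ y := by
    calc _ ≤ (∑ z ∈ F, T z / √z.1 + |C₂| / R) * y ^ (64 * B + 1) := by gcongr
      _ = (∑ z ∈ Fs, T z / √z.1) * y ^ (64 * B + 1) + (∑ z ∈ Fl, T z / √z.1) * y ^ (64 * B + 1) +
          |C₂| / R * y ^ (64 * B + 1) := by rw [hsplit]; ring
      _ ≤ y := by linarith
  have hlogB : Real.log R ^ B ≤ y ^ (64 * B) := by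
    rw [pow_mul]; gcongr; linarith
  rw [pow_succ, ← mul_assoc] at htot
  have h0 : 0 ≤ ∑ z ∈ F, ‖primeSum R z‖ / √z.1 := Finset.sum_nonneg fun z _ => by positivity
  calc _ ≤ (∑ z ∈ F, ‖primeSum R z‖ / √z.1) * y ^ (64 * B) := by gcongr
    _ ≤ 1 := by nlinarith

end PrimeGapRuns

namespace PrimeGapRuns

open Finset Matrix

variable {ι κ : Type*}

/-- The tensor product of a finite family of matrices over a set of indices. -/
def tensor (U : Finset ι) (A : ι → Matrix κ κ ℝ) : Matrix (ι → κ) (ι → κ) ℝ :=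
  Matrix.of fun s t => ∏ p ∈ U, A p (s p) (t p)

lemma tensor_insert [DecidableEq ι] {U : Finset ι} {q : ι} (hq : q ∉ U) (A : ι → Matrix κ κ ℝ) :
    tensor (insert q U) A = ((A q).submatrix (fun s => s q) (fun s => s q)).hadamard (tensor U A) := by
  ext s t
  simp [tensor, Matrix.hadamard, Finset.prod_insert hq]

section PosSemidef

variable [Finite ι] [Finite κ]

lemma tensor_posSemidef (U : Finset ι) {A : ι → Matrix κ κ ℝ} (hA : ∀ p, (A p).PosSemidef) :
    (tensor U A).PosSemidef := by
  classical
  induction U using Finset.induction_on with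
  | empty =>
    have h : tensor (∅ : Finset ι) A = Matrix.vecMulVec (fun _ => 1) (star fun _ => 1) := by
      ext s t; simp [tensor, Matrix.vecMulVec]
    rw [h]; exact Matrix.posSemidef_vecMulVec_self_star _
  | insert q U hq ih => rw [tensor_insert hq]; exact ((hA q).submatrix _).hadamard ih

lemma tensor_sub_posSemidef (U : Finset ι) {A B : ι → Matrix κ κ ℝ} (hA : ∀ p, (A p).PosSemidef)
    (hBA : ∀ p, (B p - A p).PosSemidef) : (tensor U B - tensor U A).PosSemidef := by
  classical
  induction U using Finset.induction_on with
  | empty =>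
    have h : tensor (∅ : Finset ι) B - tensor ∅ A = 0 := by ext s t; simp [tensor]
    rw [h]; exact Matrix.PosSemidef.zero
  | insert q U hq ih =>
    have hB : ∀ p, (B p).PosSemidef := fun p => by simpa using (hBA p).add (hA p)
    have h : tensor (insert q U) B - tensor (insert q U) A =
        ((B q - A q).submatrix (fun s => s q) (fun s => s q)).hadamard (tensor U B) +
        ((A q).submatrix (fun s => s q) (fun s => s q)).hadamard (tensor U B - tensor U A) := by
      rw [tensor_insert hq, tensor_insert hq]
      ext s t
      simp only [Matrix.sub_apply, Matrix.add_apply, Matrix.hadamard_apply, Matrix.submatrix_apply]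
      ring
    rw [h]
    exact (((hBA q).submatrix _).hadamard (tensor_posSemidef U hB)).add
      (((hA q).submatrix _).hadamard ih)

end PosSemidef

variable [Fintype ι] [Fintype κ] [DecidableEq ι]

/-- The quadratic form attached to a tensor product of matrices. -/
def form (A : ι → Matrix κ κ ℝ) (y : (ι → κ) → ℝ) : ℝ :=
  ∑ s, ∑ t, y s * y t * ∏ p, A p (s p) (t p)

lemma posSemidef_of_sum_nonneg {M : Matrix κ κ ℝ} (hM : ∀ i j, M i j = M j i)
    (h : ∀ x : κ → ℝ, 0 ≤ ∑ i, ∑ j, x i * x j * M i j) : M.PosSemidef := by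
  refine Matrix.PosSemidef.of_dotProduct_mulVec_nonneg (by ext i j; simp [hM i j]) fun x => ?_
  refine (h x).trans (le_of_eq ?_)
  simp only [dotProduct, Matrix.mulVec, Finset.mul_sum]
  exact Finset.sum_congr rfl fun i _ => Finset.sum_congr rfl fun j _ => by simp; ring

lemma sum_nonneg_of_posSemidef {M : Matrix κ κ ℝ} (hM : M.PosSemidef) (x : κ → ℝ) :
    0 ≤ ∑ i, ∑ j, x i * x j * M i j := by
  refine (hM.dotProduct_mulVec_nonneg x).trans (le_of_eq ?_)
  simp only [dotProduct, Matrix.mulVec, Finset.mul_sum]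
  exact Finset.sum_congr rfl fun i _ => Finset.sum_congr rfl fun j _ => by simp; ring

/-- Tensor products of positive semidefinite matrices are monotone. -/
theorem form_le_form {A B : ι → Matrix κ κ ℝ} (hA : ∀ p, (A p).PosSemidef)
    (hBA : ∀ p, (B p - A p).PosSemidef) (y : (ι → κ) → ℝ) : form A y ≤ form B y := by
  have h := sum_nonneg_of_posSemidef (tensor_sub_posSemidef Finset.univ hA hBA) y
  rw [← sub_nonneg]
  refine h.trans (le_of_eq ?_)
  simp only [form, ← Finset.sum_sub_distrib, tensor, Matrix.sub_apply, Matrix.of_apply, mul_sub]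

/-- Second moment of a tensor sieve in terms of its local Gram matrices. -/
theorem abs_sum_sq_sub_form_le {N : Type*} (T : Finset N) (w : N → ℝ) (α : ι → κ → κ → ℝ)
    (ind : ι → κ → N → ℝ) (ρ : ι → κ → κ → ℝ) (X : ℝ) (y : (ι → κ) → ℝ) {c : ℝ} (hc : 0 ≤ c)
    (𝒟 : Finset (ι → κ)) (ε : (ι → κ) → (ι → κ) → ℝ)
    (hlam : ∀ d ∈ 𝒟, |∑ s, y s * ∏ p, α p (s p) (d p)| ≤ c)
    (hlam' : ∀ d ∉ 𝒟, ∑ s, y s * ∏ p, α p (s p) (d p) = 0)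
    (hε : ∀ d ∈ 𝒟, ∀ e ∈ 𝒟, |∑ n ∈ T, w n * ((∏ p, ind p (d p) n) * ∏ p, ind p (e p) n) -
      X * ∏ p, ρ p (d p) (e p)| ≤ ε d e) :
    |∑ n ∈ T, w n * (∑ s, y s * ∏ p, ∑ o, α p (s p) o * ind p o n) ^ 2 -
      X * form (fun p => Matrix.of fun o o' => ∑ a, ∑ b, α p o a * α p o' b * ρ p a b) y| ≤
      c ^ 2 * ∑ d ∈ 𝒟, ∑ e ∈ 𝒟, ε d e := by
  classical
  set lam : (ι → κ) → ℝ := fun d => ∑ s, y s * ∏ p, α p (s p) (d p) with hl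
  have h1 : ∀ n, ∑ s, y s * ∏ p, ∑ o, α p (s p) o * ind p o n =
      ∑ d, lam d * ∏ p, ind p (d p) n := fun n => by
    simp only [hl, Finset.sum_mul]
    rw [Finset.sum_comm]
    refine Finset.sum_congr rfl fun s _ => ?_
    rw [Finset.prod_univ_sum, Fintype.piFinset_univ, Finset.mul_sum]
    exact Finset.sum_congr rfl fun d _ => by rw [Finset.prod_mul_distrib]; ring
  have h2 : ∑ n ∈ T, w n * (∑ s, y s * ∏ p, ∑ o, α p (s p) o * ind p o n) ^ 2 =
      ∑ d, ∑ e, lam d * lam e *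
        ∑ n ∈ T, w n * ((∏ p, ind p (d p) n) * ∏ p, ind p (e p) n) := by
    have hsq : ∀ n, (∑ d, lam d * ∏ p, ind p (d p) n) ^ 2 =
        ∑ d, ∑ e, lam d * lam e * ((∏ p, ind p (d p) n) * ∏ p, ind p (e p) n) := fun n => by
      rw [sq, Finset.sum_mul_sum]
      exact Finset.sum_congr rfl fun d _ => Finset.sum_congr rfl fun e _ => by ring
    simp only [h1, hsq, Finset.mul_sum]
    rw [Finset.sum_comm]
    refine Finset.sum_congr rfl fun d _ => ?_
    rw [Finset.sum_comm]
    exact Finset.sum_congr rfl fun e _ => Finset.sum_congr rfl fun n _ => by ring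
  have h3 : form (fun p => Matrix.of fun o o' => ∑ a, ∑ b, α p o a * α p o' b * ρ p a b) y =
      ∑ d, ∑ e, lam d * lam e * ∏ p, ρ p (d p) (e p) := by
    have h4 : ∀ s t : ι → κ, ∏ p, ∑ a, ∑ b, α p (s p) a * α p (t p) b * ρ p a b =
        ∑ d : ι → κ, ∑ e : ι → κ, (∏ p, α p (s p) (d p)) * (∏ p, α p (t p) (e p)) *
          ∏ p, ρ p (d p) (e p) := fun s t => by
      rw [Finset.prod_univ_sum, Fintype.piFinset_univ]
      refine Finset.sum_congr rfl fun d _ => ?_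
      rw [Finset.prod_univ_sum, Fintype.piFinset_univ]
      exact Finset.sum_congr rfl fun e _ => by rw [Finset.prod_mul_distrib, Finset.prod_mul_distrib]
    have hll : ∀ d e, lam d * lam e =
        ∑ s, ∑ t, y s * (∏ p, α p (s p) (d p)) * (y t * ∏ p, α p (t p) (e p)) :=
      fun d e => Finset.sum_mul_sum _ _ _ _
    simp only [form, Matrix.of_apply, h4, hll, Finset.mul_sum, Finset.sum_mul]
    have e1 : ∀ F : (ι → κ) → (ι → κ) → (ι → κ) → (ι → κ) → ℝ,
        ∑ s, ∑ t, ∑ d, ∑ e, F s t d e = ∑ d, ∑ e, ∑ s, ∑ t, F s t d e := fun F => by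
      simp only [← Fintype.sum_prod_type']
      exact Fintype.sum_equiv ⟨fun x => (x.2.2.1, x.2.2.2, x.1, x.2.1),
        fun x => (x.2.2.1, x.2.2.2, x.1, x.2.1), fun _ => rfl, fun _ => rfl⟩ _ _ fun _ => rfl
    rw [e1]
    exact Finset.sum_congr rfl fun d _ => Finset.sum_congr rfl fun e _ =>
      Finset.sum_congr rfl fun s _ => Finset.sum_congr rfl fun t _ => by ring
  rw [h2, h3, Finset.mul_sum, ← Finset.sum_sub_distrib]
  have h5 : ∀ d, d ∉ 𝒟 → lam d = 0 := hlam'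
  rw [← Finset.sum_subset (Finset.subset_univ 𝒟) fun d _ hd => by simp [h5 d hd]]
  rw [Finset.mul_sum]
  refine (Finset.abs_sum_le_sum_abs _ _).trans (Finset.sum_le_sum fun d hd => ?_)
  rw [Finset.mul_sum, ← Finset.sum_sub_distrib]
  rw [← Finset.sum_subset (Finset.subset_univ 𝒟) fun e _ he => by simp [h5 e he]]
  rw [Finset.mul_sum]
  refine (Finset.abs_sum_le_sum_abs _ _).trans (Finset.sum_le_sum fun e he => ?_)
  rw [show ∀ a b S X P : ℝ, a * b * S - X * (a * b * P) = a * b * (S - X * P) from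
    fun _ _ _ _ _ => by ring, abs_mul, abs_mul, sq]
  have := hlam d hd
  have := hlam e he
  have := hε d hd e he
  gcongr

end PrimeGapRuns

namespace PrimeGapRuns

open Finset Matrix

variable {k : ℕ}

/-- Coefficients of the local sieve functions `1` and `(q - 1) 1[q ∣ n + hᵢ] - 1` in terms of
the indicators `1` and `1[q ∣ n + hᵢ]`. -/
def coef (q : ℝ) : Option (Fin k) → Option (Fin k) → ℝ
  | none, none => 1
  | none, some _ => 0
  | some _, none => -1
  | some i, some j => if i = j then q - 1 else 0

/-- Local Gram matrix of the sieve functions for given correlations of the indicators. -/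
def gram (q : ℝ) (ρ : Option (Fin k) → Option (Fin k) → ℝ) :
    Matrix (Option (Fin k)) (Option (Fin k)) ℝ :=
  Matrix.of fun o o' => ∑ a, ∑ b, coef q o a * coef q o' b * ρ a b

lemma gram_symm {q : ℝ} {ρ : Option (Fin k) → Option (Fin k) → ℝ} (hρ : ∀ a b, ρ a b = ρ b a)
    (i j : Option (Fin k)) : gram q ρ i j = gram q ρ j i := by
  simp only [gram, Matrix.of_apply]
  rw [Finset.sum_comm]
  exact Finset.sum_congr rfl fun a _ => Finset.sum_congr rfl fun b _ => by rw [hρ]; ring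

lemma sum_gram (q : ℝ) (ρ : Option (Fin k) → Option (Fin k) → ℝ) (x : Option (Fin k) → ℝ) :
    ∑ i, ∑ j, x i * x j * gram q ρ i j =
      ∑ a, ∑ b, (∑ i, x i * coef q i a) * (∑ j, x j * coef q j b) * ρ a b := by
  have hll : ∀ a b, (∑ i, x i * coef q i a) * (∑ j, x j * coef q j b) =
      ∑ i, ∑ j, x i * coef q i a * (x j * coef q j b) := fun a b => Finset.sum_mul_sum _ _ _ _
  simp only [gram, Matrix.of_apply, hll, Finset.mul_sum, Finset.sum_mul]
  have e1 : ∀ F : Option (Fin k) → Option (Fin k) → Option (Fin k) → Option (Fin k) → ℝ,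
      ∑ s, ∑ t, ∑ d, ∑ e, F s t d e = ∑ d, ∑ e, ∑ s, ∑ t, F s t d e := fun F => by
    simp only [← Fintype.sum_prod_type']
    exact Fintype.sum_equiv ⟨fun x => (x.2.2.1, x.2.2.2, x.1, x.2.1),
      fun x => (x.2.2.1, x.2.2.2, x.1, x.2.1), fun _ => rfl, fun _ => rfl⟩ _ _ fun _ => rfl
  rw [e1]
  exact Finset.sum_congr rfl fun a _ => Finset.sum_congr rfl fun b _ =>
    Finset.sum_congr rfl fun i _ => Finset.sum_congr rfl fun j _ => by ring

lemma sum_mul_coef_none (q : ℝ) (x : Option (Fin k) → ℝ) :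
    ∑ i, x i * coef q i none = x none - ∑ i, x (some i) := by
  simp [Fintype.sum_option, coef, sub_eq_add_neg]

lemma sum_mul_coef_some (q : ℝ) (x : Option (Fin k) → ℝ) (j : Fin k) :
    ∑ i, x i * coef q i (some j) = (q - 1) * x (some j) := by
  simp [Fintype.sum_option, coef, mul_comm]

/-- Densities of the indicators for integers. -/
noncomputable def rhoInt (q : ℝ) : Option (Fin k) → Option (Fin k) → ℝ
  | none, none => 1
  | none, some _ => 1 / q
  | some _, none => 1 / q
  | some i, some j => if i = j then 1 / q else 0

/-- Densities of the indicators for primes at the `m`-th place. -/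
noncomputable def rhoPrime (m : Fin k) (q : ℝ) : Option (Fin k) → Option (Fin k) → ℝ
  | none, none => 1
  | none, some i => if i = m then 0 else 1 / (q - 1)
  | some i, none => if i = m then 0 else 1 / (q - 1)
  | some i, some j => if i = m then 0 else if i = j then 1 / (q - 1) else 0

lemma rhoInt_symm (q : ℝ) (a b : Option (Fin k)) : rhoInt q a b = rhoInt q b a := by
  rcases a with _ | i <;> rcases b with _ | j <;> simp [rhoInt, eq_comm]

lemma rhoPrime_symm (m : Fin k) (q : ℝ) (a b : Option (Fin k)) :
    rhoPrime m q a b = rhoPrime m q b a := by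
  rcases a with _ | i <;> rcases b with _ | j <;> simp only [rhoPrime]
  by_cases hij : i = j
  · subst hij; rfl
  · simp [hij, Ne.symm hij]

lemma sum_gram_rhoInt {q : ℝ} (hq : 0 < q) (x : Option (Fin k) → ℝ) :
    ∑ i, ∑ j, x i * x j * gram q (rhoInt q) i j =
      x none ^ 2 - 2 / q * x none * ∑ i, x (some i) + (2 / q - 1) * (∑ i, x (some i)) ^ 2 +
        (q - 2 + 1 / q) * ∑ i, x (some i) ^ 2 := by
  have h1 : ∑ i : Fin k, (q - 1) * x (some i) * ((q - 1) * x (some i)) * (1 / q) =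
      (q - 1) ^ 2 / q * ∑ i, x (some i) ^ 2 := by
    rw [Finset.mul_sum]; exact Finset.sum_congr rfl fun i _ => by ring
  rw [sum_gram]
  obtain ⟨z, hz⟩ : ∃ z : Option (Fin k) → ℝ, ∀ a, z a = ∑ i, x i * coef q i a := ⟨_, fun _ => rfl⟩
  have hz0 : z none = x none - ∑ i, x (some i) := by rw [hz, sum_mul_coef_none]
  have hz1 : ∀ j, z (some j) = (q - 1) * x (some j) := fun j => by rw [hz, sum_mul_coef_some]
  simp only [← hz, Fintype.sum_option, hz0, hz1, rhoInt, mul_ite, mul_zero,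
    Finset.sum_ite_eq, Finset.mem_univ, if_true, Finset.sum_add_distrib, h1]
  simp only [← Finset.mul_sum, ← Finset.sum_mul]
  field_simp
  ring

lemma gram_rhoInt_posSemidef {q : ℝ} (hk : (k : ℝ) ≤ q) (hq : 0 < q) :
    (gram q (rhoInt q) : Matrix (Option (Fin k)) _ ℝ).PosSemidef := by
  refine posSemidef_of_sum_nonneg (gram_symm (rhoInt_symm q)) fun x => ?_
  rw [sum_gram_rhoInt hq]
  set σ := ∑ i, x (some i)
  have h : ∑ i, (x none - σ + (q - 1) * x (some i)) ^ 2 = k * (x none - σ) ^ 2 +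
      2 * (x none - σ) * (q - 1) * σ + (q - 1) ^ 2 * ∑ i, x (some i) ^ 2 := by
    have : ∀ i, (x none - σ + (q - 1) * x (some i)) ^ 2 = (x none - σ) ^ 2 +
      2 * (x none - σ) * (q - 1) * x (some i) + (q - 1) ^ 2 * x (some i) ^ 2 := fun i => by ring
    simp only [this, Finset.sum_add_distrib, ← Finset.mul_sum]
    simp [σ]
  have h1 : 0 ≤ ∑ i, (x none - σ + (q - 1) * x (some i)) ^ 2 :=
    Finset.sum_nonneg fun i _ => sq_nonneg _
  have h2 : 0 ≤ (1 / q) * (∑ i, (x none - σ + (q - 1) * x (some i)) ^ 2 +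
      (q - k) * (x none - σ) ^ 2) := by
    have := sub_nonneg.mpr hk
    positivity
  refine h2.trans (le_of_eq ?_)
  rw [h]; field_simp; ring

/-- A diagonal majorant of the Gram matrix for integers. -/
noncomputable def diagInt (q : ℝ) : Matrix (Option (Fin k)) (Option (Fin k)) ℝ :=
  Matrix.diagonal fun o => if o = none then 1 + 3 / q ^ 2 else q - 1

lemma diagInt_sub_gram_posSemidef {q : ℝ} (hq : 3 ≤ q) :
    (diagInt q - gram q (rhoInt q) : Matrix (Option (Fin k)) _ ℝ).PosSemidef := by
  refine posSemidef_of_sum_nonneg (fun i j => ?_) fun x => ?_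
  · rw [Matrix.sub_apply, Matrix.sub_apply, gram_symm (rhoInt_symm q), diagInt]
    congr 1
    by_cases h : i = j
    · subst h; rfl
    · rw [Matrix.diagonal_apply_ne _ h, Matrix.diagonal_apply_ne _ (Ne.symm h)]
  have hq0 : 0 < q := by linarith
  have h0 : ∑ i, ∑ j, x i * x j * (diagInt q : Matrix (Option (Fin k)) _ ℝ) i j =
      (1 + 3 / q ^ 2) * x none ^ 2 + (q - 1) * ∑ i, x (some i) ^ 2 := by
    simp only [diagInt, Matrix.diagonal_apply, mul_ite, mul_zero, Finset.sum_ite_eq, Finset.mem_univ,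
      if_true, Fintype.sum_option, reduceCtorEq, if_false, Finset.mul_sum]
    congr 1
    · ring
    · exact Finset.sum_congr rfl fun i _ => by ring
  simp only [Matrix.sub_apply, mul_sub, Finset.sum_sub_distrib]
  rw [h0, sum_gram_rhoInt hq0]
  set σ := ∑ i, x (some i)
  set τ := ∑ i, x (some i) ^ 2
  have hτ : 0 ≤ τ := Finset.sum_nonneg fun i _ => sq_nonneg _
  have h1 : 0 ≤ (1 - 1 / q) * τ := by
    have : 1 / q ≤ 1 := by rw [div_le_one hq0]; linarith
    exact mul_nonneg (by linarith) hτ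
  have h2 : 1 / q ≤ 1 / 3 := one_div_le_one_div_of_le (by norm_num) hq
  have h3 : 0 ≤ (2 / 3 - 2 / q) * σ ^ 2 := mul_nonneg (by
    have : 2 / q = 2 * (1 / q) := by ring
    rw [this]; linarith) (sq_nonneg _)
  have h4 : 0 ≤ 3 * (x none / q + σ / 3) ^ 2 := by positivity
  have e : (1 + 3 / q ^ 2) * x none ^ 2 + (q - 1) * τ - (x none ^ 2 - 2 / q * x none * σ +
      (2 / q - 1) * σ ^ 2 + (q - 2 + 1 / q) * τ) =
      3 * (x none / q + σ / 3) ^ 2 + (2 / 3 - 2 / q) * σ ^ 2 + (1 - 1 / q) * τ := by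
    field_simp; ring
  rw [e]; positivity

/-- A block diagonal minorant of the Gram matrix for primes at the `m`-th place. -/
def blockPrime (m : Fin k) (q : ℝ) : Matrix (Option (Fin k)) (Option (Fin k)) ℝ :=
  Matrix.of fun
    | none, none => 1
    | none, some i => if i = m then -1 else 0
    | some i, none => if i = m then -1 else 0
    | some i, some j => if i = j then (if i = m then 1 else q - k) else 0

lemma sum_blockPrime (m : Fin k) (q : ℝ) (x : Option (Fin k) → ℝ) :
    ∑ i, ∑ j, x i * x j * blockPrime m q i j =
      (x none - x (some m)) ^ 2 + (q - k) * ∑ i with i ≠ m, x (some i) ^ 2 := by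
  have h1 : ∑ i, x (some i) * x (some i) * (if i = m then 1 else q - k) =
      x (some m) ^ 2 + (q - k) * ∑ i with i ≠ m, x (some i) ^ 2 := by
    rw [Finset.sum_filter, Finset.mul_sum,
      ← Finset.add_sum_erase _ _ (Finset.mem_univ m),
      ← Finset.add_sum_erase (a := m) Finset.univ (fun i => (q - k) * if i ≠ m then x (some i) ^ 2 else 0)
        (Finset.mem_univ m)]
    simp only [if_true, mul_one, ne_eq, not_true_eq_false, if_false, mul_zero, zero_add]
    rw [sq]
    congr 1
    refine Finset.sum_congr rfl fun i hi => ?_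
    rw [if_neg (Finset.ne_of_mem_erase hi), if_pos (Finset.ne_of_mem_erase hi)]; ring
  simp only [Fintype.sum_option, blockPrime, Matrix.of_apply, mul_ite, mul_zero, Finset.sum_ite_eq,
    Finset.sum_ite_eq', Finset.mem_univ, if_true, Finset.sum_add_distrib] at h1 ⊢
  rw [h1]; ring

lemma blockPrime_symm (m : Fin k) (q : ℝ) (a b : Option (Fin k)) :
    blockPrime m q a b = blockPrime m q b a := by
  rcases a with _ | i <;> rcases b with _ | j <;> simp only [blockPrime, Matrix.of_apply]
  by_cases hij : i = j
  · subst hij; rfl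
  · simp [hij, Ne.symm hij]

lemma blockPrime_posSemidef (m : Fin k) {q : ℝ} (hq : (k : ℝ) ≤ q) :
    (blockPrime m q).PosSemidef := by
  refine posSemidef_of_sum_nonneg (blockPrime_symm m q) fun x => ?_
  rw [sum_blockPrime]
  have := sub_nonneg.mpr hq
  have : 0 ≤ ∑ i with i ≠ m, x (some i) ^ 2 := Finset.sum_nonneg fun i _ => sq_nonneg _
  positivity

lemma sum_gram_rhoPrime (m : Fin k) {q : ℝ} (hq : 1 < q) (x : Option (Fin k) → ℝ) :
    ∑ i, ∑ j, x i * x j * gram q (rhoPrime m q) i j = (x none - x (some m)) ^ 2 -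
      (∑ i with i ≠ m, x (some i)) ^ 2 + (q - 1) * ∑ i with i ≠ m, x (some i) ^ 2 := by
  have hq1 : q - 1 ≠ 0 := by linarith
  have h0 : ∑ i, x (some i) = x (some m) + ∑ i with i ≠ m, x (some i) := by
    rw [Finset.filter_ne', Finset.add_sum_erase Finset.univ (fun i => x (some i)) (Finset.mem_univ m)]
  have h1 : ∀ c : ℝ, ∑ i, (if i = m then 0 else c * ((q - 1) * x (some i)) * (1 / (q - 1))) =
      c * ∑ i with i ≠ m, x (some i) := fun c => by
    rw [Finset.sum_filter, Finset.mul_sum]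
    refine Finset.sum_congr rfl fun i _ => ?_
    by_cases h : i = m
    · simp [h]
    · simp only [h, if_false, ne_eq, not_false_eq_true, if_true]; field_simp
  have h1' : ∀ c : ℝ, ∑ i, (if i = m then 0 else (q - 1) * x (some i) * c * (1 / (q - 1))) =
      c * ∑ i with i ≠ m, x (some i) := fun c => by
    rw [← h1]; exact Finset.sum_congr rfl fun i _ => by rw [mul_comm c]
  have h2 : ∑ i, (if i = m then 0 else (q - 1) * x (some i) * ((q - 1) * x (some i)) *
      (1 / (q - 1))) = (q - 1) * ∑ i with i ≠ m, x (some i) ^ 2 := by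
    rw [Finset.sum_filter, Finset.mul_sum]
    refine Finset.sum_congr rfl fun i _ => ?_
    by_cases h : i = m
    · simp [h]
    · simp only [h, if_false, ne_eq, not_false_eq_true, if_true]; field_simp
  have h3 : ∀ i j : Fin k, (q - 1) * x (some i) * ((q - 1) * x (some j)) *
      rhoPrime m q (some i) (some j) = if i = j then (if i = m then 0 else
        (q - 1) * x (some i) * ((q - 1) * x (some i)) * (1 / (q - 1))) else 0 := fun i j => by
    by_cases hij : i = j
    · subst hij; by_cases h : i = m <;> simp [rhoPrime, h]
    · simp [rhoPrime, hij]
  rw [sum_gram]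
  obtain ⟨z, hz⟩ : ∃ z : Option (Fin k) → ℝ, ∀ a, z a = ∑ i, x i * coef q i a := ⟨_, fun _ => rfl⟩
  have hz0 : z none = x none - ∑ i, x (some i) := by rw [hz, sum_mul_coef_none]
  have hz1 : ∀ j, z (some j) = (q - 1) * x (some j) := fun j => by rw [hz, sum_mul_coef_some]
  simp only [← hz, Fintype.sum_option, hz0, hz1, h3, Finset.sum_ite_eq,
    Finset.mem_univ, if_true, Finset.sum_add_distrib, h2]
  simp only [rhoPrime, mul_ite, mul_zero, h1, h1']
  rw [h0]
  ring

lemma gram_sub_blockPrime_posSemidef (m : Fin k) {q : ℝ} (hq : 1 < q) :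
    (gram q (rhoPrime m q) - blockPrime m q).PosSemidef := by
  refine posSemidef_of_sum_nonneg (fun i j => ?_) fun x => ?_
  · rw [Matrix.sub_apply, Matrix.sub_apply, gram_symm (rhoPrime_symm m q), blockPrime_symm]
  simp only [Matrix.sub_apply, mul_sub, Finset.sum_sub_distrib]
  rw [sum_gram_rhoPrime m hq, sum_blockPrime]
  have h := sq_sum_le_card_mul_sum_sq (s := Finset.univ.filter (fun i => i ≠ m))
    (f := fun i => x (some i))
  have hc : ((Finset.univ.filter (fun i : Fin k => i ≠ m)).card : ℝ) = k - 1 := by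
    rw [Finset.filter_ne', Finset.card_erase_of_mem (Finset.mem_univ m), Finset.card_univ,
      Fintype.card_fin, Nat.cast_sub (by have := m.2; omega)]
    simp
  rw [hc] at h
  linarith

end PrimeGapRuns

namespace PrimeGapRuns

open Finset

variable {ι : Type*} [Fintype ι] [DecidableEq ι] {k : ℕ}

/-- The primes carrying a nontrivial condition. -/
def supp (d : ι → Option (Fin k)) : Finset ι := univ.filter fun p => d p ≠ none

/-- The primes carrying the `i`-th condition. -/
def part (d : ι → Option (Fin k)) (i : Fin k) : Finset ι := univ.filter fun p => d p = some i

/-- The modulus of a system of conditions. -/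
def md (pr : ι → ℕ) (d : ι → Option (Fin k)) : ℕ := ∏ p ∈ supp d, pr p

/-- The reciprocal of Euler's function of a product of primes. -/
noncomputable def wt (pr : ι → ℕ) (A : Finset ι) : ℝ := ∏ p ∈ A, (1 / ((pr p : ℝ) - 1))

/-- The coefficient of a system of conditions in the sieve function. -/
noncomputable def lam (pr : ι → ℕ) (y : (ι → Option (Fin k)) → ℝ) (d : ι → Option (Fin k)) : ℝ :=
  ∑ s, y s * ∏ p, coef (pr p) (s p) (d p)

lemma coef_eq_zero_of_ne {q : ℝ} {o : Option (Fin k)} {j : Fin k} (h : o ≠ some j) :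
    coef q o (some j) = 0 := by
  rcases o with _ | i
  · rfl
  · simp only [coef]; rw [if_neg]; exact fun h' => h (by rw [h'])

lemma eq_of_prod_coef_ne_zero {pr : ι → ℕ} {s d : ι → Option (Fin k)}
    (h : ∏ p, coef (pr p) (s p) (d p) ≠ 0) {p : ι} (hp : d p ≠ none) : s p = d p := by
  obtain ⟨j, hj⟩ := Option.ne_none_iff_exists'.mp hp
  by_contra hne
  refine h (Finset.prod_eq_zero (mem_univ p) ?_)
  rw [hj] at hne ⊢
  exact coef_eq_zero_of_ne hne

lemma lam_eq_zero {pr : ι → ℕ} (hpr : ∀ p, (pr p).Prime) {R : ℕ} {y : (ι → Option (Fin k)) → ℝ}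
    (hy : ∀ s, R < md pr s → y s = 0) {d : ι → Option (Fin k)} (hd : R < md pr d) :
    lam pr y d = 0 := by
  refine Finset.sum_eq_zero fun s _ => ?_
  by_cases h : ∏ p, coef (pr p) (s p) (d p) = 0
  · rw [h, mul_zero]
  · rw [hy s, zero_mul]
    refine hd.trans_le (Finset.prod_le_prod_of_subset_of_one_le' (fun p hp => ?_)
      fun p _ _ => (hpr p).one_le)
    simp only [supp, mem_filter, mem_univ, true_and] at hp ⊢
    rw [eq_of_prod_coef_ne_zero h hp]; exact hp

lemma abs_lam_le {pr : ι → ℕ} (hpr : ∀ p, (pr p).Prime) {y : (ι → Option (Fin k)) → ℝ}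
    {C : ℝ} (hC : 0 ≤ C) (hy : ∀ s, |y s| ≤ C * wt pr (supp s)) (d : ι → Option (Fin k)) :
    |lam pr y d| ≤ C * ∏ p, (1 + (k : ℝ) / ((pr p : ℝ) - 1)) := by
  have hp1 : ∀ p, (0 : ℝ) < (pr p : ℝ) - 1 := fun p => by
    have : (1 : ℝ) < pr p := by exact_mod_cast (hpr p).one_lt
    linarith
  let c : ι → Option (Fin k) → ℝ := fun p o =>
    |coef (pr p) o (d p)| * if o = none then 1 else 1 / ((pr p : ℝ) - 1)
  have hwt : ∀ s : ι → Option (Fin k),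
      wt pr (supp s) = ∏ p, if s p = none then 1 else 1 / ((pr p : ℝ) - 1) := fun s => by
    rw [wt, supp, Finset.prod_filter]
    exact Finset.prod_congr rfl fun p _ => by by_cases h : s p = none <;> simp [h]
  calc |lam pr y d| ≤ ∑ s, |y s * ∏ p, coef (pr p) (s p) (d p)| := Finset.abs_sum_le_sum_abs _ _
    _ ≤ ∑ s : ι → Option (Fin k), C * ∏ p, c p (s p) := by
        refine Finset.sum_le_sum fun s _ => ?_
        rw [abs_mul, Finset.abs_prod, Finset.prod_mul_distrib, ← hwt, mul_comm, mul_left_comm]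
        exact mul_le_mul_of_nonneg_left (hy s) (Finset.prod_nonneg fun _ _ => abs_nonneg _)
    _ = C * ∏ p, ∑ o, c p o := by
        rw [← Finset.mul_sum, Finset.prod_univ_sum, Fintype.piFinset_univ]
    _ ≤ _ := by
        refine mul_le_mul_of_nonneg_left (Finset.prod_le_prod
          (fun p _ => Finset.sum_nonneg fun o _ => ?_) fun p _ => ?_) hC
        · have := hp1 p
          refine mul_nonneg (abs_nonneg _) ?_
          split_ifs <;> positivity
        · have hp := hp1 p
          have hk : 0 ≤ (k : ℝ) / ((pr p : ℝ) - 1) := by positivity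
          rcases hd : d p with _ | j
          · simp [c, hd, Fintype.sum_option, coef, div_eq_mul_inv]
          · simp only [c, hd, Fintype.sum_option, coef, abs_zero, zero_mul, zero_add, reduceCtorEq,
              if_false]
            rw [Finset.sum_eq_single j]
            · rw [if_pos rfl, abs_of_pos hp, mul_one_div_cancel hp.ne']; linarith
            · intro i _ hi; simp [hi]
            · simp

lemma card_filter_md_le {pr : ι → ℕ} (hpr : ∀ p, (pr p).Prime) (R : ℕ) :
    ((univ.filter fun d : ι → Option (Fin k) => md pr d ≤ R).card : ℝ) ≤
      R * ∏ p, (1 + (k : ℝ) / ((pr p : ℝ) - 1)) := by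
  have hp1 : ∀ p, (0 : ℝ) < (pr p : ℝ) - 1 := fun p => by
    have : (1 : ℝ) < pr p := by exact_mod_cast (hpr p).one_lt
    linarith
  have hmd : ∀ d : ι → Option (Fin k),
      (1 : ℝ) / md pr d = ∏ p, if d p = none then 1 else 1 / (pr p : ℝ) := fun s => by
    rw [md, supp, Nat.cast_prod, one_div, ← Finset.prod_inv_distrib, Finset.prod_filter]
    exact Finset.prod_congr rfl fun p _ => by by_cases h : s p = none <;> simp [h]
  have hpos : ∀ d : ι → Option (Fin k), 0 < md pr d := fun d =>
    Finset.prod_pos fun p _ => (hpr p).pos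
  calc ((univ.filter fun d : ι → Option (Fin k) => md pr d ≤ R).card : ℝ)
      = ∑ d with md (k := k) pr d ≤ R, (1 : ℝ) := by simp
    _ ≤ ∑ d with md (k := k) pr d ≤ R, (R : ℝ) * (1 / md pr d) := by
        refine Finset.sum_le_sum fun d hd => ?_
        have h1 : (0 : ℝ) < md pr d := by exact_mod_cast hpos d
        rw [mul_one_div, le_div_iff₀ h1, one_mul]
        exact_mod_cast (mem_filter.mp hd).2
    _ ≤ ∑ d : ι → Option (Fin k), (R : ℝ) * (1 / md pr d) :=
        Finset.sum_le_sum_of_subset_of_nonneg (filter_subset _ _) fun _ _ _ => by positivity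
    _ = R * ∏ p, ∑ o : Option (Fin k), (if o = none then 1 else 1 / (pr p : ℝ)) := by
        rw [← Finset.mul_sum, Finset.prod_univ_sum, Fintype.piFinset_univ]
        simp only [hmd]
    _ ≤ _ := by
        refine mul_le_mul_of_nonneg_left (Finset.prod_le_prod (fun p _ => ?_) fun p _ => ?_)
          (Nat.cast_nonneg _)
        · exact Finset.sum_nonneg fun o _ => by split_ifs <;> positivity
        · have hp := hp1 p
          simp only [Fintype.sum_option, if_true, reduceCtorEq, if_false, Finset.sum_const,
            Finset.card_univ, Fintype.card_fin, nsmul_eq_mul, mul_one_div]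
          gcongr
          linarith

end PrimeGapRuns

namespace PrimeGapRuns

open Finset

lemma sum_le_sum_of_injOn {α β : Type*} [DecidableEq β] {s : Finset α} {t : Finset β} {f : α → ℝ}
    {g : β → ℝ} (e : α → β) (he : ∀ a ∈ s, e a ∈ t) (hinj : Set.InjOn e s)
    (hfg : ∀ a ∈ s, f a ≤ g (e a)) (hg : ∀ b ∈ t, 0 ≤ g b) : ∑ a ∈ s, f a ≤ ∑ b ∈ t, g b :=
  calc ∑ a ∈ s, f a ≤ ∑ a ∈ s, g (e a) := Finset.sum_le_sum hfg
    _ = ∑ b ∈ s.image e, g b := (Finset.sum_image hinj).symm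
    _ ≤ _ := Finset.sum_le_sum_of_subset_of_nonneg (Finset.image_subset_iff.mpr he)
        fun b hb _ => hg b hb

/-- The density of the integers coprime to `W`. -/
noncomputable def dens (W : ℕ) : ℝ := (W.totient : ℝ) / W

/-- The harmonic sum over integers coprime to `W`. -/
noncomputable def fullSum (W Y : ℕ) : ℝ := ∑ c ∈ Ioc 0 Y with W.Coprime c, 1 / (c : ℝ)

lemma exists_abs_fullSum_sub_le {W : ℕ} (hW : 0 < W) :
    ∃ C : ℝ, 0 ≤ C ∧ ∀ Y : ℕ, 1 ≤ Y → |fullSum W Y - dens W * Real.log Y| ≤ C := by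
  have hW' : (0 : ℝ) < W := by exact_mod_cast hW
  have hd0 : 0 ≤ dens W := by unfold dens; positivity
  have hd1 : dens W ≤ 1 := by
    unfold dens; rw [div_le_one hW']; exact_mod_cast Nat.totient_le W
  let ψ : ℕ → ℂ := fun n => (((if W.Coprime n then 1 else 0) - dens W : ℝ) : ℂ)
  have hψ : BoundedSums ψ W := by
    refine boundedSums_of_periodic hW (fun n => ?_) ?_ fun n => ?_
    · simp only [ψ, Nat.coprime_add_self_right]
    · simp only [ψ]
      rw [← Complex.ofReal_sum, Finset.sum_sub_distrib, Finset.sum_boole, ← Nat.totient_eq_card_coprime]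
      simp [dens]; field_simp; simp [hW.ne']
    · simp only [ψ, Complex.norm_real, Real.norm_eq_abs]
      split_ifs <;> rw [abs_le] <;> constructor <;> linarith
  refine ⟨W * (5 * 1 / ((1 : ℕ) : ℝ)) + 1, by positivity, fun Y hY => ?_⟩
  have h1 := norm_sum_smooth_le hψ (G := fun _ => 1) (B := 1) (differentiable_const _)
    (fun t => by simp) (fun t => by simp) (a := 1) (b := Y + 1) le_rfl
  have hI : Ico 1 (Y + 1) = Ioc 0 Y := by ext; simp; omega
  have e : ∑ n ∈ Ico 1 (Y + 1), ψ n * ((1 / n : ℝ) : ℂ) =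
      ((fullSum W Y - dens W * ∑ n ∈ Ioc 0 Y, 1 / (n : ℝ) : ℝ) : ℂ) := by
    rw [hI, fullSum, Finset.sum_filter, Finset.mul_sum, ← Finset.sum_sub_distrib,
      Complex.ofReal_sum]
    refine Finset.sum_congr rfl fun n _ => ?_
    simp only [ψ]
    rw [← Complex.ofReal_mul]
    congr 1
    split_ifs <;> ring
  rw [e, Complex.norm_real, Real.norm_eq_abs] at h1
  have hu := sum_Ioc_one_div_le Y
  have hl : Real.log Y ≤ ∑ n ∈ Ioc 0 Y, 1 / (n : ℝ) := by
    have h := log_add_one_le_harmonic Y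
    rw [harmonic_eq_sum_Icc] at h
    push_cast at h
    have e : Ioc 0 Y = Icc 1 Y := by ext; simp [Nat.succ_le_iff]
    rw [e]
    simp only [one_div]
    refine le_trans (Real.log_le_log (by exact_mod_cast hY) (by linarith)) h
  rw [abs_le] at h1 ⊢
  have h2 : dens W * (∑ n ∈ Ioc 0 Y, 1 / (n : ℝ) - Real.log Y) ≤ 1 :=
    mul_le_one₀ hd1 (by linarith) (by linarith)
  have h3 : 0 ≤ dens W * (∑ n ∈ Ioc 0 Y, 1 / (n : ℝ) - Real.log Y) :=
    mul_nonneg hd0 (by linarith)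
  constructor <;> linarith [h1.1, h1.2]

lemma sum_one_div_sq_le {W : ℕ} (hW : 6 ∣ W) (Y : ℕ) :
    ∑ b ∈ Ioc 0 Y with W.Coprime b, 1 / (b : ℝ) ^ 2 ≤ 5 / 4 := by
  have h6 : ∀ b, W.Coprime b → b ≠ 0 ∧ b ≠ 2 ∧ b ≠ 3 ∧ b ≠ 4 := fun b hb => by
    have := Nat.Coprime.coprime_dvd_left hW hb
    refine ⟨?_, ?_, ?_, ?_⟩ <;> rintro rfl <;> revert this <;> decide
  have key : ∀ Y : ℕ, 4 ≤ Y → ∑ b ∈ Ioc 0 Y with W.Coprime b, 1 / (b : ℝ) ^ 2 ≤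
      5 / 4 - 1 / (Y : ℝ) := by
    intro Y hY
    induction Y, hY using Nat.le_induction with
    | base =>
      calc ∑ b ∈ Ioc 0 4 with W.Coprime b, 1 / (b : ℝ) ^ 2 ≤ ∑ b ∈ {1}, 1 / ((b : ℕ) : ℝ) ^ 2 := by
            refine Finset.sum_le_sum_of_subset_of_nonneg (fun b hb => ?_) fun _ _ _ => by positivity
            rw [mem_filter, mem_Ioc] at hb
            have := h6 b hb.2
            rw [mem_singleton]; omega
        _ ≤ _ := by norm_num
    | succ Y hY ih =>
      have hY0 : (0 : ℝ) < Y := by exact_mod_cast (by omega : 0 < Y)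
      have e : 1 / ((Y + 1 : ℕ) : ℝ) ^ 2 ≤ 1 / (Y : ℝ) - 1 / ((Y + 1 : ℕ) : ℝ) := by
        push_cast
        rw [div_sub_div _ _ hY0.ne' (by positivity), div_le_div_iff₀ (by positivity) (by positivity)]
        nlinarith
      have hpos : 0 ≤ 1 / ((Y + 1 : ℕ) : ℝ) ^ 2 := by positivity
      rw [Finset.sum_filter] at ih ⊢
      rw [Finset.sum_Ioc_succ_top (Nat.zero_le _)]
      split_ifs <;> linarith
  rcases le_total 4 Y with h | h
  · refine (key Y h).trans ?_
    have : 0 ≤ 1 / (Y : ℝ) := by positivity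
    linarith
  · refine (Finset.sum_le_sum_of_subset_of_nonneg (Finset.filter_subset_filter _
      (Finset.Ioc_subset_Ioc_right h)) fun _ _ _ => by positivity).trans ((key 4 le_rfl).trans ?_)
    norm_num

lemma fullSum_le_squarefree {W : ℕ} (hW : 6 ∣ W) (Y : ℕ) :
    fullSum W Y ≤ 5 / 4 * ∑ a ∈ Ioc 0 Y with Squarefree a ∧ W.Coprime a, 1 / (a : ℝ) := by
  have hex : ∀ c : ℕ, 0 < c → ∃ x : ℕ × ℕ, x.2 ^ 2 * x.1 = c ∧ Squarefree x.1 := fun c hc => by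
    obtain ⟨a, b, _, _, h, hs⟩ := Nat.sq_mul_squarefree_of_pos hc
    exact ⟨(a, b), h, hs⟩
  choose! e he hs using hex
  calc fullSum W Y ≤ ∑ x ∈ (Ioc 0 Y).filter (fun a => Squarefree a ∧ W.Coprime a) ×ˢ
        (Ioc 0 Y).filter (fun b => W.Coprime b), 1 / (x.1 : ℝ) * (1 / (x.2 : ℝ) ^ 2) := by
        refine sum_le_sum_of_injOn e (fun c hc => ?_) (fun c hc c' hc' h => ?_) (fun c hc => ?_)
          fun _ _ => by positivity
        · rw [mem_filter, mem_Ioc] at hc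
          have h1 := he c hc.1.1
          have hdv1 : (e c).1 ∣ c := ⟨_, by rw [mul_comm]; exact h1.symm⟩
          have hdv2 : (e c).2 ∣ c := (dvd_pow_self _ two_ne_zero).trans ⟨_, h1.symm⟩
          simp only [mem_product, mem_filter, mem_Ioc]
          exact ⟨⟨⟨Nat.pos_of_dvd_of_pos hdv1 hc.1.1, (Nat.le_of_dvd hc.1.1 hdv1).trans hc.1.2⟩,
            hs c hc.1.1, hc.2.coprime_dvd_right hdv1⟩,
            ⟨Nat.pos_of_dvd_of_pos hdv2 hc.1.1, (Nat.le_of_dvd hc.1.1 hdv2).trans hc.1.2⟩,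
            hc.2.coprime_dvd_right hdv2⟩
        · have h1 := (mem_Ioc.mp (mem_filter.mp hc).1).1
          have h2 := (mem_Ioc.mp (mem_filter.mp hc').1).1
          rw [← he c h1, ← he c' h2, h]
        · have h1 := (mem_Ioc.mp (mem_filter.mp hc).1).1
          rw [div_mul_div_comm, one_mul, ← Nat.cast_pow, ← Nat.cast_mul, mul_comm (e c).1, he c h1]
    _ = (∑ a ∈ Ioc 0 Y with Squarefree a ∧ W.Coprime a, 1 / (a : ℝ)) *
        ∑ b ∈ Ioc 0 Y with W.Coprime b, 1 / (b : ℝ) ^ 2 := by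
        rw [Finset.sum_product, Finset.sum_mul_sum]
    _ ≤ _ := by
        rw [mul_comm (5 / 4 : ℝ)]
        exact mul_le_mul_of_nonneg_left (sum_one_div_sq_le hW Y)
          (Finset.sum_nonneg fun _ _ => by positivity)

lemma sum_squarefree_le {W p : ℕ} (hp : p.Prime) (hp5 : 5 ≤ p) (Y : ℕ) :
    ∑ a ∈ Ioc 0 Y with Squarefree a ∧ W.Coprime a, 1 / (a : ℝ) ≤
      6 / 5 * ∑ a ∈ Ioc 0 Y with (Squarefree a ∧ W.Coprime a) ∧ ¬ p ∣ a, 1 / (a : ℝ) := by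
  have hp0 : (0 : ℝ) < p := by exact_mod_cast hp.pos
  set s := (Ioc 0 Y).filter fun a => (Squarefree a ∧ W.Coprime a) ∧ ¬ p ∣ a
  have h1 : ∑ a ∈ Ioc 0 Y with (Squarefree a ∧ W.Coprime a) ∧ p ∣ a, 1 / (a : ℝ) ≤
      ∑ a ∈ s, 1 / (p : ℝ) * (1 / (a : ℝ)) := by
    refine sum_le_sum_of_injOn (fun a => a / p) (fun a ha => ?_) (fun a ha b hb h => ?_)
      (fun a ha => ?_) fun _ _ => by positivity
    · rw [mem_filter, mem_Ioc] at ha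
      obtain ⟨⟨ha0, haY⟩, ⟨hsq, hcop⟩, c, rfl⟩ := ha
      rw [Nat.mul_div_cancel_left _ hp.pos]
      simp only [s, mem_filter, mem_Ioc]
      refine ⟨⟨Nat.pos_of_mul_pos_left ha0, (Nat.le_mul_of_pos_left c hp.pos).trans haY⟩,
        ⟨hsq.of_mul_right, hcop.coprime_dvd_right (Dvd.intro_left _ rfl)⟩, fun hpc => ?_⟩
      exact hp.one_lt.ne' (Nat.isUnit_iff.mp (hsq p (mul_dvd_mul_left p hpc)))
    · have ha' := (mem_filter.mp ha).2.2
      have hb' := (mem_filter.mp hb).2.2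
      simp only at h
      rw [← Nat.div_mul_cancel ha', ← Nat.div_mul_cancel hb', h]
    · have ha' := (mem_filter.mp ha).2.2
      rw [Nat.cast_div ha' hp0.ne', div_mul_div_comm, one_mul, mul_div_cancel₀ _ hp0.ne']
  have h2 : 1 / (p : ℝ) ≤ 1 / 5 := one_div_le_one_div_of_le (by norm_num) (by exact_mod_cast hp5)
  have h3 : 0 ≤ ∑ a ∈ s, 1 / (a : ℝ) := Finset.sum_nonneg fun _ _ => by positivity
  rw [← Finset.mul_sum] at h1
  have h4 := mul_le_mul_of_nonneg_right h2 h3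
  rw [← Finset.sum_filter_add_sum_filter_not _ (fun a => p ∣ a), Finset.filter_filter,
    Finset.filter_filter]
  linarith

section Volume

variable {ι : Type*} [Fintype ι] [DecidableEq ι]

/-- The logarithm of a product of primes. -/
noncomputable def lg (pr : ι → ℕ) (A : Finset ι) : ℝ := ∑ p ∈ A, Real.log (pr p)

/-- The total weight of the products of primes below a given logarithmic height. -/
noncomputable def vol (pr : ι → ℕ) (t : ℝ) : ℝ := ∑ A with lg pr A < t, wt pr A

lemma lg_eq_log {pr : ι → ℕ} (hpr : ∀ p, (pr p).Prime) (A : Finset ι) :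
    lg pr A = Real.log ((∏ p ∈ A, pr p : ℕ) : ℝ) := by
  rw [lg, Nat.cast_prod, Real.log_prod]
  exact fun p _ => by exact_mod_cast (hpr p).ne_zero

lemma one_lt_pr {pr : ι → ℕ} (hpr : ∀ p, (pr p).Prime) (p : ι) : (0 : ℝ) < (pr p : ℝ) - 1 := by
  have : (1 : ℝ) < pr p := by exact_mod_cast (hpr p).one_lt
  linarith

lemma wt_nonneg {pr : ι → ℕ} (hpr : ∀ p, (pr p).Prime) (A : Finset ι) : 0 ≤ wt pr A :=
  Finset.prod_nonneg fun p _ => by have := one_lt_pr hpr p; positivity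

lemma lg_nonneg {pr : ι → ℕ} (A : Finset ι) : 0 ≤ lg pr A :=
  Finset.sum_nonneg fun _ _ => Real.log_natCast_nonneg _

lemma dvd_prod_iff {pr : ι → ℕ} (hpr : ∀ p, (pr p).Prime) (hinj : Function.Injective pr)
    (A : Finset ι) (p : ι) : pr p ∣ ∏ q ∈ A, pr q ↔ p ∈ A := by
  refine ⟨fun h => ?_, fun h => Finset.dvd_prod_of_mem _ h⟩
  obtain ⟨q, hq, hpq⟩ := (hpr p).prime.exists_mem_finset_dvd h
  rw [hinj ((Nat.prime_dvd_prime_iff_eq (hpr p) (hpr q)).mp hpq)]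
  exact hq

lemma prod_injective {pr : ι → ℕ} (hpr : ∀ p, (pr p).Prime) (hinj : Function.Injective pr) :
    Function.Injective fun A : Finset ι => ∏ q ∈ A, pr q := fun A B h => by
  ext p
  rw [← dvd_prod_iff hpr hinj, ← dvd_prod_iff hpr hinj]
  simp only at h
  rw [h]

lemma sum_squarefree_le_vol {pr : ι → ℕ} (hpr : ∀ p, (pr p).Prime) {W p₀ : ℕ} {R : ℝ}
    (hall : ∀ q : ℕ, q.Prime → ¬ q ∣ W → q ≠ p₀ → (q : ℝ) ≤ R → ∃ i, pr i = q)
    (hinj : Function.Injective pr) {Y : ℕ} (hY : (Y : ℝ) ≤ R) {t : ℝ} (ht : Y < Real.exp t) :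
    ∑ a ∈ Ioc 0 Y with (Squarefree a ∧ W.Coprime a) ∧ ¬ p₀ ∣ a, 1 / (a : ℝ) ≤ vol pr t := by
  have key : ∀ a ∈ (Ioc 0 Y).filter (fun a => (Squarefree a ∧ W.Coprime a) ∧ ¬ p₀ ∣ a),
      ∏ p with pr p ∣ a, pr p = a := fun a ha => by
    obtain ⟨haY, ⟨hsq, hcop⟩, hp₀⟩ := mem_filter.mp ha
    rw [mem_Ioc] at haY
    conv_rhs => rw [← Nat.prod_primeFactors_of_squarefree hsq]
    rw [← Finset.prod_image (f := fun q => q) (g := pr) (s := univ.filter fun p => pr p ∣ a)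
      (hinj.injOn)]
    refine Finset.prod_congr ?_ fun _ _ => rfl
    ext q
    simp only [mem_image, mem_filter, mem_univ, true_and, Nat.mem_primeFactors]
    refine ⟨?_, fun ⟨hq, hqa, h0⟩ => ?_⟩
    · rintro ⟨p, hp, rfl⟩
      exact ⟨hpr p, hp, haY.1.ne'⟩
    · obtain ⟨i, hi⟩ := hall q hq (fun h => hq.one_lt.ne' (Nat.dvd_one.mp (hcop ▸ Nat.dvd_gcd h hqa)))
        (fun h => hp₀ (h ▸ hqa)) (le_trans (by exact_mod_cast (Nat.le_of_dvd haY.1 hqa).trans haY.2) hY)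
      exact ⟨i, hi ▸ hqa, hi⟩
  refine sum_le_sum_of_injOn (fun a => univ.filter fun p => pr p ∣ a) (fun a ha => ?_)
    (fun a ha b hb h => ?_) (fun a ha => ?_) fun A _ => wt_nonneg hpr A
  · have haY := mem_Ioc.mp (mem_filter.mp ha).1
    rw [mem_filter, lg_eq_log hpr, key a ha]
    refine ⟨mem_univ _, ?_⟩
    rw [Real.log_lt_iff_lt_exp (by exact_mod_cast haY.1)]
    exact lt_of_le_of_lt (by exact_mod_cast haY.2) ht
  · simp only at h
    rw [← key a ha, ← key b hb, h]
  · conv_lhs => rw [← key a ha]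
    rw [wt, Nat.cast_prod, one_div, ← Finset.prod_inv_distrib]
    refine Finset.prod_le_prod (fun _ _ => by positivity) fun p _ => ?_
    have := one_lt_pr hpr p
    rw [← one_div]
    exact one_div_le_one_div_of_le this (by linarith)

lemma vol_le_fullSum {pr : ι → ℕ} (hpr : ∀ p, (pr p).Prime) {W : ℕ}
    (hcop : ∀ p, W.Coprime (pr p)) (hinj : Function.Injective pr)
    (hsum : ∏ p, (1 + 1 / ((pr p : ℝ) * ((pr p : ℝ) - 1))) ≤ 2) {t : ℝ} :
    vol pr t ≤ 2 * fullSum W ⌊Real.exp t⌋₊ := by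
  have hpos : ∀ A : Finset ι, 0 < ∏ p ∈ A, pr p := fun A => Finset.prod_pos fun p _ => (hpr p).pos
  let f : Finset ι → ℝ := fun B => ∏ p ∈ B, (1 / ((pr p : ℝ) * ((pr p : ℝ) - 1)))
  let g : Finset ι → ℝ := fun C => 1 / ((∏ p ∈ C, pr p : ℕ) : ℝ)
  have hf0 : ∀ B, 0 ≤ f B := fun B => Finset.prod_nonneg fun p _ => by
    have := one_lt_pr hpr p; positivity
  have hg0 : ∀ C, 0 ≤ g C := fun C => by positivity
  have hwt : ∀ A, wt pr A = ∑ B ∈ A.powerset, f B * g (A \ B) := fun A => by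
    have h1 : wt pr A = ∏ p ∈ A, (1 / ((pr p : ℝ) * ((pr p : ℝ) - 1)) + 1 / (pr p : ℝ)) := by
      refine Finset.prod_congr rfl fun p _ => ?_
      have h2 := (one_lt_pr hpr p).ne'
      have h3 : (pr p : ℝ) ≠ 0 := by exact_mod_cast (hpr p).ne_zero
      field_simp; ring
    rw [h1, Finset.prod_add]
    refine Finset.sum_congr rfl fun B _ => ?_
    simp only [f, g]
    rw [Nat.cast_prod, one_div (∏ p ∈ A \ B, (pr p : ℝ)), ← Finset.prod_inv_distrib]
    simp only [one_div]
  have hlt : ∀ A : Finset ι, lg pr A < t → ∏ p ∈ A, pr p ≤ ⌊Real.exp t⌋₊ := fun A hA => by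
    rw [lg_eq_log hpr, Real.log_lt_iff_lt_exp (by exact_mod_cast hpos A)] at hA
    exact Nat.le_floor hA.le
  calc vol pr t ≤ ∑ x ∈ (univ : Finset (Finset ι)) ×ˢ univ.filter (fun C => lg pr C < t),
        f x.1 * g x.2 := by
        simp only [vol, hwt]
        rw [Finset.sum_sigma']
        refine sum_le_sum_of_injOn (fun x => (x.2, x.1 \ x.2)) (fun x hx => ?_)
          (fun x hx y hy h => ?_) (fun x hx => le_rfl) fun x _ => mul_nonneg (hf0 _) (hg0 _)
        · rw [mem_sigma, mem_filter] at hx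
          rw [mem_product, mem_filter]
          refine ⟨mem_univ _, mem_univ _, lt_of_le_of_lt ?_ hx.1.2⟩
          exact Finset.sum_le_sum_of_subset_of_nonneg Finset.sdiff_subset
            fun _ _ _ => Real.log_natCast_nonneg _
        · have hx' := (mem_powerset.mp (mem_sigma.mp hx).2)
          have hy' := (mem_powerset.mp (mem_sigma.mp hy).2)
          obtain ⟨x1, x2⟩ := x
          obtain ⟨y1, y2⟩ := y
          simp only [Prod.mk.injEq] at h hx' hy'
          obtain ⟨rfl, h⟩ := h
          rw [← Finset.sdiff_union_of_subset hx', h, Finset.sdiff_union_of_subset hy']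
    _ = (∏ p, (1 + 1 / ((pr p : ℝ) * ((pr p : ℝ) - 1)))) * ∑ C with lg pr C < t, g C := by
        rw [Finset.sum_product, ← Finset.sum_mul_sum, Finset.prod_one_add, Finset.powerset_univ]
    _ ≤ 2 * fullSum W ⌊Real.exp t⌋₊ := by
        refine mul_le_mul hsum ?_ (Finset.sum_nonneg fun C _ => hg0 C) (by norm_num)
        refine sum_le_sum_of_injOn (fun C => ∏ p ∈ C, pr p) (fun C hC => ?_)
          (prod_injective hpr hinj).injOn (fun C _ => le_rfl) fun _ _ => by positivity
        rw [mem_filter, mem_Ioc]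
        exact ⟨⟨hpos C, hlt C (mem_filter.mp hC).2⟩, Nat.Coprime.prod_right fun p _ => hcop p⟩

end Volume

end PrimeGapRuns

namespace PrimeGapRuns

open Finset

/-- A decreasing step function, roughly `z / t` on `[z, 16 ^ J z]`. -/
noncomputable def gfun (J : ℕ) (z t : ℝ) : ℝ :=
  ∑ j ∈ range J, (1 / 16 : ℝ) ^ j * if t < 16 ^ (j + 1) * z then 1 else 0

lemma gfun_succ (J : ℕ) (z t : ℝ) :
    gfun (J + 1) z t = (if t < 16 * z then 1 else 0) + 1 / 16 * gfun J (16 * z) t := by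
  rw [gfun, Finset.sum_range_succ', add_comm, gfun, Finset.mul_sum]
  congr 1
  · simp
  · refine Finset.sum_congr rfl fun j _ => ?_
    rw [pow_succ (16 : ℝ) (j + 1), mul_assoc ((16 : ℝ) ^ (j + 1))]
    ring

lemma gfun_nonneg (J : ℕ) (z t : ℝ) : 0 ≤ gfun J z t :=
  Finset.sum_nonneg fun _ _ => mul_nonneg (by positivity) (by split_ifs <;> norm_num)

lemma gfun_anti (J : ℕ) (z : ℝ) {s t : ℝ} (hst : s ≤ t) : gfun J z t ≤ gfun J z s := by
  refine Finset.sum_le_sum fun j _ => mul_le_mul_of_nonneg_left ?_ (by positivity)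
  by_cases h : t < 16 ^ (j + 1) * z
  · rw [if_pos h, if_pos (hst.trans_lt h)]
  · rw [if_neg h]; split_ifs <;> norm_num

lemma gfun_le (J : ℕ) (z t : ℝ) : gfun J z t ≤ 16 / 15 := by
  induction J generalizing z with
  | zero => norm_num [gfun]
  | succ J ih =>
    rw [gfun_succ]
    have := ih (16 * z)
    split_ifs <;> linarith

lemma gfun_eq_zero {J : ℕ} {z t : ℝ} (hz : 0 ≤ z) (ht : 16 ^ J * z ≤ t) : gfun J z t = 0 := by
  refine Finset.sum_eq_zero fun j hj => ?_
  rw [if_neg, mul_zero]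
  rw [not_lt]
  refine le_trans (mul_le_mul_of_nonneg_right ?_ hz) ht
  exact pow_le_pow_right₀ (by norm_num) (mem_range.mp hj)

lemma one_le_gfun {J : ℕ} (hJ : 1 ≤ J) {z t : ℝ} (ht : t < 16 * z) : 1 ≤ gfun J z t := by
  obtain ⟨J, rfl⟩ : ∃ J', J = J' + 1 := ⟨J - 1, by omega⟩
  rw [gfun_succ, if_pos ht]
  have := gfun_nonneg J (16 * z) t
  linarith

lemma gfun_sq_le (J : ℕ) (z t : ℝ) : gfun J z t ^ 2 ≤
    2 * ∑ j ∈ range J, (1 / 256 : ℝ) ^ j * if t < 16 ^ (j + 1) * z then 1 else 0 := by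
  induction J generalizing z with
  | zero => simp [gfun]
  | succ J ih =>
    have e : ∑ j ∈ range (J + 1), (1 / 256 : ℝ) ^ j * (if t < 16 ^ (j + 1) * z then 1 else 0) =
        (if t < 16 * z then 1 else 0) + 1 / 256 *
        ∑ j ∈ range J, (1 / 256 : ℝ) ^ j * if t < 16 ^ (j + 1) * (16 * z) then 1 else 0 := by
      rw [Finset.sum_range_succ', add_comm, Finset.mul_sum]
      congr 1
      · simp
      · refine Finset.sum_congr rfl fun j _ => ?_
        rw [pow_succ (16 : ℝ) (j + 1), mul_assoc ((16 : ℝ) ^ (j + 1))]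
        ring
    rw [e, gfun_succ]
    have h0 := gfun_nonneg J (16 * z) t
    have h1 := gfun_le J (16 * z) t
    have h2 := ih (16 * z)
    have h3 : 0 ≤ ∑ j ∈ range J,
        (1 / 256 : ℝ) ^ j * if t < 16 ^ (j + 1) * (16 * z) then 1 else 0 :=
      Finset.sum_nonneg fun _ _ => mul_nonneg (by positivity) (by split_ifs <;> norm_num)
    split_ifs <;> nlinarith

section

variable {ι : Type*} [Fintype ι] [DecidableEq ι]

lemma sum_one_div_mul_pred_le {pr : ι → ℕ} (hinj : Function.Injective pr) {D : ℕ} (hD : 1 ≤ D)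
    (hDp : ∀ p, D < pr p) : ∑ p, 1 / ((pr p : ℝ) * ((pr p : ℝ) - 1)) ≤ 1 / (D : ℝ) := by
  have key : ∀ N, D ≤ N → ∑ n ∈ Ioc D N, 1 / ((n : ℝ) * ((n : ℝ) - 1)) ≤ 1 / (D : ℝ) - 1 / N := by
    intro N hN
    induction N, hN using Nat.le_induction with
    | base => simp
    | succ N hN ih =>
      have hN0 : (0 : ℝ) < N := by exact_mod_cast (by omega : 0 < N)
      rw [Finset.sum_Ioc_succ_top hN]
      have : 1 / (((N + 1 : ℕ) : ℝ) * (((N + 1 : ℕ) : ℝ) - 1)) = 1 / (N : ℝ) - 1 / ((N + 1 : ℕ) : ℝ) := by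
        push_cast; rw [add_sub_cancel_right]; field_simp; ring
      linarith
  set N := D + ∑ p, pr p
  have hN := key N (Nat.le_add_right _ _)
  have h0 : 0 ≤ 1 / (N : ℝ) := by positivity
  refine le_trans (sum_le_sum_of_injOn pr (t := Ioc D N) (fun p _ => ?_) hinj.injOn
    (fun p _ => le_rfl) fun n hn => ?_) (by linarith)
  · rw [mem_Ioc]
    exact ⟨hDp p, (Finset.single_le_sum (f := pr) (fun _ _ => Nat.zero_le _) (mem_univ p)).trans
      (Nat.le_add_left _ _)⟩
  · have : (1 : ℝ) ≤ n := by exact_mod_cast (by have := (mem_Ioc.mp hn).1; omega : 1 ≤ n)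
    have : (0 : ℝ) ≤ n - 1 := by linarith
    positivity

lemma prod_one_add_le_two {pr : ι → ℕ} (hinj : Function.Injective pr) {D : ℕ} (hD : 2 ≤ D)
    (hDp : ∀ p, D < pr p) : ∏ p, (1 + 1 / ((pr p : ℝ) * ((pr p : ℝ) - 1))) ≤ 2 := by
  have h1 : ∏ p, (1 + 1 / ((pr p : ℝ) * ((pr p : ℝ) - 1))) ≤
      Real.exp (∑ p, 1 / ((pr p : ℝ) * ((pr p : ℝ) - 1))) := by
    rw [Real.exp_sum]
    refine Finset.prod_le_prod (fun p _ => ?_) fun p _ => by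
      rw [add_comm]; exact Real.add_one_le_exp _
    have : (1 : ℝ) ≤ pr p := by exact_mod_cast (by have := hDp p; omega : 1 ≤ pr p)
    have : (0 : ℝ) ≤ pr p - 1 := by linarith
    positivity
  have h2 := sum_one_div_mul_pred_le hinj (by omega) hDp
  have h3 : 1 / (D : ℝ) ≤ 1 / 2 := one_div_le_one_div_of_le (by norm_num) (by exact_mod_cast hD)
  refine h1.trans ((Real.exp_le_exp.mpr (h2.trans h3)).trans ?_)
  have := Real.exp_one_lt_d9
  have e : Real.exp (1 / 2) ^ 2 = Real.exp 1 := by rw [← Real.exp_nat_mul]; norm_num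
  nlinarith [Real.exp_pos (1 / 2)]

end

section

variable {ι : Type*} [Fintype ι] [DecidableEq ι]

/-- The total mass of the squared profile. -/
noncomputable def massSq (pr : ι → ℕ) (J : ℕ) (z : ℝ) : ℝ :=
  ∑ A, gfun J z (lg pr A) ^ 2 * wt pr A

/-- The total mass of the profile. -/
noncomputable def massOne (pr : ι → ℕ) (J : ℕ) (z : ℝ) : ℝ :=
  ∑ A, gfun J z (lg pr A) * wt pr A

lemma sum_step_mul_wt (pr : ι → ℕ) (J : ℕ) (z : ℝ) (c : ℕ → ℝ) :
    ∑ A, (∑ j ∈ range J, c j * if lg pr A < 16 ^ (j + 1) * z then 1 else 0) * wt pr A =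
      ∑ j ∈ range J, c j * vol pr (16 ^ (j + 1) * z) := by
  simp only [Finset.sum_mul, vol, Finset.mul_sum, Finset.sum_filter]
  rw [Finset.sum_comm]
  refine Finset.sum_congr rfl fun j _ => Finset.sum_congr rfl fun A _ => ?_
  split_ifs <;> ring

lemma massOne_ge {pr : ι → ℕ} {J : ℕ} {z κ : ℝ}
    (hV : ∀ j < J, κ * (16 ^ (j + 1) * z) / 2 ≤ vol pr (16 ^ (j + 1) * z)) :
    8 * J * (κ * z) ≤ massOne pr J z := by
  rw [massOne]
  simp only [gfun]
  rw [sum_step_mul_wt]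
  calc 8 * J * (κ * z) = ∑ j ∈ range J, 8 * (κ * z) := by simp; ring
    _ ≤ _ := Finset.sum_le_sum fun j hj => by
      refine le_trans (le_of_eq ?_) (mul_le_mul_of_nonneg_left (hV j (mem_range.mp hj))
        (by positivity))
      rw [pow_succ, one_div, inv_pow]
      field_simp
      ring

lemma massSq_le {pr : ι → ℕ} (hpr : ∀ p, (pr p).Prime) {J : ℕ} {z κ : ℝ} (hz : 0 ≤ κ * z)
    (hV : ∀ j < J, vol pr (16 ^ (j + 1) * z) ≤ 3 * (κ * (16 ^ (j + 1) * z))) :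
    massSq pr J z ≤ 103 * (κ * z) := by
  have hgeo : ∑ j ∈ range J, (1 / 16 : ℝ) ^ j ≤ 16 / 15 := by
    rw [geom_sum_eq (by norm_num)]
    have : (0 : ℝ) ≤ (1 / 16) ^ J := by positivity
    rw [div_le_iff_of_neg (by norm_num)]; linarith
  calc massSq pr J z ≤ ∑ A, (2 * ∑ j ∈ range J, (1 / 256 : ℝ) ^ j *
        if lg pr A < 16 ^ (j + 1) * z then 1 else 0) * wt pr A :=
        Finset.sum_le_sum fun A _ => mul_le_mul_of_nonneg_right (gfun_sq_le _ _ _) (wt_nonneg hpr A)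
    _ = 2 * ∑ j ∈ range J, (1 / 256 : ℝ) ^ j * vol pr (16 ^ (j + 1) * z) := by
        rw [← sum_step_mul_wt, Finset.mul_sum]
        exact Finset.sum_congr rfl fun A _ => by ring
    _ ≤ 2 * ∑ j ∈ range J, (1 / 256 : ℝ) ^ j * (3 * (κ * (16 ^ (j + 1) * z))) := by
        gcongr with j hj
        exact hV j (mem_range.mp hj)
    _ = 96 * (κ * z) * ∑ j ∈ range J, (1 / 16 : ℝ) ^ j := by
        rw [Finset.mul_sum, Finset.mul_sum]
        refine Finset.sum_congr rfl fun j _ => ?_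
        have : (1 / 256 : ℝ) ^ j * 16 ^ j = (1 / 16) ^ j := by rw [← mul_pow]; norm_num
        rw [← this, pow_succ]; ring
    _ ≤ 96 * (κ * z) * (16 / 15) := by gcongr
    _ ≤ _ := by linarith

lemma massSq_ge {pr : ι → ℕ} (hpr : ∀ p, (pr p).Prime) {J : ℕ} (hJ : 1 ≤ J) {z : ℝ} :
    vol pr (16 * z) ≤ massSq pr J z := by
  rw [vol, massSq, Finset.sum_filter]
  refine Finset.sum_le_sum fun A _ => ?_
  split_ifs with h
  · have := one_le_gfun hJ h
    exact le_mul_of_one_le_left (wt_nonneg hpr A) (by nlinarith)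
  · exact mul_nonneg (sq_nonneg _) (wt_nonneg hpr A)

lemma sum_gfun_sq_mul_lg_le {pr : ι → ℕ} (hpr : ∀ p, (pr p).Prime) {J : ℕ} {z κ : ℝ} (hz : 0 ≤ z)
    (hV : ∀ j < J, vol pr (16 ^ (j + 1) * z) ≤ 3 * (κ * (16 ^ (j + 1) * z))) :
    ∑ A, gfun J z (lg pr A) ^ 2 * wt pr A * lg pr A ≤ 1536 * J * (κ * z) * z := by
  calc ∑ A, gfun J z (lg pr A) ^ 2 * wt pr A * lg pr A
      ≤ ∑ A, (∑ j ∈ range J, (2 * (1 / 256 : ℝ) ^ j * (16 ^ (j + 1) * z)) *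
        if lg pr A < 16 ^ (j + 1) * z then 1 else 0) * wt pr A := by
        refine Finset.sum_le_sum fun A _ => ?_
        rw [mul_right_comm]
        refine mul_le_mul_of_nonneg_right ?_ (wt_nonneg hpr A)
        refine (mul_le_mul_of_nonneg_right (gfun_sq_le _ _ _) (lg_nonneg A)).trans ?_
        rw [Finset.mul_sum, Finset.sum_mul]
        refine Finset.sum_le_sum fun j _ => ?_
        split_ifs with h
        · have : (2 * (1 / 256 : ℝ) ^ j) * lg pr A ≤ (2 * (1 / 256 : ℝ) ^ j) * (16 ^ (j + 1) * z) := by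
            gcongr
          linarith
        · simp
    _ = ∑ j ∈ range J, (2 * (1 / 256 : ℝ) ^ j * (16 ^ (j + 1) * z)) * vol pr (16 ^ (j + 1) * z) :=
        sum_step_mul_wt pr J z _
    _ ≤ ∑ j ∈ range J, (2 * (1 / 256 : ℝ) ^ j * (16 ^ (j + 1) * z)) *
          (3 * (κ * (16 ^ (j + 1) * z))) := by
        gcongr with j hj
        exact hV j (mem_range.mp hj)
    _ = ∑ j ∈ range J, 1536 * (κ * z) * z := by
        refine Finset.sum_congr rfl fun j _ => ?_
        have : (1 / 256 : ℝ) ^ j * (16 ^ j * 16 ^ j) = 1 := by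
          rw [← mul_pow, ← mul_pow]; norm_num
        rw [pow_succ]
        linear_combination 1536 * κ * z * z * this
    _ = _ := by simp; ring

end

universe u

lemma exists_vol_bounds {W : ℕ} (hW : 6 ∣ W) (hW0 : 0 < W) : ∃ z₀ : ℝ, 0 < z₀ ∧
    ∀ (ι : Type u) [Fintype ι] [DecidableEq ι] (pr : ι → ℕ), (∀ p, (pr p).Prime) →
    Function.Injective pr → (∀ p, 5 ≤ pr p) → (∀ p, W.Coprime (pr p)) →
    ∀ t, z₀ ≤ t → vol pr t ≤ 3 * (dens W * t) ∧ ∀ (R : ℝ) (p₀ : ℕ), p₀.Prime → 5 ≤ p₀ →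
      (∀ q : ℕ, q.Prime → ¬ q ∣ W → q ≠ p₀ → (q : ℝ) ≤ R → ∃ i, pr i = q) → Real.exp t ≤ R →
      dens W * t / 2 ≤ vol pr t := by
  obtain ⟨C, hC, hfull⟩ := exists_abs_fullSum_sub_le hW0
  have hκ : 0 < dens W := by
    have := Nat.totient_pos.mpr hW0
    unfold dens; positivity
  refine ⟨12 * (C / dens W) + 16, by positivity, fun ι _ _ pr hpr hinj h5 hcop t ht => ?_⟩
  have hCt : 12 * C + 16 * dens W ≤ dens W * t := by
    have := mul_le_mul_of_nonneg_left ht hκ.le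
    have e : dens W * (12 * (C / dens W) + 16) = 12 * C + 16 * dens W := by field_simp
    linarith
  have ht2 : 2 ≤ t := by
    have : 0 ≤ C / dens W := by positivity
    linarith
  refine ⟨?_, fun R p₀ hp₀ hp₀5 hall htR => ?_⟩
  · have h1 := vol_le_fullSum hpr hcop hinj
      (prod_one_add_le_two hinj (by norm_num : 2 ≤ 4) fun p => by have := h5 p; omega) (t := t)
    have hY : 1 ≤ ⌊Real.exp t⌋₊ := by
      rw [Nat.one_le_floor_iff]; exact Real.one_le_exp (by linarith)
    have h2 := (abs_le.mp (hfull _ hY)).2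
    have h3 : Real.log ⌊Real.exp t⌋₊ ≤ t := by
      rw [Real.log_le_iff_le_exp (by exact_mod_cast hY)]
      exact Nat.floor_le (Real.exp_pos t).le
    have h4 := mul_le_mul_of_nonneg_left h3 hκ.le
    linarith
  · set Y := ⌊Real.exp t / 2⌋₊
    have hexp := Real.exp_pos t
    have hY1 : (Y : ℝ) ≤ Real.exp t / 2 := Nat.floor_le (by positivity)
    have hY2 : Real.exp (t - 2) ≤ Y := by
      have h1 := Nat.lt_floor_add_one (Real.exp t / 2)
      have h2 : Real.exp t = Real.exp (t - 2) * Real.exp 2 := by rw [← Real.exp_add]; ring_nf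
      have h3 : 1 ≤ Real.exp (t - 2) := Real.one_le_exp (by linarith)
      have h4 : (4 : ℝ) ≤ Real.exp 2 := by
        have e : Real.exp 2 = Real.exp 1 ^ 2 := by rw [← Real.exp_nat_mul]; norm_num
        have := Real.exp_one_gt_d9
        rw [e]; nlinarith
      have : Real.exp (t - 2) * 4 ≤ Real.exp t := by rw [h2]; gcongr
      linarith
    have hY0 : (0 : ℝ) < Y := (Real.exp_pos _).trans_le hY2
    have h1 := (abs_le.mp (hfull Y (by exact_mod_cast hY0))).1
    have h2 : t - 2 ≤ Real.log Y := (Real.le_log_iff_exp_le hY0).mpr hY2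
    have h3 := mul_le_mul_of_nonneg_left h2 hκ.le
    have h4 := fullSum_le_squarefree hW Y
    have h5 := sum_squarefree_le (W := W) hp₀ hp₀5 Y
    have h6 := sum_squarefree_le_vol hpr hall hinj (Y := Y) (t := t) (by linarith) (by linarith)
    linarith

end PrimeGapRuns

namespace PrimeGapRuns

open Finset

variable {ι : Type*} [Fintype ι] [DecidableEq ι] {k : ℕ}

lemma part_injective : Function.Injective (part : (ι → Option (Fin k)) → Fin k → Finset ι) := by
  intro s t h
  have h' : ∀ p i, s p = some i ↔ t p = some i := fun p i => by
    have := congrArg (fun A => p ∈ A i) h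
    simpa [part] using this
  funext p
  rcases hs : s p with _ | i
  · rcases ht : t p with _ | j
    · rfl
    · rw [(h' p j).mpr ht] at hs; cases hs
  · rw [(h' p i).mp hs]

lemma exists_part_eq {A : Fin k → Finset ι} (hA : Pairwise fun i j => Disjoint (A i) (A j)) :
    ∃ s : ι → Option (Fin k), part s = A := by
  classical
  refine ⟨fun p => if h : ∃ i, p ∈ A i then some h.choose else none, ?_⟩
  funext i
  ext p
  simp only [part, mem_filter, mem_univ, true_and]
  constructor
  · intro h
    split_ifs at h with hp
    rw [← Option.some.inj h]
    exact hp.choose_spec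
  · intro h
    have hp : ∃ i, p ∈ A i := ⟨i, h⟩
    rw [dif_pos hp]
    by_contra hne
    have hne' : hp.choose ≠ i := fun h' => hne (by rw [h'])
    exact Finset.disjoint_left.mp (hA hne') hp.choose_spec h

section Expectation

variable {α : Type*} [Fintype α] {ν : Fin k → α → ℝ}

lemma sum_prod_eq_one (h1 : ∀ i, ∑ a, ν i a = 1) : ∑ A : Fin k → α, ∏ i, ν i (A i) = 1 := by
  rw [← Fintype.piFinset_univ, ← Finset.prod_univ_sum]
  simp [h1]

lemma sum_prod_mul (h1 : ∀ i, ∑ a, ν i a = 1) (j : Fin k) (F : α → ℝ) :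
    ∑ A : Fin k → α, (∏ i, ν i (A i)) * F (A j) = ∑ a, ν j a * F a := by
  have e : ∀ A : Fin k → α, (∏ i, ν i (A i)) * F (A j) =
      ∏ i, ν i (A i) * if i = j then F (A i) else 1 := fun A => by
    rw [Finset.prod_mul_distrib]
    simp
  simp only [e]
  rw [← Fintype.piFinset_univ,
    ← Finset.prod_univ_sum (fun _ => univ) (fun i a => ν i a * if i = j then F a else 1),
    Finset.prod_eq_single j]
  · simp
  · intro i _ hi; simp [hi, h1]
  · simp

lemma sum_prod_mul_mul (h1 : ∀ i, ∑ a, ν i a = 1) {j l : Fin k} (hjl : j ≠ l) (F G : α → ℝ) :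
    ∑ A : Fin k → α, (∏ i, ν i (A i)) * (F (A j) * G (A l)) =
      (∑ a, ν j a * F a) * ∑ a, ν l a * G a := by
  have e : ∀ A : Fin k → α, (∏ i, ν i (A i)) * (F (A j) * G (A l)) =
      ∏ i, ν i (A i) * ((if i = j then F (A i) else 1) * if i = l then G (A i) else 1) := fun A => by
    rw [Finset.prod_mul_distrib, Finset.prod_mul_distrib]
    simp
  simp only [e]
  rw [← Fintype.piFinset_univ, ← Finset.prod_univ_sum (fun _ => univ)
    (fun i a => ν i a * ((if i = j then F a else 1) * if i = l then G a else 1)),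
    ← Finset.mul_prod_erase _ _ (mem_univ j), ← Finset.mul_prod_erase (univ.erase j) _
      (mem_erase.mpr ⟨hjl.symm, mem_univ l⟩), Finset.prod_eq_one, mul_one]
  · simp [hjl, hjl.symm]
  · intro i hi
    have h2 := Finset.ne_of_mem_erase hi
    have h3 := Finset.ne_of_mem_erase (Finset.mem_of_mem_erase hi)
    simp [h2, h3, h1]

end Expectation

lemma le_sum_pairwise_disjoint {ν : Fin k → Finset ι → ℝ} (h0 : ∀ i A, 0 ≤ ν i A)
    (h1 : ∀ i, ∑ A, ν i A = 1) {c : Finset ι → ℝ} (hc : ∀ A, 0 ≤ c A) {r : ι → ℝ}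
    (hr : ∀ i p, ∑ A, ν i A * (if p ∈ A then 1 else 0) ≤ r p)
    [DecidablePred fun A : Fin k → Finset ι => Pairwise fun i j => Disjoint (A i) (A j)] :
    1 - ∑ i, ∑ A, ν i A * c A - (k : ℝ) ^ 2 * ∑ p, r p ^ 2 ≤
      ∑ A : Fin k → Finset ι with Pairwise fun i j => Disjoint (A i) (A j),
        (∏ i, ν i (A i)) * (1 - ∑ i, c (A i)) := by
  have hI : ∀ (p : ι) (A : Finset ι), (0 : ℝ) ≤ if p ∈ A then 1 else 0 := fun p A => by
    split_ifs <;> norm_num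
  calc 1 - ∑ i, ∑ A, ν i A * c A - (k : ℝ) ^ 2 * ∑ p, r p ^ 2
      ≤ 1 - ∑ i, ∑ A, ν i A * c A - ∑ i : Fin k, ∑ j ∈ univ.erase i, ∑ p,
        (∑ A, ν i A * if p ∈ A then 1 else 0) * ∑ A, ν j A * if p ∈ A then 1 else 0 := by
        refine sub_le_sub_left ?_ _
        calc _ ≤ ∑ i : Fin k, ∑ j ∈ univ.erase i, ∑ p, r p ^ 2 := by
              refine Finset.sum_le_sum fun i _ => Finset.sum_le_sum fun j _ =>
                Finset.sum_le_sum fun p _ => ?_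
              rw [sq]
              exact mul_le_mul (hr i p) (hr j p)
                (Finset.sum_nonneg fun A _ => mul_nonneg (h0 _ _) (hI _ _))
                (le_trans (Finset.sum_nonneg fun A _ => mul_nonneg (h0 _ _) (hI _ _)) (hr i p))
          _ ≤ ∑ i : Fin k, ∑ j : Fin k, ∑ p, r p ^ 2 :=
              Finset.sum_le_sum fun i _ => Finset.sum_le_sum_of_subset_of_nonneg (erase_subset _ _)
                fun _ _ _ => Finset.sum_nonneg fun _ _ => sq_nonneg _
          _ = _ := by simp; ring
    _ = ∑ A : Fin k → Finset ι, (∏ i, ν i (A i)) * (1 - ∑ i, c (A i) - ∑ i : Fin k,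
        ∑ j ∈ univ.erase i, ∑ p, (if p ∈ A i then 1 else 0) * if p ∈ A j then 1 else 0) := by
        simp only [mul_sub, mul_one, Finset.sum_sub_distrib]
        rw [sum_prod_eq_one h1]
        congr 1
        · congr 1
          conv_rhs => simp only [Finset.mul_sum]
          conv_rhs => rw [Finset.sum_comm]
          exact Finset.sum_congr rfl fun i _ => (sum_prod_mul h1 i c).symm
        · conv_rhs => simp only [Finset.mul_sum]
          conv_rhs => rw [Finset.sum_comm]
          refine Finset.sum_congr rfl fun i _ => ?_
          conv_rhs => rw [Finset.sum_comm]
          refine Finset.sum_congr rfl fun j hj => ?_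
          conv_rhs => rw [Finset.sum_comm]
          refine Finset.sum_congr rfl fun p _ => ?_
          exact (sum_prod_mul_mul h1 (Finset.ne_of_mem_erase hj).symm
            (fun A => if p ∈ A then 1 else 0) fun A => if p ∈ A then 1 else 0).symm
    _ ≤ _ := by
        rw [Finset.sum_filter]
        refine Finset.sum_le_sum fun A _ => ?_
        have hP : 0 ≤ ∏ i, ν i (A i) := Finset.prod_nonneg fun i _ => h0 i _
        have hS : ∀ i : Fin k, 0 ≤ ∑ j ∈ univ.erase i, ∑ p,
            ((if p ∈ A i then 1 else 0) * if p ∈ A j then 1 else 0 : ℝ) := fun i =>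
          Finset.sum_nonneg fun j _ => Finset.sum_nonneg fun p _ => mul_nonneg (hI _ _) (hI _ _)
        split_ifs with hdis
        · refine mul_le_mul_of_nonneg_left ?_ hP
          have := Finset.sum_nonneg fun i (_ : i ∈ univ) => hS i
          linarith
        · refine mul_nonpos_of_nonneg_of_nonpos hP ?_
          have hc0 := Finset.sum_nonneg fun i (_ : i ∈ (univ : Finset (Fin k))) => hc (A i)
          have : (1 : ℝ) ≤ ∑ i : Fin k, ∑ j ∈ univ.erase i, ∑ p,
              ((if p ∈ A i then 1 else 0) * if p ∈ A j then 1 else 0) := by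
            simp only [Pairwise, not_forall] at hdis
            obtain ⟨i, j, hij, hd⟩ := hdis
            obtain ⟨p, hpi, hpj⟩ := Finset.not_disjoint_iff.mp hd
            calc (1 : ℝ) = (if p ∈ A i then 1 else 0) * if p ∈ A j then 1 else 0 := by simp [hpi, hpj]
              _ ≤ ∑ p, ((if p ∈ A i then 1 else 0) * if p ∈ A j then 1 else 0 : ℝ) :=
                  Finset.single_le_sum (f := fun p =>
                    ((if p ∈ A i then 1 else 0) * if p ∈ A j then 1 else 0 : ℝ))
                    (fun p _ => mul_nonneg (hI _ _) (hI _ _)) (mem_univ p)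
              _ ≤ ∑ j ∈ univ.erase i, ∑ p,
                  ((if p ∈ A i then 1 else 0) * if p ∈ A j then 1 else 0 : ℝ) :=
                  Finset.single_le_sum (f := fun j => ∑ p,
                    ((if p ∈ A i then 1 else 0) * if p ∈ A j then 1 else 0 : ℝ))
                    (fun j _ => Finset.sum_nonneg fun p _ => mul_nonneg (hI _ _) (hI _ _))
                    (mem_erase.mpr ⟨hij.symm, mem_univ j⟩)
              _ ≤ _ := Finset.single_le_sum (fun i _ => hS i) (mem_univ i)
          linarith

end PrimeGapRuns

namespace PrimeGapRuns

open Finset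

variable {ι : Type*} [Fintype ι] [DecidableEq ι] {k : ℕ}

/-- The diagonalised sieve weights. -/
noncomputable def yv (pr : ι → ℕ) (J : ℕ) (z : ℝ) (R : ℕ) (s : ι → Option (Fin k)) : ℝ :=
  (if md pr s ≤ R then 1 else 0) * (∏ p, if s p = none then 1 else -(1 / ((pr p : ℝ) - 1))) *
    ∏ i, gfun J z (lg pr (part s i))

lemma prod_part (s : ι → Option (Fin k)) (f : ι → ℝ) :
    ∏ i, ∏ p ∈ part s i, f p = ∏ p, if s p = none then 1 else f p := by
  simp only [part, Finset.prod_filter]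
  rw [Finset.prod_comm]
  refine Finset.prod_congr rfl fun p _ => ?_
  rcases hs : s p with _ | j
  · simp
  · simp

lemma sum_part (s : ι → Option (Fin k)) (f : ι → ℝ) :
    ∑ i, ∑ p ∈ part s i, f p = ∑ p ∈ supp s, f p := by
  simp only [part, supp, Finset.sum_filter]
  rw [Finset.sum_comm]
  refine Finset.sum_congr rfl fun p _ => ?_
  rcases hs : s p with _ | j
  · simp
  · simp

lemma prod_ite_none (s : ι → Option (Fin k)) (f : ι → ℝ) :
    (∏ p, if s p = none then 1 else f p) = ∏ p ∈ supp s, f p := by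
  rw [supp, Finset.prod_filter]
  exact Finset.prod_congr rfl fun p _ => by by_cases h : s p = none <;> simp [h]

lemma prod_wt_part (pr : ι → ℕ) (s : ι → Option (Fin k)) :
    ∏ i, wt pr (part s i) = ∏ p, if s p = none then 1 else 1 / ((pr p : ℝ) - 1) := prod_part s _

lemma abs_yv_le {pr : ι → ℕ} (hpr : ∀ p, (pr p).Prime) (J : ℕ) (z : ℝ) (R : ℕ)
    (s : ι → Option (Fin k)) : |yv pr J z R s| ≤ (16 / 15) ^ k * wt pr (supp s) := by
  have h1 : |∏ i, gfun J z (lg pr (part s i))| ≤ (16 / 15) ^ k := by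
    rw [Finset.abs_prod]
    calc _ ≤ ∏ _i : Fin k, (16 / 15 : ℝ) :=
          Finset.prod_le_prod (fun _ _ => abs_nonneg _) fun i _ => by
            rw [abs_of_nonneg (gfun_nonneg _ _ _)]
            exact gfun_le _ _ _
      _ = _ := by rw [Finset.prod_const, Finset.card_univ, Fintype.card_fin]
  have h2 : |∏ p, if s p = none then 1 else -(1 / ((pr p : ℝ) - 1))| = wt pr (supp s) := by
    rw [prod_ite_none, Finset.abs_prod]
    refine Finset.prod_congr rfl fun p _ => ?_
    have := one_lt_pr hpr p
    rw [abs_neg, abs_of_nonneg (by positivity)]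
  have h3 : |(if md pr s ≤ R then 1 else 0 : ℝ)| ≤ 1 := by split_ifs <;> simp
  have hw := wt_nonneg hpr (supp s)
  rw [yv, abs_mul, abs_mul, h2, mul_comm ((16 / 15 : ℝ) ^ k)]
  refine mul_le_mul ?_ h1 (abs_nonneg _) hw
  exact mul_le_of_le_one_left hw h3

lemma yv_eq_zero {pr : ι → ℕ} {J : ℕ} {z : ℝ} {R : ℕ} {s : ι → Option (Fin k)}
    (hs : R < md pr s) : yv pr J z R s = 0 := by
  rw [yv, if_neg (by omega), zero_mul, zero_mul]

lemma form_diagonal (v : ι → Option (Fin k) → ℝ) (y : (ι → Option (Fin k)) → ℝ) :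
    form (fun p => Matrix.diagonal (v p)) y = ∑ s, y s ^ 2 * ∏ p, v p (s p) := by
  refine Finset.sum_congr rfl fun s _ => ?_
  rw [Finset.sum_eq_single s]
  · simp only [Matrix.diagonal_apply_eq]; ring
  · intro t _ hts
    obtain ⟨p, hp⟩ := Function.ne_iff.mp hts.symm
    have h0 : ∏ p, Matrix.diagonal (v p) (s p) (t p) = 0 :=
      Finset.prod_eq_zero (mem_univ p) (Matrix.diagonal_apply_ne _ hp)
    rw [h0, mul_zero]
  · simp

lemma form_gram_rhoInt_le {pr : ι → ℕ} (hpr : ∀ p, (pr p).Prime) (hinj : Function.Injective pr)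
    {D : ℕ} (hD : 3 ≤ D) (hkD : k ≤ D) (hDp : ∀ p, D < pr p) (J : ℕ) (z : ℝ) (R : ℕ) :
    form (fun p => gram (pr p) (rhoInt (pr p)))
      (yv pr J z R : (ι → Option (Fin k)) → ℝ) ≤ 21 * massSq pr J z ^ k := by
  have hq3 : ∀ p, (3 : ℝ) ≤ pr p := fun p => by exact_mod_cast hD.trans (hDp p).le
  have hqk : ∀ p, (k : ℝ) ≤ pr p := fun p => by exact_mod_cast hkD.trans (hDp p).le
  have hE : ∏ p, (1 + 3 / (pr p : ℝ) ^ 2) ≤ 21 := by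
    calc ∏ p, (1 + 3 / (pr p : ℝ) ^ 2) ≤ ∏ p, Real.exp (3 / (pr p : ℝ) ^ 2) :=
          Finset.prod_le_prod (fun p _ => by positivity) fun p _ => by
            rw [add_comm]; exact Real.add_one_le_exp _
      _ = Real.exp (∑ p, 3 / (pr p : ℝ) ^ 2) := (Real.exp_sum _ _).symm
      _ ≤ Real.exp 1 := by
          refine Real.exp_le_exp.mpr ?_
          calc ∑ p, 3 / (pr p : ℝ) ^ 2 ≤ ∑ p, 3 * (1 / ((pr p : ℝ) * ((pr p : ℝ) - 1))) := by
                refine Finset.sum_le_sum fun p _ => ?_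
                rw [mul_one_div]
                have := hq3 p
                have := one_lt_pr hpr p
                refine div_le_div_of_nonneg_left (by norm_num) (by positivity) (by nlinarith)
            _ = 3 * ∑ p, 1 / ((pr p : ℝ) * ((pr p : ℝ) - 1)) := by rw [Finset.mul_sum]
            _ ≤ 3 * (1 / (D : ℝ)) := by
                have := sum_one_div_mul_pred_le hinj (by omega : 1 ≤ D) hDp
                linarith
            _ ≤ 1 := by
                rw [mul_one_div, div_le_one (by exact_mod_cast (by omega : 0 < D))]
                exact_mod_cast hD
      _ ≤ 21 := by have := Real.exp_one_lt_d9; linarith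
  have hterm : ∀ s : ι → Option (Fin k), yv pr J z R s ^ 2 *
      ∏ p, (if s p = none then 1 + 3 / (pr p : ℝ) ^ 2 else (pr p : ℝ) - 1) ≤
      21 * ∏ i, (gfun J z (lg pr (part s i)) ^ 2 * wt pr (part s i)) := fun s => by
    have h1 : (if md pr s ≤ R then 1 else 0 : ℝ) ^ 2 ≤ 1 := by split_ifs <;> norm_num
    have h2 : (∏ p, if s p = none then 1 else -(1 / ((pr p : ℝ) - 1))) ^ 2 *
        ∏ p, (if s p = none then 1 + 3 / (pr p : ℝ) ^ 2 else (pr p : ℝ) - 1) ≤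
        21 * ∏ i, wt pr (part s i) := by
      rw [prod_wt_part, ← Finset.prod_pow, ← Finset.prod_mul_distrib]
      calc _ ≤ ∏ p, ((1 + 3 / (pr p : ℝ) ^ 2) * if s p = none then 1 else 1 / ((pr p : ℝ) - 1)) := by
            refine Finset.prod_le_prod (fun p _ => ?_) fun p _ => ?_
            · have := one_lt_pr hpr p
              split_ifs <;> positivity
            · have h := one_lt_pr hpr p
              split_ifs
              · simp
              · have e : (-(1 / ((pr p : ℝ) - 1))) ^ 2 * ((pr p : ℝ) - 1) = 1 / ((pr p : ℝ) - 1) := by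
                  field_simp
                rw [e]
                exact le_mul_of_one_le_left (by positivity) (by
                  have : 0 ≤ 3 / (pr p : ℝ) ^ 2 := by positivity
                  linarith)
        _ ≤ _ := by
            rw [Finset.prod_mul_distrib]
            refine mul_le_mul_of_nonneg_right hE (Finset.prod_nonneg fun p _ => ?_)
            have := one_lt_pr hpr p
            split_ifs <;> positivity
    have h3 : 0 ≤ ∏ i, gfun J z (lg pr (part s i)) ^ 2 :=
      Finset.prod_nonneg fun _ _ => sq_nonneg _
    have h4 : 0 ≤ ∏ i, wt pr (part s i) := Finset.prod_nonneg fun _ _ => wt_nonneg hpr _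
    rw [yv, mul_pow, mul_pow, Finset.prod_mul_distrib, ← Finset.prod_pow univ 2 (fun i =>
      gfun J z (lg pr (part s i)))]
    set a := (if md pr s ≤ R then 1 else 0 : ℝ) ^ 2
    have ha : 0 ≤ a := sq_nonneg _
    have h5 := mul_le_mul h1 (mul_le_mul_of_nonneg_right h2 h3) (mul_nonneg (mul_nonneg (sq_nonneg _)
      (Finset.prod_nonneg fun p _ => ?_)) h3) zero_le_one
    · linarith
    · have := one_lt_pr hpr p
      split_ifs <;> positivity
  calc _ ≤ form (fun p => diagInt (k := k) (pr p)) (yv pr J z R) :=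
        form_le_form (fun p => gram_rhoInt_posSemidef (hqk p) (by have := hq3 p; linarith))
          (fun p => diagInt_sub_gram_posSemidef (hq3 p)) _
    _ ≤ ∑ s : ι → Option (Fin k), 21 * ∏ i, (gfun J z (lg pr (part s i)) ^ 2 * wt pr (part s i)) := by
        unfold diagInt
        rw [form_diagonal]
        exact Finset.sum_le_sum fun s _ => hterm s
    _ ≤ ∑ A : Fin k → Finset ι, 21 * ∏ i, (gfun J z (lg pr (A i)) ^ 2 * wt pr (A i)) :=
        sum_le_sum_of_injOn part (fun _ _ => mem_univ _) part_injective.injOn (fun _ _ => le_rfl)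
          fun A _ => mul_nonneg (by norm_num) (Finset.prod_nonneg fun i _ =>
            mul_nonneg (sq_nonneg _) (wt_nonneg hpr _))
    _ = _ := by
        rw [← Finset.mul_sum, ← Fintype.piFinset_univ, ← Finset.prod_univ_sum (fun _ => univ)
          (fun _ A => gfun J z (lg pr A) ^ 2 * wt pr A)]
        simp [massSq]

end PrimeGapRuns

namespace PrimeGapRuns

open Finset

section General

variable {ι κ : Type*} [Fintype ι] [DecidableEq ι] [Fintype κ]

lemma form_eq_sum_sq {B : ι → Matrix κ κ ℝ} {l : ι → κ → ℝ} {v : κ → κ → ℝ}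
    (hB : ∀ p o o', B p o o' = ∑ c, l p c * (v c o * v c o')) (y : (ι → κ) → ℝ) :
    form B y = ∑ c : ι → κ, (∏ p, l p (c p)) * (∑ s, y s * ∏ p, v (c p) (s p)) ^ 2 := by
  classical
  have h1 : ∀ s t : ι → κ, ∏ p, B p (s p) (t p) =
      ∑ c : ι → κ, (∏ p, l p (c p)) * ((∏ p, v (c p) (s p)) * ∏ p, v (c p) (t p)) := fun s t => by
    simp only [hB]
    rw [Finset.prod_univ_sum (fun _ => univ)
      (fun p c => l p c * (v c (s p) * v c (t p))), Fintype.piFinset_univ]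
    simp only [Finset.prod_mul_distrib]
  simp only [form, h1]
  have h2 : ∀ c : ι → κ, (∏ p, l p (c p)) * (∑ s, y s * ∏ p, v (c p) (s p)) ^ 2 =
      ∑ s, ∑ t, y s * y t *
        ((∏ p, l p (c p)) * ((∏ p, v (c p) (s p)) * ∏ p, v (c p) (t p))) := fun c => by
    rw [sq, Finset.sum_mul_sum, Finset.mul_sum]
    refine Finset.sum_congr rfl fun s _ => ?_
    rw [Finset.mul_sum]
    exact Finset.sum_congr rfl fun t _ => by ring
  simp only [h2, Finset.mul_sum]
  conv_rhs => rw [Finset.sum_comm]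
  refine Finset.sum_congr rfl fun s _ => ?_
  rw [Finset.sum_comm]

lemma one_sub_sum_le_prod {s : Finset ι} {f : ι → ℝ} (h0 : ∀ p ∈ s, 0 ≤ f p)
    (h1 : ∀ p ∈ s, f p ≤ 1) : 1 - ∑ p ∈ s, f p ≤ ∏ p ∈ s, (1 - f p) := by
  induction s using Finset.induction_on with
  | empty => simp
  | insert a s ha ih =>
    rw [Finset.sum_insert ha, Finset.prod_insert ha]
    have := ih (fun p hp => h0 p (mem_insert_of_mem hp)) fun p hp => h1 p (mem_insert_of_mem hp)
    have h2 := h0 a (mem_insert_self _ _)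
    have h3 := h1 a (mem_insert_self _ _)
    have h4 : 0 ≤ ∑ p ∈ s, f p := Finset.sum_nonneg fun p hp => h0 p (mem_insert_of_mem hp)
    nlinarith

lemma sum_mem_mul_wt_le {pr : ι → ℕ} (hpr : ∀ p, (pr p).Prime) {G : ℝ → ℝ} (hG : Antitone G)
    (hG0 : ∀ t, 0 ≤ G t) (p : ι) :
    ∑ A with p ∈ A, G (lg pr A) * wt pr A ≤
      1 / ((pr p : ℝ) - 1) * ∑ A, G (lg pr A) * wt pr A := by
  rw [Finset.mul_sum]
  have h1 := one_lt_pr hpr p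
  refine sum_le_sum_of_injOn (fun A => A.erase p) (fun _ _ => mem_univ _) ?_ ?_ fun A _ =>
    mul_nonneg (by positivity) (mul_nonneg (hG0 _) (wt_nonneg hpr _))
  · intro A hA B hB h
    simp only [coe_filter, mem_univ, true_and, Set.mem_ofPred_eq] at hA hB
    rw [← Finset.insert_erase hA, ← Finset.insert_erase hB]
    exact congrArg (insert p) h
  · intro A hA
    have hA := (mem_filter.mp hA).2
    have e : wt pr A = 1 / ((pr p : ℝ) - 1) * wt pr (A.erase p) :=
      (Finset.mul_prod_erase A _ hA).symm
    have hlg : lg pr (A.erase p) ≤ lg pr A :=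
      Finset.sum_le_sum_of_subset_of_nonneg (Finset.erase_subset _ _) fun q _ _ =>
        Real.log_nonneg (by exact_mod_cast (hpr q).one_le)
    rw [e, mul_left_comm]
    refine mul_le_mul_of_nonneg_left ?_ (by positivity)
    exact mul_le_mul_of_nonneg_right (hG hlg) (wt_nonneg hpr _)

end General

variable {ι : Type*} [Fintype ι] [DecidableEq ι] {k : ℕ}

/-- The local eigenvectors of the block diagonal minorant. -/
def bvec (m : Fin k) : Option (Fin k) → Option (Fin k) → ℝ
  | none, none => 1
  | none, some j => if j = m then -1 else 0
  | some _, none => 0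
  | some i, some j => if i = j then 1 else 0

/-- The local eigenvalues of the block diagonal minorant. -/
def bval (m : Fin k) (q : ℝ) : Option (Fin k) → ℝ
  | none => 1
  | some i => if i = m then 0 else q - k

lemma blockPrime_eq_sum (m : Fin k) (q : ℝ) (o o' : Option (Fin k)) :
    blockPrime m q o o' = ∑ c, bval m q c * (bvec m c o * bvec m c o') := by
  rw [Fintype.sum_option]
  rcases o with _ | i <;> rcases o' with _ | j
  · simp [blockPrime, bval, bvec]
  · simp [blockPrime, bval, bvec]
  · simp [blockPrime, bval, bvec]
  · simp only [blockPrime, Matrix.of_apply, bval, bvec]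
    rw [Finset.sum_eq_single i (fun b _ hb => by simp [hb]) (by simp)]
    by_cases hij : i = j
    · subst hij
      by_cases him : i = m <;> simp [him]
    · by_cases him : i = m
      · have : j ≠ m := fun h => hij (him.trans h.symm)
        simp [him, this, this.symm]
      · simp [him, hij]

/-- Adding `A` to the `m`-th part. -/
def addPart (m : Fin k) (c : ι → Option (Fin k)) (A : Finset ι) (p : ι) : Option (Fin k) :=
  if p ∈ A then some m else c p

lemma part_addPart_of_ne {m i : Fin k} (hi : i ≠ m) {c : ι → Option (Fin k)} {A : Finset ι}
    (hA : Disjoint A (supp c)) : part (addPart m c A) i = part c i := by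
  ext p
  simp only [part, mem_filter, mem_univ, true_and]
  unfold addPart
  by_cases hp : p ∈ A
  · have h1 : c p = none := by
      by_contra h
      exact Finset.disjoint_left.mp hA hp (by simpa [supp] using h)
    simp [hp, h1, hi.symm]
  · simp [hp]

lemma part_addPart_self {m : Fin k} {c : ι → Option (Fin k)} (hc : part c m = ∅) (A : Finset ι) :
    part (addPart m c A) m = A := by
  ext p
  have h1 : c p ≠ some m := fun h => by
    have : p ∈ part c m := by simpa [part] using h
    rw [hc] at this; simp at this
  simp only [part, mem_filter, mem_univ, true_and]
  unfold addPart
  by_cases hp : p ∈ A <;> simp [hp, h1]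

lemma supp_addPart (m : Fin k) (c : ι → Option (Fin k)) (A : Finset ι) :
    supp (addPart m c A) = A ∪ supp c := by
  ext p
  simp only [supp, mem_filter, mem_univ, true_and, mem_union]
  unfold addPart
  by_cases hp : p ∈ A <;> simp [hp]

lemma sum_mul_prod_bvec {m : Fin k} {c : ι → Option (Fin k)} (hc : part c m = ∅)
    (y : (ι → Option (Fin k)) → ℝ) :
    ∑ s, y s * ∏ p, bvec m (c p) (s p) =
      ∑ A with Disjoint A (supp c), y (addPart m c A) * ∏ _p ∈ A, (-1 : ℝ) := by
  have hcm : ∀ p, c p ≠ some m := fun p h => by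
    have : p ∈ part c m := by simpa [part] using h
    rw [hc] at this; simp at this
  have hinj : Set.InjOn (addPart m c) (SetLike.coe (univ.filter fun A => Disjoint A (supp c))) :=
    fun A _ B _ h => by rw [← part_addPart_self hc A, h, part_addPart_self hc B]
  have hval : ∀ A, Disjoint A (supp c) →
      ∏ p, bvec m (c p) (addPart m c A p) = ∏ _p ∈ A, (-1 : ℝ) := fun A hA => by
    rw [← Finset.prod_subset (subset_univ A)]
    · refine Finset.prod_congr rfl fun p hp => ?_
      have h1 : c p = none := by
        by_contra h
        exact Finset.disjoint_left.mp hA hp (by simpa [supp] using h)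
      simp [addPart, hp, h1, bvec]
    · intro p _ hp
      rcases hcp : c p with _ | i <;> simp [addPart, hp, hcp, bvec]
  symm
  rw [Finset.sum_congr rfl fun A hA => by rw [← hval A (mem_filter.mp hA).2],
    ← Finset.sum_image (f := fun s => y s * ∏ p, bvec m (c p) (s p)) hinj]
  refine Finset.sum_subset (subset_univ _) fun s _ hs => ?_
  by_contra hne
  refine hs (mem_image.mpr ⟨part s m, ?_, ?_⟩)
  all_goals
    have hb : ∀ p, bvec m (c p) (s p) ≠ 0 := fun p h0 =>
      hne (by rw [Finset.prod_eq_zero (mem_univ p) h0, mul_zero])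
  · rw [mem_filter]
    refine ⟨mem_univ _, Finset.disjoint_left.mpr fun p hp hp' => ?_⟩
    have h1 : s p = some m := by simpa [part] using hp
    obtain ⟨i, hi⟩ := Option.ne_none_iff_exists'.mp (show c p ≠ none by simpa [supp] using hp')
    have h2 := hb p
    rw [h1, hi] at h2
    have : i ≠ m := fun h => hcm p (by rw [hi, h])
    simp [bvec, this] at h2
  · funext p
    have h2 := hb p
    rcases hcp : c p with _ | i <;> rcases hsp : s p with _ | j <;> rw [hcp, hsp] at h2
    · simp [addPart, part, hsp, hcp]
    · have : j = m := by by_contra h; simp [bvec, h] at h2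
      simp [addPart, part, hsp, this]
    · simp [bvec] at h2
    · have : i = j := by by_contra h; simp [bvec, h] at h2
      subst this
      have : i ≠ m := fun h => hcm p (by rw [hcp, h])
      simp [addPart, part, hsp, hcp, this]

lemma sum_yv_mul_prod_bvec {pr : ι → ℕ} (J : ℕ) (z : ℝ) (R : ℕ) {m : Fin k}
    {c : ι → Option (Fin k)} (hc : part c m = ∅) :
    ∑ s, yv pr J z R s * ∏ p, bvec m (c p) (s p) =
      (∏ p ∈ supp c, -(1 / ((pr p : ℝ) - 1))) * (∏ i with i ≠ m, gfun J z (lg pr (part c i))) *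
      ∑ A with Disjoint A (supp c), (if (∏ p ∈ A, pr p) * md pr c ≤ R then 1 else 0) *
        (gfun J z (lg pr A) * wt pr A) := by
  rw [sum_mul_prod_bvec hc, Finset.mul_sum]
  refine Finset.sum_congr rfl fun A hA => ?_
  have hA := (mem_filter.mp hA).2
  have h1 : md pr (addPart m c A) = (∏ p ∈ A, pr p) * md pr c := by
    rw [md, supp_addPart, Finset.prod_union hA, md]
  have h2 : ∏ i, gfun J z (lg pr (part (addPart m c A) i)) =
      gfun J z (lg pr A) * ∏ i with i ≠ m, gfun J z (lg pr (part c i)) := by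
    rw [← Finset.mul_prod_erase _ _ (mem_univ m), part_addPart_self hc, Finset.filter_ne']
    congr 1
    exact Finset.prod_congr rfl fun i hi => by rw [part_addPart_of_ne (Finset.ne_of_mem_erase hi) hA]
  have h3 : (∏ p ∈ A, -(1 / ((pr p : ℝ) - 1))) * ∏ _p ∈ A, (-1 : ℝ) = wt pr A := by
    rw [wt, ← Finset.prod_mul_distrib]
    exact Finset.prod_congr rfl fun p _ => by ring
  rw [yv, h1, h2, prod_ite_none, supp_addPart, Finset.prod_union hA, ← h3]
  ring


lemma massOne_mul_le {pr : ι → ℕ} (hpr : ∀ p, (pr p).Prime) (J : ℕ) (z : ℝ) (S : Finset ι) :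
    massOne pr J z * (1 - ∑ p ∈ S, 1 / ((pr p : ℝ) - 1)) ≤
      ∑ A with Disjoint A S, gfun J z (lg pr A) * wt pr A := by
  have h0 : ∀ A, 0 ≤ gfun J z (lg pr A) * wt pr A := fun A =>
    mul_nonneg (gfun_nonneg _ _ _) (wt_nonneg hpr _)
  have h1 : massOne pr J z ≤ ∑ A with Disjoint A S, gfun J z (lg pr A) * wt pr A +
      ∑ p ∈ S, ∑ A with p ∈ A, gfun J z (lg pr A) * wt pr A := by
    simp only [massOne, Finset.sum_filter]
    rw [Finset.sum_comm, ← Finset.sum_add_distrib]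
    refine Finset.sum_le_sum fun A _ => ?_
    by_cases hA : Disjoint A S
    · rw [if_pos hA]
      have : 0 ≤ ∑ p ∈ S, if p ∈ A then gfun J z (lg pr A) * wt pr A else 0 :=
        Finset.sum_nonneg fun p _ => by split_ifs; exacts [h0 A, le_rfl]
      linarith
    · rw [if_neg hA, zero_add]
      obtain ⟨p, hpA, hpS⟩ := Finset.not_disjoint_iff.mp hA
      refine le_trans ?_ (Finset.single_le_sum (f := fun p =>
        if p ∈ A then gfun J z (lg pr A) * wt pr A else 0) (fun p _ => ?_) hpS)
      · simp [hpA]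
      · split_ifs; exacts [h0 A, le_rfl]
  have h2 : ∑ p ∈ S, ∑ A with p ∈ A, gfun J z (lg pr A) * wt pr A ≤
      ∑ p ∈ S, 1 / ((pr p : ℝ) - 1) * massOne pr J z :=
    Finset.sum_le_sum fun p _ => sum_mem_mul_wt_le hpr (fun _ _ h => gfun_anti J z h)
      (fun t => gfun_nonneg J z t) p
  rw [← Finset.sum_mul] at h2
  linarith

lemma massOne_sq_mul_le {pr : ι → ℕ} (hpr : ∀ p, (pr p).Prime) {J R : ℕ} {z : ℝ} (hz : 0 ≤ z)
    (hzR : 2 * (16 ^ J * z) ≤ Real.log R) (hk : 1 ≤ k) (hkp : ∀ p, k ≤ pr p) (S : Finset ι) :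
    massOne pr J z ^ 2 * (1 - (∑ p ∈ S, ((k : ℝ) + 1) / ((pr p : ℝ) - 1) +
      2 * lg pr S / Real.log R)) ≤ (∏ p ∈ S, (1 - ((k : ℝ) - 1) / ((pr p : ℝ) - 1))) *
      (∑ A with Disjoint A S, (if (∏ p ∈ A, pr p) * (∏ p ∈ S, pr p) ≤ R then 1 else 0) *
        (gfun J z (lg pr A) * wt pr A)) ^ 2 := by
  have hk' : (1 : ℝ) ≤ k := by exact_mod_cast hk
  have hf0 : ∀ p ∈ S, 0 ≤ ((k : ℝ) - 1) / ((pr p : ℝ) - 1) := fun p _ =>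
    div_nonneg (by linarith) (one_lt_pr hpr p).le
  have hf1 : ∀ p ∈ S, ((k : ℝ) - 1) / ((pr p : ℝ) - 1) ≤ 1 := fun p _ => by
    rw [div_le_one (one_lt_pr hpr p)]
    have : (k : ℝ) ≤ pr p := by exact_mod_cast hkp p
    linarith
  have hprod := one_sub_sum_le_prod hf0 hf1
  have hprod0 : 0 ≤ ∏ p ∈ S, (1 - ((k : ℝ) - 1) / ((pr p : ℝ) - 1)) :=
    Finset.prod_nonneg fun p hp => by have := hf1 p hp; linarith
  obtain ⟨σ, hσ⟩ : ∃ σ, σ = ∑ p ∈ S, 1 / ((pr p : ℝ) - 1) := ⟨_, rfl⟩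
  have hσ0 : 0 ≤ σ := hσ ▸ Finset.sum_nonneg fun p _ => (one_div_pos.mpr (one_lt_pr hpr p)).le
  have e : ∀ a : ℝ, ∑ p ∈ S, a / ((pr p : ℝ) - 1) = a * σ := fun a => by
    rw [hσ, Finset.mul_sum]; exact Finset.sum_congr rfl fun p _ => by ring
  rw [e] at hprod ⊢
  have hlR : 0 ≤ Real.log R := Real.log_natCast_nonneg R
  have hl0 : 0 ≤ 2 * lg pr S / Real.log R :=
    div_nonneg (mul_nonneg zero_le_two (Finset.sum_nonneg fun p _ => Real.log_natCast_nonneg _)) hlR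
  have hM0 : 0 ≤ massOne pr J z :=
    Finset.sum_nonneg fun A _ => mul_nonneg (gfun_nonneg _ _ _) (wt_nonneg hpr _)
  by_cases hpos : 1 - (((k : ℝ) + 1) * σ + 2 * lg pr S / Real.log R) ≤ 0
  · exact (mul_nonpos_of_nonneg_of_nonpos (sq_nonneg _) hpos).trans
      (mul_nonneg hprod0 (sq_nonneg _))
  rw [not_le] at hpos
  have hinner : ∑ A with Disjoint A S, (if (∏ p ∈ A, pr p) * (∏ p ∈ S, pr p) ≤ R then 1 else 0) *
        (gfun J z (lg pr A) * wt pr A) = ∑ A with Disjoint A S, gfun J z (lg pr A) * wt pr A := by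
    refine Finset.sum_congr rfl fun A _ => ?_
    by_cases hA : 16 ^ J * z ≤ lg pr A
    · rw [gfun_eq_zero hz hA, zero_mul, mul_zero]
    rw [if_pos, one_mul]
    rw [not_le] at hA
    have hApos : 0 < ∏ p ∈ A, pr p := Finset.prod_pos fun p _ => (hpr p).pos
    have hSpos : 0 < ∏ p ∈ S, pr p := Finset.prod_pos fun p _ => (hpr p).pos
    have hlR' : 0 < Real.log R := by
      have : 0 ≤ lg pr A := lg_nonneg A
      linarith
    have hlt : 2 * lg pr S / Real.log R < 1 := by nlinarith
    rw [div_lt_one hlR'] at hlt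
    have h1 : Real.log (((∏ p ∈ A, pr p) * (∏ p ∈ S, pr p) : ℕ) : ℝ) ≤ Real.log R := by
      rw [Nat.cast_mul, Real.log_mul (by exact_mod_cast hApos.ne') (by exact_mod_cast hSpos.ne'),
        ← lg_eq_log hpr, ← lg_eq_log hpr]
      linarith
    have hR0 : (0 : ℝ) < R := by
      rcases Nat.eq_zero_or_pos R with h | h
      · rw [h] at hlR'; simp at hlR'
      · exact_mod_cast h
    exact_mod_cast (Real.log_le_log_iff (by exact_mod_cast Nat.mul_pos hApos hSpos) hR0).mp h1
  rw [hinner]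
  have h2 := massOne_mul_le hpr J z S
  rw [← hσ] at h2
  have hσ1 : ((k : ℝ) + 1) * σ < 1 := by linarith
  have hσ2 : σ < 1 := by nlinarith
  have h3 : massOne pr J z ^ 2 * (1 - σ) ^ 2 ≤
      (∑ A with Disjoint A S, gfun J z (lg pr A) * wt pr A) ^ 2 := by
    rw [← mul_pow]
    exact pow_le_pow_left₀ (mul_nonneg hM0 (by linarith)) h2 2
  have h4 : 0 ≤ 1 - ((k : ℝ) - 1) * σ := by nlinarith
  calc _ ≤ massOne pr J z ^ 2 * ((1 - ((k : ℝ) - 1) * σ) * (1 - σ) ^ 2) := by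
        refine mul_le_mul_of_nonneg_left ?_ (sq_nonneg _)
        nlinarith [mul_nonneg h4 (sq_nonneg σ), mul_nonneg (mul_nonneg (sub_nonneg.mpr hk') hσ0) hσ0]
    _ = (1 - ((k : ℝ) - 1) * σ) * (massOne pr J z ^ 2 * (1 - σ) ^ 2) := by ring
    _ ≤ _ := mul_le_mul hprod h3 (mul_nonneg (sq_nonneg _) (sq_nonneg _)) hprod0

lemma mul_one_sub_le_block_term {pr : ι → ℕ} (hpr : ∀ p, (pr p).Prime) {J R : ℕ} {z : ℝ}
    (hz : 0 ≤ z) (hzR : 2 * (16 ^ J * z) ≤ Real.log R) (hkp : ∀ p, k ≤ pr p) {m : Fin k}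
    {c : ι → Option (Fin k)} (hc : part c m = ∅) :
    massOne pr J z ^ 2 * ((∏ i with i ≠ m, gfun J z (lg pr (part c i)) ^ 2 * wt pr (part c i)) *
      (1 - ∑ i, (∑ p ∈ part c i, ((k : ℝ) + 1) / ((pr p : ℝ) - 1) +
        2 * lg pr (part c i) / Real.log R))) ≤
    (∏ p, bval m (pr p) (c p)) * (∑ s, yv pr J z R s * ∏ p, bvec m (c p) (s p)) ^ 2 := by
  have hcm : ∀ p, c p ≠ some m := fun p h => by
    have : p ∈ part c m := by simpa [part] using h
    rw [hc] at this; simp at this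
  have h1 : ∏ p, bval m (pr p) (c p) = ∏ p ∈ supp c, ((pr p : ℝ) - k) := by
    rw [supp, Finset.prod_filter]
    refine Finset.prod_congr rfl fun p _ => ?_
    rcases hcp : c p with _ | i
    · simp [bval]
    · have : i ≠ m := fun h => hcm p (by rw [hcp, h])
      simp [bval, this]
  have h2 : ∑ i, (∑ p ∈ part c i, ((k : ℝ) + 1) / ((pr p : ℝ) - 1) +
        2 * lg pr (part c i) / Real.log R) = ∑ p ∈ supp c, ((k : ℝ) + 1) / ((pr p : ℝ) - 1) +
        2 * lg pr (supp c) / Real.log R := by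
    rw [Finset.sum_add_distrib, sum_part, ← Finset.sum_div, ← Finset.mul_sum]
    simp only [lg, sum_part]
  have h3 : ∏ i with i ≠ m, wt pr (part c i) = wt pr (supp c) := by
    have : ∏ i, wt pr (part c i) = wt pr (supp c) := by rw [prod_wt_part, prod_ite_none]; rfl
    rw [← this, ← Finset.mul_prod_erase _ _ (mem_univ m), hc, Finset.filter_ne']
    simp [wt]
  have h4 : (∏ p ∈ supp c, ((pr p : ℝ) - k)) * (∏ p ∈ supp c, -(1 / ((pr p : ℝ) - 1))) ^ 2 =
      wt pr (supp c) * ∏ p ∈ supp c, (1 - ((k : ℝ) - 1) / ((pr p : ℝ) - 1)) := by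
    rw [wt, ← Finset.prod_pow, ← Finset.prod_mul_distrib, ← Finset.prod_mul_distrib]
    refine Finset.prod_congr rfl fun p _ => ?_
    have := (one_lt_pr hpr p).ne'
    field_simp
    ring
  have h5 := massOne_sq_mul_le hpr hz hzR (by have := m.2; omega : 1 ≤ k) hkp (supp c)
  rw [sum_yv_mul_prod_bvec J z R hc, h1, h2, Finset.prod_mul_distrib, h3, Finset.prod_pow]
  rw [md]
  have h6 : 0 ≤ wt pr (supp c) * (∏ i with i ≠ m, gfun J z (lg pr (part c i))) ^ 2 :=
    mul_nonneg (wt_nonneg hpr _) (sq_nonneg _)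
  calc _ = wt pr (supp c) * (∏ i with i ≠ m, gfun J z (lg pr (part c i))) ^ 2 *
        (massOne pr J z ^ 2 * (1 - (∑ p ∈ supp c, ((k : ℝ) + 1) / ((pr p : ℝ) - 1) +
        2 * lg pr (supp c) / Real.log R))) := by ring
    _ ≤ _ := mul_le_mul_of_nonneg_left h5 h6
    _ = _ := by rw [mul_pow, mul_pow, ← mul_assoc, ← mul_assoc, ← mul_assoc, h4]; ring

lemma le_form_gram_rhoPrime {pr : ι → ℕ} (hpr : ∀ p, (pr p).Prime) (hinj : Function.Injective pr)
    {D : ℕ} (hkD : 15 * k ^ 2 ≤ D) (hDp : ∀ p, D < pr p) {J R : ℕ} {z : ℝ}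
    (hz : 0 ≤ z) (hzR : 2 * (16 ^ J * z) ≤ Real.log R) (hR : 0 < Real.log R)
    (hN : 0 < massSq pr J z)
    (hM : 20 * k * ∑ A, gfun J z (lg pr A) ^ 2 * wt pr A * lg pr A ≤ Real.log R * massSq pr J z)
    (m : Fin k) :
    1 / 2 * (massSq pr J z ^ (k - 1) * massOne pr J z ^ 2) ≤
      form (fun p => gram (pr p) (rhoPrime m (pr p))) (yv pr J z R) := by
  classical
  have hk : 1 ≤ k := by have := m.2; omega
  have hkk : k ≤ k ^ 2 := by nlinarith
  have hkp : ∀ p, k ≤ pr p := fun p => by have := hDp p; omega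
  have hkp' : ∀ p, (k : ℝ) ≤ pr p := fun p => by exact_mod_cast hkp p
  obtain ⟨N, hNdef⟩ : ∃ N, N = massSq pr J z := ⟨_, rfl⟩
  obtain ⟨μ, hμ⟩ : ∃ μ : Finset ι → ℝ, ∀ A, μ A = gfun J z (lg pr A) ^ 2 * wt pr A :=
    ⟨_, fun _ => rfl⟩
  have hμ0 : ∀ A, 0 ≤ μ A := fun A => by
    rw [hμ]; exact mul_nonneg (sq_nonneg _) (wt_nonneg hpr _)
  have hμN : ∑ A, μ A = N := by rw [hNdef, massSq]; simp only [hμ]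
  rw [← hNdef] at hN hM ⊢
  simp only [← hμ] at hM
  let ν : Fin k → Finset ι → ℝ := fun i A => if i = m then (if A = ∅ then 1 else 0) else μ A / N
  let cc : Finset ι → ℝ := fun A => ∑ p ∈ A, ((k : ℝ) + 1) / ((pr p : ℝ) - 1) +
    2 * lg pr A / Real.log R
  have hν0 : ∀ i A, 0 ≤ ν i A := fun i A => by
    have := hμ0 A
    simp only [ν]
    split_ifs <;> positivity
  have hν1 : ∀ i, ∑ A, ν i A = 1 := fun i => by
    by_cases hi : i = m
    · simp [ν, hi]
    · simp only [ν, hi, if_false]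
      rw [← Finset.sum_div, hμN, div_self hN.ne']
  have hr0 : ∀ p, 0 ≤ 1 / ((pr p : ℝ) - 1) := fun p => (one_div_pos.mpr (one_lt_pr hpr p)).le
  have hcc0 : ∀ A, 0 ≤ cc A := fun A => by
    refine add_nonneg (Finset.sum_nonneg fun p _ => div_nonneg (by positivity)
      (one_lt_pr hpr p).le) (div_nonneg (mul_nonneg zero_le_two (lg_nonneg A)) hR.le)
  have hμr : ∀ p, ∑ A, μ A * (if p ∈ A then 1 else 0) ≤ 1 / ((pr p : ℝ) - 1) * N := fun p => by
    have h := sum_mem_mul_wt_le hpr (G := fun t => gfun J z t ^ 2)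
      (fun s t h => pow_le_pow_left₀ (gfun_nonneg _ _ _) (gfun_anti J z h) 2)
      (fun t => sq_nonneg _) p
    simp only [← hμ, hμN, Finset.sum_filter] at h
    simpa using h
  have hνr : ∀ i p, ∑ A, ν i A * (if p ∈ A then 1 else 0) ≤ 1 / ((pr p : ℝ) - 1) := fun i p => by
    by_cases hi : i = m
    · simp only [ν, hi, if_true]
      rw [Finset.sum_eq_zero]
      · exact hr0 p
      · intro A _
        by_cases hA : A = ∅ <;> simp [hA]
    · simp only [ν, hi, if_false]
      have : ∀ A, μ A / N * (if p ∈ A then 1 else 0) = (μ A * if p ∈ A then 1 else 0) / N :=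
        fun A => by ring
      simp only [this]
      rw [← Finset.sum_div, div_le_iff₀ hN]
      exact hμr p
  have hD1 : 1 ≤ D := by nlinarith
  have hD0 : (0 : ℝ) < D := by exact_mod_cast hD1
  have hsq : ∑ p, (1 / ((pr p : ℝ) - 1)) ^ 2 ≤ (2 / D : ℝ) := by
    have h1 := sum_one_div_mul_pred_le hinj hD1 hDp
    calc ∑ p, (1 / ((pr p : ℝ) - 1)) ^ 2 ≤ ∑ p, 2 * (1 / ((pr p : ℝ) * ((pr p : ℝ) - 1))) := by
          refine Finset.sum_le_sum fun p _ => ?_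
          have h2 := one_lt_pr hpr p
          have h3 : (2 : ℝ) ≤ pr p := by exact_mod_cast (hpr p).two_le
          rw [one_div_pow, mul_one_div, div_le_div_iff₀ (by positivity) (by positivity)]
          nlinarith
      _ = 2 * ∑ p, 1 / ((pr p : ℝ) * ((pr p : ℝ) - 1)) := by rw [Finset.mul_sum]
      _ ≤ 2 * (1 / (D : ℝ)) := by linarith
      _ = _ := by ring
  have hkD' : 15 * (k : ℝ) ^ 2 ≤ D := by exact_mod_cast hkD
  have hk1 : (1 : ℝ) ≤ k := by exact_mod_cast hk
  have hνc : ∀ i, ∑ A, ν i A * cc A ≤ (k + 1) * (2 / D) + 1 / (10 * k) := fun i => by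
    by_cases hi : i = m
    · have : ∑ A, ν i A * cc A = 0 := by
        refine Finset.sum_eq_zero fun A _ => ?_
        by_cases hA : A = ∅ <;> simp [ν, cc, hi, hA, lg]
      rw [this]; positivity
    · have h1 : ∑ A, ν i A * cc A = (∑ p, (k + 1) / ((pr p : ℝ) - 1) *
          ∑ A, μ A * (if p ∈ A then 1 else 0)) / N + 2 / (Real.log R * N) * ∑ A, μ A * lg pr A := by
        have h2 : ∑ p, (k + 1) / ((pr p : ℝ) - 1) * ∑ A, μ A * (if p ∈ A then 1 else 0) =
            ∑ A, μ A * ∑ p ∈ A, (k + 1) / ((pr p : ℝ) - 1) := by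
          simp only [Finset.mul_sum]
          rw [Finset.sum_comm]
          refine Finset.sum_congr rfl fun A _ => ?_
          rw [← Finset.sum_filter_add_sum_filter_not univ (fun p => p ∈ A)]
          rw [Finset.sum_congr (s₁ := univ.filter (fun p => p ∉ A)) rfl (g := fun _ => (0 : ℝ))
            (fun p hp => by simp [(mem_filter.mp hp).2])]
          simp only [Finset.filter_univ_mem, Finset.sum_const_zero, add_zero]
          exact Finset.sum_congr rfl fun p hp => by simp [hp]; ring
        rw [h2, Finset.sum_div, Finset.mul_sum, ← Finset.sum_add_distrib]
        refine Finset.sum_congr rfl fun A _ => ?_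
        simp only [ν, cc, hi, if_false]
        field_simp
      rw [h1]
      refine add_le_add ?_ ?_
      · rw [div_le_iff₀ hN]
        calc _ ≤ ∑ p, (k + 1) / ((pr p : ℝ) - 1) * (1 / ((pr p : ℝ) - 1) * N) :=
              Finset.sum_le_sum fun p _ => mul_le_mul_of_nonneg_left (hμr p)
                (div_nonneg (by positivity) (one_lt_pr hpr p).le)
          _ = (k + 1) * (∑ p, (1 / ((pr p : ℝ) - 1)) ^ 2) * N := by
              rw [Finset.mul_sum, Finset.sum_mul]
              exact Finset.sum_congr rfl fun p _ => by ring
          _ ≤ _ := by gcongr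
      · rw [div_mul_eq_mul_div, div_le_div_iff₀ (by positivity) (by positivity)]
        linarith
  have key := le_sum_pairwise_disjoint hν0 hν1 hcc0 hνr
  have hhalf : 1 / 2 ≤ 1 - ∑ i, ∑ A, ν i A * cc A -
      (k : ℝ) ^ 2 * ∑ p, (1 / ((pr p : ℝ) - 1)) ^ 2 := by
    have h1 : ∑ i, ∑ A, ν i A * cc A ≤ k * ((k + 1) * (2 / D) + 1 / (10 * k)) :=
      (Finset.sum_le_sum fun i _ => hνc i).trans (by
        rw [Finset.sum_const, Finset.card_univ, Fintype.card_fin, nsmul_eq_mul])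
    have h2 : (k : ℝ) ^ 2 * ∑ p, (1 / ((pr p : ℝ) - 1)) ^ 2 ≤ (k : ℝ) ^ 2 * (2 / D) :=
      mul_le_mul_of_nonneg_left hsq (sq_nonneg _)
    have h3 : (k : ℝ) ^ 2 / D ≤ 1 / 15 := by
      rw [div_le_div_iff₀ hD0 (by norm_num)]; linarith
    have h4 : k * ((k + 1) * (2 / (D : ℝ)) + 1 / (10 * k)) ≤ 4 * (k ^ 2 / D) + 1 / 10 := by
      have : (k : ℝ) * (1 / (10 * k)) = 1 / 10 := by field_simp
      rw [mul_add, this]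
      have : k * ((k + 1) * (2 / (D : ℝ))) = (2 * k * (k + 1)) / D := by ring
      rw [this, ← mul_div_assoc]
      have := div_le_div_of_nonneg_right (show 2 * (k : ℝ) * (k + 1) ≤ 4 * k ^ 2 by nlinarith) hD0.le
      linarith
    have h5 : (k : ℝ) ^ 2 * (2 / D) = 2 * (k ^ 2 / D) := by ring
    linarith
  have hM0 : 0 ≤ N ^ (k - 1) * massOne pr J z ^ 2 := mul_nonneg (by positivity) (sq_nonneg _)
  have hterm0 : ∀ c : ι → Option (Fin k), 0 ≤ (∏ p, bval m (pr p) (c p)) *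
      (∑ s, yv pr J z R s * ∏ p, bvec m (c p) (s p)) ^ 2 := fun c => by
    refine mul_nonneg (Finset.prod_nonneg fun p _ => ?_) (sq_nonneg _)
    rcases c p with _ | i
    · simp [bval]
    · have := hkp' p
      simp only [bval]; split_ifs <;> linarith
  have hterm : ∀ c : ι → Option (Fin k), N ^ (k - 1) * massOne pr J z ^ 2 *
      ((∏ i, ν i (part c i)) * (1 - ∑ i, cc (part c i))) ≤ (∏ p, bval m (pr p) (c p)) *
      (∑ s, yv pr J z R s * ∏ p, bvec m (c p) (s p)) ^ 2 := fun c => by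
    by_cases hc : part c m = ∅
    · refine le_trans (le_of_eq ?_) (mul_one_sub_le_block_term hpr hz hzR hkp hc)
      have h1 : N ^ (k - 1) * ∏ i, ν i (part c i) = ∏ i with i ≠ m, μ (part c i) := by
        rw [← Finset.mul_prod_erase _ _ (mem_univ m), Finset.filter_ne']
        have : ∏ i ∈ univ.erase m, ν i (part c i) = (∏ i ∈ univ.erase m, μ (part c i)) / N ^ (k - 1) := by
          rw [Finset.prod_congr rfl fun i hi => show ν i (part c i) = μ (part c i) / N by
            simp [ν, Finset.ne_of_mem_erase hi], Finset.prod_div_distrib, Finset.prod_const]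
          simp
        rw [this]
        simp only [ν, hc, if_true, one_mul]
        field_simp
      simp only [← hμ]
      rw [← h1]
      simp only [cc]
      ring
    · have : ∏ i, ν i (part c i) = 0 :=
        Finset.prod_eq_zero (mem_univ m) (by simp [ν, hc])
      rw [this, zero_mul, mul_zero]
      exact hterm0 c
  choose! e he using fun (A : Fin k → Finset ι)
    (hA : Pairwise fun i j => Disjoint (A i) (A j)) => exists_part_eq hA
  calc 1 / 2 * (N ^ (k - 1) * massOne pr J z ^ 2)
      ≤ N ^ (k - 1) * massOne pr J z ^ 2 *
        ∑ A : Fin k → Finset ι with Pairwise fun i j => Disjoint (A i) (A j),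
        (∏ i, ν i (A i)) * (1 - ∑ i, cc (A i)) := by
        rw [mul_comm]
        exact mul_le_mul_of_nonneg_left (hhalf.trans key) hM0
    _ = ∑ A : Fin k → Finset ι with Pairwise fun i j => Disjoint (A i) (A j),
        N ^ (k - 1) * massOne pr J z ^ 2 * ((∏ i, ν i (A i)) * (1 - ∑ i, cc (A i))) :=
        Finset.mul_sum _ _ _
    _ ≤ ∑ c : ι → Option (Fin k), (∏ p, bval m (pr p) (c p)) *
        (∑ s, yv pr J z R s * ∏ p, bvec m (c p) (s p)) ^ 2 := by
        refine sum_le_sum_of_injOn e (fun _ _ => mem_univ _) ?_ ?_ fun c _ => hterm0 c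
        · intro A hA B hB h
          simp only [coe_filter, mem_univ, true_and, Set.mem_ofPred_eq] at hA hB
          rw [← he A hA, h, he B hB]
        · intro A hA
          have h := hterm (e A)
          rw [he A (mem_filter.mp hA).2] at h
          exact h
    _ = form (fun p => blockPrime m (pr p)) (yv pr J z R) :=
        (form_eq_sum_sq (fun p o o' => blockPrime_eq_sum m (pr p) o o') _).symm
    _ ≤ _ := form_le_form (fun p => blockPrime_posSemidef m (hkp' p))
        (fun p => gram_sub_blockPrime_posSemidef m (by have := one_lt_pr hpr p; linarith)) _

end PrimeGapRuns

namespace PrimeGapRuns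

open Finset

lemma add_modEq_iff {q n a c : ℕ} (hq : 0 < q) :
    n + a ≡ c [MOD q] ↔ n ≡ c + (q - 1) * a [MOD q] := by
  have h : c + (q - 1) * a + a ≡ c [MOD q] := by
    have : c + (q - 1) * a + a = c + q * a := by
      obtain ⟨q, rfl⟩ : ∃ r, q = r + 1 := ⟨q - 1, by omega⟩
      simp only [Nat.add_sub_cancel]; ring
    rw [this]
    simp [Nat.ModEq]
  exact ⟨fun h' => Nat.ModEq.add_right_cancel' a (h'.trans h.symm),
    fun h' => (Nat.ModEq.add_right a h').trans h⟩

lemma exists_modEq_iff {ι : Type*} [DecidableEq ι] {pr : ι → ℕ} (hpr : ∀ p, (pr p).Prime)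
    (hinj : Function.Injective pr) {W : ℕ} (hW : ∀ p, W.Coprime (pr p)) (a : ℕ) (r : ι → ℕ)
    (S : Finset ι) : ∃ b, ∀ n, (n ≡ a [MOD W] ∧ ∀ p ∈ S, n ≡ r p [MOD pr p]) ↔
      n ≡ b [MOD W * ∏ p ∈ S, pr p] := by
  induction S using Finset.induction_on with
  | empty => exact ⟨a, by simp⟩
  | insert p S hp ih =>
    obtain ⟨b, hb⟩ := ih
    have hcop : (W * ∏ q ∈ S, pr q).Coprime (pr p) :=
      Nat.Coprime.mul_left (hW p) (Nat.Coprime.prod_left fun q hq =>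
        (Nat.coprime_primes (hpr q) (hpr p)).mpr fun h => hp (hinj h ▸ hq))
    obtain ⟨x, hx1, hx2⟩ := Nat.chineseRemainder hcop b (r p)
    refine ⟨x, fun n => ?_⟩
    rw [Finset.prod_insert hp, mul_left_comm, mul_comm (pr p),
      ← Nat.modEq_and_modEq_iff_modEq_mul hcop]
    simp only [Finset.mem_insert, forall_eq_or_imp]
    constructor
    · rintro ⟨h1, h2, h3⟩
      exact ⟨((hb n).mp ⟨h1, h3⟩).trans hx1.symm, h2.trans hx2.symm⟩
    · rintro ⟨h1, h2⟩
      obtain ⟨h3, h4⟩ := (hb n).mpr (h1.trans hx1)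
      exact ⟨h3, h2.trans hx2, h4⟩

variable {ι : Type*} {k : ℕ}

/-- The indicator of a single condition `n + h i ≡ c`. -/
def ind (pr : ι → ℕ) (h : Fin k → ℕ) (c : ℕ) (p : ι) : Option (Fin k) → ℕ → ℝ
  | none, _ => 1
  | some i, n => if n + h i ≡ c [MOD pr p] then 1 else 0

/-- Two systems of conditions do not ask for two different places at the same prime. -/
def Compat (d e : ι → Option (Fin k)) : Prop :=
  ∀ p i j, d p = some i → e p = some j → i = j

/-- The conjunction of two systems of conditions. -/
def join (d e : ι → Option (Fin k)) (p : ι) : Option (Fin k) := (d p).or (e p)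

variable {pr : ι → ℕ} {h : Fin k → ℕ} {c : ℕ}

lemma ind_mul_ind {d e : ι → Option (Fin k)} (hde : Compat d e) (p : ι) (n : ℕ) :
    ind pr h c p (d p) n * ind pr h c p (e p) n = ind pr h c p (join d e p) n := by
  rcases hd : d p with _ | i
  · simp [join, hd, ind]
  · rcases he : e p with _ | j
    · simp [join, hd, he, ind]
    · obtain rfl := hde p i j hd he
      simp [join, hd, ind]

lemma ind_add_right (m : Fin k) (p : ι) (o : Option (Fin k)) (n : ℕ) :
    ind pr h (h m) p o (n + h m) = ind pr h 0 p o n := by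
  rcases o with _ | i
  · rfl
  · have : n + h m + h i ≡ h m [MOD pr p] ↔ n + h i ≡ 0 [MOD pr p] := by
      rw [show n + h m + h i = (n + h i) + h m by ring]
      refine ⟨fun hh => Nat.ModEq.add_right_cancel' (h m) (by rwa [zero_add]), fun hh => ?_⟩
      simpa using Nat.ModEq.add_right (h m) hh
    simp [ind, this]

variable [Fintype ι]

lemma prod_rhoInt_of_compat {d e : ι → Option (Fin k)} (hde : Compat d e) :
    ∏ p, rhoInt (pr p) (d p) (e p) = 1 / (md pr (join d e) : ℝ) := by
  rw [md, supp, Nat.cast_prod, one_div, ← Finset.prod_inv_distrib, Finset.prod_filter]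
  refine Finset.prod_congr rfl fun p _ => ?_
  rcases hd : d p with _ | i <;> rcases he : e p with _ | j <;> simp only [join, hd, he] <;>
    simp [rhoInt]
  exact fun hij => absurd (hde p i j hd he) hij

lemma prod_rhoPrime_of_compat {d e : ι → Option (Fin k)} (hde : Compat d e) {m : Fin k}
    (hm : ∀ p, join d e p ≠ some m) :
    ∏ p, rhoPrime m (pr p) (d p) (e p) = wt pr (supp (join d e)) := by
  rw [wt, supp, Finset.prod_filter]
  refine Finset.prod_congr rfl fun p _ => ?_
  have hm := hm p
  rcases hd : d p with _ | i <;> rcases he : e p with _ | j <;> simp only [join, hd, he] at hm ⊢ <;>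
    simp [rhoPrime]
  · exact fun hij => absurd (by simp [hij]) hm
  · exact fun hij => absurd (by simp [hij]) hm
  · obtain rfl := hde p i j hd he
    rw [if_neg (fun hij => absurd (by simp [hij]) hm), if_pos rfl]

lemma prod_rhoPrime_eq_zero {d e : ι → Option (Fin k)} {m : Fin k}
    (hm : ∃ p, join d e p = some m) :
    ∏ p, rhoPrime m (pr p) (d p) (e p) = 0 := by
  obtain ⟨p, hp⟩ := hm
  refine Finset.prod_eq_zero (mem_univ p) ?_
  rcases hd : d p with _ | i <;> rcases he : e p with _ | j <;> simp only [join, hd, he] at hp <;>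
    simp at hp <;> subst hp <;> simp [rhoPrime]

lemma prod_rhoInt_eq_zero {d e : ι → Option (Fin k)} (hde : ¬ Compat d e) :
    ∏ p, rhoInt (pr p) (d p) (e p) = 0 := by
  simp only [Compat, not_forall] at hde
  obtain ⟨p, i, j, hd, he, hij⟩ := hde
  exact Finset.prod_eq_zero (mem_univ p) (by simp [hd, he, rhoInt, hij])

lemma prod_rhoPrime_eq_zero_of_not_compat {d e : ι → Option (Fin k)} (hde : ¬ Compat d e)
    (m : Fin k) : ∏ p, rhoPrime m (pr p) (d p) (e p) = 0 := by
  simp only [Compat, not_forall] at hde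
  obtain ⟨p, i, j, hd, he, hij⟩ := hde
  exact Finset.prod_eq_zero (mem_univ p) (by simp [hd, he, rhoPrime, hij])

lemma prod_ind_mul_prod_ind {d e : ι → Option (Fin k)} (hde : Compat d e) (n : ℕ) :
    (∏ p, ind pr h c p (d p) n) * ∏ p, ind pr h c p (e p) n =
      ∏ p, ind pr h c p (join d e p) n := by
  rw [← Finset.prod_mul_distrib]
  exact Finset.prod_congr rfl fun p _ => ind_mul_ind hde p n

lemma prod_ind_mul_prod_ind_eq_zero {d e : ι → Option (Fin k)} (hde : ¬ Compat d e)
    (hh : Function.Injective h) (hlt : ∀ p i, h i < pr p) (n : ℕ) :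
    (∏ p, ind pr h c p (d p) n) * ∏ p, ind pr h c p (e p) n = 0 := by
  simp only [Compat, not_forall] at hde
  obtain ⟨p, i, j, hd, he, hij⟩ := hde
  rw [← Finset.prod_mul_distrib]
  refine Finset.prod_eq_zero (mem_univ p) ?_
  rw [hd, he]
  simp only [ind]
  by_cases h1 : n + h i ≡ c [MOD pr p]
  · by_cases h2 : n + h j ≡ c [MOD pr p]
    · refine absurd (hh ?_) hij
      exact Nat.ModEq.eq_of_lt_of_lt (Nat.ModEq.add_left_cancel' n (h1.trans h2.symm))
        (hlt p i) (hlt p j)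
    · simp [h2]
  · simp [h1]

lemma prod_ind_eq (u : ι → Option (Fin k)) (n : ℕ) :
    ∏ p, ind pr h c p (u p) n =
      if ∀ p i, u p = some i → n + h i ≡ c [MOD pr p] then 1 else 0 := by
  split_ifs with hu
  · refine Finset.prod_eq_one fun p _ => ?_
    rcases hp : u p with _ | i
    · rfl
    · simp [ind, hu p i hp]
  · push Not at hu
    obtain ⟨p, i, hp, hn⟩ := hu
    exact Finset.prod_eq_zero (mem_univ p) (by simp [hp, ind, hn])

variable [DecidableEq ι]

lemma supp_join (d e : ι → Option (Fin k)) : supp (join d e) = supp d ∪ supp e := by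
  ext p
  simp only [supp, join, mem_filter, mem_univ, true_and, mem_union]
  rcases hd : d p with _ | i <;> simp [hd]

lemma md_join_le (hpr : ∀ p, (pr p).Prime) (d e : ι → Option (Fin k)) :
    md pr (join d e) ≤ md pr d * md pr e := by
  rw [md, supp_join, md, md, ← Finset.prod_union_inter]
  exact Nat.le_mul_of_pos_right _ (Finset.prod_pos fun p _ => (hpr p).pos)

/-- A system of conditions is a single residue class. -/
lemma exists_residue (hpr : ∀ p, (pr p).Prime) (hinj : Function.Injective pr) {W : ℕ}
    (hW : ∀ p, W.Coprime (pr p)) (h : Fin k → ℕ) (c a : ℕ) (u : ι → Option (Fin k)) :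
    ∃ b, ∀ n, (n ≡ a [MOD W] ∧ ∀ p i, u p = some i → n + h i ≡ c [MOD pr p]) ↔
      n ≡ b [MOD W * md pr u] := by
  obtain ⟨b, hb⟩ := exists_modEq_iff hpr hinj hW a
    (fun p => match u p with | none => 0 | some i => c + (pr p - 1) * h i) (supp u)
  refine ⟨b, fun n => ?_⟩
  rw [md, ← hb n]
  refine and_congr_right fun _ => ⟨fun hn p hp => ?_, fun hn p i hp => ?_⟩
  · simp only [supp, mem_filter, mem_univ, true_and] at hp
    obtain ⟨i, hi⟩ := Option.ne_none_iff_exists'.mp hp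
    have := (add_modEq_iff (hpr p).pos).mp (hn p i hi)
    simpa only [hi] using this
  · have := hn p (by simp [supp, hp])
    simp only [hp] at this
    exact (add_modEq_iff (hpr p).pos).mpr this

lemma sum_mul_prod_ind (hpr : ∀ p, (pr p).Prime) (hinj : Function.Injective pr) {W : ℕ}
    (hW : ∀ p, W.Coprime (pr p)) (h : Fin k → ℕ) (c a : ℕ) (u : ι → Option (Fin k)) :
    ∃ b, (∀ n, (n ≡ a [MOD W] ∧ ∀ p i, u p = some i → n + h i ≡ c [MOD pr p]) ↔
      n ≡ b [MOD W * md pr u]) ∧ ∀ (I : Finset ℕ) (w : ℕ → ℝ),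
      ∑ n ∈ I with n ≡ a [MOD W], w n * ∏ p, ind pr h c p (u p) n =
        ∑ n ∈ I with n ≡ b [MOD W * md pr u], w n := by
  obtain ⟨b, hb⟩ := exists_residue hpr hinj hW h c a u
  refine ⟨b, hb, fun I w => ?_⟩
  simp only [prod_ind_eq, mul_ite, mul_one, mul_zero]
  rw [← Finset.sum_filter, Finset.filter_filter]
  exact Finset.sum_congr (Finset.filter_congr fun n _ => hb n) fun _ _ => rfl

end PrimeGapRuns

namespace PrimeGapRuns

open Finset

lemma abs_sum_modEq_sub_le {M : ℕ} (hM : 0 < M) (b : ℕ) {N₀ : ℕ} (hN₀ : 0 < N₀) (N : ℕ) :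
    |∑ n ∈ Ioc N₀ N with n ≡ b [MOD M], 1 / (n : ℝ) - 1 / M * ∑ n ∈ Ioc N₀ N, 1 / (n : ℝ)| ≤
      5 * M / N₀ := by
  have hM' : (0 : ℝ) < M := by exact_mod_cast hM
  have hM1 : (1 : ℝ) / M ≤ 1 := by rw [div_le_one hM']; exact_mod_cast hM
  have hM0 : (0 : ℝ) < 1 / M := by positivity
  let ψ : ℕ → ℂ := fun n => (((if n ≡ b [MOD M] then 1 else 0) - 1 / M : ℝ) : ℂ)
  have hψ : BoundedSums ψ M := by
    refine boundedSums_of_periodic hM (fun n => ?_) ?_ fun n => ?_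
    · have : n + M ≡ b [MOD M] ↔ n ≡ b [MOD M] := by simp [Nat.ModEq]
      simp only [ψ, this]
    · have hf : (range M).filter (fun n => n ≡ b [MOD M]) = {b % M} := by
        ext n
        rw [mem_filter, mem_range, mem_singleton]
        exact ⟨fun h => by rw [← h.2, Nat.mod_eq_of_lt h.1],
          fun h => by subst h; exact ⟨Nat.mod_lt _ hM, Nat.mod_mod _ _⟩⟩
      simp only [ψ]
      rw [← Complex.ofReal_sum, Finset.sum_sub_distrib, Finset.sum_boole, hf]
      simp [hM.ne']
    · simp only [ψ, Complex.norm_real, Real.norm_eq_abs]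
      split_ifs <;> rw [abs_le] <;> constructor <;> linarith
  have h1 := norm_sum_smooth_le hψ (G := fun _ => 1) (B := 1) (differentiable_const _)
    (fun t => by simp) (fun t => by simp) (a := N₀ + 1) (b := N + 1) (by omega)
  have hI : Ico (N₀ + 1) (N + 1) = Ioc N₀ N := by ext n; rw [mem_Ico, mem_Ioc]; omega
  have e : ∑ n ∈ Ico (N₀ + 1) (N + 1), ψ n * ((1 / n : ℝ) : ℂ) =
      ((∑ n ∈ Ioc N₀ N with n ≡ b [MOD M], 1 / (n : ℝ) -
        1 / M * ∑ n ∈ Ioc N₀ N, 1 / (n : ℝ) : ℝ) : ℂ) := by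
    rw [hI, Finset.sum_filter, Finset.mul_sum, ← Finset.sum_sub_distrib, Complex.ofReal_sum]
    refine Finset.sum_congr rfl fun n _ => ?_
    simp only [ψ]
    rw [← Complex.ofReal_mul]
    congr 1
    split_ifs <;> ring
  rw [e, Complex.norm_real, Real.norm_eq_abs] at h1
  refine h1.trans ?_
  have h0 : (0 : ℝ) < N₀ := by exact_mod_cast hN₀
  push_cast
  calc (M : ℝ) * (5 * 1 / (N₀ + 1)) ≤ M * (5 * 1 / N₀) := by gcongr; linarith
    _ = _ := by ring

variable {ι : Type*} [Fintype ι] [DecidableEq ι] {k : ℕ}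

/-- The sieve function. -/
noncomputable def sieve (pr : ι → ℕ) (h : Fin k → ℕ) (c : ℕ) (y : (ι → Option (Fin k)) → ℝ)
    (n : ℕ) : ℝ :=
  ∑ s, y s * ∏ p, ∑ o, coef (pr p) (s p) o * ind pr h c p o n

lemma sieve_add (pr : ι → ℕ) (h : Fin k → ℕ) (m : Fin k) (y : (ι → Option (Fin k)) → ℝ) (n : ℕ) :
    sieve pr h (h m) y (n + h m) = sieve pr h 0 y n := by
  simp only [sieve, ind_add_right]

/-- A product measuring divisor-type losses. -/
noncomputable def loss (pr : ι → ℕ) (c : ℕ) : ℝ := ∏ p, (1 + (c : ℝ) / ((pr p : ℝ) - 1))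

lemma one_le_loss {pr : ι → ℕ} (hpr : ∀ p, (pr p).Prime) (c : ℕ) : 1 ≤ loss pr c := by
  calc (1 : ℝ) = ∏ _p : ι, (1 : ℝ) := by simp
    _ ≤ loss pr c := ?_
  refine Finset.prod_le_prod (fun _ _ => zero_le_one) fun p _ => ?_
  have := one_lt_pr hpr p
  have : 0 ≤ (c : ℝ) / ((pr p : ℝ) - 1) := by positivity
  linarith

theorem abs_sum_sieve_sq_sub_le {pr : ι → ℕ} (hpr : ∀ p, (pr p).Prime)
    (hinj : Function.Injective pr) {W : ℕ} (hW0 : 0 < W) (hW : ∀ p, W.Coprime (pr p))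
    {h : Fin k → ℕ} (hh : Function.Injective h) (hlt : ∀ p i, h i < pr p) (a : ℕ) {R : ℕ}
    {y : (ι → Option (Fin k)) → ℝ} {C : ℝ} (hC : 0 ≤ C) (hy : ∀ s, |y s| ≤ C * wt pr (supp s))
    (hy0 : ∀ s, R < md pr s → y s = 0) {N₀ : ℕ} (hN₀ : 0 < N₀) (N : ℕ) :
    |∑ n ∈ Ioc N₀ N with n ≡ a [MOD W], 1 / (n : ℝ) * sieve pr h 0 y n ^ 2 -
      (∑ n ∈ Ioc N₀ N, 1 / (n : ℝ)) / W * form (fun p => gram (pr p) (rhoInt (pr p))) y| ≤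
      (C * loss pr k) ^ 2 * ((R * loss pr k) ^ 2 * (5 * (W * R ^ 2) / N₀)) := by
  have hΛ : 0 ≤ C * loss pr k := mul_nonneg hC (zero_le_one.trans (one_le_loss hpr k))
  have hb : (0 : ℝ) ≤ 5 * (W * R ^ 2) / N₀ := by positivity
  have key := abs_sum_sq_sub_form_le ((Ioc N₀ N).filter fun n => n ≡ a [MOD W])
    (fun n => 1 / (n : ℝ)) (fun p => coef (pr p)) (ind pr h 0) (fun p => rhoInt (pr p))
    ((∑ n ∈ Ioc N₀ N, 1 / (n : ℝ)) / W) y hΛ (univ.filter fun d => md pr d ≤ R)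
    (fun _ _ => 5 * (W * R ^ 2) / N₀) (fun d _ => abs_lam_le hpr hC hy d)
    (fun d hd => lam_eq_zero hpr hy0 (by simpa using hd)) ?_
  · refine key.trans (mul_le_mul_of_nonneg_left ?_ (sq_nonneg _))
    simp only [Finset.sum_const, nsmul_eq_mul]
    rw [← mul_assoc, ← sq]
    have := card_filter_md_le (k := k) hpr R
    exact mul_le_mul_of_nonneg_right (pow_le_pow_left₀ (Nat.cast_nonneg _) this 2) hb
  · intro d hd e he
    simp only [mem_filter, mem_univ, true_and] at hd he
    by_cases hde : Compat d e
    · obtain ⟨b, -, hb⟩ := sum_mul_prod_ind hpr hinj hW h 0 a (join d e)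
      have hmd : 0 < md pr (join d e) := Finset.prod_pos fun p _ => (hpr p).pos
      simp only [prod_ind_mul_prod_ind hde, prod_rhoInt_of_compat hde]
      rw [hb]
      have h1 := abs_sum_modEq_sub_le (Nat.mul_pos hW0 hmd) b hN₀ N
      have e1 : (∑ n ∈ Ioc N₀ N, 1 / (n : ℝ)) / W * (1 / (md pr (join d e) : ℝ)) =
          1 / ((W * md pr (join d e) : ℕ) : ℝ) * ∑ n ∈ Ioc N₀ N, 1 / (n : ℝ) := by
        push_cast; field_simp
      rw [e1]
      refine h1.trans ?_
      have h2 : (md pr (join d e) : ℝ) ≤ R ^ 2 := by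
        have := (md_join_le hpr d e).trans (Nat.mul_le_mul hd he)
        rw [sq]; exact_mod_cast this
      push_cast
      gcongr
    · simp only [prod_ind_mul_prod_ind_eq_zero hde hh hlt, mul_zero, Finset.sum_const_zero]
      rw [prod_rhoInt_eq_zero hde, mul_zero, sub_zero, abs_zero]
      exact hb

end PrimeGapRuns

namespace PrimeGapRuns

open Finset

/-- Smooth logarithmic weights on the primes. -/
noncomputable def pw (R q : ℕ) : ℝ :=
  logPrime q * bump (Real.log q / Real.log ((R ^ 120 : ℕ) : ℝ)) / q

lemma pw_nonneg (R q : ℕ) : 0 ≤ pw R q := by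
  have h : 0 ≤ logPrime q := by
    unfold logPrime; split_ifs
    · exact Real.log_natCast_nonneg _
    · exact le_rfl
  exact div_nonneg (mul_nonneg h (bump_nonneg _)) (Nat.cast_nonneg _)

lemma prime_of_pw_ne_zero {R q : ℕ} (h : pw R q ≠ 0) : q.Prime := by
  by_contra hq
  exact h (by simp [pw, logPrime, hq])

lemma lt_of_pw_ne_zero {R q : ℕ} (hR : 2 ≤ R) (h : pw R q ≠ 0) : R ^ 60 < q := by
  by_contra! hq
  have hq0 : 0 < q := (prime_of_pw_ne_zero h).pos
  refine h ?_
  have hR' : (1 : ℝ) < R := by exact_mod_cast hR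
  have hlog := Real.log_pos hR'
  have h1 : Real.log q ≤ 60 * Real.log R := by
    have := Real.log_le_log (by exact_mod_cast hq0) (by exact_mod_cast hq : (q : ℝ) ≤ (R : ℝ) ^ 60)
    rwa [Real.log_pow] at this
  have h2 : Real.log q / Real.log ((R ^ 120 : ℕ) : ℝ) ≤ 1 / 2 := by
    push_cast
    rw [Real.log_pow, div_le_iff₀ (by positivity)]
    push_cast
    linarith
  rw [pw, bump_eq_zero_of_le h2]
  simp

lemma coprime_of_pw_ne_zero {R q M : ℕ} (hR : 2 ≤ R) (hM : 0 < M) (hMR : M ≤ R ^ 3)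
    (h : pw R q ≠ 0) : q.Coprime M := by
  refine ((prime_of_pw_ne_zero h).coprime_iff_not_dvd).mpr fun hd => ?_
  have h1 := Nat.le_of_dvd hM hd
  have h2 := lt_of_pw_ne_zero hR h
  have h3 : R ^ 3 ≤ R ^ 60 := Nat.pow_le_pow_right (by omega) (by norm_num)
  omega

/-- The total mass of the weights. -/
noncomputable def pwSum (R : ℕ) : ℝ := ∑ q ∈ Ioc 0 (R ^ 120), pw R q

lemma exists_primFin (R qe : ℕ) : ∃ F : Finset Chars, ∀ z : Chars, z ∈ F ↔
    z.2.IsPrimitive ∧ 1 < z.1 ∧ z.1 ≤ R ^ 3 ∧ z.1 ≠ qe := by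
  have hfin : {z : Chars | z.2.IsPrimitive ∧ 1 < z.1 ∧ z.1 ≤ R ^ 3 ∧ z.1 ≠ qe}.Finite := by
    refine ((Set.finite_Icc 1 (R ^ 3)).biUnion (t := fun q =>
      if 0 < q then Set.range (Sigma.mk q : DirichletCharacter ℂ q → Chars) else ∅)
        fun q _ => ?_).subset fun z hz => ?_
    · split_ifs with hq
      · have : NeZero q := ⟨hq.ne'⟩
        exact Set.finite_range _
      · exact Set.finite_empty
    · simp only [Set.mem_iUnion]
      refine ⟨z.1, ⟨hz.2.1.le, hz.2.2.1⟩, ?_⟩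
      rw [if_pos (zero_lt_one.trans hz.2.1)]
      exact ⟨z.2, rfl⟩
  exact ⟨hfin.toFinset, fun z => by simp⟩

/-- The primitive characters of bounded conductor, the exceptional conductor being left out. -/
noncomputable def primFin (R qe : ℕ) : Finset Chars := (exists_primFin R qe).choose

lemma mem_primFin {R qe : ℕ} {z : Chars} : z ∈ primFin R qe ↔
    z.2.IsPrimitive ∧ 1 < z.1 ∧ z.1 ≤ R ^ 3 ∧ z.1 ≠ qe := (exists_primFin R qe).choose_spec z

/-- The primitive character attached to a character. -/
noncomputable def toPrim {M : ℕ} (χ : DirichletCharacter ℂ M) : Chars :=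
  ⟨χ.conductor, χ.primitiveCharacter⟩

lemma toPrim_injective {M : ℕ} : Function.Injective (toPrim (M := M)) := by
  classical
  let back : Chars → DirichletCharacter ℂ M := fun z =>
    if h : z.1 ∣ M then DirichletCharacter.changeLevel h z.2 else 1
  refine Function.LeftInverse.injective (g := back) fun χ => ?_
  simp only [back, toPrim]
  rw [dif_pos χ.conductor_dvd_level]
  exact χ.changeLevel_primitiveCharacter

lemma ev_toPrim {M : ℕ} (χ : DirichletCharacter ℂ M) {n : ℕ} (hn : n.Coprime M) :
    ev (toPrim χ) n = χ (n : ZMod M) := by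
  have := χ.primitiveCharacter_apply_of_isCoprime (a := (n : ℤ))
    (Nat.isCoprime_iff_coprime.mpr hn)
  rw [Int.cast_natCast, Int.cast_natCast] at this
  exact this

lemma sum_pw_mul_eq {R M : ℕ} (hR : 2 ≤ R) (hM : 0 < M) (hMR : M ≤ R ^ 3)
    (χ : DirichletCharacter ℂ M) :
    ∑ q ∈ Ioc 0 (R ^ 120), (pw R q : ℂ) * χ (q : ZMod M) = primeSum R (toPrim χ) := by
  rw [primeSum, wsum]
  refine Finset.sum_congr rfl fun q _ => ?_
  by_cases h : pw R q = 0
  · have : (logPrime q * bump (Real.log q / Real.log ((R ^ 120 : ℕ) : ℝ)) / q : ℝ) = 0 := h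
    rw [h, this]
    simp
  · rw [ev_toPrim χ (coprime_of_pw_ne_zero hR hM hMR h)]
    rfl

theorem abs_sum_pw_modEq_sub_le {R M : ℕ} (hR : 2 ≤ R) (hM : 0 < M) (hMR : M ≤ R ^ 3) {qe : ℕ}
    (hqe : ¬ qe ∣ M) {b : ℕ} (hb : b.Coprime M) :
    |∑ q ∈ Ioc 0 (R ^ 120) with q ≡ b [MOD M], pw R q - pwSum R / M.totient| ≤
      1 / M.totient * ∑ z ∈ primFin R qe with z.1 ∣ M, ‖primeSum R z‖ := by
  classical
  have : NeZero M := ⟨hM.ne'⟩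
  have hφ : (0 : ℝ) < M.totient := by exact_mod_cast Nat.totient_pos.mpr hM
  have hu : IsUnit (b : ZMod M) := (ZMod.isUnit_iff_coprime b M).mpr hb
  have h1 : ((M.totient : ℝ) * ∑ q ∈ Ioc 0 (R ^ 120) with q ≡ b [MOD M], pw R q : ℝ) =
      ∑ χ : DirichletCharacter ℂ M, χ (b : ZMod M)⁻¹ *
        ∑ q ∈ Ioc 0 (R ^ 120), (pw R q : ℂ) * χ (q : ZMod M) := by
    simp only [Finset.mul_sum]
    rw [Finset.sum_comm, Complex.ofReal_sum, Finset.sum_filter]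
    refine Finset.sum_congr rfl fun q _ => ?_
    have h2 := DirichletCharacter.sum_char_inv_mul_char_eq ℂ hu (q : ZMod M)
    have h3 : ∑ χ : DirichletCharacter ℂ M, χ (b : ZMod M)⁻¹ * ((pw R q : ℂ) * χ (q : ZMod M)) =
        pw R q * ∑ χ : DirichletCharacter ℂ M, χ (b : ZMod M)⁻¹ * χ (q : ZMod M) := by
      rw [Finset.mul_sum]
      exact Finset.sum_congr rfl fun χ _ => by ring
    rw [h3, h2]
    have h4 : (b : ZMod M) = q ↔ q ≡ b [MOD M] := by
      rw [ZMod.natCast_eq_natCast_iff]; exact ⟨Nat.ModEq.symm, Nat.ModEq.symm⟩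
    by_cases h5 : q ≡ b [MOD M]
    · rw [if_pos h5, if_pos (h4.mpr h5)]; push_cast; ring
    · rw [if_neg h5, if_neg (h4.not.mpr h5)]; simp
  rw [← Finset.add_sum_erase _ _ (mem_univ (1 : DirichletCharacter ℂ M))] at h1
  have h2 : (1 : DirichletCharacter ℂ M) (b : ZMod M)⁻¹ * ∑ q ∈ Ioc 0 (R ^ 120),
      (pw R q : ℂ) * (1 : DirichletCharacter ℂ M) (q : ZMod M) = (pwSum R : ℂ) := by
    have hu' : IsUnit (b : ZMod M)⁻¹ := by
      obtain ⟨u, hu⟩ := hu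
      rw [← hu, ZMod.inv_coe_unit]; exact Units.isUnit _
    rw [MulChar.one_apply hu', one_mul, pwSum, Complex.ofReal_sum]
    refine Finset.sum_congr rfl fun q _ => ?_
    by_cases h : pw R q = 0
    · simp [h]
    · rw [MulChar.one_apply ((ZMod.isUnit_iff_coprime q M).mpr
        (coprime_of_pw_ne_zero hR hM hMR h)), mul_one]
  rw [h2] at h1
  have h3 : (((M.totient : ℝ) * ∑ q ∈ Ioc 0 (R ^ 120) with q ≡ b [MOD M], pw R q - pwSum R : ℝ) : ℂ)
      = ∑ χ ∈ univ.erase (1 : DirichletCharacter ℂ M), χ (b : ZMod M)⁻¹ *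
        primeSum R (toPrim χ) := by
    rw [Complex.ofReal_sub, h1, add_sub_cancel_left]
    exact Finset.sum_congr rfl fun χ _ => by rw [sum_pw_mul_eq hR hM hMR]
  have h4 : |(M.totient : ℝ) * ∑ q ∈ Ioc 0 (R ^ 120) with q ≡ b [MOD M], pw R q - pwSum R| ≤
      ∑ z ∈ primFin R qe with z.1 ∣ M, ‖primeSum R z‖ := by
    rw [← Real.norm_eq_abs, ← Complex.norm_real, h3]
    refine (norm_sum_le _ _).trans ?_
    refine sum_le_sum_of_injOn toPrim (fun χ hχ => ?_) (toPrim_injective.injOn) (fun χ _ => ?_)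
      fun _ _ => norm_nonneg _
    · have hne : χ.conductor ≠ 1 := fun h =>
        (Finset.mem_erase.mp hχ).1 (χ.eq_one_iff_conductor_eq_one.mpr h)
      have hd := χ.conductor_dvd_level
      have h0 := Nat.pos_of_dvd_of_pos hd hM
      refine mem_filter.mpr ⟨mem_primFin.mpr ⟨χ.primitiveCharacter_isPrimitive, ?_,
        (Nat.le_of_dvd hM hd).trans hMR, fun h => hqe (h ▸ hd)⟩, hd⟩
      change 1 < χ.conductor
      omega
    · rw [norm_mul]
      exact mul_le_of_le_one_left (norm_nonneg _) (χ.norm_le_one _)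
  have h5 : ∑ q ∈ Ioc 0 (R ^ 120) with q ≡ b [MOD M], pw R q - pwSum R / M.totient =
      1 / M.totient * ((M.totient : ℝ) * ∑ q ∈ Ioc 0 (R ^ 120) with q ≡ b [MOD M], pw R q -
        pwSum R) := by
    field_simp
  rw [h5, abs_mul, abs_of_pos (by positivity)]
  exact mul_le_mul_of_nonneg_left h4 (by positivity)

end PrimeGapRuns

namespace PrimeGapRuns

open Finset

lemma sum_sum_prod {ι κ : Type*} [Fintype ι] [DecidableEq ι] [Fintype κ] (G : ι → κ → κ → ℝ) :
    ∑ d : ι → κ, ∑ e : ι → κ, ∏ p, G p (d p) (e p) = ∏ p, ∑ a, ∑ b, G p a b := by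
  classical
  rw [Finset.prod_univ_sum, Fintype.piFinset_univ]
  refine Finset.sum_congr rfl fun d _ => ?_
  rw [Finset.prod_univ_sum, Fintype.piFinset_univ]

variable {ι : Type*} [Fintype ι] [DecidableEq ι] {k : ℕ}

lemma totient_mul_md {pr : ι → ℕ} (hpr : ∀ p, (pr p).Prime) (hinj : Function.Injective pr) {W : ℕ}
    (hW : ∀ p, W.Coprime (pr p)) (S : Finset ι) :
    (1 : ℝ) / (W * ∏ p ∈ S, pr p).totient = 1 / W.totient * wt pr S := by
  induction S using Finset.induction_on with
  | empty => simp [wt]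
  | insert p S hp ih =>
    have hcop : (W * ∏ q ∈ S, pr q).Coprime (pr p) :=
      Nat.Coprime.mul_left (hW p) (Nat.Coprime.prod_left fun q hq =>
        (Nat.coprime_primes (hpr q) (hpr p)).mpr fun h => hp (hinj h ▸ hq))
    rw [Finset.prod_insert hp, mul_left_comm, mul_comm (pr p), Nat.totient_mul hcop,
      Nat.totient_prime (hpr p), wt, Finset.prod_insert hp, ← wt, Nat.cast_mul,
      Nat.cast_sub (hpr p).one_le, Nat.cast_one, one_div, mul_inv, ← one_div, ih]
    ring

/-- Local factors in the Rankin bound. -/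
noncomputable def rankinFactor (f q : ℕ) : Option (Fin k) → ℝ
  | none => if q ∣ f then 0 else 1
  | some _ => (if q ∣ f then √(q : ℝ) else 1) * (1 / ((q : ℝ) - 1))

lemma ite_dvd_le_prod_rankinFactor {pr : ι → ℕ} (hpr : ∀ p, (pr p).Prime)
    (hinj : Function.Injective pr) {W : ℕ} (hW0 : 0 < W) (hW : ∀ p, W.Coprime (pr p)) {f : ℕ}
    (hf : 0 < f) (u : ι → Option (Fin k)) :
    (if f ∣ W * md pr u then wt pr (supp u) else 0) ≤
      √(W : ℝ) / √(f : ℝ) * ∏ p, rankinFactor f (pr p) (u p) := by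
  have h0 : ∀ p, ∀ o : Option (Fin k), 0 ≤ rankinFactor f (pr p) o := fun p o => by
    have := one_lt_pr hpr p
    rcases o with _ | i <;> simp only [rankinFactor] <;> split_ifs <;> positivity
  split_ifs with hd
  · have h1 : ∀ p, pr p ∣ f → p ∈ supp u := fun p hp => by
      rw [← dvd_prod_iff hpr hinj (supp u) p]
      exact Nat.Coprime.dvd_of_dvd_mul_left (hW p).symm (hp.trans hd)
    have h2 : ∏ p, rankinFactor f (pr p) (u p) =
        wt pr (supp u) * ∏ p ∈ supp u with pr p ∣ f, √(pr p : ℝ) := by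
      rw [Finset.prod_filter, wt, ← Finset.prod_mul_distrib]
      conv_rhs => rw [supp, Finset.prod_filter]
      refine Finset.prod_congr rfl fun p _ => ?_
      rcases hp : u p with _ | i
      · have : ¬ pr p ∣ f := fun h => by simpa [supp, hp] using h1 p h
        simp [rankinFactor, this]
      · simp [rankinFactor, mul_comm]
    have h3 : f ∣ W * ∏ p ∈ supp u with pr p ∣ f, pr p := by
      have hsplit := Finset.prod_filter_mul_prod_filter_not (supp u) (fun p => pr p ∣ f) pr
      rw [md, ← hsplit, ← mul_assoc] at hd
      refine Nat.Coprime.dvd_of_dvd_mul_right (Nat.Coprime.prod_right fun p hp => ?_) hd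
      exact (((hpr p).coprime_iff_not_dvd).mpr (mem_filter.mp hp).2).symm
    have h4 : (f : ℝ) ≤ W * ∏ p ∈ supp u with pr p ∣ f, (pr p : ℝ) := by
      have := Nat.le_of_dvd (Nat.mul_pos hW0 (Finset.prod_pos fun p _ => (hpr p).pos)) h3
      exact_mod_cast this
    have h5 : √(f : ℝ) ≤ √(W : ℝ) * ∏ p ∈ supp u with pr p ∣ f, √(pr p : ℝ) := by
      rw [← Real.sqrt_prod _ (fun _ _ => Nat.cast_nonneg _), ← Real.sqrt_mul (Nat.cast_nonneg _)]
      exact Real.sqrt_le_sqrt h4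
    have hf' : 0 < √(f : ℝ) := Real.sqrt_pos.mpr (by exact_mod_cast hf)
    rw [h2, div_mul_eq_mul_div, le_div_iff₀ hf', mul_left_comm]
    exact mul_le_mul_of_nonneg_left h5 (wt_nonneg hpr _)
  · exact mul_nonneg (by positivity) (Finset.prod_nonneg fun p _ => h0 p _)

lemma sum_rankinFactor_le {q : ℕ} (f : ℕ) (hk : 4 * (k + 1) ^ 4 ≤ q) :
    ∑ o : Option (Fin k), ∑ o' : Option (Fin k), rankinFactor f q (o.or o') ≤
      1 + (((k + 1) ^ 2 : ℕ) : ℝ) / ((q : ℝ) - 1) := by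
  have hk' : 4 * ((k : ℝ) + 1) ^ 4 ≤ q := by exact_mod_cast hk
  have hk1 : (1 : ℝ) ≤ ((k : ℝ) + 1) ^ 2 := by
    have : (0 : ℝ) ≤ k := Nat.cast_nonneg _
    nlinarith
  have hq4 : (4 : ℝ) ≤ q := by nlinarith
  have hq1 : (0 : ℝ) < (q : ℝ) - 1 := by linarith
  set t : ℝ := (if q ∣ f then √(q : ℝ) else 1) * (1 / ((q : ℝ) - 1)) with ht
  have ht0 : 0 ≤ t := by rw [ht]; split_ifs <;> positivity
  set T : ℝ := if q ∣ f then 0 else 1 with hT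
  have hT0 : 0 ≤ T := by rw [hT]; split_ifs <;> norm_num
  have hn : rankinFactor f q (none : Option (Fin k)) = T := rfl
  have hs : ∀ i : Fin k, rankinFactor f q (some i) = t := fun _ => rfl
  clear_value t T
  have h1 : ∑ o : Option (Fin k), ∑ o' : Option (Fin k), rankinFactor f q (o.or o') ≤
      T + ((k : ℝ) + 1) ^ 2 * t := by
    calc _ ≤ ∑ o : Option (Fin k), ∑ o' : Option (Fin k),
          ((if o = none then if o' = none then T else 0 else 0) + t) := by
          refine Finset.sum_le_sum fun o _ => Finset.sum_le_sum fun o' _ => ?_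
          rcases o with _ | i <;> rcases o' with _ | j <;> simp [hn, hs, ht0]
      _ = _ := by
          simp only [Finset.sum_add_distrib, Finset.sum_const, Finset.card_univ,
            Fintype.card_option, Fintype.card_fin, nsmul_eq_mul]
          simp
          ring
  refine h1.trans ?_
  push_cast
  by_cases hqf : q ∣ f
  · have hs : √(q : ℝ) * √(q : ℝ) = q := Real.mul_self_sqrt (by linarith)
    have hs2 : 2 * ((k : ℝ) + 1) ^ 2 ≤ √(q : ℝ) := by
      apply Real.le_sqrt_of_sq_le
      calc _ = 4 * ((k : ℝ) + 1) ^ 4 := by ring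
        _ ≤ _ := hk'
    have h2 : ((k : ℝ) + 1) ^ 2 * t ≤ 1 := by
      rw [ht, if_pos hqf, mul_one_div, mul_div_assoc', div_le_one hq1]
      nlinarith [Real.sqrt_nonneg (q : ℝ)]
    have h3 : 0 ≤ ((k : ℝ) + 1) ^ 2 / ((q : ℝ) - 1) := by positivity
    rw [hT, if_pos hqf]
    linarith
  · rw [hT, ht, if_neg hqf, if_neg hqf, one_mul, mul_one_div]

lemma sum_sum_ite_dvd_le {pr : ι → ℕ} (hpr : ∀ p, (pr p).Prime)
    (hinj : Function.Injective pr) {W : ℕ} (hW0 : 0 < W) (hW : ∀ p, W.Coprime (pr p))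
    (hk : ∀ p, 4 * (k + 1) ^ 4 ≤ pr p) {f : ℕ} (hf : 0 < f) :
    ∑ d : ι → Option (Fin k), ∑ e : ι → Option (Fin k),
      (if f ∣ W * md pr (join d e) then wt pr (supp (join d e)) else 0) ≤
      √(W : ℝ) / √(f : ℝ) * loss pr ((k + 1) ^ 2) := by
  calc _ ≤ ∑ d : ι → Option (Fin k), ∑ e : ι → Option (Fin k),
        √(W : ℝ) / √(f : ℝ) * ∏ p, rankinFactor f (pr p) ((d p).or (e p)) :=
        Finset.sum_le_sum fun d _ => Finset.sum_le_sum fun e _ =>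
          ite_dvd_le_prod_rankinFactor hpr hinj hW0 hW hf (join d e)
    _ = √(W : ℝ) / √(f : ℝ) * ∏ p, ∑ o : Option (Fin k), ∑ o' : Option (Fin k),
          rankinFactor f (pr p) (o.or o') := by
        simp only [← Finset.mul_sum]
        rw [sum_sum_prod fun p (o o' : Option (Fin k)) => rankinFactor f (pr p) (o.or o')]
    _ ≤ _ := by
        refine mul_le_mul_of_nonneg_left (Finset.prod_le_prod (fun p _ => ?_) fun p _ =>
          sum_rankinFactor_le f (hk p)) (by positivity)
        refine Finset.sum_nonneg fun o _ => Finset.sum_nonneg fun o' _ => ?_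
        have := one_lt_pr hpr p
        rcases o.or o' with _ | i <;> simp only [rankinFactor] <;> split_ifs <;> positivity

/-- The second moment of the sieve over the primes at the `m`-th place. -/
theorem abs_sum_pw_sieve_sq_sub_le {pr : ι → ℕ} (hpr : ∀ p, (pr p).Prime)
    (hinj : Function.Injective pr) {W : ℕ} (hW0 : 0 < W) (hW : ∀ p, W.Coprime (pr p))
    (hk : ∀ p, 4 * (k + 1) ^ 4 ≤ pr p) {h : Fin k → ℕ} (hh : Function.Injective h)
    (hlt : ∀ p i, h i < pr p) {a R : ℕ} (m : Fin k) (ha : (a + h m).Coprime W) (hR : 2 ≤ R)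
    (hWR : W ≤ R) (hpR : ∀ p, pr p ≤ R) {qe : ℕ}
    (hqe : ∀ S : Finset ι, ¬ qe ∣ W * ∏ p ∈ S, pr p)
    {y : (ι → Option (Fin k)) → ℝ} {C : ℝ} (hC : 0 ≤ C) (hy : ∀ s, |y s| ≤ C * wt pr (supp s))
    (hy0 : ∀ s, R < md pr s → y s = 0) :
    |∑ q ∈ Ioc 0 (R ^ 120) with q ≡ a + h m [MOD W], pw R q * sieve pr h (h m) y q ^ 2 -
      pwSum R / W.totient * form (fun p => gram (pr p) (rhoPrime m (pr p))) y| ≤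
      (C * loss pr k) ^ 2 * (√(W : ℝ) * loss pr ((k + 1) ^ 2) *
        ∑ z ∈ primFin R qe, ‖primeSum R z‖ / √(z.1 : ℝ)) := by
  have hΛ : 0 ≤ C * loss pr k := mul_nonneg hC (zero_le_one.trans (one_le_loss hpr k))
  have hφ : (1 : ℝ) ≤ W.totient := by exact_mod_cast Nat.totient_pos.mpr hW0
  let ε : (ι → Option (Fin k)) → (ι → Option (Fin k)) → ℝ := fun d e =>
    wt pr (supp (join d e)) * ∑ z ∈ primFin R qe with z.1 ∣ W * md pr (join d e), ‖primeSum R z‖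
  have hε0 : ∀ d e, 0 ≤ ε d e := fun d e =>
    mul_nonneg (wt_nonneg hpr _) (Finset.sum_nonneg fun _ _ => norm_nonneg _)
  have key := abs_sum_sq_sub_form_le ((Ioc 0 (R ^ 120)).filter fun q => q ≡ a + h m [MOD W])
    (pw R) (fun p => coef (pr p)) (ind pr h (h m)) (fun p => rhoPrime m (pr p))
    (pwSum R / W.totient) y hΛ (univ.filter fun d => md pr d ≤ R)
    ε (fun d _ => abs_lam_le hpr hC hy d)
    (fun d hd => lam_eq_zero hpr hy0 (by simpa using hd)) ?_
  · refine key.trans (mul_le_mul_of_nonneg_left ?_ (sq_nonneg _))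
    calc _ ≤ ∑ d, ∑ e, ε d e := by
          refine (Finset.sum_le_sum_of_subset_of_nonneg (filter_subset _ _) fun d _ _ =>
            Finset.sum_nonneg fun e _ => hε0 d e).trans (Finset.sum_le_sum fun d _ => ?_)
          exact Finset.sum_le_sum_of_subset_of_nonneg (filter_subset _ _) fun e _ _ => hε0 d e
      _ = ∑ z ∈ primFin R qe, ‖primeSum R z‖ * ∑ d : ι → Option (Fin k),
            ∑ e : ι → Option (Fin k),
            (if z.1 ∣ W * md pr (join d e) then wt pr (supp (join d e)) else 0) := by
          simp only [ε, Finset.sum_filter, Finset.mul_sum]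
          conv_rhs => rw [Finset.sum_comm]
          refine Finset.sum_congr rfl fun d _ => ?_
          conv_rhs => rw [Finset.sum_comm]
          refine Finset.sum_congr rfl fun e _ => Finset.sum_congr rfl fun z _ => ?_
          split_ifs
          · exact mul_comm _ _
          · simp
      _ ≤ ∑ z ∈ primFin R qe, ‖primeSum R z‖ *
            (√(W : ℝ) / √(z.1 : ℝ) * loss pr ((k + 1) ^ 2)) := by
          refine Finset.sum_le_sum fun z hz => mul_le_mul_of_nonneg_left ?_ (norm_nonneg _)
          exact sum_sum_ite_dvd_le hpr hinj hW0 hW hk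
            (zero_lt_one.trans (mem_primFin.mp hz).2.1)
      _ = _ := by
          rw [Finset.mul_sum]
          exact Finset.sum_congr rfl fun z _ => by ring
  · intro d hd e he
    simp only [mem_filter, mem_univ, true_and] at hd he
    by_cases hde : Compat d e
    · simp only [prod_ind_mul_prod_ind hde]
      by_cases hm : ∃ p, join d e p = some m
      · rw [prod_rhoPrime_eq_zero hm, Finset.sum_eq_zero, mul_zero, sub_zero, abs_zero]
        · exact hε0 d e
        · intro q _
          by_cases hq : pw R q = 0
          · rw [hq, zero_mul]
          · obtain ⟨p, hp⟩ := hm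
            rw [Finset.prod_eq_zero (mem_univ p), mul_zero]
            rw [hp]
            simp only [ind]
            rw [if_neg]
            intro hmod
            have h1 : q ≡ 0 [MOD pr p] := Nat.ModEq.add_right_cancel' (h m) (by rwa [zero_add])
            have h2 := (Nat.prime_dvd_prime_iff_eq (hpr p) (prime_of_pw_ne_zero hq)).mp
              ((Nat.modEq_zero_iff_dvd).mp h1)
            have h3 := lt_of_pw_ne_zero hR hq
            have h4 := hpR p
            have h5 : R ≤ R ^ 60 := Nat.le_self_pow (by norm_num) R
            omega
      · push Not at hm
        obtain ⟨b, hb, hsum⟩ := sum_mul_prod_ind hpr hinj hW h (h m) (a + h m) (join d e)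
        rw [hsum, prod_rhoPrime_of_compat hde hm]
        obtain ⟨hb1, hb2⟩ := (hb b).mpr rfl
        have hcop : b.Coprime (W * md pr (join d e)) := by
          refine Nat.Coprime.mul_right ?_ (Nat.Coprime.prod_right fun p hp => ?_)
          · have := hb1.gcd_eq
            rw [Nat.Coprime, this]; exact ha
          · simp only [supp, mem_filter, mem_univ, true_and] at hp
            obtain ⟨i, hi⟩ := Option.ne_none_iff_exists'.mp hp
            refine (((hpr p).coprime_iff_not_dvd).mpr fun hdvd => hm p ?_).symm
            have h1 : 0 + h i ≡ h m [MOD pr p] :=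
              ((Nat.ModEq.add_right (h i) ((Nat.modEq_zero_iff_dvd).mpr hdvd)).symm).trans
                (hb2 p i hi)
            rw [zero_add] at h1
            rw [hi, hh (Nat.ModEq.eq_of_lt_of_lt h1 (hlt p i) (hlt p m))]
        have hM0 : 0 < W * md pr (join d e) :=
          Nat.mul_pos hW0 (Finset.prod_pos fun p _ => (hpr p).pos)
        have hMR : W * md pr (join d e) ≤ R ^ 3 :=
          calc _ ≤ R * (R * R) := Nat.mul_le_mul hWR
                ((md_join_le hpr d e).trans (Nat.mul_le_mul hd he))
            _ = R ^ 3 := by ring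
        have h1 := abs_sum_pw_modEq_sub_le hR hM0 hMR (hqe _) hcop
        have h2 := totient_mul_md hpr hinj hW (supp (join d e))
        rw [← md] at h2
        have h3 : pwSum R / W.totient * wt pr (supp (join d e)) =
            pwSum R / (W * md pr (join d e)).totient := by
          rw [div_eq_mul_one_div (pwSum R) ((W * md pr (join d e)).totient : ℝ), h2]; ring
        rw [h3]
        refine h1.trans ?_
        rw [h2]
        refine mul_le_mul_of_nonneg_right ?_ (Finset.sum_nonneg fun _ _ => norm_nonneg _)
        refine mul_le_of_le_one_left (wt_nonneg hpr _) ?_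
        rw [div_le_one (by linarith)]; exact hφ
    · simp only [prod_ind_mul_prod_ind_eq_zero hde hh hlt, mul_zero, Finset.sum_const_zero]
      rw [prod_rhoPrime_eq_zero_of_not_compat hde, mul_zero, sub_zero, abs_zero]
      exact hε0 d e

end PrimeGapRuns

namespace PrimeGapRuns

open Finset Filter ArithmeticFunction

lemma sum_prime_one_div_le {x y : ℕ} (hx : 2 ≤ x) (hxy : y = x ^ 2) :
    ∑ p ∈ Ioc x y with p.Prime, 1 / (p : ℝ) ≤ 19 := by
  have hlog2 := Real.log_two_gt_d9
  have hlx : Real.log 2 ≤ Real.log x := Real.log_le_log (by norm_num) (by exact_mod_cast hx)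
  have hlx0 : 0 < Real.log x := by linarith
  have h1 : ∑ p ∈ Ioc x y with p.Prime, 1 / (p : ℝ) ≤
      (∑ n ∈ Ioc x y, (Λ n : ℝ) / n) / Real.log x := by
    rw [Finset.sum_filter, Finset.sum_div]
    refine Finset.sum_le_sum fun p hp => ?_
    have hpx : x < p := (mem_Ioc.mp hp).1
    have hp0 : (0 : ℝ) < p := by exact_mod_cast (by omega : 0 < p)
    split_ifs with hpp
    · rw [vonMangoldt_apply_prime hpp, le_div_iff₀ hlx0, one_div_mul_eq_div]
      gcongr
    · have := vonMangoldt_nonneg (n := p)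
      positivity
  have h2 : ∑ n ∈ Ioc x y, (Λ n : ℝ) / n ≤ Real.log x + 12 := by
    have hxy' : x ≤ y := by rw [hxy]; exact Nat.le_self_pow (by norm_num) x
    have h3 := (abs_le.mp (abs_sum_vonMangoldt_div_sub_log_le (N := x) (by omega))).1
    have h4 := (abs_le.mp (abs_sum_vonMangoldt_div_sub_log_le (N := y) (by omega))).2
    have h5 := Finset.sum_Ioc_consecutive (fun n => (Λ n : ℝ) / n) (Nat.zero_le x) hxy'
    have h6 : Real.log y = 2 * Real.log x := by
      rw [hxy]; push_cast; rw [Real.log_pow]; norm_num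
    linarith
  refine h1.trans ?_
  rw [div_le_iff₀ hlx0]
  linarith

lemma sum_prime_one_div_le_tower (j : ℕ) :
    ∑ p ∈ Ioc (0 : ℕ) (2 ^ 2 ^ j : ℕ) with p.Prime, 1 / (p : ℝ) ≤ 1 + 19 * j := by
  induction j with
  | zero =>
    rw [Finset.sum_filter]
    have : Ioc 0 (2 ^ 2 ^ 0) = ({1, 2} : Finset ℕ) := by decide
    rw [this]
    norm_num
  | succ j ih =>
    have h := sum_prime_one_div_le (x := 2 ^ 2 ^ j) (y := 2 ^ 2 ^ (j + 1))
      (Nat.le_self_pow (by positivity) 2) (by rw [← pow_mul, ← pow_succ])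
    have hle : 2 ^ 2 ^ j ≤ 2 ^ 2 ^ (j + 1) := by
      apply Nat.pow_le_pow_right (by norm_num)
      exact Nat.pow_le_pow_right (by norm_num) (by omega)
    have h5 := Finset.sum_Ioc_consecutive (fun n => if n.Prime then 1 / (n : ℝ) else 0)
      (Nat.zero_le _) hle
    simp only [Finset.sum_filter] at h ih ⊢
    push_cast
    linarith

lemma loss_le {ι : Type*} [Fintype ι] [DecidableEq ι] {pr : ι → ℕ} (hpr : ∀ p, (pr p).Prime)
    (hinj : Function.Injective pr) {R : ℕ} (hpR : ∀ p, pr p ≤ R) (hR : 8 ≤ Real.log R) (c : ℕ) :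
    loss pr c ≤ Real.log R ^ (160 * c) := by
  have hR2 : 2 ≤ R := by
    by_contra! h
    have : R = 0 ∨ R = 1 := by omega
    rcases this with rfl | rfl <;> norm_num at hR
  set l := Nat.log 2 R with hl
  have hl1 : 0 < l := Nat.log_pos (by norm_num) hR2
  set j := Nat.log 2 l + 1 with hj
  have hRj : R ≤ 2 ^ 2 ^ j := by
    refine (Nat.lt_pow_succ_log_self (b := 2) (by norm_num) R).le.trans ?_
    exact Nat.pow_le_pow_right (by norm_num) (Nat.lt_pow_succ_log_self (b := 2) (by norm_num) l)
  have hsum : ∑ p, 1 / (pr p : ℝ) ≤ 1 + 19 * j := by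
    refine le_trans ?_ (sum_prime_one_div_le_tower j)
    refine sum_le_sum_of_injOn pr (fun p _ => ?_) hinj.injOn (fun _ _ => le_rfl)
      fun _ _ => by positivity
    exact mem_filter.mpr ⟨mem_Ioc.mpr ⟨(hpr p).pos, (hpR p).trans hRj⟩, hpr p⟩
  have h1 : loss pr c ≤ Real.exp (2 * c * (1 + 19 * j)) := by
    calc loss pr c ≤ ∏ p, Real.exp (2 * c * (1 / (pr p : ℝ))) := by
          refine Finset.prod_le_prod (fun p _ => ?_) fun p _ => ?_
          · have := one_lt_pr hpr p
            positivity
          · have h2 : (2 : ℝ) ≤ pr p := by exact_mod_cast (hpr p).two_le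
            have h3 : (c : ℝ) / ((pr p : ℝ) - 1) ≤ 2 * c * (1 / (pr p : ℝ)) := by
              rw [mul_one_div, div_le_div_iff₀ (by linarith) (by linarith)]
              have : (0 : ℝ) ≤ c := Nat.cast_nonneg c
              nlinarith
            have := Real.add_one_le_exp (2 * c * (1 / (pr p : ℝ)))
            linarith
      _ = Real.exp (2 * c * ∑ p, 1 / (pr p : ℝ)) := by rw [← Real.exp_sum, Finset.mul_sum]
      _ ≤ _ := by
          apply Real.exp_le_exp.mpr
          exact mul_le_mul_of_nonneg_left hsum (by positivity)
  have h2 : Real.exp ((j : ℝ) + 1) ≤ (8 * Real.log R) ^ 2 := by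
    have he : Real.exp 1 ≤ 4 := by have := Real.exp_one_lt_d9; linarith
    have h3 : (2 : ℝ) ^ (j + 1) ≤ 8 * Real.log R := by
      have h4 : (2 : ℝ) ^ Nat.log 2 l ≤ l := by
        exact_mod_cast Nat.pow_log_le_self 2 hl1.ne'
      have h5 : (l : ℝ) * Real.log 2 ≤ Real.log R := by
        rw [← Real.log_pow]
        refine Real.log_le_log (by positivity) ?_
        exact_mod_cast Nat.pow_log_le_self 2 (by omega)
      have hlog2 := Real.log_two_gt_d9
      have h6 : (l : ℝ) ≤ 2 * Real.log R := by
        have : (0 : ℝ) ≤ l := Nat.cast_nonneg l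
        nlinarith
      rw [hj, pow_succ, pow_succ]
      linarith
    calc Real.exp ((j : ℝ) + 1) = Real.exp 1 ^ (j + 1) := by
          rw [← Real.exp_nat_mul]; push_cast; rw [mul_one]
      _ ≤ 4 ^ (j + 1) := by gcongr
      _ = (2 ^ (j + 1)) ^ 2 := by rw [← pow_mul, mul_comm, pow_mul]; norm_num
      _ ≤ _ := by gcongr
  have hc0 : (0 : ℝ) ≤ c := Nat.cast_nonneg c
  have hj0 : (0 : ℝ) ≤ j := Nat.cast_nonneg j
  calc loss pr c ≤ Real.exp (2 * c * (1 + 19 * j)) := h1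
    _ ≤ Real.exp (((40 * c : ℕ) : ℝ) * ((j : ℝ) + 1)) := by
        apply Real.exp_le_exp.mpr
        push_cast
        nlinarith [mul_nonneg hc0 hj0]
    _ = Real.exp ((j : ℝ) + 1) ^ (40 * c) := Real.exp_nat_mul _ _
    _ ≤ ((8 * Real.log R) ^ 2) ^ (40 * c) := by gcongr
    _ ≤ ((Real.log R ^ 2) ^ 2) ^ (40 * c) := by
        gcongr
        nlinarith
    _ = Real.log R ^ (160 * c) := by
        rw [← pow_mul, ← pow_mul]; congr 1; ring

lemma eventually_le_pwSum : ∀ᶠ R : ℕ in atTop, 20 * Real.log R ≤ pwSum R := by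
  obtain ⟨C, hC0, hC⟩ := exists_sum_not_prime_vonMangoldt_le
  filter_upwards [(Real.tendsto_log_atTop.comp
    (tendsto_natCast_atTop_atTop (R := ℝ))).eventually_ge_atTop (12 + C), eventually_ge_atTop 2]
    with R hRC hR2
  simp only [Function.comp_apply] at hRC
  have hR1 : (1 : ℝ) ≤ R := by exact_mod_cast (by omega : 1 ≤ R)
  have hl0 : 0 < Real.log R := by linarith
  have hpow : ∀ n : ℕ, Real.log ((R ^ n : ℕ) : ℝ) = n * Real.log R := fun n => by
    push_cast; exact Real.log_pow _ _
  have h1 : ∑ n ∈ Ioc (R ^ 75) (R ^ 105) with n.Prime, (Λ n : ℝ) / n ≤ pwSum R := by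
    rw [Finset.sum_filter]
    refine le_trans (Finset.sum_le_sum fun n hn => ?_)
      (Finset.sum_le_sum_of_subset_of_nonneg (f := pw R) (fun n hn => ?_) fun n _ _ => pw_nonneg R n)
    · obtain ⟨hn1, hn2⟩ := mem_Ioc.mp hn
      split_ifs with hp
      · have hn0 : (0 : ℝ) < n := by exact_mod_cast hp.pos
        have hRp : ∀ j : ℕ, (0 : ℝ) < ((R ^ j : ℕ) : ℝ) := fun j => by positivity
        have e1 := Real.log_le_log (hRp 75) (by exact_mod_cast hn1.le : ((R ^ 75 : ℕ) : ℝ) ≤ n)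
        have e2 := Real.log_le_log hn0 (by exact_mod_cast hn2 : (n : ℝ) ≤ ((R ^ 105 : ℕ) : ℝ))
        rw [hpow] at e1 e2
        have e3 := bump_eq_one (t := Real.log n / Real.log ((R ^ 120 : ℕ) : ℝ))
          (by rw [hpow, le_div_iff₀ (by positivity)]; push_cast at e1 ⊢; linarith)
          (by rw [hpow, div_le_iff₀ (by positivity)]; push_cast at e2 ⊢; linarith)
        rw [pw, e3, logPrime, if_pos hp, mul_one, vonMangoldt_apply_prime hp]
      · exact pw_nonneg R n
    · obtain ⟨hn1, hn2⟩ := mem_Ioc.mp hn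
      exact mem_Ioc.mpr ⟨by omega, hn2.trans (Nat.pow_le_pow_right (by omega) (by norm_num))⟩
  have hle : R ^ 75 ≤ R ^ 105 := Nat.pow_le_pow_right (by omega) (by norm_num)
  have hp75 : 1 ≤ R ^ 75 := Nat.one_le_pow _ _ (by omega)
  have h2 := Finset.sum_filter_add_sum_filter_not (Ioc (R ^ 75) (R ^ 105)) Nat.Prime
    (fun n => (Λ n : ℝ) / n)
  have h3 := (abs_le.mp (abs_sum_vonMangoldt_div_sub_log_le (N := R ^ 75) hp75)).2
  have h4 := (abs_le.mp (abs_sum_vonMangoldt_div_sub_log_le (N := R ^ 105) (hp75.trans hle))).1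
  have h5 := Finset.sum_Ioc_consecutive (fun n => (Λ n : ℝ) / n) (Nat.zero_le _) hle
  have h6 := hC (R ^ 75) (R ^ 105) hp75
  have h7 : C / √((R ^ 75 : ℕ) : ℝ) ≤ C := by
    refine div_le_self hC0.le ?_
    rw [Real.one_le_sqrt]
    exact_mod_cast hp75
  rw [hpow] at h3 h4
  push_cast at h3 h4
  linarith

end PrimeGapRuns

namespace PrimeGapRuns

open Finset Filter

/-- A possibly exceptional modulus is avoided by omitting a single prime. -/
lemma exists_prime_not_dvd_primorial_mul (D : ℕ) {qe : ℕ} (hqe : qe = 0 ∨ primorial D < qe) :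
    ∃ p₀ : ℕ, p₀.Prime ∧ D < p₀ ∧ ∀ S : Finset ℕ, (∀ p ∈ S, p.Prime ∧ D < p ∧ p ≠ p₀) →
      ¬ qe ∣ primorial D * ∏ p ∈ S, p := by
  by_cases hr : ∃ r : ℕ, r.Prime ∧ D < r ∧ r ∣ qe
  · obtain ⟨r, hrp, hDr, hrq⟩ := hr
    refine ⟨r, hrp, hDr, fun S hS hd => ?_⟩
    rcases hrp.dvd_mul.mp (hrq.trans hd) with h | h
    · have := hrp.dvd_primorial_iff.mp h
      omega
    · obtain ⟨p, hp, hrp'⟩ := (hrp.prime.dvd_finsetProd_iff _).mp h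
      obtain ⟨hpp, -, hne⟩ := hS p hp
      exact hne ((Nat.prime_dvd_prime_iff_eq hrp hpp).mp hrp').symm
  · push Not at hr
    obtain ⟨p₀, hp₀, hp₀p⟩ := Nat.exists_infinite_primes (D + 1)
    refine ⟨p₀, hp₀p, by omega, fun S hS hd => ?_⟩
    rcases hqe with rfl | hqe
    · exact hr p₀ hp₀p (by omega) (dvd_zero _)
    · have hc : qe.Coprime (∏ p ∈ S, p) := by
        refine Nat.Coprime.prod_right fun p hp => ?_
        obtain ⟨hpp, hDp, -⟩ := hS p hp
        exact ((Nat.Prime.coprime_iff_not_dvd hpp).mpr (hr p hpp hDp)).symm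
      have := Nat.le_of_dvd (primorial_pos D) (hc.dvd_of_dvd_mul_right hd)
      omega

/-- If each short tuple contains few primes then the prime-weighted sums are small. -/
lemma sum_sum_pw_le {k : ℕ} {h : Fin k → ℕ} {W a R m₀ : ℕ} (hR : 2 ≤ R) (hhR : ∀ i, h i ≤ R)
    (hfew : ∀ n ∈ Ioc (R ^ 30) (R ^ 120), n ≡ a [MOD W] → #{i | (n + h i).Prime} ≤ m₀)
    (f : ℕ → ℝ) (g : Fin k → ℕ → ℝ) (hfg : ∀ i n, g i (n + h i) = f n) :
    ∑ i, ∑ q ∈ Ioc 0 (R ^ 120) with q ≡ a + h i [MOD W], pw R q * g i q ^ 2 ≤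
      120 * Real.log R * m₀ *
        ∑ n ∈ Ioc (R ^ 30) (R ^ 120) with n ≡ a [MOD W], 1 / (n : ℝ) * f n ^ 2 := by
  classical
  have hl0 : 0 ≤ Real.log R := Real.log_natCast_nonneg R
  set T := (Ioc (R ^ 30) (R ^ 120)).filter fun n => n ≡ a [MOD W] with hT
  have h1 : ∀ i, ∑ q ∈ Ioc 0 (R ^ 120) with q ≡ a + h i [MOD W], pw R q * g i q ^ 2 ≤
      ∑ n ∈ T, if (n + h i).Prime then 120 * Real.log R * (1 / (n : ℝ) * f n ^ 2) else 0 := by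
    intro i
    rw [← Finset.sum_filter_of_ne (p := fun q => pw R q ≠ 0) fun q _ hq h0 => hq (by rw [h0, zero_mul])]
    have hbig : ∀ q, pw R q ≠ 0 → h i + R ^ 30 < q := by
      intro q hq
      have e1 := lt_of_pw_ne_zero hR hq
      have e2 : R ^ 60 = R ^ 30 * R ^ 30 := by rw [← pow_add]
      have e3 : R ≤ R ^ 30 := Nat.le_self_pow (by norm_num) R
      have := hhR i
      nlinarith
    refine sum_le_sum_of_injOn (fun q => q - h i) ?_ ?_ ?_ ?_
    · intro q hq
      rw [mem_filter, mem_filter, mem_Ioc] at hq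
      obtain ⟨⟨⟨-, hq1⟩, hq2⟩, hq3⟩ := hq
      have := hbig q hq3
      rw [hT, mem_filter, mem_Ioc]
      refine ⟨⟨by omega, by omega⟩, ?_⟩
      refine Nat.ModEq.add_right_cancel' (h i) ?_
      rwa [Nat.sub_add_cancel (by omega)]
    · intro q hq q' hq' hqq
      rw [mem_coe, mem_filter] at hq hq'
      have e1 := hbig q hq.2
      have e2 := hbig q' hq'.2
      simp only at hqq
      omega
    · intro q hq
      rw [mem_filter, mem_filter, mem_Ioc] at hq
      obtain ⟨⟨⟨-, hq1⟩, -⟩, hq3⟩ := hq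
      have hb := hbig q hq3
      have hp := prime_of_pw_ne_zero hq3
      have hsub : q - h i + h i = q := Nat.sub_add_cancel (by omega)
      rw [hsub, if_pos hp, ← hfg i (q - h i), hsub, ← mul_assoc]
      refine mul_le_mul_of_nonneg_right ?_ (sq_nonneg _)
      have hn0 : (0 : ℝ) < ((q - h i : ℕ) : ℝ) := by exact_mod_cast (by omega : 0 < q - h i)
      have hnq : ((q - h i : ℕ) : ℝ) ≤ q := by exact_mod_cast Nat.sub_le _ _
      have hlq : Real.log q ≤ 120 * Real.log R := by
        calc Real.log q ≤ Real.log ((R ^ 120 : ℕ) : ℝ) :=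
              Real.log_le_log (by linarith) (by exact_mod_cast hq1)
          _ = 120 * Real.log R := by push_cast; rw [Real.log_pow]; norm_num
      rw [pw, logPrime, if_pos hp, mul_one_div]
      refine div_le_div₀ (by positivity) ?_ hn0 hnq
      exact (mul_le_of_le_one_right (Real.log_natCast_nonneg q) (bump_le_one _)).trans hlq
    · intro n _
      split_ifs <;> positivity
  calc _ ≤ ∑ i, ∑ n ∈ T,
        if (n + h i).Prime then 120 * Real.log R * (1 / (n : ℝ) * f n ^ 2) else 0 :=
        Finset.sum_le_sum fun i _ => h1 i
    _ = ∑ n ∈ T, (#{i | (n + h i).Prime} : ℝ) * (120 * Real.log R * (1 / (n : ℝ) * f n ^ 2)) := by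
        rw [Finset.sum_comm]
        refine Finset.sum_congr rfl fun n _ => ?_
        rw [← Finset.sum_filter, Finset.sum_const, nsmul_eq_mul]
    _ ≤ ∑ n ∈ T, (m₀ : ℝ) * (120 * Real.log R * (1 / (n : ℝ) * f n ^ 2)) := by
        refine Finset.sum_le_sum fun n hn => ?_
        rw [hT, mem_filter] at hn
        refine mul_le_mul_of_nonneg_right ?_ (by positivity)
        exact_mod_cast hfew n hn.1 hn.2
    _ = _ := by rw [Finset.mul_sum]; exact Finset.sum_congr rfl fun n _ => by ring

/-- The numerical contradiction between the main terms of the two sieve sums. -/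
lemma false_of_sieve_bounds {L W φ Y P N₁ N₂ k J m₀ X FI pS e₁ e₂ S₁ : ℝ} {K : ℕ}
    {FP S₂ : Fin K → ℝ} (hK : (K : ℝ) = k) (hL : 1 ≤ L) (hW : 0 < W) (hφ : 0 < φ) (hY : 0 < Y)
    (hP : 1 ≤ P) (hYN : 1 ≤ Y) (hk : 1 ≤ k) (hJ : 1 ≤ J) (hm₀ : 0 ≤ m₀)
    (hLY : L * φ = 4000 * k * J * Y * W) (hX0 : 0 ≤ X) (hX : X ≤ 121 * L)
    (hFI : FI ≤ 21 * (P * N₁)) (hN₁ : N₁ ≤ 103 * Y) (hN₂ : 8 * J * Y ≤ N₂)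
    (hFP : ∀ i, 1 / 2 * (P * N₂ ^ 2) ≤ FP i) (hpS : 20 * L ≤ pS)
    (hS₁ : S₁ ≤ X / W * FI + e₁) (hS₂ : ∀ i, pS / φ * FP i - e₂ ≤ S₂ i)
    (hS : ∑ i, S₂ i ≤ 120 * L * m₀ * S₁) (he₂ : 4 * φ * e₂ ≤ L) (he₁ : 480 * m₀ * φ * e₁ ≤ 1)
    (hJm : 4000 * (120 * 121 * 21 * 103) * m₀ + 1 ≤ 640 * J) : False := by
  have hP0 : 0 < P := by linarith
  have h1 : S₁ * φ ≤ 121 * 21 * 103 * 4000 * (k * J * P * Y ^ 2) + e₁ * φ := by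
    have e1 : X / W * FI ≤ 121 * L / W * (21 * (P * (103 * Y))) := by
      calc X / W * FI ≤ X / W * (21 * (P * (103 * Y))) := by
            refine mul_le_mul_of_nonneg_left (hFI.trans ?_) (by positivity)
            gcongr
        _ ≤ _ := by gcongr
    calc S₁ * φ ≤ (121 * L / W * (21 * (P * (103 * Y))) + e₁) * φ := by gcongr; linarith
      _ = 121 * 21 * 103 * (L * φ) / W * P * Y + e₁ * φ := by ring
      _ = _ := by rw [hLY]; field_simp
  have h2 : k * (640 * L * (P * J ^ 2 * Y ^ 2) - e₂ * φ) ≤ (∑ i, S₂ i) * φ := by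
    have e1 : ∀ i, 640 * L * (P * J ^ 2 * Y ^ 2) - e₂ * φ ≤ S₂ i * φ := by
      intro i
      have e2 : 32 * (P * J ^ 2 * Y ^ 2) ≤ FP i := by
        refine le_trans ?_ (hFP i)
        have : (8 * J * Y) ^ 2 ≤ N₂ ^ 2 := by gcongr
        nlinarith
      have e3 : 20 * L * (32 * (P * J ^ 2 * Y ^ 2)) ≤ pS * FP i := by
        refine mul_le_mul hpS e2 (by positivity) (by linarith)
      have e4 : (pS / φ * FP i - e₂) * φ ≤ S₂ i * φ := by gcongr; exact hS₂ i
      have e5 : (pS / φ * FP i - e₂) * φ = pS * FP i - e₂ * φ := by field_simp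
      linarith
    calc k * (640 * L * (P * J ^ 2 * Y ^ 2) - e₂ * φ)
        = ∑ _i : Fin K, (640 * L * (P * J ^ 2 * Y ^ 2) - e₂ * φ) := by
          rw [Finset.sum_const, card_univ, Fintype.card_fin, nsmul_eq_mul, hK]
      _ ≤ ∑ i, S₂ i * φ := Finset.sum_le_sum fun i _ => e1 i
      _ = _ := by rw [Finset.sum_mul]
  have h3 : (∑ i, S₂ i) * φ ≤ 120 * L * m₀ *
      (121 * 21 * 103 * 4000 * (k * J * P * Y ^ 2) + e₁ * φ) := by
    calc (∑ i, S₂ i) * φ ≤ 120 * L * m₀ * S₁ * φ := by gcongr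
      _ = 120 * L * m₀ * (S₁ * φ) := by ring
      _ ≤ _ := by gcongr
  set Q := L * (k * J * P * Y ^ 2) with hQ
  have hQL : L * k ≤ Q := by
    rw [hQ]
    have : k ≤ k * J * P * Y ^ 2 := by
      have e1 : 1 ≤ J * P := one_le_mul_of_one_le_of_one_le hJ hP
      have e2 : 1 ≤ J * P * Y ^ 2 := one_le_mul_of_one_le_of_one_le e1 (one_le_pow₀ hYN)
      calc k = k * 1 := by ring
        _ ≤ k * (J * P * Y ^ 2) := by gcongr
        _ = _ := by ring
    gcongr
  have h4 : Q * (640 * J - 4000 * (120 * 121 * 21 * 103) * m₀) ≤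
      k * (e₂ * φ) + 120 * L * m₀ * (e₁ * φ) := by
    have := h2.trans h3
    rw [hQ]
    linarith
  have hQ0 : 0 < Q := lt_of_lt_of_le (by positivity) hQL
  have h5 : Q ≤ Q * (640 * J - 4000 * (120 * 121 * 21 * 103) * m₀) := by
    nlinarith
  have h6 : k * (e₂ * φ) ≤ k * (L / 4) := by gcongr; linarith
  have h7 : 120 * L * m₀ * (e₁ * φ) ≤ L / 4 := by nlinarith
  nlinarith

end PrimeGapRuns

namespace PrimeGapRuns

open Finset Filter

set_option maxHeartbeats 1000000 in
/-- The Maynard–Tao theorem. -/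
theorem maynard_tao (m₀ : ℕ) : ∃ k D₀ : ℕ, ∀ D ≥ D₀, ∀ h : Fin k → ℕ, Function.Injective h →
    (∀ i, h i ≤ D) → ∀ a, (∀ i, (a + h i).Coprime (primorial D)) → ∀ N,
    ∃ n ≥ N, n ≡ a [MOD primorial D] ∧ m₀ < #{i | (n + h i).Prime} := by
  obtain ⟨J, hJ1, hJm⟩ : ∃ J : ℕ, 1 ≤ J ∧
      4000 * (120 * 121 * 21 * 103) * (m₀ : ℝ) + 1 ≤ 640 * J := by
    refine ⟨4000 * (120 * 121 * 21 * 103) * m₀ + 1, by omega, ?_⟩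
    push_cast
    have : (0 : ℝ) ≤ m₀ := Nat.cast_nonneg m₀
    linarith
  obtain ⟨k, hk⟩ : ∃ k : ℕ, k = 16 ^ J := ⟨_, rfl⟩
  have hk1 : 1 ≤ k := by rw [hk]; exact Nat.one_le_pow _ _ (by norm_num)
  refine ⟨k, 15 * k ^ 2 + 4 * (k + 1) ^ 4 + 5, fun D hD h hh hhD a ha N => ?_⟩
  have hkD : k ≤ D := by nlinarith [Nat.zero_le ((k + 1) ^ 4)]
  obtain ⟨W, hWdef⟩ : ∃ W, W = primorial D := ⟨_, rfl⟩
  rw [← hWdef] at ha ⊢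
  have hdvd : ∀ {p : ℕ}, p.Prime → (p ∣ W ↔ p ≤ D) := fun hp => by
    rw [hWdef]; exact hp.dvd_primorial_iff
  have hW0 : 0 < W := hWdef ▸ primorial_pos D
  have hW6 : 6 ∣ W := by
    have h2 : 2 ∣ W := (hdvd Nat.prime_two).mpr (by omega)
    have h3 : 3 ∣ W := (hdvd Nat.prime_three).mpr (by omega)
    omega
  have hW0' : (0 : ℝ) < W := by exact_mod_cast hW0
  have hφ : (0 : ℝ) < W.totient := by exact_mod_cast Nat.totient_pos.mpr hW0
  have hκ : 0 < dens W := div_pos hφ hW0'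
  obtain ⟨z₀, hz₀, hvol⟩ := exists_vol_bounds.{0} hW6 hW0
  obtain ⟨R₀, hR₀⟩ := exists_sum_primeSum_le (320 * k + 160 * (k + 1) ^ 2) W
  set C : ℝ := (16 / 15) ^ k with hC
  have hC0 : 0 ≤ C := by positivity
  have hk1' : (1 : ℝ) ≤ k := by exact_mod_cast hk1
  have hJ1' : (1 : ℝ) ≤ J := by exact_mod_cast hJ1
  have hkJ : (0 : ℝ) < 4000 * k * J := by positivity
  have hev1 := (Real.tendsto_log_atTop.comp (tendsto_natCast_atTop_atTop (R := ℝ))).eventually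
    ((eventually_ge_atTop 8).and <| (eventually_ge_atTop (4000 * k * J * z₀)).and <|
      (eventually_ge_atTop (4000 * k * J / dens W)).and <|
      (eventually_ge_atTop (4 * W.totient * (C ^ 2 * √(W : ℝ)))).and <|
      eventually_mul_pow_le_exp (2400 * m₀ * W.totient * C ^ 2 * W) (640 * k))
  obtain ⟨R, ⟨hL8, hLz, hLκ, hLe, hLexp⟩, hpS, hRR₀, hRmax⟩ := (hev1.and <|
    eventually_le_pwSum.and <| (eventually_ge_atTop R₀).and <|
    eventually_ge_atTop (W + 2 + D + N)).exists
  simp only [Function.comp_apply] at hL8 hLz hLκ hLe hLexp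
  set L := Real.log R with hL
  have hR0 : (0 : ℝ) < R := by exact_mod_cast (by omega : 0 < R)
  rw [Real.exp_log hR0] at hLexp
  obtain ⟨qe, hqe, hF⟩ := hR₀ R hRR₀
  obtain ⟨p₀, hp₀, hDp₀, hp₀d⟩ := exists_prime_not_dvd_primorial_mul D (hWdef ▸ hqe)
  rw [← hWdef] at hp₀d
  set PS := (Ioc D R).filter fun p => p.Prime ∧ p ≠ p₀ with hPS
  let pr : PS → ℕ := fun p => p
  have hmem : ∀ p : PS, (D < pr p ∧ pr p ≤ R) ∧ (pr p).Prime ∧ pr p ≠ p₀ := fun p => by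
    have := mem_filter.mp p.2
    rwa [mem_Ioc] at this
  have hinj : Function.Injective pr := Subtype.coe_injective
  have hpr : ∀ p, (pr p).Prime := fun p => (hmem p).2.1
  have hDp : ∀ p, D < pr p := fun p => (hmem p).1.1
  have hpR : ∀ p, pr p ≤ R := fun p => (hmem p).1.2
  have hWc : ∀ p, W.Coprime (pr p) := fun p => by
    rw [Nat.coprime_comm, Nat.Prime.coprime_iff_not_dvd (hpr p), hdvd (hpr p)]
    have := hDp p
    omega
  have hsurj : ∀ q : ℕ, q.Prime → ¬ q ∣ W → q ≠ p₀ → (q : ℝ) ≤ R → ∃ i, pr i = q := by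
    intro q hq hqW hq0 hqR
    rw [hdvd hq] at hqW
    exact ⟨⟨q, mem_filter.mpr ⟨mem_Ioc.mpr ⟨by omega, by exact_mod_cast hqR⟩, hq, hq0⟩⟩, rfl⟩
  have hqe' : ∀ S : Finset PS, ¬ qe ∣ W * ∏ p ∈ S, pr p := by
    intro S
    have := hp₀d (S.map ⟨pr, hinj⟩) fun p hp => by
      obtain ⟨p, -, rfl⟩ := mem_map.mp hp
      exact ⟨hpr p, hDp p, (hmem p).2.2⟩
    rwa [Finset.prod_map] at this
  have hv := hvol PS pr hpr hinj (fun p => by have := hDp p; omega) hWc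
  set z := L / (4000 * k * J) with hz
  have hzL : 4000 * k * J * z = L := by rw [hz]; field_simp
  have hzz₀ : z₀ ≤ z := by rw [hz, le_div_iff₀ hkJ]; linarith
  have hz0 : 0 < z := hz₀.trans_le hzz₀
  have hkz : (16 : ℝ) ^ J * z ≤ L / 4000 := by
    have : (16 : ℝ) ^ J = k := by rw [hk]; push_cast; rfl
    rw [this]
    nlinarith [mul_pos (lt_of_lt_of_le one_pos hk1') hz0]
  have hY1 : 1 ≤ dens W * z := by
    rw [div_le_iff₀ hκ] at hLκ
    rw [hz, mul_div_assoc', le_div_iff₀ hkJ]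
    linarith
  have hY0 : 0 < dens W * z := by linarith
  have hzj : ∀ j < J, z₀ ≤ 16 ^ (j + 1) * z ∧ Real.exp (16 ^ (j + 1) * z) ≤ R := by
    intro j hj
    constructor
    · have : (1 : ℝ) ≤ 16 ^ (j + 1) := one_le_pow₀ (by norm_num)
      nlinarith
    · rw [← Real.le_log_iff_exp_le hR0]
      have : (16 : ℝ) ^ (j + 1) * z ≤ 16 ^ J * z := by
        gcongr
        · norm_num
        · omega
      linarith
  have hvle : ∀ j < J, vol pr (16 ^ (j + 1) * z) ≤ 3 * (dens W * (16 ^ (j + 1) * z)) :=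
    fun j hj => (hv _ (hzj j hj).1).1
  have hvge : ∀ j < J, dens W * (16 ^ (j + 1) * z) / 2 ≤ vol pr (16 ^ (j + 1) * z) :=
    fun j hj => (hv _ (hzj j hj).1).2 R p₀ hp₀ (by omega) hsurj (hzj j hj).2
  have hN1 : massSq pr J z ≤ 103 * (dens W * z) := massSq_le hpr hY0.le hvle
  have hN1' : 8 * (dens W * z) ≤ massSq pr J z := by
    refine le_trans ?_ (massSq_ge hpr hJ1)
    have := hvge 0 hJ1
    rw [zero_add, pow_one] at this
    linarith
  have hN2 : 8 * J * (dens W * z) ≤ massOne pr J z := massOne_ge hvge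
  have hN10 : 0 < massSq pr J z := by linarith
  set y : (PS → Option (Fin k)) → ℝ := yv pr J z R with hy
  have hlt : ∀ p i, h i < pr p := fun p i => (hhD i).trans_lt (hDp p)
  have hyC : ∀ s, |y s| ≤ C * wt pr (supp s) := abs_yv_le hpr J z R
  have hy0 : ∀ s, R < md pr s → y s = 0 := fun s hs => yv_eq_zero hs
  have hFI := form_gram_rhoInt_le (k := k) hpr hinj (by omega) hkD hDp J z R
  have hFP := le_form_gram_rhoPrime (k := k) (R := R) hpr hinj (by omega) hDp hz0.le
    (by linarith) (by linarith) hN10 (by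
      have e1 := sum_gfun_sq_mul_lg_le hpr hz0.le hvle
      calc 20 * (k : ℝ) * ∑ A, gfun J z (lg pr A) ^ 2 * wt pr A * lg pr A
          ≤ 20 * k * (1536 * J * (dens W * z) * z) := by gcongr
        _ = 30720 / 4000 * (dens W * z) * (4000 * k * J * z) := by ring
        _ = 30720 / 4000 * (dens W * z) * L := by rw [hzL]
        _ ≤ L * (8 * (dens W * z)) := by nlinarith [mul_pos hY0 (by linarith : 0 < L)]
        _ ≤ L * massSq pr J z := by gcongr)
  rw [← hy] at hFI
  have h_int := abs_sum_sieve_sq_sub_le hpr hinj hW0 hWc hh hlt a hC0 hyC hy0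
    (N₀ := R ^ 30) (Nat.pow_pos (by omega)) (R ^ 120)
  have hprime := fun i => abs_sum_pw_sieve_sq_sub_le hpr hinj hW0 hWc
    (fun p => by have := hDp p; nlinarith [Nat.zero_le (k ^ 2)]) hh hlt i (ha i) (by omega)
    (by omega) hpR hqe' hC0 hyC hy0
  have hloss : ∀ c, 0 ≤ loss pr c ∧ loss pr c ≤ L ^ (160 * c) := fun c =>
    ⟨zero_le_one.trans (one_le_loss hpr c), loss_le hpr hinj hpR hL8 c⟩
  by_contra! hcon
  have hsum := sum_sum_pw_le (W := W) (a := a) (m₀ := m₀) (R := R) (h := h) (by omega)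
    (fun i => (hhD i).trans (by omega)) (fun n hn hna => hcon n (by
      have e1 := (mem_Ioc.mp hn).1
      have e2 : R ≤ R ^ 30 := Nat.le_self_pow (by norm_num) R
      omega) hna) (sieve pr h 0 y) (fun i => sieve pr h (h i) y) (fun i n => sieve_add pr h i y n)
  have hX0 : 0 ≤ ∑ n ∈ Ioc (R ^ 30) (R ^ 120), 1 / (n : ℝ) :=
    Finset.sum_nonneg fun n _ => by positivity
  have hX : ∑ n ∈ Ioc (R ^ 30) (R ^ 120), 1 / (n : ℝ) ≤ 121 * L := by
    calc ∑ n ∈ Ioc (R ^ 30) (R ^ 120), 1 / (n : ℝ) ≤ ∑ n ∈ Ioc 0 (R ^ 120), 1 / (n : ℝ) :=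
          Finset.sum_le_sum_of_subset_of_nonneg (Ioc_subset_Ioc_left (Nat.zero_le _))
            fun n _ _ => by positivity
      _ ≤ 1 + Real.log ((R ^ 120 : ℕ) : ℝ) := sum_Ioc_one_div_le _
      _ ≤ 121 * L := by push_cast; rw [Real.log_pow]; push_cast; linarith
  refine false_of_sieve_bounds (K := k) (P := massSq pr J z ^ (k - 1)) rfl (by linarith) hW0' hφ
    hY0 (one_le_pow₀ (by linarith)) hY1 hk1' hJ1' (Nat.cast_nonneg m₀) ?_ hX0 hX ?_ hN1 hN2
    hFP hpS (sub_le_iff_le_add'.mp (abs_le.mp h_int).2)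
    (fun i => sub_le_of_abs_sub_le_left (hprime i)) hsum ?_ ?_ hJm
  · calc L * (W.totient : ℝ) = 4000 * k * J * z * W.totient := by rw [hzL]
      _ = _ := by rw [dens]; field_simp
  · rwa [← pow_succ, Nat.sub_add_cancel hk1]
  · have hS0 : 0 ≤ ∑ z ∈ primFin R qe, ‖primeSum R z‖ / √(z.1 : ℝ) :=
      Finset.sum_nonneg fun z _ => by positivity
    have hS1 := hF (primFin R qe) fun z hz => mem_primFin.mp hz
    refine le_trans ?_ hLe
    refine mul_le_mul_of_nonneg_left ?_ (by positivity)
    have e1 := (hloss k).1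
    have e2 := (hloss ((k + 1) ^ 2)).1
    calc _ ≤ (C * L ^ (160 * k)) ^ 2 * (√(W : ℝ) * L ^ (160 * (k + 1) ^ 2) *
          ∑ z ∈ primFin R qe, ‖primeSum R z‖ / √(z.1 : ℝ)) := by
          gcongr
          · exact (hloss k).2
          · exact (hloss _).2
      _ = C ^ 2 * √(W : ℝ) * ((∑ z ∈ primFin R qe, ‖primeSum R z‖ / √(z.1 : ℝ)) *
          L ^ (320 * k + 160 * (k + 1) ^ 2)) := by
          rw [pow_add, show 320 * k = 160 * k * 2 by ring, pow_mul L (160 * k) 2]; ring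
      _ ≤ C ^ 2 * √(W : ℝ) := mul_le_of_le_one_right (by positivity) hS1
  · have e1 := (hloss k).1
    have hR1 : (1 : ℝ) ≤ R := by exact_mod_cast (by omega : 1 ≤ R)
    calc _ ≤ 480 * (m₀ : ℝ) * W.totient * ((C * L ^ (160 * k)) ^ 2 * ((R * L ^ (160 * k)) ^ 2 *
          (5 * (W * R ^ 2) / ((R ^ 30 : ℕ) : ℝ)))) := by
          gcongr
          · exact (hloss k).2
          · exact (hloss k).2
      _ = 2400 * m₀ * W.totient * C ^ 2 * W * L ^ (640 * k) / R ^ 26 := by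
          rw [show 640 * k = 160 * k * 4 by ring, pow_mul L (160 * k) 4]
          push_cast
          field_simp
          ring
      _ ≤ 1 := by
          rw [div_le_one (by positivity)]
          exact hLexp.trans (le_self_pow₀ hR1 (by norm_num))

end PrimeGapRuns

namespace PrimeGapRuns

open Finset

/-- Every prime has a residue class in which all terms of the tuple `k! * 2 ^ i` are invertible. -/
lemma exists_not_dvd_add_factorial_mul_two_pow (k : ℕ) {p : ℕ} (hp : p.Prime) :
    ∃ c : ℕ, ∀ i : Fin k, ¬ p ∣ c + k.factorial * 2 ^ (i : ℕ) := by
  classical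
  have : Fact p.Prime := ⟨hp⟩
  by_cases hpk : p ≤ k
  · refine ⟨1, fun i hd => hp.one_lt.ne' ?_⟩
    rw [Nat.dvd_add_left ((Nat.dvd_factorial hp.pos hpk).mul_right _)] at hd
    exact Nat.dvd_one.mp hd
  · have hlt : #(univ.image fun i : Fin k => -((k.factorial * 2 ^ (i : ℕ) : ℕ) : ZMod p)) <
        #(univ : Finset (ZMod p)) := by
      refine card_image_le.trans_lt ?_
      rw [card_univ, card_univ, Fintype.card_fin, ZMod.card]
      omega
    obtain ⟨x, -, hx⟩ := exists_mem_notMem_of_card_lt_card hlt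
    refine ⟨x.val, fun i hd => hx (mem_image.mpr ⟨i, mem_univ _, ?_⟩)⟩
    rw [← ZMod.natCast_eq_zero_iff, Nat.cast_add, ZMod.natCast_zmod_val] at hd
    exact (eq_neg_of_add_eq_zero_left hd).symm

/-- A residue class in which the tuple `k! * 2 ^ i` is admissible while all other shifts are
divisible by small primes. -/
lemma exists_residue_class (k D₀ : ℕ) : ∃ D ≥ D₀, k.factorial * 2 ^ k ≤ D ∧ ∃ a : ℕ,
    (∀ i : Fin k, (a + k.factorial * 2 ^ (i : ℕ)).Coprime (primorial D)) ∧
    ∀ t < k.factorial * 2 ^ k, (∀ i : Fin k, t ≠ k.factorial * 2 ^ (i : ℕ)) →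
      ∃ q : ℕ, q.Prime ∧ q ≤ D ∧ q ∣ a + t := by
  classical
  set M := k.factorial * 2 ^ k with hM
  have hhM : ∀ i : Fin k, k.factorial * 2 ^ (i : ℕ) < M := fun i =>
    Nat.mul_lt_mul_of_pos_left (Nat.pow_lt_pow_right (by norm_num) i.2) k.factorial_pos
  set q : ℕ → ℕ := fun t => Nat.nth Nat.Prime (M + t) with hq
  have hmono : StrictMono (Nat.nth Nat.Prime) := Nat.nth_strictMono Nat.infinite_setOfPred_prime
  have hqp : ∀ t, (q t).Prime := fun t => Nat.prime_nth_prime _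
  have hqM : ∀ t, M < q t := fun t => by
    have := Nat.add_two_le_nth_prime (M + t)
    simp only [hq]
    omega
  have hc : ∀ p : ℕ, ∃ c : ℕ, p.Prime → (∀ i : Fin k, ¬ p ∣ c + k.factorial * 2 ^ (i : ℕ)) ∧
      ∀ t < M, (∀ i : Fin k, t ≠ k.factorial * 2 ^ (i : ℕ)) → p = q t → p ∣ c + t := by
    intro p
    by_cases hp : ∃ t < M, (∀ i : Fin k, t ≠ k.factorial * 2 ^ (i : ℕ)) ∧ p = q t
    · obtain ⟨t, htM, hti, rfl⟩ := hp
      have hqt := hqM t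
      refine ⟨q t - t, fun _ => ⟨fun i hd => hti i ?_, fun t' _ _ ht' => ?_⟩⟩
      · have hi := hhM i
        have e1 : q t - t + k.factorial * 2 ^ (i : ℕ) ≡ q t - t + t [MOD q t] := by
          rw [Nat.sub_add_cancel (by omega)]
          exact ((Nat.modEq_zero_iff_dvd.mpr hd).trans
            (Nat.modEq_zero_iff_dvd.mpr dvd_rfl).symm)
        have e2 := Nat.ModEq.add_left_cancel' _ e1
        exact (Nat.ModEq.eq_of_lt_of_lt e2 (by omega) (by omega)).symm
      · have : t = t' := by
          have := hmono.injective ht'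
          omega
        rw [← this, Nat.sub_add_cancel (by omega)]
    · by_cases hpp : p.Prime
      · obtain ⟨c, hc⟩ := exists_not_dvd_add_factorial_mul_two_pow k hpp
        exact ⟨c, fun _ => ⟨hc, fun t ht hti hpt => absurd ⟨t, ht, hti, hpt⟩ hp⟩⟩
      · exact ⟨0, fun h => absurd h hpp⟩
  choose c hc using hc
  set D := D₀ + Nat.nth Nat.Prime (M + M) with hD
  have hMD : M ≤ D := by have := Nat.add_two_le_nth_prime (M + M); omega
  obtain ⟨a, ha⟩ := Nat.chineseRemainderOfFinset c id ((range (D + 1)).filter Nat.Prime)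
    (fun p hp => (mem_filter.mp hp).2.ne_zero) (fun p hp p' hp' hne =>
      (Nat.coprime_primes (mem_filter.mp hp).2 (mem_filter.mp hp').2).mpr hne)
  have ha' : ∀ p : ℕ, p.Prime → p ≤ D → a ≡ c p [MOD p] := fun p hp hpD =>
    ha p (mem_filter.mpr ⟨mem_range.mpr (by omega), hp⟩)
  refine ⟨D, by omega, hMD, a, fun i => ?_, fun t ht hti => ?_⟩
  · refine Nat.coprime_of_dvd fun p hp hpa hpD => ?_
    have hpD' := hp.dvd_primorial_iff.mp hpD
    exact (hc p hp).1 i ((((ha' p hp hpD').add_right _).dvd_iff dvd_rfl).mp hpa)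
  · have hqD : q t ≤ D := by
      have : q t ≤ Nat.nth Nat.Prime (M + M) := hmono.monotone (by omega)
      omega
    exact ⟨q t, hqp t, hqD, (((ha' _ (hqp t) hqD).add_right _).dvd_iff dvd_rfl).mpr
      ((hc _ (hqp t)).2 t ht hti rfl)⟩

end PrimeGapRuns

open PrimeGapRuns in
/-- For every `m ≥ 2` there are infinitely many `r` such that the run of
consecutive prime gaps `δ j = primeGap r j` for `1 ≤ j ≤ m` is strictly
increasing: `δ 1 < δ 2 < ⋯ < δ m`. -/
theorem increasing_prime_gap_runs (m : ℕ) (hm : 2 ≤ m) :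
    {r : ℕ | ∀ j : ℕ, 1 ≤ j → j < m → primeGap r j < primeGap r (j + 1)}.Infinite := by
  obtain ⟨k, D₀, hMT⟩ := maynard_tao m
  obtain ⟨D, hD, hMD, a, ha, hcomp⟩ := exists_residue_class k D₀
  set M := k.factorial * 2 ^ k with hM
  have hk0 := k.factorial_pos
  have hmono : StrictMono (Nat.nth Nat.Prime) := Nat.nth_strictMono Nat.infinite_setOfPred_prime
  have hhM : ∀ i : Fin k, k.factorial * 2 ^ (i : ℕ) < M := fun i =>
    Nat.mul_lt_mul_of_pos_left (Nat.pow_lt_pow_right (by norm_num) i.2) hk0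
  have hinj : Function.Injective fun i : Fin k => k.factorial * 2 ^ (i : ℕ) := fun i j hij =>
    Fin.ext (Nat.pow_right_injective le_rfl (Nat.eq_of_mul_eq_mul_left hk0 hij))
  refine Set.infinite_of_forall_exists_gt fun b => ?_
  obtain ⟨n, hnN, hna, hn⟩ := hMT D hD _ hinj (fun i => (hhM i).le.trans hMD) a ha
    (D + 1 + Nat.nth Nat.Prime (b + 1))
  refine ⟨Nat.count Nat.Prime n, fun j hj1 hjm => ?_, ?_⟩
  swap
  · have h1 := Nat.count_monotone Nat.Prime (show Nat.nth Nat.Prime (b + 1) ≤ n by omega)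
    rw [Nat.count_nth_of_infinite Nat.infinite_setOfPred_prime] at h1
    omega
  set r := Nat.count Nat.Prime n with hr
  have hcount : r + m < Nat.count Nat.Prime (n + M) := by
    rw [Nat.count_add, Nat.count_eq_card_filter_range (fun t => (n + t).Prime) M]
    refine Nat.add_lt_add_left (hn.trans_le ?_) _
    refine Finset.card_le_card_of_injOn _ (fun i hi => ?_) hinj.injOn
    rw [Finset.mem_coe, Finset.mem_filter] at hi ⊢
    exact ⟨Finset.mem_range.mpr (hhM i), hi.2⟩
  have hform : ∀ j ≤ m, ∃ i : Fin k, Nat.nth Nat.Prime (r + j) = n + k.factorial * 2 ^ (i : ℕ) := by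
    intro j hj
    have hp := Nat.prime_nth_prime (r + j)
    have hlt : Nat.nth Nat.Prime (r + j) < n + M := Nat.nth_lt_of_lt_count (by omega)
    have hge : n ≤ Nat.nth Nat.Prime (r + j) := by
      by_contra! h
      have h1 := Nat.count_strict_mono hp h
      rw [Nat.count_nth_of_infinite Nat.infinite_setOfPred_prime] at h1
      omega
    by_contra! hno
    obtain ⟨q, hq, hqD, hqa⟩ := hcomp (Nat.nth Nat.Prime (r + j) - n) (by omega)
      (fun i hi => hno i (by omega))
    have hqn : q ∣ Nat.nth Nat.Prime (r + j) := by
      have h1 : q ∣ primorial D := hq.dvd_primorial_iff.mpr hqD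
      have h2 := ((hna.of_dvd h1).add_right (Nat.nth Nat.Prime (r + j) - n)).dvd_iff dvd_rfl
      rw [Nat.add_sub_cancel' hge] at h2
      exact h2.mpr hqa
    have := (Nat.prime_dvd_prime_iff_eq hq hp).mp hqn
    omega
  obtain ⟨j, rfl⟩ : ∃ j', j = j' + 1 := ⟨j - 1, by omega⟩
  obtain ⟨i₀, h₀⟩ := hform j (by omega)
  obtain ⟨i₁, h₁⟩ := hform (j + 1) (by omega)
  obtain ⟨i₂, h₂⟩ := hform (j + 2) (by omega)
  have h₀₁ : Nat.nth Nat.Prime (r + j) < Nat.nth Nat.Prime (r + (j + 1)) := hmono (by omega)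
  have h₁₂ : Nat.nth Nat.Prime (r + (j + 1)) < Nat.nth Nat.Prime (r + (j + 2)) := hmono (by omega)
  have hdouble : 2 * (k.factorial * 2 ^ (i₁ : ℕ)) ≤ k.factorial * 2 ^ (i₂ : ℕ) := by
    have h3 : 2 ^ (i₁ : ℕ) < 2 ^ (i₂ : ℕ) := by
      refine lt_of_mul_lt_mul_left (a := k.factorial) ?_ hk0.le
      omega
    have h4 : (i₁ : ℕ) + 1 ≤ i₂ := (Nat.pow_lt_pow_iff_right (by norm_num)).mp h3
    calc 2 * (k.factorial * 2 ^ (i₁ : ℕ)) = k.factorial * 2 ^ ((i₁ : ℕ) + 1) := by ring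
      _ ≤ _ := Nat.mul_le_mul_left _ (Nat.pow_le_pow_right (by norm_num) h4)
  have hpos : 0 < k.factorial * 2 ^ (i₀ : ℕ) := by positivity
  simp only [primeGap, nthPrime]
  rw [show r + (j + 1) + 1 - 1 = r + (j + 1) by omega, show r + (j + 1) - 1 = r + j by omega,
    show r + (j + 1 + 1) + 1 - 1 = r + (j + 2) by omega,
    show r + (j + 1 + 1) - 1 = r + (j + 1) by omega]
  omega
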